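/- Let S be a finite set of rational primes and S_1 ⊆ S. As K varies over real (respectively imaginary) quadratic fields, ordered by absolute discriminant, such that every prime in S_1 splits in K/ℚ and no prime in S \ S_1 splits in K/ℚ, the average size of Cl(K)_S[3] equals 1 + c'_∞/3^{|S_1|}, where c'_∞ = 1/3 in the real case and c'_∞ = 1 in the imaginary case. -/

import Mathlib

open IntermediateField NumberField Filter Asymptotics
open scoped nonZeroDivisors

/-- A square root of `d` in `ℂ`. -/
noncomputable def sqrtD (d : ℤ) : ℂ :=
  if 0 ≤ d then ((Real.sqrt d : ℝ) : ℂ) else Complex.I * ((Real.sqrt (-d) : ℝ) : ℂ)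

lemma sqrtD_sq (d : ℤ) : (sqrtD d) ^ 2 = (d : ℂ) := by
  unfold sqrtD
  split_ifs with h
  · rw [← Complex.ofReal_pow, Real.sq_sqrt (by exact_mod_cast h)]
    simp
  · rw [mul_pow, Complex.I_sq, ← Complex.ofReal_pow,
      Real.sq_sqrt (by push_neg at h; nlinarith [show (d:ℝ) < 0 from by exact_mod_cast h])]
    push_cast
    ring

/-- The quadratic field `K = ℚ(√d)` realized inside `ℂ`.  For `d` a fundamental
discriminant, these realize all quadratic fields (identified with their
fundamental discriminants), `d > 0` giving the real ones and `d < 0` the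
imaginary ones. -/
noncomputable def Kd (d : ℤ) : IntermediateField ℚ ℂ := ℚ⟮sqrtD d⟯

instance (d : ℤ) : FiniteDimensional ℚ (Kd d) := by
  apply IntermediateField.adjoin.finiteDimensional
  have : IsAlgebraic ℚ (sqrtD d) := by
    refine ⟨Polynomial.X ^ 2 - Polynomial.C (d : ℚ), ?_, ?_⟩
    · exact Polynomial.X_pow_sub_C_ne_zero (by norm_num) _
    · simp [sqrtD_sq d]
  exact this.isIntegral

instance (d : ℤ) : NumberField (Kd d) := ⟨⟩

/-- The ring of integers `O_K` of `K = ℚ(√d)`. -/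
noncomputable abbrev Od (d : ℤ) := 𝓞 (Kd d)

/-- `d` is a fundamental discriminant, i.e. the discriminant of a quadratic field:
either `d ≡ 1 (mod 4)` and `d` squarefree, or `d = 4m` with `m` squarefree and
`m ≡ 2, 3 (mod 4)` (and `d ≠ 1`, which is not the discriminant of a quadratic field). -/
def IsFundamentalDiscriminant (d : ℤ) : Prop :=
  d ≠ 1 ∧ ((d % 4 = 1 ∧ Squarefree d) ∨
    ∃ m : ℤ, d = 4 * m ∧ (m % 4 = 2 ∨ m % 4 = 3) ∧ Squarefree m)

/-- The average of `f` over the family of quadratic fields (identified with their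
fundamental discriminants `d`) satisfying `F`, ordered by absolute discriminant,
exists and equals `A`:
`lim_{X→∞} (∑_{F d, |d| < X} f d) / #{d : F d, |d| < X} = A`. -/
noncomputable def HasAverage (F : ℤ → Prop) (f : ℤ → ℝ) (A : ℝ) : Prop :=
  Tendsto (fun X : ℝ =>
      (∑ᶠ d ∈ {d : ℤ | F d ∧ |(d : ℝ)| < X}, f d) /
        (Nat.card {d : ℤ // F d ∧ |(d : ℝ)| < X} : ℝ))
    atTop (nhds A)

/-- The rational prime `p` splits (completely) in `K = ℚ(√d)`: `pO_K` is a product of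
two distinct prime ideals. -/
def SplitsIn (p : ℕ) (d : ℤ) : Prop :=
  ∃ P Q : Ideal (Od d), P ≠ Q ∧ P.IsPrime ∧ Q.IsPrime ∧
    Ideal.span {((p : ℕ) : Od d)} = P * Q

/-- The subgroup `⟨S_K⟩` of the class group generated by the classes of the primes
of `O_K` lying above the primes in `S`. -/
noncomputable def SClassSubgroup (S : Finset ℕ) (d : ℤ) : Subgroup (ClassGroup (Od d)) :=
  Subgroup.closure {c | ∃ P : (Ideal (Od d))⁰, (P : Ideal (Od d)).IsPrime ∧
    (∃ p ∈ S, ((p : ℕ) : Od d) ∈ (P : Ideal (Od d))) ∧ c = ClassGroup.mk0 P}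

/-- `Cl(K)_S := Cl(K)/⟨S_K⟩` for `K = ℚ(√d)`. -/
noncomputable def ClS (S : Finset ℕ) (d : ℤ) :=
  ClassGroup (Od d) ⧸ SClassSubgroup S d

noncomputable instance (S : Finset ℕ) (d : ℤ) : CommGroup (ClS S d) := by
  unfold ClS; infer_instance

namespace CubicForm

/-! Binary cubic forms `a x³ + 3b x²y + 3c xy² + e y³` are encoded as `![a, b, c, e]`. -/

section Ring

variable {R : Type*} [CommRing R]

/-- The value of the form at `(x, y)`. -/
def eval (f : Fin 4 → R) (x y : R) : R :=
  f 0 * x ^ 3 + 3 * f 1 * x ^ 2 * y + 3 * f 2 * x * y ^ 2 + f 3 * y ^ 3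

/-- The `x²` coefficient of the (negated, reduced) Hessian. -/
def hessA (f : Fin 4 → R) : R := f 1 ^ 2 - f 0 * f 2

/-- The `xy` coefficient of the Hessian. -/
def hessB (f : Fin 4 → R) : R := f 1 * f 2 - f 0 * f 3

/-- The `y²` coefficient of the Hessian. -/
def hessC (f : Fin 4 → R) : R := f 2 ^ 2 - f 1 * f 3

/-- The reduced discriminant. -/
def disc (f : Fin 4 → R) : R := hessB f ^ 2 - 4 * hessA f * hessC f

/-- The leading coefficient of the cubic covariant. -/
def covA (f : Fin 4 → R) : R := f 0 ^ 2 * f 3 - 3 * f 0 * f 1 * f 2 + 2 * f 1 ^ 3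

/-- The last coefficient of the cubic covariant, up to sign. -/
def covD (f : Fin 4 → R) : R := f 0 * f 3 ^ 2 - 3 * f 1 * f 2 * f 3 + 2 * f 2 ^ 3

/-- Substitution `f(px + qy, rx + sy)`, where `g = !![p, q; r, s]`. -/
def act (g : Matrix (Fin 2) (Fin 2) R) (f : Fin 4 → R) : Fin 4 → R :=
  ![f 0 * g 0 0 ^ 3 + 3 * f 1 * g 0 0 ^ 2 * g 1 0 + 3 * f 2 * g 0 0 * g 1 0 ^ 2
      + f 3 * g 1 0 ^ 3,
    f 0 * g 0 0 ^ 2 * g 0 1 + f 1 * (g 0 0 ^ 2 * g 1 1 + 2 * g 0 0 * g 0 1 * g 1 0)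
      + f 2 * (2 * g 0 0 * g 1 0 * g 1 1 + g 0 1 * g 1 0 ^ 2) + f 3 * g 1 0 ^ 2 * g 1 1,
    f 0 * g 0 0 * g 0 1 ^ 2 + f 1 * (2 * g 0 0 * g 0 1 * g 1 1 + g 0 1 ^ 2 * g 1 0)
      + f 2 * (g 0 0 * g 1 1 ^ 2 + 2 * g 0 1 * g 1 0 * g 1 1) + f 3 * g 1 0 * g 1 1 ^ 2,
    f 0 * g 0 1 ^ 3 + 3 * f 1 * g 0 1 ^ 2 * g 1 1 + 3 * f 2 * g 0 1 * g 1 1 ^ 2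
      + f 3 * g 1 1 ^ 3]

lemma act_one (f : Fin 4 → R) : act 1 f = f := by
  funext i; fin_cases i <;> simp [act]

lemma act_mul (g h : Matrix (Fin 2) (Fin 2) R) (f : Fin 4 → R) :
    act (g * h) f = act h (act g f) := by
  funext i; fin_cases i <;> simp [act, Matrix.mul_apply, Fin.sum_univ_two] <;> ring

lemma act_neg_one (f : Fin 4 → R) : act (-1) f = -f := by
  funext i; fin_cases i <;> simp [act] <;> ring

lemma eval_act (g : Matrix (Fin 2) (Fin 2) R) (f : Fin 4 → R) (x y : R) :
    eval (act g f) x y = eval f (g 0 0 * x + g 0 1 * y) (g 1 0 * x + g 1 1 * y) := by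
  simp [act, eval]; ring

lemma hessA_act (g : Matrix (Fin 2) (Fin 2) R) (f : Fin 4 → R) :
    hessA (act g f) = (g 0 0 * g 1 1 - g 0 1 * g 1 0) ^ 2 *
      (hessA f * g 0 0 ^ 2 + hessB f * g 0 0 * g 1 0 + hessC f * g 1 0 ^ 2) := by
  simp [act, hessA, hessB, hessC]; ring

lemma hessB_act (g : Matrix (Fin 2) (Fin 2) R) (f : Fin 4 → R) :
    hessB (act g f) = (g 0 0 * g 1 1 - g 0 1 * g 1 0) ^ 2 *
      (2 * hessA f * g 0 0 * g 0 1 + hessB f * (g 0 0 * g 1 1 + g 0 1 * g 1 0)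
        + 2 * hessC f * g 1 0 * g 1 1) := by
  simp [act, hessA, hessB, hessC]; ring

lemma hessC_act (g : Matrix (Fin 2) (Fin 2) R) (f : Fin 4 → R) :
    hessC (act g f) = (g 0 0 * g 1 1 - g 0 1 * g 1 0) ^ 2 *
      (hessA f * g 0 1 ^ 2 + hessB f * g 0 1 * g 1 1 + hessC f * g 1 1 ^ 2) := by
  simp [act, hessA, hessB, hessC]; ring

lemma disc_act (g : Matrix (Fin 2) (Fin 2) R) (f : Fin 4 → R) :
    disc (act g f) = (g 0 0 * g 1 1 - g 0 1 * g 1 0) ^ 6 * disc f := by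
  simp only [disc, hessA_act, hessB_act, hessC_act]; ring

lemma covA_sq (f : Fin 4 → R) : covA f ^ 2 = disc f * f 0 ^ 2 + 4 * hessA f ^ 3 := by
  simp only [disc, covA, hessA, hessB, hessC]; ring

lemma covD_sq (f : Fin 4 → R) : covD f ^ 2 = disc f * f 3 ^ 2 + 4 * hessC f ^ 3 := by
  simp only [disc, covD, hessA, hessB, hessC]; ring

end Ring

section Map

variable {R R' : Type*} [CommRing R] [CommRing R'] (φ : R →+* R')

lemma map_hessA (f : Fin 4 → R) : φ (hessA f) = hessA (φ ∘ f) := by simp [hessA]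

lemma map_hessB (f : Fin 4 → R) : φ (hessB f) = hessB (φ ∘ f) := by simp [hessB]

lemma map_hessC (f : Fin 4 → R) : φ (hessC f) = hessC (φ ∘ f) := by simp [hessC]

lemma map_disc (f : Fin 4 → R) : φ (disc f) = disc (φ ∘ f) := by
  simp [disc, map_ofNat, ← map_hessA, ← map_hessB, ← map_hessC]

lemma map_act (g : Matrix (Fin 2) (Fin 2) R) (f : Fin 4 → R) :
    φ ∘ act g f = act (g.map φ) (φ ∘ f) := by
  funext i; fin_cases i <;> simp [act, map_ofNat]

end Map

end CubicForm

namespace LatticeCount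

open MeasureTheory Set

variable {ι : Type*} [Fintype ι]

/-- The point of the scaled coset `(r + M ℤ^ι) / t` just below `x`. -/
noncomputable def cosetFloor (r : ι → ℤ) (M : ℕ) (t : ℝ) (x : ι → ℝ) : ι → ℝ :=
  fun i => (r i + M * (⌊(t * x i - r i) / M⌋ : ℝ)) / t

/-- The points of the scaled coset `(r + M ℤ^ι) / t`. -/
noncomputable def cosetPt (r : ι → ℤ) (M : ℕ) (t : ℝ) (w : ι → ℤ) : ι → ℝ :=
  fun i => (r i + M * (w i : ℝ)) / t

lemma tendsto_cosetFloor (r : ι → ℤ) {M : ℕ} (hM : 0 < M) (x : ι → ℝ) :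
    Tendsto (fun t : ℝ => cosetFloor r M t x) atTop (nhds x) := by
  rw [tendsto_pi_nhds]
  intro i
  have hM' : (0 : ℝ) < M := by exact_mod_cast hM
  have h1 : Tendsto (fun t : ℝ => x i - M / t) atTop (nhds (x i)) := by
    have : Tendsto (fun t : ℝ => (M : ℝ) / t) atTop (nhds 0) :=
      tendsto_const_nhds.div_atTop tendsto_id
    simpa using tendsto_const_nhds.sub this
  refine tendsto_of_tendsto_of_tendsto_of_le_of_le' h1 tendsto_const_nhds ?_ ?_
  · filter_upwards [eventually_gt_atTop (0 : ℝ)] with t ht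
    simp only [cosetFloor]
    have := (Int.sub_one_lt_floor ((t * x i - r i) / M)).le
    rw [le_div_iff₀ ht, sub_mul, div_mul_cancel₀ _ ht.ne']
    have h2 : ((t * x i - r i) / M - 1) * M ≤ ⌊(t * x i - r i) / M⌋ * (M : ℝ) :=
      mul_le_mul_of_nonneg_right this hM'.le
    rw [sub_mul, div_mul_cancel₀ _ hM'.ne'] at h2
    linarith
  · filter_upwards [eventually_gt_atTop (0 : ℝ)] with t ht
    simp only [cosetFloor]
    rw [div_le_iff₀ ht]
    have h2 := mul_le_mul_of_nonneg_right (Int.floor_le ((t * x i - r i) / M)) hM'.le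
    rw [div_mul_cancel₀ _ hM'.ne'] at h2
    linarith

/-- The cell of the scaled coset with lower corner `cosetPt r M t w`. -/
def cell (r : ι → ℤ) (M : ℕ) (t : ℝ) (w : ι → ℤ) : Set (ι → ℝ) :=
  Set.pi univ fun i => Ico ((r i + M * (w i : ℝ)) / t) ((r i + M * (w i : ℝ)) / t + M / t)

lemma mem_cell_iff (r : ι → ℤ) {M : ℕ} (hM : 0 < M) {t : ℝ} (ht : 0 < t) (w : ι → ℤ)
    (x : ι → ℝ) : x ∈ cell r M t w ↔ (fun i => ⌊(t * x i - r i) / M⌋) = w := by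
  have hM' : (0 : ℝ) < M := by exact_mod_cast hM
  simp only [cell, Set.mem_pi, mem_univ, true_implies, mem_Ico, funext_iff, Int.floor_eq_iff]
  refine forall_congr' fun i => and_congr ?_ ?_
  · rw [div_le_iff₀ ht, le_div_iff₀ hM']
    constructor <;> intro h <;> linarith
  · rw [← add_div, lt_div_iff₀ ht, div_lt_iff₀ hM']
    constructor <;> intro h <;> linarith

lemma preimage_eq_iUnion (R : Set (ι → ℝ)) (r : ι → ℤ) {M : ℕ} (hM : 0 < M) {t : ℝ}
    (ht : 0 < t) :
    cosetFloor r M t ⁻¹' R = ⋃ w ∈ {w : ι → ℤ | cosetPt r M t w ∈ R}, cell r M t w := by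
  ext x
  simp only [mem_preimage, mem_iUnion, mem_cell_iff r hM ht, mem_ofPred_eq, exists_prop]
  constructor
  · intro h
    exact ⟨_, h, rfl⟩
  · rintro ⟨w, hw, rfl⟩
    exact hw

lemma pairwiseDisjoint_cell (r : ι → ℤ) {M : ℕ} (hM : 0 < M) {t : ℝ} (ht : 0 < t)
    (s : Set (ι → ℤ)) : s.PairwiseDisjoint (cell r M t) := by
  intro w _ w' _ hww'
  refine Set.disjoint_left.2 fun x hx hx' => hww' ?_
  rw [mem_cell_iff r hM ht] at hx hx'
  exact hx.symm.trans hx'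

lemma measurableSet_cell (r : ι → ℤ) (M : ℕ) (t : ℝ) (w : ι → ℤ) :
    MeasurableSet (cell r M t w) :=
  MeasurableSet.univ_pi fun _ => measurableSet_Ico

lemma volume_cell (r : ι → ℤ) (M : ℕ) {t : ℝ} (ht : 0 < t) (w : ι → ℤ) :
    volume (cell r M t w) = ENNReal.ofReal ((M / t) ^ Fintype.card ι) := by
  rw [cell, volume_pi_pi]
  simp [Real.volume_Ico, ENNReal.ofReal_pow (show 0 ≤ (M : ℝ) / t by positivity)]

lemma finite_lattice_of_isBounded {R : Set (ι → ℝ)} (hb : Bornology.IsBounded R) {t : ℝ}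
    (ht : 0 < t) : {v : ι → ℤ | (fun i => (v i : ℝ) / t) ∈ R}.Finite := by
  classical
  obtain ⟨C, hC⟩ := hb.exists_norm_le
  refine (Set.finite_Icc (fun _ : ι => -⌈C * t⌉) (fun _ => ⌈C * t⌉)).subset fun v hv => ?_
  have h := hC _ hv
  have hi : ∀ i, |(v i : ℝ)| ≤ C * t := fun i => by
    have := (norm_le_pi_norm _ i).trans h
    rw [Real.norm_eq_abs, abs_div, abs_of_pos ht, div_le_iff₀ ht] at this
    exact this
  constructor
  · intro i
    have h1 : -(⌈C * t⌉ : ℝ) ≤ v i := by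
      linarith [neg_le_of_abs_le (hi i), Int.le_ceil (C * t)]
    exact_mod_cast h1
  · intro i
    have h1 : (v i : ℝ) ≤ ⌈C * t⌉ := by
      linarith [le_of_abs_le (hi i), Int.le_ceil (C * t)]
    exact_mod_cast h1

lemma finite_cosetPt {R : Set (ι → ℝ)} (hb : Bornology.IsBounded R) (r : ι → ℤ) {M : ℕ}
    (hM : 0 < M) {t : ℝ} (ht : 0 < t) : {w : ι → ℤ | cosetPt r M t w ∈ R}.Finite := by
  refine Set.Finite.of_finite_image (f := fun w : ι → ℤ => fun i => r i + M * w i)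
    ((finite_lattice_of_isBounded hb ht).subset ?_) ?_
  · rintro _ ⟨w, hw, rfl⟩
    have : (fun i => ((r i + M * w i : ℤ) : ℝ) / t) = cosetPt r M t w := by
      funext i; simp [cosetPt]
    rw [mem_ofPred_eq, this]
    exact hw
  · intro w _ w' _ h
    funext i
    have := congrFun h i
    simpa [hM.ne'] using this

lemma volume_preimage {R : Set (ι → ℝ)} (hb : Bornology.IsBounded R) (r : ι → ℤ) {M : ℕ}
    (hM : 0 < M) {t : ℝ} (ht : 0 < t) :
    volume (cosetFloor r M t ⁻¹' R) =
      Nat.card {w : ι → ℤ // cosetPt r M t w ∈ R} *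
        ENNReal.ofReal ((M / t) ^ Fintype.card ι) := by
  have hf := finite_cosetPt hb r hM ht
  rw [preimage_eq_iUnion R r hM ht,
    measure_biUnion hf.countable (pairwiseDisjoint_cell r hM ht _)
      (fun w _ => measurableSet_cell r M t w)]
  simp only [volume_cell r M ht]
  rw [ENNReal.tsum_const]
  congr 1
  rw [ENat.card_coe_set_eq, ← hf.cast_ncard_eq, ← Nat.card_coe_set_eq]
  rfl

lemma isBounded_union_preimage {R : Set (ι → ℝ)} (hb : Bornology.IsBounded R) (r : ι → ℤ)
    {M : ℕ} (hM : 0 < M) :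
    ∃ B : Set (ι → ℝ), MeasurableSet B ∧ volume B ≠ ⊤ ∧
      ∀ t : ℝ, 1 ≤ t → cosetFloor r M t ⁻¹' R ⊆ B := by
  have hM' : (0 : ℝ) < M := by exact_mod_cast hM
  obtain ⟨C, hC⟩ := hb.exists_norm_le
  refine ⟨Metric.closedBall 0 (|C| + M), Metric.isClosed_closedBall.measurableSet,
    (isCompact_closedBall _ _).measure_lt_top.ne, fun t ht x hx => ?_⟩
  have ht0 : 0 < t := by linarith
  rw [mem_closedBall_zero_iff, pi_norm_le_iff_of_nonneg (by positivity)]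
  intro i
  have h1 := (norm_le_pi_norm _ i).trans (hC _ hx)
  have h2 : x ∈ cell r M t (fun i => ⌊(t * x i - r i) / M⌋) := (mem_cell_iff r hM ht0 _ _).2 rfl
  have h3 := h2 i (mem_univ i)
  simp only [mem_Ico] at h3
  have h4 : (M : ℝ) / t ≤ M := div_le_self hM'.le ht
  simp only [cosetFloor, Real.norm_eq_abs] at h1 ⊢
  rw [abs_le] at h1 ⊢
  have := le_abs_self C
  constructor <;> linarith [h1.1, h1.2, h3.1, h3.2]

theorem tendsto_card_coset {R : Set (ι → ℝ)} (hb : Bornology.IsBounded R)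
    (hR : MeasurableSet R) (hfr : volume (frontier R) = 0) (r : ι → ℤ) {M : ℕ} (hM : 0 < M) :
    Tendsto (fun t : ℝ => (Nat.card {w : ι → ℤ // cosetPt r M t w ∈ R} : ℝ) /
      t ^ Fintype.card ι) atTop (nhds ((volume R).toReal / (M : ℝ) ^ Fintype.card ι)) := by
  obtain ⟨B, hB, hBt, hsub⟩ := isBounded_union_preimage hb r hM
  have hmeas : ∀ t : ℝ, MeasurableSet (cosetFloor r M (max t 1) ⁻¹' R) := fun t => by
    rw [preimage_eq_iUnion R r hM (by positivity)]
    exact MeasurableSet.biUnion (Set.to_countable _) fun w _ => measurableSet_cell _ _ _ _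
  have key := tendsto_measure_of_ae_tendsto_indicator (μ := volume) (atTop : Filter ℝ) hR hmeas hB
    hBt (Eventually.of_forall fun t => hsub _ (le_max_right t 1)) (by
      have : ∀ᵐ x, x ∉ frontier R := by
        rw [ae_iff]; simpa using hfr
      filter_upwards [this] with x hx
      have hx2 := tendsto_cosetFloor r hM x
      have hmax : ∀ᶠ t : ℝ in atTop, max t 1 = t := by
        filter_upwards [eventually_ge_atTop 1] with t ht using max_eq_left ht
      by_cases hxi : x ∈ interior R
      · filter_upwards [hx2.eventually (isOpen_interior.mem_nhds hxi), hmax] with t h1 h2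
        rw [h2]
        exact ⟨fun _ => interior_subset hxi, fun _ => mem_preimage.2 (interior_subset h1)⟩
      · have hxc : x ∉ closure R := fun h => hx ⟨h, hxi⟩
        filter_upwards [hx2.eventually (isClosed_closure.isOpen_compl.mem_nhds hxc), hmax]
          with t h1 h2
        rw [h2]
        exact ⟨fun h => absurd (subset_closure (mem_preimage.1 h)) h1, fun h => absurd (subset_closure h) hxc⟩)
  have hfin : volume R ≠ ⊤ := hb.measure_lt_top.ne
  have key2 := ((ENNReal.tendsto_toReal hfin).comp key).div_const ((M : ℝ) ^ Fintype.card ι)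
  refine key2.congr' ?_
  filter_upwards [eventually_ge_atTop 1] with t ht
  have ht0 : 0 < t := by linarith
  simp only [Function.comp_apply, max_eq_left ht]
  rw [volume_preimage hb r hM ht0, ENNReal.toReal_mul, ENNReal.toReal_natCast,
    ENNReal.toReal_ofReal (by positivity), div_pow]
  field_simp

/-- The number of residue classes modulo `M` on which the `M`-periodic set `E` is supported. -/
noncomputable def residueCount (M : ℕ) (E : Set (ι → ℤ)) : ℕ :=
  Nat.card {r : ι → ZMod M // (fun i => ((r i).val : ℤ)) ∈ E}

/-- Invariance of a set of integer points under translation by `M ℤ^ι`. -/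
def IsPeriodic (M : ℕ) (E : Set (ι → ℤ)) : Prop :=
  ∀ v w : ι → ℤ, (∀ i, (v i : ZMod M) = w i) → v ∈ E → w ∈ E

theorem tendsto_card_periodic {R : Set (ι → ℝ)} (hb : Bornology.IsBounded R)
    (hR : MeasurableSet R) (hfr : volume (frontier R) = 0) {M : ℕ} (hM : 0 < M)
    {E : Set (ι → ℤ)} (hE : IsPeriodic M E) :
    Tendsto (fun t : ℝ => (Nat.card {v : ι → ℤ // v ∈ E ∧ (fun i => (v i : ℝ) / t) ∈ R} : ℝ) /
      t ^ Fintype.card ι) atTop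
      (nhds ((volume R).toReal * (residueCount M E / (M : ℝ) ^ Fintype.card ι))) := by
  have : NeZero M := ⟨hM.ne'⟩
  set ρ := {r : ι → ZMod M // (fun i => ((r i).val : ℤ)) ∈ E} with hρ
  have : Fintype ρ := Fintype.ofFinite _
  have hsum := tendsto_finsetSum (Finset.univ : Finset ρ) fun r _ =>
    tendsto_card_coset hb hR hfr (fun i => ((r.1 i).val : ℤ)) hM
  have hlim : ∑ _r : ρ, (volume R).toReal / (M : ℝ) ^ Fintype.card ι =
      (volume R).toReal * (residueCount M E / (M : ℝ) ^ Fintype.card ι) := by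
    rw [Finset.sum_const, residueCount, Nat.card_eq_fintype_card, Finset.card_univ, nsmul_eq_mul]
    ring
  rw [hlim] at hsum
  refine hsum.congr' ?_
  filter_upwards [eventually_gt_atTop 0] with t ht
  rw [← Finset.sum_div, ← Nat.cast_sum]
  congr 2
  have hfinw : ∀ r : ρ, Finite {w : ι → ℤ // cosetPt (fun i => ((r.1 i).val : ℤ)) M t w ∈ R} :=
    fun r => finite_cosetPt hb _ hM ht
  rw [← Nat.card_sigma]
  refine Nat.card_congr
    (Equiv.ofBijective (fun x => ⟨fun i => ((x.1.1 i).val : ℤ) + M * x.2.1 i, ?_, ?_⟩) ⟨?_, ?_⟩)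
  · refine hE _ _ (fun i => ?_) x.1.2
    simp
  · have h1 : (fun i => ((((x.1.1 i).val : ℤ) + M * x.2.1 i : ℤ) : ℝ) / t) =
        cosetPt (fun i => ((x.1.1 i).val : ℤ)) M t x.2.1 := by
      funext i; simp [cosetPt]
    rw [h1]
    exact x.2.2
  · rintro ⟨⟨r, hr⟩, ⟨w, hw⟩⟩ ⟨⟨r', hr'⟩, ⟨w', hw'⟩⟩ h
    have h1 : ∀ i, ((r i).val : ℤ) + M * w i = ((r' i).val : ℤ) + M * w' i := fun i =>
      congrFun (congrArg Subtype.val h) i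
    have h2 : r = r' := by
      funext i
      have := congrArg (Int.cast : ℤ → ZMod M) (h1 i)
      simpa using this
    subst h2
    have h3 : w = w' := by
      funext i
      have := h1 i
      have hM' : (M : ℤ) ≠ 0 := by exact_mod_cast hM.ne'
      exact mul_left_cancel₀ hM' (by linarith)
    subst h3
    rfl
  · rintro ⟨v, hvE, hvR⟩
    have hv : ∀ i, (((v i : ZMod M)).val : ℤ) + M * (v i / M) = v i := fun i => by
      rw [ZMod.val_intCast]
      exact Int.emod_add_mul_ediv _ _
    refine ⟨⟨⟨fun i => (v i : ZMod M), hE v _ (fun i => ?_) hvE⟩, ⟨fun i => v i / M, ?_⟩⟩, ?_⟩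
    · simp
    · have : cosetPt (fun i => (((v i : ZMod M)).val : ℤ)) M t (fun i => v i / M) =
          fun i => (v i : ℝ) / t := by
        funext i
        simp only [cosetPt]
        have := hv i
        congr 1
        exact_mod_cast this
      rw [this]
      exact hvR
    · simp only [Subtype.mk.injEq]
      funext i
      exact hv i

end LatticeCount

namespace LatticeCount

variable {ι : Type*}

lemma IsPeriodic.mem_iff {M : ℕ} {E : Set (ι → ℤ)} (hE : IsPeriodic M E) {v w : ι → ℤ}
    (h : ∀ i, (v i : ZMod M) = w i) : v ∈ E ↔ w ∈ E :=
  ⟨hE v w h, hE w v fun i => (h i).symm⟩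

lemma IsPeriodic.of_dvd {M N : ℕ} (hMN : M ∣ N) {E : Set (ι → ℤ)} (hE : IsPeriodic M E) :
    IsPeriodic N E := by
  intro v w h
  refine hE v w fun i => ?_
  have := congrArg (ZMod.castHom hMN (ZMod M)) (h i)
  simpa using this

lemma residueCount_mul {M N : ℕ} [NeZero M] [NeZero N] (h : M.Coprime N) {E F : Set (ι → ℤ)}
    (hE : IsPeriodic M E) (hF : IsPeriodic N F) :
    residueCount (M * N) (E ∩ F) = residueCount M E * residueCount N F := by
  unfold residueCount
  rw [← Nat.card_prod]
  let e := ZMod.chineseRemainder h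
  have e1 : ∀ x : ZMod (M * N), (e x).1 = ((x.val : ℤ) : ZMod M) := fun x => by
    rw [← ZMod.natCast_zmod_val x, map_natCast]
    simp
  have e2 : ∀ x : ZMod (M * N), (e x).2 = ((x.val : ℤ) : ZMod N) := fun x => by
    rw [← ZMod.natCast_zmod_val x, map_natCast]
    simp
  have hM : ∀ r : ι → ZMod (M * N), (fun i => ((r i).val : ℤ)) ∈ E ↔
      (fun i => ((e (r i)).1.val : ℤ)) ∈ E := fun r =>
    hE.mem_iff fun i => by simp [e1]
  have hN : ∀ r : ι → ZMod (M * N), (fun i => ((r i).val : ℤ)) ∈ F ↔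
      (fun i => ((e (r i)).2.val : ℤ)) ∈ F := fun r =>
    hF.mem_iff fun i => by simp [e2]
  refine Nat.card_congr
    { toFun := fun r => (⟨fun i => (e (r.1 i)).1, (hM _).1 r.2.1⟩,
        ⟨fun i => (e (r.1 i)).2, (hN _).1 r.2.2⟩)
      invFun := fun r => ⟨fun i => e.symm (r.1.1 i, r.2.1 i), (hM _).2 ?_, (hN _).2 ?_⟩
      left_inv := fun r => by simp
      right_inv := fun r => by simp }
  · simpa using r.1.2
  · simpa using r.2.2

lemma IsPeriodic.biInter {α : Type*} (P : Finset α) (q : α → ℕ) (E : α → Set (ι → ℤ))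
    (hE : ∀ p ∈ P, IsPeriodic (q p) (E p)) :
    IsPeriodic (∏ p ∈ P, q p) (⋂ p ∈ P, E p) := by
  intro v w h hv
  simp only [Set.mem_iInter] at hv ⊢
  exact fun p hp => (hE p hp).of_dvd (Finset.dvd_prod_of_mem q hp) v w h (hv p hp)

theorem residueCount_biInter [Finite ι] {α : Type*} (P : Finset α) (q : α → ℕ)
    (E : α → Set (ι → ℤ))
    (hq : ∀ p ∈ P, q p ≠ 0) (hE : ∀ p ∈ P, IsPeriodic (q p) (E p))
    (hcop : (P : Set α).Pairwise fun a b => (q a).Coprime (q b)) :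
    residueCount (∏ p ∈ P, q p) (⋂ p ∈ P, E p) = ∏ p ∈ P, residueCount (q p) (E p) := by
  classical
  induction P using Finset.induction_on with
  | empty =>
    simp [residueCount]
  | insert a P ha ih =>
    have hcop' : (q a).Coprime (∏ p ∈ P, q p) := Nat.Coprime.prod_right fun p hp =>
      hcop (by simp) (by simp [hp]) (by rintro rfl; exact ha hp)
    have : NeZero (q a) := ⟨hq a (by simp)⟩
    have : NeZero (∏ p ∈ P, q p) :=
      ⟨Finset.prod_ne_zero_iff.2 fun p hp => hq p (by simp [hp])⟩
    rw [Finset.prod_insert ha, Finset.prod_insert ha, Finset.set_biInter_insert,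
      residueCount_mul hcop' (hE a (by simp))
        (IsPeriodic.biInter P q E fun p hp => hE p (by simp [hp])),
      ih (fun p hp => hq p (by simp [hp])) (fun p hp => hE p (by simp [hp]))
        (hcop.mono (by simp))]

/-- Density of a periodic set. -/
noncomputable def density [Fintype ι] (M : ℕ) (E : Set (ι → ℤ)) : ℝ :=
  residueCount M E / (M : ℝ) ^ Fintype.card ι

lemma density_biInter [Fintype ι] {α : Type*} (P : Finset α) (q : α → ℕ)
    (E : α → Set (ι → ℤ))
    (hq : ∀ p ∈ P, q p ≠ 0) (hE : ∀ p ∈ P, IsPeriodic (q p) (E p))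
    (hcop : (P : Set α).Pairwise fun a b => (q a).Coprime (q b)) :
    density (∏ p ∈ P, q p) (⋂ p ∈ P, E p) = ∏ p ∈ P, density (q p) (E p) := by
  simp only [density, residueCount_biInter P q E hq hE hcop]
  push_cast
  rw [← Finset.prod_pow, Finset.prod_div_distrib]

lemma residueCount_compl_add [Fintype ι] (M : ℕ) [NeZero M] {E F : Set (ι → ℤ)} (h : F ⊆ E) :
    residueCount M (E \ F) + residueCount M F = residueCount M E := by
  classical
  unfold residueCount
  simp only [Nat.card_eq_fintype_card, Fintype.card_subtype]
  rw [← Finset.card_union_of_disjoint]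
  · congr 1
    ext r
    simp only [Finset.mem_union, Finset.mem_filter, Finset.mem_univ, true_and, Set.mem_sdiff]
    constructor
    · rintro (h1 | h1)
      · exact h1.1
      · exact h h1
    · grind
  · rw [Finset.disjoint_filter]
    exact fun r _ h1 h2 => h1.2 h2

end LatticeCount

namespace LatticeCount

open MeasureTheory

lemma isPeriodic_of_iff {ι : Type*} {M : ℕ} {E : Set (ι → ℤ)} (Q : (ι → ZMod M) → Prop)
    (h : ∀ v, v ∈ E ↔ Q fun i => (v i : ZMod M)) : IsPeriodic M E := by
  intro v w hvw hv
  rw [h] at hv ⊢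
  rwa [show (fun i => (w i : ZMod M)) = fun i => (v i : ZMod M) from
    funext fun i => (hvw i).symm]

lemma residueCount_eq_card {ι : Type*} {M : ℕ} [NeZero M] {E : Set (ι → ℤ)}
    (Q : (ι → ZMod M) → Prop) (h : ∀ v, v ∈ E ↔ Q fun i => (v i : ZMod M)) :
    residueCount M E = Nat.card {r : ι → ZMod M // Q r} := by
  refine Nat.card_congr (Equiv.subtypeEquivRight fun r => ?_)
  rw [h]
  simp

/-- The density does not depend on the chosen period. -/
lemma density_eq_of_isPeriodic {ι : Type*} [Fintype ι] {M N : ℕ} (hM : 0 < M) (hN : 0 < N)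
    {E : Set (ι → ℤ)} (h1 : IsPeriodic M E) (h2 : IsPeriodic N E) : density M E = density N E := by
  classical
  let R : Set (ι → ℝ) := Metric.ball 0 1
  have hb : Bornology.IsBounded R := Metric.isBounded_ball
  have hm : MeasurableSet R := Metric.isOpen_ball.measurableSet
  have hf : volume (frontier R) = 0 := by
    have := (convex_ball (0 : ι → ℝ) 1).addHaar_frontier (volume : Measure (ι → ℝ))
    exact this
  have hpos : (volume R).toReal ≠ 0 :=
    (ENNReal.toReal_pos (Metric.measure_ball_pos volume _ one_pos).ne' hb.measure_lt_top.ne).ne'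
  have := tendsto_nhds_unique (tendsto_card_periodic hb hm hf hM h1)
    (tendsto_card_periodic hb hm hf hN h2)
  exact mul_left_cancel₀ hpos this

lemma card_fin_four {R : Type*} [Fintype R] (Q : (Fin 4 → R) → Prop)
    [DecidablePred Q] :
    Nat.card {r : Fin 4 → R // Q r} =
      ∑ e : R, ∑ c : R, ∑ b : R, ∑ a : R, if Q ![a, b, c, e] then 1 else 0 := by
  classical
  rw [Nat.card_eq_fintype_card, Fintype.card_subtype, Finset.card_filter]
  let eqv : R × R × R × R ≃ (Fin 4 → R) :=
    { toFun := fun x => ![x.2.2.2, x.2.2.1, x.2.1, x.1]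
      invFun := fun f => (f 3, f 2, f 1, f 0)
      left_inv := fun x => by simp
      right_inv := fun f => by funext i; fin_cases i <;> rfl }
  rw [← eqv.sum_comp]
  simp only [Fintype.sum_prod_type]
  rfl

end LatticeCount

namespace ZModSq

open CubicForm

lemma sum_affine {R α : Type*} [CommRing R] [Fintype R] [AddCommMonoid α] (F : R → α) {u : R}
    (hu : IsUnit u) (v : R) : ∑ a, F (u * a + v) = ∑ a, F a := by
  obtain ⟨u, rfl⟩ := hu
  exact (u.mulLeft.trans (Equiv.addRight v)).sum_comp F

lemma sum_unit_cusp {R : Type*} [CommRing R] [Fintype R] [DecidableEq R]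
    [DecidablePred (IsUnit : R → Prop)] (h2 : IsUnit (2 : R)) :
    (∑ C : R, ∑ g : R, if IsUnit C ∧ g ^ 2 = 4 * C ^ 3 then 1 else 0) =
      ∑ C : R, if IsUnit C then 1 else 0 := by
  classical
  rw [← Fintype.sum_prod_type' (f := fun C g : R => if IsUnit C ∧ g ^ 2 = 4 * C ^ 3 then 1 else 0),
    ← Finset.card_filter, ← Finset.card_filter]
  symm
  refine Finset.card_bij (fun t _ => (t ^ 2, 2 * t ^ 3)) ?_ ?_ ?_
  · intro t ht
    simp only [Finset.mem_filter, Finset.mem_univ, true_and] at ht ⊢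
    exact ⟨ht.pow 2, by ring⟩
  · intro t ht s hs h
    simp only [Finset.mem_filter, Finset.mem_univ, true_and, Prod.mk.injEq] at ht hs h
    have h3 : t ^ 3 = s ^ 3 := h2.mul_left_cancel h.2
    refine (ht.pow 2).mul_left_cancel ?_
    calc t ^ 2 * t = t ^ 3 := by ring
      _ = s ^ 2 * s := by rw [h3]; ring
      _ = t ^ 2 * s := by rw [h.1]
  · rintro ⟨C, g⟩ h
    simp only [Finset.mem_filter, Finset.mem_univ, true_and] at h
    obtain ⟨hC, hg⟩ := h
    obtain ⟨w, hw⟩ := (h2.mul hC).exists_left_inv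
    have h1 : (w * g) ^ 2 = C := by grind
    refine ⟨w * g, ?_, ?_⟩
    · simp only [Finset.mem_filter, Finset.mem_univ, true_and]
      exact (isUnit_pow_iff two_ne_zero).1 (h1 ▸ hC)
    · grind

section Sq

variable {p : ℕ} [Fact p.Prime]

lemma isUnit_or_dvd (x : ZMod (p ^ 2)) : IsUnit x ↔ ¬ (p : ZMod (p ^ 2)) ∣ x := by
  have hp : p.Prime := Fact.out
  obtain ⟨n, rfl⟩ : ∃ n : ℕ, (n : ZMod (p ^ 2)) = x := ⟨x.val, by simp⟩
  rw [ZMod.isUnit_iff_coprime, Nat.coprime_pow_right_iff (by norm_num), Nat.coprime_comm,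
    hp.coprime_iff_not_dvd, not_iff_not]
  constructor
  · rintro ⟨k, rfl⟩
    exact ⟨k, by simp⟩
  · rintro ⟨k, hk⟩
    obtain ⟨l, rfl⟩ : ∃ l : ℕ, (l : ZMod (p ^ 2)) = k := ⟨k.val, by simp⟩
    rw [← Nat.cast_mul, ZMod.natCast_eq_natCast_iff] at hk
    exact (Nat.ModEq.dvd_iff (hk.of_dvd (dvd_pow_self p two_ne_zero)) dvd_rfl).2 ⟨l, rfl⟩

omit [Fact p.Prime] in
lemma mul_eq_zero_of_dvd {x y : ZMod (p ^ 2)} (hx : (p : ZMod (p ^ 2)) ∣ x)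
    (hy : (p : ZMod (p ^ 2)) ∣ y) : x * y = 0 := by
  obtain ⟨a, rfl⟩ := hx
  obtain ⟨b, rfl⟩ := hy
  have : ((p ^ 2 : ℕ) : ZMod (p ^ 2)) = 0 := ZMod.natCast_self _
  push_cast at this
  linear_combination a * b * this

lemma dvd_of_mul_eq_zero {x y : ZMod (p ^ 2)} (hy : y ≠ 0) (h : x * y = 0) :
    (p : ZMod (p ^ 2)) ∣ x := by
  by_contra h1
  rw [← isUnit_or_dvd] at h1
  exact hy ((h1.mul_right_eq_zero).1 h)

lemma dvd_of_dvd_pow {x : ZMod (p ^ 2)} {n : ℕ} (h : (p : ZMod (p ^ 2)) ∣ x ^ n) :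
    (p : ZMod (p ^ 2)) ∣ x := by
  by_contra h1
  rw [← isUnit_or_dvd] at h1
  exact (isUnit_or_dvd _).1 (h1.pow n) h

lemma sum_dvd [DecidablePred fun x : ZMod (p ^ 2) => (p : ZMod (p ^ 2)) ∣ x] :
    (∑ x : ZMod (p ^ 2), if (p : ZMod (p ^ 2)) ∣ x then 1 else 0) = p := by
  have hp : p.Prime := Fact.out
  have hcard := ZMod.card_units_eq_totient (p ^ 2)
  have h3 : (∑ x : ZMod (p ^ 2), if (p : ZMod (p ^ 2)) ∣ x then 1 else 0) +
      Fintype.card (ZMod (p ^ 2))ˣ = p ^ 2 := by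
    classical
    rw [← Finset.card_filter, Fintype.card_congr (Equiv.ofBijective
      (fun u : (ZMod (p ^ 2))ˣ => (⟨u, u.isUnit⟩ : {x : ZMod (p ^ 2) // IsUnit x}))
      ⟨fun u v h => Units.ext (congrArg Subtype.val h), fun x => ⟨x.2.unit, rfl⟩⟩), Fintype.card_subtype]
    simp only [isUnit_or_dvd]
    rw [Finset.card_filter_add_card_filter_not]
    simp [ZMod.card]
  rw [hcard, Nat.totient_prime_pow hp (by norm_num)] at h3
  have : p ^ (2 - 1) * (p - 1) + p = p ^ 2 := by
    obtain ⟨k, hk⟩ : ∃ k, p = k + 1 := ⟨p - 1, by have := hp.pos; omega⟩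
    subst hk; simp; ring
  omega

end Sq

lemma ite_one_congr {P Q : Prop} [Decidable P] [Decidable Q] (h : P ↔ Q) :
    (if P then 1 else 0 : ℕ) = if Q then 1 else 0 :=
  if_congr h rfl rfl

open scoped Classical in
lemma sum_isUnit_ite {p : ℕ} [Fact p.Prime] (F G : ZMod (p ^ 2) → ℕ) (A B : ℕ)
    (hA : ∀ x, IsUnit x → F x = A) (hB : ∀ x, ¬ IsUnit x → F x = B + G x) :
    ∑ x, F x = (p ^ 2 - p) * A + p * B + ∑ x, if IsUnit x then 0 else G x := by
  have h1 : ∀ x, F x = (if (p : ZMod (p ^ 2)) ∣ x then 0 else A) +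
      (if (p : ZMod (p ^ 2)) ∣ x then 1 else 0) * B + if IsUnit x then 0 else G x := by
    intro x
    by_cases hx : (p : ZMod (p ^ 2)) ∣ x
    · have hu : ¬ IsUnit x := by rw [isUnit_or_dvd]; exact not_not.2 hx
      simp [hx, hu, hB x hu]
    · have hu : IsUnit x := by rw [isUnit_or_dvd]; exact hx
      simp [hx, hu, hA x hu]
  have h2 : (∑ x : ZMod (p ^ 2), if (p : ZMod (p ^ 2)) ∣ x then 0 else A) = (p ^ 2 - p) * A := by
    have h3 : ∀ x : ZMod (p ^ 2), (if (p : ZMod (p ^ 2)) ∣ x then 0 else A) +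
        (if (p : ZMod (p ^ 2)) ∣ x then 1 else 0) * A = A := fun x => by split_ifs <;> simp
    have h4 : ∑ x : ZMod (p ^ 2), ((if (p : ZMod (p ^ 2)) ∣ x then 0 else A) +
        (if (p : ZMod (p ^ 2)) ∣ x then 1 else 0) * A) = p ^ 2 * A := by
      simp only [h3]
      simp [ZMod.card]
    rw [Finset.sum_add_distrib, ← Finset.sum_mul, sum_dvd] at h4
    rw [Nat.sub_mul]
    omega
  rw [Finset.sum_congr rfl fun x _ => h1 x, Finset.sum_add_distrib, Finset.sum_add_distrib, h2,
    ← Finset.sum_mul, sum_dvd]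

section Fiber

variable {R : Type*} [CommRing R]

/-- For a unit last coefficient `e`, `(c, b, a) ↦ (c, C, g)` is a bijection. -/
lemma sum_fiber [Fintype R] {α : Type*} [AddCommMonoid α] (F : R → R → α) {e : R} (he : IsUnit e) (c : R) :
    ∑ b : R, ∑ a : R, F (hessC ![a, b, c, e]) (covD ![a, b, c, e]) = ∑ C : R, ∑ g : R, F C g := by
  have h1 : ∀ b, ∑ a : R, F (hessC ![a, b, c, e]) (covD ![a, b, c, e]) =
      ∑ g : R, F (c ^ 2 - b * e) g := by
    intro b
    rw [← sum_affine (F (c ^ 2 - b * e)) (he.pow 2) (-3 * b * c * e + 2 * c ^ 3)]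
    refine Finset.sum_congr rfl fun a _ => ?_
    congr 1
    simp [covD]
    ring
  simp only [h1]
  rw [← sum_affine (fun C => ∑ g : R, F C g) he.neg (c ^ 2)]
  refine Finset.sum_congr rfl fun b _ => ?_
  congr 2
  funext g
  congr 1
  ring

lemma disc_eq_zero_iff {f : Fin 4 → R} (he : IsUnit (f 3)) :
    disc f = 0 ↔ covD f ^ 2 = 4 * hessC f ^ 3 := by
  have h := covD_sq f
  constructor
  · intro h0
    rw [h, h0]; ring
  · intro h0
    rw [h0] at h
    have : disc f * f 3 ^ 2 = 0 := by linear_combination -h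
    exact (he.pow 2).mul_left_eq_zero.1 this

end Fiber

section Sq

variable {p : ℕ} [Fact p.Prime]

lemma isUnit_two (hp : p ≠ 2) : IsUnit (2 : ZMod (p ^ 2)) := by
  have h : p.Prime := Fact.out
  have : IsUnit ((2 : ℕ) : ZMod (p ^ 2)) := by
    rw [ZMod.isUnit_iff_coprime]
    exact Nat.Coprime.pow_right 2 ((Nat.coprime_primes Nat.prime_two h).2 hp.symm)
  exact_mod_cast this

open scoped Classical in
lemma sum_cusp (hp : p ≠ 2) :
    (∑ C : ZMod (p ^ 2), ∑ g : ZMod (p ^ 2), if g ^ 2 = 4 * C ^ 3 then 1 else 0) =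
      (p ^ 2 - p) + p * p := by
  have h0 : ∀ C g : ZMod (p ^ 2), (if g ^ 2 = 4 * C ^ 3 then 1 else 0) =
      (if IsUnit C ∧ g ^ 2 = 4 * C ^ 3 then 1 else 0) +
      (if (p : ZMod (p ^ 2)) ∣ C then 1 else 0) * (if (p : ZMod (p ^ 2)) ∣ g then 1 else 0) := by
    intro C g
    by_cases hC : IsUnit C
    · simp [hC, (isUnit_or_dvd C).1 hC]
    · have hC' : (p : ZMod (p ^ 2)) ∣ C := by rwa [isUnit_or_dvd, not_not] at hC
      have h3 : C ^ 3 = 0 := by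
        rw [show C ^ 3 = C * C * C by ring, mul_eq_zero_of_dvd hC' hC', zero_mul]
      simp only [hC, false_and, if_false, hC', if_true, h3, mul_zero, zero_add, one_mul]
      congr 1
      refine propext ⟨fun h => dvd_of_dvd_pow (n := 2) (h ▸ dvd_zero _), fun h => ?_⟩
      exact (sq g).trans (mul_eq_zero_of_dvd h h)
  simp only [h0, Finset.sum_add_distrib]
  rw [sum_unit_cusp (isUnit_two hp)]
  simp only [← Finset.mul_sum, sum_dvd, ← Finset.sum_mul]
  have := sum_isUnit_ite (p := p) (fun C => if IsUnit C then 1 else 0) (fun _ => 0) 1 0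
    (fun x hx => by simp [hx]) (fun x hx => by simp [hx])
  rw [this]
  simp

lemma sum_linear_eq_zero {u : ZMod (p ^ 2)} (hu : IsUnit u) (v : ZMod (p ^ 2)) :
    (∑ a : ZMod (p ^ 2), if u * a + v = 0 then 1 else 0) = 1 := by
  rw [sum_affine (fun a => if a = 0 then 1 else 0) hu]
  simp

open scoped Classical in
lemma card_disc_eq_zero (hp : p ≠ 2) :
    Nat.card {f : Fin 4 → ZMod (p ^ 2) // disc f = 0} + p ^ 4 = 2 * p ^ 6 := by
  rw [LatticeCount.card_fin_four]
  have hsub : p ^ 2 - p + p = p ^ 2 := Nat.sub_add_cancel (Nat.le_self_pow two_ne_zero p)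
  have hunit : ∀ e : ZMod (p ^ 2), IsUnit e →
      (∑ c, ∑ b, ∑ a, if disc ![a, b, c, e] = 0 then 1 else 0) =
        p ^ 2 * ((p ^ 2 - p) + p * p) := by
    intro e he
    have : ∀ c, (∑ b, ∑ a, if disc ![a, b, c, e] = 0 then 1 else 0) = (p ^ 2 - p) + p * p := by
      intro c
      rw [← sum_cusp hp, ← sum_fiber (fun C g => if g ^ 2 = 4 * C ^ 3 then 1 else 0) he c]
      refine Finset.sum_congr rfl fun b _ => Finset.sum_congr rfl fun a _ => ?_
      exact ite_one_congr (disc_eq_zero_iff (by simpa using he))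
    simp only [this, Finset.sum_const, Finset.card_univ, ZMod.card, smul_eq_mul]
  have hb : ∀ e : ZMod (p ^ 2), ¬ IsUnit e →
      (∑ b : ZMod (p ^ 2), if b ^ 3 * e = 0 then 1 else 0) =
        p + if e = 0 then p ^ 2 - p else 0 := by
    intro e he
    by_cases h0 : e = 0
    · simp [h0, ZMod.card]; omega
    · simp only [h0, if_false, add_zero]
      refine Eq.trans ?_ (sum_dvd (p := p))
      refine Finset.sum_congr rfl fun b _ => ite_one_congr ⟨fun h => dvd_of_dvd_pow (n := 3) (dvd_of_mul_eq_zero h0 h), fun h => ?_⟩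
      refine mul_eq_zero_of_dvd (h.trans (dvd_pow_self b (by norm_num))) ?_
      rwa [isUnit_or_dvd, not_not] at he
  have hnon : ∀ e : ZMod (p ^ 2), ¬ IsUnit e →
      (∑ c, ∑ b, ∑ a, if disc ![a, b, c, e] = 0 then 1 else 0) =
        ((p ^ 2 - p) * p ^ 2 + p * (p ^ 2 * p)) +
          p * (p ^ 2 * if e = 0 then p ^ 2 - p else 0) := by
    intro e he
    have hpe : (p : ZMod (p ^ 2)) ∣ e := by rwa [isUnit_or_dvd, not_not] at he
    have hee : e * e = 0 := mul_eq_zero_of_dvd hpe hpe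
    rw [sum_isUnit_ite _ (fun _ => 0) (p ^ 2)
      (p ^ 2 * (p + if e = 0 then p ^ 2 - p else 0))]
    · simp only [ite_self, Finset.sum_const_zero]; ring
    · intro c hc
      have : ∀ b, (∑ a, if disc ![a, b, c, e] = 0 then 1 else 0) = 1 := by
        intro b
        have hu : IsUnit (4 * c ^ 3 - 6 * b * c * e) := by
          rw [isUnit_or_dvd, dvd_sub_left (hpe.mul_left _), ← isUnit_or_dvd]
          have h4 : IsUnit (4 : ZMod (p ^ 2)) := by
            have := (isUnit_two hp).pow 2
            norm_num at this
            exact this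
          exact h4.mul (hc.pow 3)
        refine Eq.trans ?_ (sum_linear_eq_zero hu (4 * b ^ 3 * e - 3 * b ^ 2 * c ^ 2))
        refine Finset.sum_congr rfl fun a _ => ite_one_congr (Eq.congr_left ?_)
        simp [disc, hessA, hessB, hessC]
        linear_combination a ^ 2 * hee
      simp only [this, Finset.sum_const, Finset.card_univ, ZMod.card, smul_eq_mul, mul_one]
    · intro c hc
      have hpc : (p : ZMod (p ^ 2)) ∣ c := by rwa [isUnit_or_dvd, not_not] at hc
      have hcc : c * c = 0 := mul_eq_zero_of_dvd hpc hpc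
      have hce : c * e = 0 := mul_eq_zero_of_dvd hpc hpe
      have : ∀ b, (∑ a, if disc ![a, b, c, e] = 0 then 1 else 0) =
          p ^ 2 * if b ^ 3 * e = 0 then 1 else 0 := by
        intro b
        refine Eq.trans ?_ (show (∑ _a : ZMod (p ^ 2), if b ^ 3 * e = 0 then 1 else 0) =
          p ^ 2 * (if b ^ 3 * e = 0 then 1 else 0) by
            rw [Finset.sum_const, Finset.card_univ, ZMod.card, smul_eq_mul])
        refine Finset.sum_congr rfl fun a _ => ite_one_congr ?_
        have h4 : IsUnit (4 : ZMod (p ^ 2)) := by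
          have := (isUnit_two hp).pow 2
          norm_num at this
          exact this
        rw [← h4.mul_right_eq_zero (a := 4) (b := b ^ 3 * e)]
        refine Eq.congr_left ?_
        simp [disc, hessA, hessB, hessC]
        linear_combination a ^ 2 * hee - 6 * a * b * hce + (4 * a * c - 3 * b ^ 2) * hcc
      simp only [this, ← Finset.mul_sum, hb e he, add_zero]
  rw [sum_isUnit_ite _ _ _ _ hunit hnon]
  have hfin : (∑ x : ZMod (p ^ 2), if IsUnit x then 0 else
      p * (p ^ 2 * if x = 0 then p ^ 2 - p else 0)) = p * (p ^ 2 * (p ^ 2 - p)) := by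
    have hz : ¬ IsUnit (0 : ZMod (p ^ 2)) := by
      rw [isUnit_or_dvd, not_not]; exact dvd_zero _
    rw [Finset.sum_eq_single 0]
    · simp only [hz, if_false, if_true]
    · intro b _ hb
      simp [hb]
    · simp
  rw [hfin]
  obtain ⟨q, hq⟩ : ∃ q, p ^ 2 - p = q := ⟨_, rfl⟩
  rw [hq] at hsub ⊢
  zify at hsub ⊢
  have : (q : ℤ) = p ^ 2 - p := by linarith
  rw [this]
  ring

end Sq

section Sq

variable {p : ℕ} [Fact p.Prime]

/-- Forms modulo `p²` that are `p`-ramified to the least possible order. -/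
def URam (p : ℕ) (f : Fin 4 → ZMod (p ^ 2)) : Prop :=
  (p : ZMod (p ^ 2)) ∣ hessA f ∧ (p : ZMod (p ^ 2)) ∣ hessB f ∧ (p : ZMod (p ^ 2)) ∣ hessC f ∧
    (IsUnit (f 3) → covD f ≠ 0) ∧ (¬ IsUnit (f 3) → covA f ≠ 0)

omit [Fact p.Prime] in
lemma uRam_of_isUnit {f : Fin 4 → ZMod (p ^ 2)} (he : IsUnit (f 3)) :
    URam p f ↔ (p : ZMod (p ^ 2)) ∣ hessC f ∧ (p : ZMod (p ^ 2)) ∣ covD f ∧ covD f ≠ 0 := by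
  have h1 : f 3 * hessB f = -covD f + 2 * f 2 * hessC f := by
    simp [hessB, covD, hessC]; ring
  have h2 : f 3 ^ 2 * hessA f = hessC f ^ 2 + f 2 ^ 2 * hessC f - f 2 * covD f := by
    simp [hessA, covD, hessC]; ring
  constructor
  · rintro ⟨_, hB, hC, h3, _⟩
    refine ⟨hC, ?_, h3 he⟩
    rw [show covD f = 2 * f 2 * hessC f - f 3 * hessB f by rw [h1]; ring]
    exact dvd_sub (hC.mul_left _) (hB.mul_left _)
  · rintro ⟨hC, hD, h0⟩
    refine ⟨?_, ?_, hC, fun _ => h0, fun h => absurd he h⟩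
    · refine (he.pow 2).dvd_mul_left.1 ?_
      rw [h2]
      exact dvd_sub (dvd_add (dvd_pow hC two_ne_zero) (hC.mul_left _)) (hD.mul_left _)
    · refine he.dvd_mul_left.1 ?_
      rw [h1]
      exact dvd_add (dvd_neg.2 hD) (hC.mul_left _)

lemma uRam_of_not_isUnit {a b c e : ZMod (p ^ 2)} (he : ¬ IsUnit e) :
    URam p ![a, b, c, e] ↔ IsUnit a ∧ (p : ZMod (p ^ 2)) ∣ b ∧ (p : ZMod (p ^ 2)) ∣ c ∧ e ≠ 0 := by
  have hpe : (p : ZMod (p ^ 2)) ∣ e := by rwa [isUnit_or_dvd, not_not] at he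
  simp only [URam, hessA, hessB, hessC, covA, Matrix.cons_val, he, false_imp_iff, true_and,
    not_false_eq_true, true_imp_iff]
  constructor
  · rintro ⟨hA, _, hC, h0⟩
    have hc : (p : ZMod (p ^ 2)) ∣ c :=
      dvd_of_dvd_pow ((dvd_sub_left (hpe.mul_left b)).1 hC)
    have hb : (p : ZMod (p ^ 2)) ∣ b := dvd_of_dvd_pow ((dvd_sub_left (hc.mul_left a)).1 hA)
    have hbc := mul_eq_zero_of_dvd hb hc
    have hbb := mul_eq_zero_of_dvd hb hb
    have hg : a ^ 2 * e - 3 * a * b * c + 2 * b ^ 3 = a * (a * e) := by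
      linear_combination (-3 * a) * hbc + 2 * b * hbb
    rw [hg] at h0
    refine ⟨?_, hb, hc, ?_⟩
    · rw [isUnit_or_dvd]
      intro ha
      exact h0 (mul_eq_zero_of_dvd ha (ha.mul_right e))
    · rintro rfl
      simp at h0
  · rintro ⟨ha, hb, hc, h0⟩
    have hbc := mul_eq_zero_of_dvd hb hc
    have hbb := mul_eq_zero_of_dvd hb hb
    have hg : a ^ 2 * e - 3 * a * b * c + 2 * b ^ 3 = a ^ 2 * e := by
      linear_combination (-3 * a) * hbc + 2 * b * hbb
    rw [hg]
    exact ⟨dvd_sub (dvd_pow hb two_ne_zero) (hc.mul_left _),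
      dvd_sub (hc.mul_left _) (hpe.mul_left _), dvd_sub (dvd_pow hc two_ne_zero) (hpe.mul_left _),
      fun h => h0 (((ha.pow 2).mul_right_eq_zero).1 h)⟩

lemma ite_and_mul (P Q : Prop) [Decidable P] [Decidable Q] :
    (if P ∧ Q then 1 else 0 : ℕ) = (if P then 1 else 0) * if Q then 1 else 0 := by
  by_cases hP : P <;> by_cases hQ : Q <;> simp [hP, hQ]

open scoped Classical in
lemma sum_isUnit : (∑ x : ZMod (p ^ 2), if IsUnit x then 1 else 0) = p ^ 2 - p := by
  have := sum_isUnit_ite (p := p) (fun C => if IsUnit C then 1 else 0) (fun _ => 0) 1 0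
    (fun x hx => by simp [hx]) (fun x hx => by simp [hx])
  rw [this]
  simp

open scoped Classical in
lemma sum_dvd_ne_zero :
    (∑ x : ZMod (p ^ 2), if (p : ZMod (p ^ 2)) ∣ x ∧ x ≠ 0 then 1 else 0) = p - 1 := by
  have h1 : ∀ x : ZMod (p ^ 2), (if (p : ZMod (p ^ 2)) ∣ x then 1 else 0) =
      (if (p : ZMod (p ^ 2)) ∣ x ∧ x ≠ 0 then 1 else 0) + if x = 0 then 1 else 0 := by
    intro x
    by_cases hx : x = 0 <;> simp [hx]
  have h2 := sum_dvd (p := p)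
  simp only [h1, Finset.sum_add_distrib, Finset.sum_ite_eq', Finset.mem_univ, if_true] at h2
  omega

open scoped Classical in
lemma card_uRam : Nat.card {f : Fin 4 → ZMod (p ^ 2) // URam p f} =
    (p ^ 2 - 1) * (p ^ 4 - p ^ 3) := by
  have hp' : p.Prime := Fact.out
  rw [LatticeCount.card_fin_four]
  have hunit : ∀ e : ZMod (p ^ 2), IsUnit e →
      (∑ c, ∑ b, ∑ a, if URam p ![a, b, c, e] then 1 else 0) = p ^ 2 * (p * (p - 1)) := by
    intro e he
    have : ∀ c, (∑ b, ∑ a, if URam p ![a, b, c, e] then 1 else 0) = p * (p - 1) := by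
      intro c
      have h := sum_fiber (fun C g : ZMod (p ^ 2) =>
        if (p : ZMod (p ^ 2)) ∣ C ∧ (p : ZMod (p ^ 2)) ∣ g ∧ g ≠ 0 then 1 else 0) he c
      refine Eq.trans ?_ (h.trans ?_)
      · exact Finset.sum_congr rfl fun b _ => Finset.sum_congr rfl fun a _ =>
          ite_one_congr (uRam_of_isUnit (by simpa using he))
      · simp only [ite_and_mul (_ ∣ _) (_ ∣ _ ∧ _), ← Finset.mul_sum, sum_dvd_ne_zero,
          ← Finset.sum_mul, sum_dvd]
    simp only [this, Finset.sum_const, Finset.card_univ, ZMod.card, smul_eq_mul]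
  have hnon : ∀ e : ZMod (p ^ 2), ¬ IsUnit e →
      (∑ c, ∑ b, ∑ a, if URam p ![a, b, c, e] then 1 else 0) =
        0 + (p * (p * (p ^ 2 - p))) * if e ≠ 0 then 1 else 0 := by
    intro e he
    have h1 : ∀ a b c, (if URam p ![a, b, c, e] then 1 else 0) =
        (if (p : ZMod (p ^ 2)) ∣ c then 1 else 0) * ((if (p : ZMod (p ^ 2)) ∣ b then 1 else 0) *
          ((if IsUnit a then 1 else 0) * if e ≠ 0 then 1 else 0)) := by
      intro a b c
      rw [← ite_and_mul, ← ite_and_mul, ← ite_and_mul]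
      refine ite_one_congr ((uRam_of_not_isUnit he).trans ?_)
      tauto
    simp only [h1, ← Finset.mul_sum, ← Finset.sum_mul, sum_dvd, sum_isUnit]
    ring
  rw [sum_isUnit_ite _ _ _ _ hunit hnon]
  have hfin : (∑ x : ZMod (p ^ 2), if IsUnit x then 0 else
      (p * (p * (p ^ 2 - p))) * if x ≠ 0 then 1 else 0) = (p * (p * (p ^ 2 - p))) * (p - 1) := by
    rw [← sum_dvd_ne_zero (p := p), Finset.mul_sum]
    refine Finset.sum_congr rfl fun x _ => ?_
    by_cases hx : IsUnit x
    · simp [hx, (isUnit_or_dvd x).1 hx]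
    · have hx' : (p : ZMod (p ^ 2)) ∣ x := by rwa [isUnit_or_dvd, not_not] at hx
      simp [hx, hx']
  rw [hfin]
  obtain ⟨k, rfl⟩ : ∃ k, p = k + 1 := ⟨p - 1, by have := hp'.pos; omega⟩
  have e1 : (k + 1) ^ 2 - (k + 1) = k * (k + 1) := by
    rw [Nat.sub_eq_iff_eq_add (Nat.le_self_pow two_ne_zero _)]; ring
  have e2 : (k + 1) ^ 2 - 1 = k * (k + 2) := by
    rw [Nat.sub_eq_iff_eq_add (Nat.one_le_pow _ _ (by omega))]; ring
  have e3 : (k + 1) ^ 4 - (k + 1) ^ 3 = k * (k + 1) ^ 3 := by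
    rw [Nat.sub_eq_iff_eq_add (Nat.pow_le_pow_right (by omega) (by norm_num))]; ring
  rw [e1, e2, e3, Nat.add_sub_cancel]
  ring

end Sq

section Field

variable {p : ℕ} [Fact p.Prime]

lemma two_ne_zero' (hp : p ≠ 2) : (2 : ZMod p) ≠ 0 := by
  have h : p.Prime := Fact.out
  intro h0
  have : ((2 : ℕ) : ZMod p) = 0 := by exact_mod_cast h0
  rw [ZMod.natCast_eq_zero_iff] at this
  exact hp ((Nat.prime_dvd_prime_iff_eq h Nat.prime_two).1 this)

open scoped Classical in
lemma sum_ne_zero : (∑ x : ZMod p, if x ≠ 0 then 1 else 0) = p - 1 := by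
  have h1 : ∀ x : ZMod p, (1 : ℕ) = (if x ≠ 0 then 1 else 0) + if x = 0 then 1 else 0 := by
    intro x
    by_cases hx : x = 0 <;> simp [hx]
  have h2 : (∑ _x : ZMod p, 1) = p := by simp [ZMod.card]
  rw [Finset.sum_congr rfl fun x _ => h1 x, Finset.sum_add_distrib] at h2
  simp only [Finset.sum_ite_eq', Finset.mem_univ, if_true] at h2
  omega

lemma sum_linear {u : ZMod p} (hu : u ≠ 0) (v : ZMod p) :
    (∑ a : ZMod p, if u * a + v = 0 then 1 else 0) = 1 := by
  rw [sum_affine (fun a => if a = 0 then 1 else 0) hu.isUnit]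
  simp

open scoped Classical in
lemma sum_sqrt (hp : p ≠ 2) (D : ZMod p) :
    (∑ s : ZMod p, if s ≠ 0 ∧ D = s ^ 2 then 1 else 0) =
      2 * if D ≠ 0 ∧ IsSquare D then 1 else 0 := by
  by_cases h : D ≠ 0 ∧ IsSquare D
  · obtain ⟨h0, t, ht⟩ := h
    have ht0 : t ≠ 0 := by rintro rfl; simp at ht; exact h0 ht
    have hne : t ≠ -t := fun h => by
      have : 2 * t = 0 := by linear_combination h
      rcases mul_eq_zero.1 this with h | h
      · exact two_ne_zero' hp h
      · exact ht0 h
    rw [if_pos ⟨h0, t, ht⟩, mul_one, ← Finset.card_filter]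
    refine (congrArg Finset.card ?_).trans (Finset.card_pair hne)
    ext s
    simp only [Finset.mem_filter, Finset.mem_univ, true_and, Finset.mem_insert,
      Finset.mem_singleton]
    rw [ht, ← sq, sq_eq_sq_iff_eq_or_eq_neg]
    constructor
    · grind
    · grind
  · rw [if_neg h, mul_zero]
    refine Finset.sum_eq_zero fun s _ => if_neg ?_
    rintro ⟨hs, hD⟩
    exact h ⟨hD ▸ pow_ne_zero 2 hs, s, by rw [hD, sq]⟩

open scoped Classical in
lemma sum_hyperbola (hp : p ≠ 2) (k : ZMod p) :
    (∑ g : ZMod p, ∑ s : ZMod p, if g ^ 2 - s ^ 2 = k then 1 else 0) =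
      (p - 1) + if k = 0 then p else 0 := by
  rw [Finset.sum_comm]
  have h1 : ∀ s : ZMod p, (∑ g : ZMod p, if g ^ 2 - s ^ 2 = k then 1 else 0) =
      ∑ X : ZMod p, if X * (X + 2 * s) = k then 1 else 0 := by
    intro s
    rw [← sum_affine (fun g : ZMod p => if g ^ 2 - s ^ 2 = k then 1 else 0) isUnit_one s]
    refine Finset.sum_congr rfl fun X _ => ite_one_congr (Eq.congr_left ?_)
    ring
  simp only [h1]
  rw [Finset.sum_comm]
  have h2 : ∀ X : ZMod p, (∑ s : ZMod p, if X * (X + 2 * s) = k then 1 else 0) =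
      (if X ≠ 0 then 1 else 0) + if X = 0 then (if k = 0 then p else 0) else 0 := by
    intro X
    by_cases hX : X = 0
    · by_cases hk : k = 0
      · simp [hX, hk, ZMod.card]
      · simp [hX, hk, Ne.symm hk]
    · simp only [hX, ne_eq, not_false_eq_true, if_true, if_false, add_zero]
      refine Eq.trans ?_ (sum_linear (mul_ne_zero (two_ne_zero' hp) hX) (X ^ 2 - k))
      refine Finset.sum_congr rfl fun s _ => ite_one_congr ?_
      rw [← sub_eq_zero]
      exact Eq.congr_left (by ring)
  simp only [h2, Finset.sum_add_distrib, sum_ne_zero, Finset.sum_ite_eq', Finset.mem_univ, if_true]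

open scoped Classical in
lemma sum_cusp_field (hp : p ≠ 2) :
    (∑ C : ZMod p, ∑ g : ZMod p, if g ^ 2 = 4 * C ^ 3 then 1 else 0) = p := by
  have h0 : ∀ C g : ZMod p, (if g ^ 2 = 4 * C ^ 3 then 1 else 0) =
      (if IsUnit C ∧ g ^ 2 = 4 * C ^ 3 then 1 else 0) +
      (if C = 0 then (if g = 0 then 1 else 0) else 0) := by
    intro C g
    by_cases hC : C = 0
    · simp [hC]
    · simp [hC, isUnit_iff_ne_zero]
  simp only [h0, Finset.sum_add_distrib]
  rw [sum_unit_cusp (two_ne_zero' hp).isUnit]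
  simp only [isUnit_iff_ne_zero, sum_ne_zero]
  rw [Finset.sum_comm]
  simp only [Finset.sum_ite_eq', Finset.mem_univ, if_true]
  have := (Fact.out : p.Prime).pos
  omega

open scoped Classical in
lemma sum_cusp_split (hp : p ≠ 2) :
    (∑ C : ZMod p, ∑ g : ZMod p, ∑ s : ZMod p, if s ≠ 0 ∧ g ^ 2 - s ^ 2 = 4 * C ^ 3 then 1 else 0)
      + p = p ^ 2 := by
  have hpos := (Fact.out : p.Prime).pos
  have h1 : ∀ C g s : ZMod p, (if g ^ 2 - s ^ 2 = 4 * C ^ 3 then 1 else 0) =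
      (if s ≠ 0 ∧ g ^ 2 - s ^ 2 = 4 * C ^ 3 then 1 else 0) +
        if s = 0 then (if g ^ 2 = 4 * C ^ 3 then 1 else 0) else 0 := by
    intro C g s
    by_cases hs : s = 0 <;> simp [hs]
  have h2 : (∑ C : ZMod p, ∑ g : ZMod p, ∑ s : ZMod p,
      if g ^ 2 - s ^ 2 = 4 * C ^ 3 then 1 else 0) = p ^ 2 := by
    have h4 : (4 : ZMod p) ≠ 0 := by
      have := mul_ne_zero (two_ne_zero' hp) (two_ne_zero' hp)
      norm_num at this
      exact this
    have h3 : ∀ C : ZMod p, 4 * C ^ 3 = 0 ↔ C = 0 := fun C => by simp [h4]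
    simp only [sum_hyperbola hp, h3, Finset.sum_add_distrib, Finset.sum_ite_eq', Finset.mem_univ,
      if_true, Finset.sum_const, Finset.card_univ, ZMod.card, smul_eq_mul]
    obtain ⟨k, hk⟩ : ∃ k, p = k + 1 := ⟨p - 1, by omega⟩
    rw [hk, Nat.add_sub_cancel]
    ring
  simp only [h1, Finset.sum_add_distrib, Finset.sum_ite_eq', Finset.mem_univ, if_true,
    sum_cusp_field hp] at h2
  exact h2

open scoped Classical in
lemma card_split (hp : p ≠ 2) :
    2 * Nat.card {f : Fin 4 → ZMod p // disc f ≠ 0 ∧ IsSquare (disc f)} =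
      (p - 1) * (p ^ 3 - p) := by
  have hpos := (Fact.out : p.Prime).pos
  rw [LatticeCount.card_fin_four]
  simp only [Finset.mul_sum, ← sum_sqrt hp]
  have he : ∀ e : ZMod p, (∑ c : ZMod p, ∑ b : ZMod p, ∑ a : ZMod p, ∑ s : ZMod p,
      if s ≠ 0 ∧ disc ![a, b, c, e] = s ^ 2 then 1 else 0) =
      (if e ≠ 0 then 1 else 0) * (p * (p ^ 2 - p)) +
        if e = 0 then (p - 1) * (p * (p - 1)) else 0 := by
    intro e
    by_cases he : e = 0
    · subst he
      have hc : ∀ c : ZMod p, (∑ b : ZMod p, ∑ a : ZMod p, ∑ s : ZMod p,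
          if s ≠ 0 ∧ disc ![a, b, c, 0] = s ^ 2 then 1 else 0) =
          (if c ≠ 0 then 1 else 0) * (p * (p - 1)) := by
        intro c
        by_cases hc : c = 0
        · subst hc
          simp only [ne_eq, not_true_eq_false, if_false, zero_mul]
          refine Finset.sum_eq_zero fun b _ => Finset.sum_eq_zero fun a _ =>
            Finset.sum_eq_zero fun s _ => if_neg ?_
          rintro ⟨hs, h⟩
          simp [disc, hessA, hessB, hessC] at h
          exact hs (pow_eq_zero_iff two_ne_zero |>.1 h.symm)
        · have hb : ∀ b : ZMod p, (∑ a : ZMod p, ∑ s : ZMod p,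
              if s ≠ 0 ∧ disc ![a, b, c, 0] = s ^ 2 then 1 else 0) = p - 1 := by
            intro b
            rw [Finset.sum_comm, ← sum_ne_zero (p := p)]
            refine Finset.sum_congr rfl fun s _ => ?_
            by_cases hs : s = 0
            · simp [hs]
            · simp only [hs, ne_eq, not_false_eq_true, true_and, if_true]
              have h4 : (4 : ZMod p) * c ^ 3 ≠ 0 := by
                have := mul_ne_zero (two_ne_zero' hp) (two_ne_zero' hp)
                norm_num at this
                exact mul_ne_zero this (pow_ne_zero 3 hc)
              refine Eq.trans ?_ (sum_linear h4 (-3 * b ^ 2 * c ^ 2 - s ^ 2))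
              refine Finset.sum_congr rfl fun a _ => ite_one_congr ?_
              rw [← sub_eq_zero]
              refine Eq.congr_left ?_
              simp [disc, hessA, hessB, hessC]
              ring
          simp only [hb, hc, ne_eq, not_false_eq_true, if_true, Finset.sum_const,
            Finset.card_univ, ZMod.card, smul_eq_mul, one_mul]
      simp only [hc, ← Finset.sum_mul, sum_ne_zero]
      simp
    · have hc : ∀ c : ZMod p, (∑ b : ZMod p, ∑ a : ZMod p, ∑ s : ZMod p,
          if s ≠ 0 ∧ disc ![a, b, c, e] = s ^ 2 then 1 else 0) = p ^ 2 - p := by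
        intro c
        have h := sum_fiber (fun C g : ZMod p =>
          ∑ s : ZMod p, if s ≠ 0 ∧ g ^ 2 - s ^ 2 = 4 * C ^ 3 then 1 else 0)
          (Ne.isUnit he) c
        refine Eq.trans ?_ (h.trans (by have := sum_cusp_split (p := p) hp; omega))
        refine Finset.sum_congr rfl fun b _ => Finset.sum_congr rfl fun a _ => ?_
        rw [← sum_affine (fun s : ZMod p => if s ≠ 0 ∧ covD ![a, b, c, e] ^ 2 - s ^ 2 =
          4 * hessC ![a, b, c, e] ^ 3 then 1 else 0) (Ne.isUnit he) 0]
        refine Finset.sum_congr rfl fun s _ => ite_one_congr (and_congr ?_ ?_)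
        · simp [he]
        · have h3 := covD_sq ![a, b, c, e]
          rw [h3]
          simp only [Matrix.cons_val]
          constructor
          · intro h5
            rw [h5]; ring
          · grind
      simp only [hc, he, ne_eq, not_false_eq_true, if_true, if_false, add_zero, one_mul,
        Finset.sum_const, Finset.card_univ, ZMod.card, smul_eq_mul]
  simp only [he, Finset.sum_add_distrib, ← Finset.sum_mul, sum_ne_zero, Finset.sum_ite_eq',
    Finset.mem_univ, if_true]
  obtain ⟨k, hk⟩ : ∃ k, p = k + 1 := ⟨p - 1, by omega⟩
  rw [hk, Nat.add_sub_cancel]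
  have e1 : (k + 1) ^ 2 - (k + 1) = k * (k + 1) := by
    rw [Nat.sub_eq_iff_eq_add (Nat.le_self_pow two_ne_zero _)]; ring
  have e3 : (k + 1) ^ 3 - (k + 1) = k * (k + 2) * (k + 1) := by
    rw [Nat.sub_eq_iff_eq_add (Nat.le_self_pow three_ne_zero _)]; ring
  rw [e1, e3]
  ring

end Field

end ZModSq

/-! Local conditions on discriminants. -/

namespace Loc

open LatticeCount

/-- `d` is fundamental at `p`. -/
def Fund (p : ℕ) (d : ℤ) : Prop :=
  if p = 2 then d % 4 = 1 ∨ d % 16 = 8 ∨ d % 16 = 12 else ¬ (p : ℤ) ^ 2 ∣ d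

/-- `p` splits in the quadratic algebra of discriminant `d`. -/
def Spl (p : ℕ) (d : ℤ) : Prop :=
  if p = 2 then d % 8 = 1 else ¬ (p : ℤ) ∣ d ∧ IsSquare (d : ZMod p)

/-- The density of `Fund p`. -/
noncomputable def fundD (p : ℕ) : ℝ := if p = 2 then 3 / 8 else 1 - 1 / (p : ℝ) ^ 2

/-- The density of `Spl p`. -/
noncomputable def splD (p : ℕ) : ℝ := if p = 2 then 1 / 8 else (p - 1) / (2 * p)

/-- A period for the local conditions on discriminants. -/
def qD (p : ℕ) : ℕ := if p = 2 then 16 else p ^ 2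

lemma Spl.fund {p : ℕ} {d : ℤ} (h : Spl p d) : Fund p d := by
  unfold Spl at h
  unfold Fund
  split_ifs at h ⊢
  · omega
  · exact fun h2 => h.1 ((dvd_pow_self _ two_ne_zero).trans h2)

lemma qD_pos {p : ℕ} (hp : p.Prime) : 0 < qD p := by
  unfold qD
  split_ifs
  · norm_num
  · exact pow_pos hp.pos 2

lemma card_fin_one {R : Type*} (Q : R → Prop) :
    Nat.card {r : Fin 1 → R // Q (r 0)} = Nat.card {x : R // Q x} :=
  Nat.card_congr ((Equiv.funUnique (Fin 1) R).subtypeEquiv fun _ => Iff.rfl)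

lemma isPeriodic_fin_one {M : ℕ} [NeZero M] {P : ℤ → Prop} (Q : ZMod M → Prop)
    (h : ∀ d : ℤ, P d ↔ Q d) :
    IsPeriodic M {v : Fin 1 → ℤ | P (v 0)} ∧
      residueCount M {v : Fin 1 → ℤ | P (v 0)} = Nat.card {x : ZMod M // Q x} := by
  have h' : ∀ v : Fin 1 → ℤ, v ∈ {v : Fin 1 → ℤ | P (v 0)} ↔
      (fun r : Fin 1 → ZMod M => Q (r 0)) fun i => (v i : ZMod M) := fun v => h (v 0)
  exact ⟨isPeriodic_of_iff (fun r => Q (r 0)) h',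
    (residueCount_eq_card (fun r => Q (r 0)) h').trans (card_fin_one Q)⟩

lemma fund_two_iff (d : ℤ) : Fund 2 d ↔
    (d : ZMod 16) ∈ ({1, 5, 9, 13, 8, 12} : Finset (ZMod 16)) := by
  have h : (d : ZMod 16) = ((d % 16 : ℤ) : ZMod 16) := by simp [← ZMod.intCast_mod d 16]
  have h4 : d % 4 = (d % 16) % 4 := by omega
  have h1 : 0 ≤ d % 16 := by omega
  have h2 : d % 16 < 16 := by omega
  simp only [Fund, if_true, h, h4]
  generalize d % 16 = r at *
  interval_cases r <;> decide

lemma spl_two_iff (d : ℤ) : Spl 2 d ↔ (d : ZMod 16) ∈ ({1, 9} : Finset (ZMod 16)) := by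
  have h : (d : ZMod 16) = ((d % 16 : ℤ) : ZMod 16) := by simp [← ZMod.intCast_mod d 16]
  have h4 : d % 8 = (d % 16) % 8 := by omega
  have h1 : 0 ≤ d % 16 := by omega
  have h2 : d % 16 < 16 := by omega
  simp only [Spl, if_true, h, h4]
  generalize d % 16 = r at *
  interval_cases r <;> decide

lemma not_sq_dvd_iff (p : ℕ) (d : ℤ) : ¬ (p : ℤ) ^ 2 ∣ d ↔ (d : ZMod (p ^ 2)) ≠ 0 := by
  rw [ne_eq, ZMod.intCast_zmod_eq_zero_iff_dvd]
  push_cast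
  rfl

lemma spl_odd_iff {p : ℕ} (hp : p ≠ 2) (d : ℤ) :
    Spl p d ↔ (d : ZMod p) ≠ 0 ∧ IsSquare (d : ZMod p) := by
  simp only [Spl, hp, if_false, ne_eq, ZMod.intCast_zmod_eq_zero_iff_dvd]

lemma fund_odd_iff {p : ℕ} (hp : p ≠ 2) (d : ℤ) : Fund p d ↔ (d : ZMod (p ^ 2)) ≠ 0 := by
  simp only [Fund, hp, if_false, not_sq_dvd_iff]

lemma fund_int (p : ℕ) (hp : p.Prime) :
    IsPeriodic (qD p) {v : Fin 1 → ℤ | Fund p (v 0)} ∧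
      density (qD p) {v : Fin 1 → ℤ | Fund p (v 0)} = fundD p := by
  have := Fact.mk hp
  by_cases h2 : p = 2
  · subst h2
    obtain ⟨h1, h2⟩ := isPeriodic_fin_one (M := 16) (P := Fund 2)
      (fun r => r ∈ ({1, 5, 9, 13, 8, 12} : Finset (ZMod 16))) fund_two_iff
    refine ⟨h1, ?_⟩
    simp only [density, qD, if_true]
    rw [h2, Nat.card_eq_fintype_card, Fintype.card_coe]
    simp [fundD]
    norm_num [show ({1, 5, 9, 13, 8, 12} : Finset (ZMod 16)).card = 6 by decide]
  · obtain ⟨h1, h3⟩ := isPeriodic_fin_one (M := p ^ 2) (P := Fund p)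
      (fun r => r ≠ 0) (fund_odd_iff h2)
    simp only [qD, h2, if_false]
    refine ⟨h1, ?_⟩
    simp only [density]
    rw [h3, Nat.card_eq_fintype_card,
      Fintype.card_subtype_compl, Fintype.card_subtype_eq, ZMod.card,
      Nat.cast_sub (Nat.one_le_pow _ _ hp.pos)]
    have : (p : ℝ) ≠ 0 := by exact_mod_cast hp.ne_zero
    simp [fundD, h2]
    field_simp

lemma spl_int (p : ℕ) (hp : p.Prime) :
    IsPeriodic (qD p) {v : Fin 1 → ℤ | Spl p (v 0)} ∧
      density (qD p) {v : Fin 1 → ℤ | Spl p (v 0)} = splD p := by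
  classical
  have := Fact.mk hp
  by_cases h2 : p = 2
  · subst h2
    obtain ⟨h1, h2⟩ := isPeriodic_fin_one (M := 16) (P := Spl 2)
      (fun r => r ∈ ({1, 9} : Finset (ZMod 16))) spl_two_iff
    refine ⟨h1, ?_⟩
    simp only [density, qD, if_true]
    rw [h2, Nat.card_eq_fintype_card, Fintype.card_coe]
    simp [splD]
    norm_num [show ({1, 9} : Finset (ZMod 16)).card = 2 by decide]
  · obtain ⟨h1, h3⟩ := isPeriodic_fin_one (M := p) (P := Spl p)
      (fun r => r ≠ 0 ∧ IsSquare r) (spl_odd_iff h2)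
    simp only [qD, h2, if_false]
    have h1' := h1.of_dvd (dvd_pow_self p two_ne_zero)
    refine ⟨h1', ?_⟩
    rw [density_eq_of_isPeriodic (pow_pos hp.pos 2) hp.pos h1' h1]
    simp only [density]
    rw [h3, Nat.card_eq_fintype_card, Fintype.card_subtype]
    have hc : 2 * (Finset.univ.filter fun r : ZMod p => r ≠ 0 ∧ IsSquare r).card = p - 1 := by
      rw [Finset.card_filter, Finset.mul_sum]
      simp only [← ZModSq.sum_sqrt h2]
      rw [Finset.sum_comm, ← ZModSq.sum_ne_zero (p := p)]
      refine Finset.sum_congr rfl fun s _ => ?_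
      by_cases hs : s = 0 <;> simp [hs]
    have hc' : 2 * ((Finset.univ.filter fun r : ZMod p => r ≠ 0 ∧ IsSquare r).card : ℝ) = p - 1 := by
      have h4 := congrArg (Nat.cast : ℕ → ℝ) hc
      rw [Nat.cast_sub hp.one_le] at h4
      push_cast at h4
      exact h4
    have : (p : ℝ) ≠ 0 := by exact_mod_cast hp.ne_zero
    simp only [splD, h2, if_false, Fintype.card_fin, pow_one]
    rw [← hc']
    field_simp

/-! Local conditions on cubic forms. -/

open LatticeCount CubicForm

/-- Forms whose discriminant is fundamental at `p`. -/
def FundF (p : ℕ) : Set (Fin 4 → ℤ) := {f | Fund p (disc f)}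

/-- Forms whose discriminant is split at `p`. -/
def SplF (p : ℕ) : Set (Fin 4 → ℤ) := {f | Spl p (disc f)}

/-- Forms whose Hessian is divisible by `p` with split primitive part. -/
def RamF (p : ℕ) : Set (Fin 4 → ℤ) :=
  {f | (p : ℤ) ∣ hessA f ∧ (p : ℤ) ∣ hessB f ∧ (p : ℤ) ∣ hessC f ∧ Spl p (disc f / (p : ℤ) ^ 2)}

section Two

lemma disc_mod_sixteen (A B C : ℤ) :
    (B ^ 2 - 4 * A * C) % 16 = ((B % 8) ^ 2 - 4 * (A % 4) * (C % 4)) % 16 := by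
  have hA := Int.emod_add_mul_ediv A 4
  have hB := Int.emod_add_mul_ediv B 8
  have hC := Int.emod_add_mul_ediv C 4
  generalize B % 8 = j at *
  generalize A % 4 = i at *
  generalize C % 4 = l at *
  generalize A / 4 = a at *
  generalize B / 8 = b at *
  generalize C / 4 = c at *
  subst hA hB hC
  refine Int.ModEq.symm (Int.modEq_iff_dvd.2
    ⟨4 * b ^ 2 + b * j - 4 * a * c - a * l - i * c, ?_⟩)
  ring

def FundTwo (A B C : ZMod 4) : Prop :=
  (B = 1 ∨ B = 3) ∨ (B = 0 ∧ (A * C = 1 ∨ A * C = 2)) ∨ (B = 2 ∧ (A * C = 2 ∨ A * C = 3))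

def SplTwo (A B C : ZMod 4) : Prop := (B = 1 ∨ B = 3) ∧ (A * C = 0 ∨ A * C = 2)

def RamTwo (A B C : ZMod 4) : Prop := 2 * A = 0 ∧ 2 * C = 0 ∧ B = 2 ∧ (A = 0 ∨ C = 0)

instance (A B C : ZMod 4) : Decidable (FundTwo A B C) := by unfold FundTwo; infer_instance
instance (A B C : ZMod 4) : Decidable (SplTwo A B C) := by unfold SplTwo; infer_instance
instance (A B C : ZMod 4) : Decidable (RamTwo A B C) := by unfold RamTwo; infer_instance

lemma two_cases (A B C : ℤ) :
    (Fund 2 (B ^ 2 - 4 * A * C) ↔ FundTwo A B C) ∧ (Spl 2 (B ^ 2 - 4 * A * C) ↔ SplTwo A B C) := by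
  have hA : (A : ZMod 4) = ((A % 4 : ℤ) : ZMod 4) := by simp [← ZMod.intCast_mod A 4]
  have hB : (B : ZMod 4) = ((B % 8 : ℤ) : ZMod 4) := by
    rw [ZMod.intCast_eq_intCast_iff_dvd_sub]; omega
  have hC : (C : ZMod 4) = ((C % 4 : ℤ) : ZMod 4) := by simp [← ZMod.intCast_mod C 4]
  have h4 : (B ^ 2 - 4 * A * C) % 4 = ((B ^ 2 - 4 * A * C) % 16) % 4 := by omega
  have h8 : (B ^ 2 - 4 * A * C) % 8 = ((B ^ 2 - 4 * A * C) % 16) % 8 := by omega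
  simp only [Fund, Spl, if_true, h4, h8]
  rw [disc_mod_sixteen, hA, hB, hC]
  have a1 : 0 ≤ A % 4 := by omega
  have a2 : A % 4 < 4 := by omega
  have b1 : 0 ≤ B % 8 := by omega
  have b2 : B % 8 < 8 := by omega
  have c1 : 0 ≤ C % 4 := by omega
  have c2 : C % 4 < 4 := by omega
  clear h4 h8 hA hB hC
  generalize B % 8 = j at *
  generalize A % 4 = i at *
  generalize C % 4 = l at *
  interval_cases i <;> interval_cases l <;> interval_cases j <;> decide

lemma card_fundTwo : Nat.card {f : Fin 4 → ZMod 4 // FundTwo (hessA f) (hessB f) (hessC f)} =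
    144 := by
  rw [card_fin_four]
  decide +kernel

lemma card_splTwo : Nat.card {f : Fin 4 → ZMod 4 // SplTwo (hessA f) (hessB f) (hessC f)} =
    48 := by
  rw [card_fin_four]
  decide +kernel

lemma card_ramTwo : Nat.card {f : Fin 4 → ZMod 4 // RamTwo (hessA f) (hessB f) (hessC f)} =
    24 := by
  rw [card_fin_four]
  decide +kernel

lemma ramTwo_two_mul : ∀ A B C : ZMod 4, SplTwo A B C ↔ RamTwo (2 * A) (2 * B) (2 * C) := by
  decide

lemma two_dvd_iff (A : ℤ) : 2 ∣ A ↔ 2 * (A : ZMod 4) = 0 := by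
  have : 2 * (A : ZMod 4) = ((2 * A : ℤ) : ZMod 4) := by push_cast; rfl
  rw [this, ZMod.intCast_zmod_eq_zero_iff_dvd]
  omega

lemma ramTwo_iff (A B C : ℤ) :
    (2 ∣ A ∧ 2 ∣ B ∧ 2 ∣ C ∧ Spl 2 ((B ^ 2 - 4 * A * C) / 2 ^ 2)) ↔ RamTwo A B C := by
  have key : ∀ A B C : ℤ, Spl 2 (((2 * B) ^ 2 - 4 * (2 * A) * (2 * C)) / 2 ^ 2) ↔
      RamTwo ((2 * A : ℤ) : ZMod 4) ((2 * B : ℤ) : ZMod 4) ((2 * C : ℤ) : ZMod 4) := by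
    intro A B C
    rw [show (2 * B) ^ 2 - 4 * (2 * A) * (2 * C) = 2 ^ 2 * (B ^ 2 - 4 * A * C) by ring,
      Int.mul_ediv_cancel_left _ (by norm_num), (two_cases A B C).2, ramTwo_two_mul]
    push_cast
    rfl
  constructor
  · rintro ⟨⟨A, rfl⟩, ⟨B, rfl⟩, ⟨C, rfl⟩, h⟩
    exact (key A B C).1 h
  · intro h
    have h' := h
    obtain ⟨hA, hC, hB, _⟩ := h'
    rw [← two_dvd_iff] at hA hC
    have hB2 : 2 ∣ B := by
      rw [two_dvd_iff, hB]
      decide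
    refine ⟨hA, hB2, hC, ?_⟩
    obtain ⟨A, rfl⟩ := hA
    obtain ⟨B, rfl⟩ := hB2
    obtain ⟨C, rfl⟩ := hC
    exact (key A B C).2 h

lemma isPeriodic_fin_four {M : ℕ} [NeZero M] {E : Set (Fin 4 → ℤ)} (Q : (Fin 4 → ZMod M) → Prop)
    (h : ∀ f : Fin 4 → ℤ, f ∈ E ↔ Q (Int.castRingHom (ZMod M) ∘ f)) :
    IsPeriodic M E ∧ residueCount M E = Nat.card {x : Fin 4 → ZMod M // Q x} :=
  ⟨isPeriodic_of_iff Q h, residueCount_eq_card Q h⟩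

lemma local_two : (IsPeriodic 4 (FundF 2) ∧ residueCount 4 (FundF 2) = 144) ∧
    (IsPeriodic 4 (SplF 2) ∧ residueCount 4 (SplF 2) = 48) ∧
    (IsPeriodic 4 (RamF 2) ∧ residueCount 4 (RamF 2) = 24) := by
  rw [← card_fundTwo, ← card_splTwo, ← card_ramTwo]
  refine ⟨isPeriodic_fin_four _ fun f => ?_, isPeriodic_fin_four _ fun f => ?_,
    isPeriodic_fin_four _ fun f => ?_⟩
  · rw [← map_hessA, ← map_hessB, ← map_hessC]
    exact (two_cases _ _ _).1
  · rw [← map_hessA, ← map_hessB, ← map_hessC]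
    exact (two_cases _ _ _).2
  · rw [← map_hessA, ← map_hessB, ← map_hessC]
    exact ramTwo_iff _ _ _

end Two

section Odd

variable {p : ℕ} [Fact p.Prime]

omit [Fact p.Prime] in
lemma dvd_cast_iff (A : ℤ) : (p : ZMod (p ^ 2)) ∣ (A : ZMod (p ^ 2)) ↔ (p : ℤ) ∣ A := by
  constructor
  · rintro ⟨k, hk⟩
    obtain ⟨k, rfl⟩ := ZMod.intCast_surjective k
    have h : ((A - p * k : ℤ) : ZMod (p ^ 2)) = 0 := by push_cast; rw [hk, sub_self]
    rw [ZMod.intCast_zmod_eq_zero_iff_dvd] at h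
    have h2 : (p : ℤ) ∣ A - p * k := (Dvd.intro_left _ (by push_cast; ring)).trans h
    exact (dvd_sub_left (Dvd.intro _ rfl)).1 h2
  · rintro ⟨k, rfl⟩
    exact ⟨k, by push_cast; rfl⟩

lemma spl_div_iff (hp : p ≠ 2) {g D e C : ℤ} (h : g ^ 2 = D * e ^ 2 + 4 * C ^ 3) (hC : (p : ℤ) ∣ C)
    (hD : (p : ℤ) ^ 2 ∣ D) (he : ¬ (p : ℤ) ∣ e) :
    Spl p (D / (p : ℤ) ^ 2) ↔ (g : ZMod (p ^ 2)) ≠ 0 := by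
  have hpp : Prime (p : ℤ) := Nat.prime_iff_prime_int.1 Fact.out
  obtain ⟨C, rfl⟩ := hC
  obtain ⟨D, rfl⟩ := hD
  have hg : (p : ℤ) ∣ g := by
    refine hpp.dvd_of_dvd_pow (n := 2) ⟨p * D * e ^ 2 + 4 * p ^ 2 * C ^ 3, ?_⟩
    rw [h]; ring
  obtain ⟨g, rfl⟩ := hg
  rw [Int.mul_ediv_cancel_left _ (pow_ne_zero 2 hpp.ne_zero), spl_odd_iff hp,
    ← not_sq_dvd_iff, sq (p : ℤ), mul_dvd_mul_iff_left hpp.ne_zero,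
    ← ZMod.intCast_zmod_eq_zero_iff_dvd]
  have h1 : g ^ 2 = D * e ^ 2 + 4 * p * C ^ 3 :=
    mul_left_cancel₀ (pow_ne_zero 2 hpp.ne_zero) (by linear_combination h)
  have h2 : (g : ZMod p) ^ 2 = D * (e : ZMod p) ^ 2 := by
    have := congrArg (Int.cast : ℤ → ZMod p) h1
    push_cast at this
    simpa using this
  have he' : (e : ZMod p) ≠ 0 := by rwa [ne_eq, ZMod.intCast_zmod_eq_zero_iff_dvd]
  constructor
  · grind
  · intro hg
    refine ⟨fun h0 => ?_, g / e, ?_⟩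
    · grind
    · field_simp
      exact h2.symm

lemma mem_ramF_iff (hp : p ≠ 2) (f : Fin 4 → ℤ) :
    f ∈ RamF p ↔ ZModSq.URam p (Int.castRingHom (ZMod (p ^ 2)) ∘ f) := by
  have hpp : Prime (p : ℤ) := Nat.prime_iff_prime_int.1 Fact.out
  simp only [ZModSq.URam, ← map_hessA, ← map_hessB, ← map_hessC, eq_intCast, dvd_cast_iff,
    ZModSq.isUnit_or_dvd, Function.comp_apply, not_not]
  refine and_congr_right fun hA => and_congr_right fun hB => and_congr_right fun hC => ?_
  have hD : (p : ℤ) ^ 2 ∣ disc f := by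
    rw [disc, sq]
    refine dvd_sub ?_ ?_
    · rw [sq]; exact mul_dvd_mul hB hB
    · rw [mul_assoc]; exact (mul_dvd_mul hA hC).mul_left 4
  have cD : covD (Int.castRingHom (ZMod (p ^ 2)) ∘ f) = ((covD f : ℤ) : ZMod (p ^ 2)) := by
    simp [covD]
  have cA : covA (Int.castRingHom (ZMod (p ^ 2)) ∘ f) = ((covA f : ℤ) : ZMod (p ^ 2)) := by
    simp [covA]
  rw [cD, cA]
  by_cases he : (p : ℤ) ∣ f 3
  · simp only [he, not_true, false_imp_iff, true_and, true_imp_iff]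
    by_cases ha : (p : ℤ) ∣ f 0
    · have hb : (p : ℤ) ∣ f 1 := hpp.dvd_of_dvd_pow (n := 2) <| by
        have := dvd_add hA (ha.mul_right (f 2))
        simpa [hessA] using this
      have hc : (p : ℤ) ∣ f 2 := hpp.dvd_of_dvd_pow (n := 2) <| by
        have := dvd_add hC (he.mul_left (f 1))
        simpa [hessC] using this
      obtain ⟨a, ha⟩ := ha
      obtain ⟨b, hb⟩ := hb
      obtain ⟨c, hc⟩ := hc
      obtain ⟨e, he⟩ := he
      have h1 : disc f = (p : ℤ) ^ 2 * (p * (p * disc ![a, b, c, e])) := by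
        simp [disc, hessA, hessB, hessC, ha, hb, hc, he]; ring
      have h2 : covA f = (p : ℤ) ^ 2 * (p * covA ![a, b, c, e]) := by
        simp [covA, ha, hb, hc, he]; ring
      rw [h1, h2, Int.mul_ediv_cancel_left _ (pow_ne_zero 2 hpp.ne_zero), spl_odd_iff hp]
      have h3 : ((p : ZMod (p ^ 2)) ^ 2) = 0 := by
        have := ZMod.natCast_self (p ^ 2)
        push_cast at this
        exact this
      simp [h3]
    · exact spl_div_iff hp (covA_sq f) hA hD ha
  · simp only [he, not_false_eq_true, true_imp_iff, false_imp_iff, and_true]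
    exact spl_div_iff hp (covD_sq f) hC hD he

end Odd

/-- The exceptional factor at `2` in the density of cubic forms. -/
noncomputable def kap (p : ℕ) : ℝ := (if p = 2 then 2 else 1) * (1 - 1 / (p : ℝ) ^ 2)

lemma fund_form (p : ℕ) (hp : p.Prime) :
    IsPeriodic (p ^ 2) (FundF p) ∧ density (p ^ 2) (FundF p) = kap p * fundD p := by
  have := Fact.mk hp
  by_cases h2 : p = 2
  · subst h2
    refine ⟨local_two.1.1, ?_⟩
    simp only [density, show 2 ^ 2 = 4 from rfl, local_two.1.2, kap, fundD, if_true]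
    norm_num
  · obtain ⟨h1, h3⟩ := isPeriodic_fin_four (M := p ^ 2) (E := FundF p) (fun f => disc f ≠ 0)
      (fun f => by rw [← map_disc]; exact fund_odd_iff h2 _)
    refine ⟨h1, ?_⟩
    have h4 := ZModSq.card_disc_eq_zero (p := p) h2
    have h5 : Nat.card {f : Fin 4 → ZMod (p ^ 2) // disc f ≠ 0} +
        Nat.card {f : Fin 4 → ZMod (p ^ 2) // disc f = 0} = p ^ 8 := by
      classical
      rw [add_comm, Nat.card_eq_fintype_card, Nat.card_eq_fintype_card,
        Fintype.card_subtype_compl, Nat.add_sub_cancel' (Fintype.card_subtype_le _)]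
      simp [ZMod.card]
      ring
    have hp0 : (p : ℝ) ≠ 0 := by exact_mod_cast hp.ne_zero
    have h6 : (Nat.card {f : Fin 4 → ZMod (p ^ 2) // disc f ≠ 0} : ℝ) =
        p ^ 8 - (2 * p ^ 6 - p ^ 4) := by
      have a := congrArg (Nat.cast : ℕ → ℝ) h4
      have b := congrArg (Nat.cast : ℕ → ℝ) h5
      push_cast at a b
      linarith
    simp only [density, h3, h6, kap, fundD, h2, if_false, Fintype.card_fin]
    push_cast
    field_simp
    ring

lemma spl_form (p : ℕ) (hp : p.Prime) :
    IsPeriodic (p ^ 2) (SplF p) ∧ density (p ^ 2) (SplF p) = kap p * splD p := by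
  have := Fact.mk hp
  by_cases h2 : p = 2
  · subst h2
    refine ⟨local_two.2.1.1, ?_⟩
    simp only [density, show 2 ^ 2 = 4 from rfl, local_two.2.1.2, kap, splD, if_true]
    norm_num
  · obtain ⟨h1, h3⟩ := isPeriodic_fin_four (M := p) (E := SplF p)
      (fun f => disc f ≠ 0 ∧ IsSquare (disc f))
      (fun f => by rw [← map_disc]; exact spl_odd_iff h2 _)
    have h1' := h1.of_dvd (dvd_pow_self p two_ne_zero)
    refine ⟨h1', ?_⟩
    rw [density_eq_of_isPeriodic (pow_pos hp.pos 2) hp.pos h1' h1]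
    have h4 := congrArg (Nat.cast : ℕ → ℝ) (ZModSq.card_split (p := p) h2)
    push_cast [Nat.cast_sub hp.one_le, Nat.cast_sub (Nat.le_self_pow three_ne_zero p)] at h4
    have hp0 : (p : ℝ) ≠ 0 := by exact_mod_cast hp.ne_zero
    simp only [density, h3, kap, splD, h2, if_false, Fintype.card_fin]
    field_simp
    linear_combination h4

lemma ram_form (p : ℕ) (hp : p.Prime) :
    IsPeriodic (p ^ 2) (RamF p) ∧
      density (p ^ 2) (RamF p) = kap p * splD p * (2 / (p : ℝ) ^ 2) := by
  have := Fact.mk hp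
  by_cases h2 : p = 2
  · subst h2
    refine ⟨local_two.2.2.1, ?_⟩
    simp only [density, show 2 ^ 2 = 4 from rfl, local_two.2.2.2, kap, splD, if_true]
    norm_num
  · obtain ⟨h1, h3⟩ := isPeriodic_fin_four (M := p ^ 2) (E := RamF p)
      (fun f => ZModSq.URam p f) (mem_ramF_iff h2)
    refine ⟨h1, ?_⟩
    have h4 := congrArg (Nat.cast : ℕ → ℝ) (ZModSq.card_uRam (p := p))
    push_cast [Nat.cast_sub (Nat.one_le_pow 2 p hp.pos),
      Nat.cast_sub (Nat.pow_le_pow_right hp.pos (show 3 ≤ 4 by norm_num))] at h4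
    have hp0 : (p : ℝ) ≠ 0 := by exact_mod_cast hp.ne_zero
    simp only [density, h3, h4, kap, splD, h2, if_false, Fintype.card_fin]
    push_cast
    field_simp

variable (S S₁ U : Finset ℕ)

/-- The local condition at `p` on the discriminant. -/
def LocD (p : ℕ) (d : ℤ) : Prop :=
  Fund p d ∧ (p ∈ S₁ → Spl p d) ∧ (p ∈ S → p ∉ S₁ → ¬ Spl p d)

/-- The density of `LocD`. -/
noncomputable def nu (p : ℕ) : ℝ :=
  if p ∈ S₁ then splD p else if p ∈ S then fundD p - splD p else fundD p

/-- The local condition at `p` on cubic forms. -/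
def LocF (p : ℕ) : Set (Fin 4 → ℤ) :=
  if p ∈ U then RamF p else {f | LocD S S₁ p (disc f)}

lemma density_diff {ι : Type*} [Fintype ι] {M : ℕ} (hM : 0 < M) {E F : Set (ι → ℤ)} (h : F ⊆ E) :
    density M (E \ F) = density M E - density M F := by
  have : NeZero M := ⟨hM.ne'⟩
  have h1 := congrArg (Nat.cast : ℕ → ℝ) (residueCount_compl_add M h)
  push_cast at h1
  simp only [density]
  rw [← h1]
  ring

lemma IsPeriodic.sdiff {ι : Type*} {M : ℕ} {E F : Set (ι → ℤ)} (hE : IsPeriodic M E)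
    (hF : IsPeriodic M F) : IsPeriodic M (E \ F) :=
  fun v w h hv => ⟨hE v w h hv.1, fun hw => hv.2 (hF w v (fun i => (h i).symm) hw)⟩

lemma locD_density_aux {ι : Type*} [Fintype ι] {M : ℕ} (hM : 0 < M) {p : ℕ} (φ : (ι → ℤ) → ℤ)
    {k : ℝ} (h1 : IsPeriodic M {v | Fund p (φ v)} ∧ density M {v | Fund p (φ v)} = k * fundD p)
    (h2 : IsPeriodic M {v | Spl p (φ v)} ∧ density M {v | Spl p (φ v)} = k * splD p) :
    IsPeriodic M {v | LocD S S₁ p (φ v)} ∧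
      density M {v | LocD S S₁ p (φ v)} = k * nu S S₁ p := by
  by_cases hS₁ : p ∈ S₁
  · have : {v | LocD S S₁ p (φ v)} = {v | Spl p (φ v)} := by
      ext v
      exact ⟨fun h => h.2.1 hS₁, fun h => ⟨Spl.fund h, fun _ => h, fun _ h' => absurd hS₁ h'⟩⟩
    rw [this]
    simpa only [nu, hS₁, if_true] using h2
  · by_cases hS : p ∈ S
    · have : {v | LocD S S₁ p (φ v)} = {v | Fund p (φ v)} \ {v | Spl p (φ v)} := by
        ext v
        exact ⟨fun h => ⟨h.1, h.2.2 hS hS₁⟩,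
          fun h => ⟨h.1, fun h' => absurd h' hS₁, fun _ _ => h.2⟩⟩
      have hsub : {v | Spl p (φ v)} ⊆ {v | Fund p (φ v)} := fun v (hv : Spl p (φ v)) => hv.fund
      rw [this, density_diff hM hsub, h1.2, h2.2]
      simp only [nu, hS, hS₁, if_true, if_false]
      exact ⟨IsPeriodic.sdiff h1.1 h2.1, by ring⟩
    · have : {v | LocD S S₁ p (φ v)} = {v | Fund p (φ v)} := by
        ext v
        exact ⟨fun h => h.1, fun h => ⟨h, fun h' => absurd h' hS₁, fun h' => absurd h' hS⟩⟩
      rw [this]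
      simpa only [nu, hS, hS₁, if_false] using h1

lemma locD_density (p : ℕ) (hp : p.Prime) :
    IsPeriodic (qD p) {v : Fin 1 → ℤ | LocD S S₁ p (v 0)} ∧
      density (qD p) {v : Fin 1 → ℤ | LocD S S₁ p (v 0)} = nu S S₁ p := by
  have h := locD_density_aux S S₁ (qD_pos hp) (k := 1) (p := p) (fun v : Fin 1 → ℤ => v 0)
    (by simpa using fund_int p hp) (by simpa using spl_int p hp)
  simpa using h

lemma locF_density (hU : U ⊆ S₁) (p : ℕ) (hp : p.Prime) :
    IsPeriodic (p ^ 2) (LocF S S₁ U p) ∧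
      density (p ^ 2) (LocF S S₁ U p) =
        kap p * nu S S₁ p * (if p ∈ U then 2 / (p : ℝ) ^ 2 else 1) := by
  unfold LocF
  split_ifs with h
  · simpa only [nu, hU h, if_true] using ram_form p hp
  · rw [mul_one]
    exact locD_density_aux S S₁ (pow_pos hp.pos 2) _ (fund_form p hp) (spl_form p hp)

lemma splD_pos {p : ℕ} (hp : p.Prime) : 0 < splD p := by
  unfold splD
  split_ifs
  · norm_num
  · have := hp.one_lt
    have h1 : (1 : ℝ) < p := by exact_mod_cast this
    exact div_pos (by linarith) (by linarith)

lemma splD_lt {p : ℕ} (hp : p.Prime) : splD p < fundD p := by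
  unfold splD fundD
  split_ifs with h
  · norm_num
  · have h1 : (2 : ℝ) ≤ p := by exact_mod_cast hp.two_le
    rw [div_lt_iff₀ (by linarith), sub_mul]
    have : 1 / (p : ℝ) ^ 2 * (2 * p) = 2 / p := by field_simp
    rw [this]
    have : 2 / (p : ℝ) ≤ 1 := by rw [div_le_one (by linarith)]; exact h1
    linarith

lemma nu_pos {p : ℕ} (hp : p.Prime) : 0 < nu S S₁ p := by
  have := splD_pos hp
  have := splD_lt hp
  unfold nu
  split_ifs <;> linarith

end Loc

namespace Loc

lemma tendsto_prod_one_sub : Tendsto (fun n : ℕ => ∏ p ∈ n.primesBelow, (1 - 1 / (p : ℝ) ^ 2))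
    atTop (nhds (6 / Real.pi ^ 2)) := by
  have h := riemannZeta_eulerProduct (s := 2) (by norm_num)
  rw [riemannZeta_two] at h
  have h2 := (h.inv₀ (by
    simp [Real.pi_ne_zero]))
  have h3 := (Complex.continuous_re.tendsto _).comp h2
  have h4 : ((Real.pi : ℂ) ^ 2 / 6)⁻¹.re = 6 / Real.pi ^ 2 := by
    rw [inv_div, ← Complex.ofReal_pow]
    norm_cast
  rw [h4] at h3
  refine h3.congr fun n => ?_
  simp only [Function.comp_apply, ← Finset.prod_inv_distrib, inv_inv]
  have : ∀ p ∈ n.primesBelow, (1 - (p : ℂ) ^ (-2 : ℂ)) = ((1 - 1 / (p : ℝ) ^ 2 : ℝ) : ℂ) := by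
    intro p _
    rw [Complex.cpow_neg]
    push_cast
    rw [one_div]
    norm_cast
  rw [Finset.prod_congr rfl this, ← Complex.ofReal_prod, Complex.ofReal_re]

lemma tendsto_prod_of_eq_off {T : Finset ℕ} (hT : ∀ p ∈ T, p.Prime) {f g : ℕ → ℝ}
    (hfg : ∀ p, p.Prime → p ∉ T → f p = g p) (hg : ∀ p, p.Prime → g p ≠ 0) {L : ℝ}
    (h : Tendsto (fun n : ℕ => ∏ p ∈ n.primesBelow, g p) atTop (nhds L)) :
    Tendsto (fun n : ℕ => ∏ p ∈ n.primesBelow, f p) atTop (nhds (L * ∏ p ∈ T, f p / g p)) := by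
  refine (h.mul_const _).congr' ?_
  filter_upwards [eventually_gt_atTop (T.sup id)] with n hn
  have hsub : T ⊆ n.primesBelow := fun p hp =>
    Nat.mem_primesBelow.2 ⟨(Finset.le_sup (f := id) hp).trans_lt hn, hT p hp⟩
  have h1 : ∏ p ∈ T, f p / g p = ∏ p ∈ n.primesBelow, f p / g p := by
    refine Finset.prod_subset hsub fun p hp hpT => ?_
    have := (Nat.mem_primesBelow.1 hp).2
    rw [hfg p this hpT, div_self (hg p this)]
  rw [h1, ← Finset.prod_mul_distrib]
  refine Finset.prod_congr rfl fun p hp => ?_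
  rw [mul_div_cancel₀]
  exact hg p (Nat.mem_primesBelow.1 hp).2

lemma one_sub_pos {p : ℕ} (hp : p.Prime) : 0 < 1 - 1 / (p : ℝ) ^ 2 := by
  have h1 : (1 : ℝ) < p := by exact_mod_cast hp.one_lt
  have : 1 / (p : ℝ) ^ 2 < 1 := by
    rw [div_lt_one (by positivity)]
    nlinarith
  linarith

lemma tendsto_prod_kap :
    Tendsto (fun n : ℕ => ∏ p ∈ n.primesBelow, kap p) atTop (nhds (12 / Real.pi ^ 2)) := by
  have h := tendsto_prod_of_eq_off (T := {2}) (f := kap) (fun p hp => by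
    rw [Finset.mem_singleton.1 hp]; exact Nat.prime_two) (fun p _ h2 => by
    simp [kap, Finset.mem_singleton.not.1 h2]) (fun p hp => (one_sub_pos hp).ne')
    tendsto_prod_one_sub
  convert h using 2
  simp [kap]
  ring

variable (S S₁ : Finset ℕ)

lemma exists_tendsto_prod_nu (hS : ∀ p ∈ S, p.Prime) (hS₁ : S₁ ⊆ S) :
    ∃ φ : ℝ, 0 < φ ∧ Tendsto (fun n : ℕ => ∏ p ∈ n.primesBelow, nu S S₁ p) atTop (nhds φ) := by
  have hT : ∀ p ∈ insert 2 S, p.Prime := by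
    intro p hp
    rcases Finset.mem_insert.1 hp with rfl | hp
    · exact Nat.prime_two
    · exact hS p hp
  refine ⟨_, ?_, tendsto_prod_of_eq_off hT (fun p hp h => ?_) (fun p hp => (one_sub_pos hp).ne')
    tendsto_prod_one_sub⟩
  · refine mul_pos (by positivity) (Finset.prod_pos fun p hp => ?_)
    exact div_pos (nu_pos S S₁ (hT p hp)) (one_sub_pos (hT p hp))
  · rw [Finset.mem_insert, not_or] at h
    have h1 : p ∉ S₁ := fun h' => h.2 (hS₁ h')
    simp [nu, h.2, h1, fundD, h.1]

lemma sieve_limit {a : ℝ → ℝ} {β ε : ℕ → ℝ} {L : ℝ} (hβ : Tendsto β atTop (nhds L))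
    (hε : Tendsto ε atTop (nhds 0))
    (h : ∀ᶠ n in atTop, ∀ᶠ X in atTop, |a X - β n| ≤ ε n) : Tendsto a atTop (nhds L) := by
  rw [Metric.tendsto_nhds]
  intro η hη
  obtain ⟨n, hn, h1, h2⟩ := (h.and ((Metric.tendsto_nhds.1 hβ (η / 2) (half_pos hη)).and
    (Metric.tendsto_nhds.1 hε (η / 2) (half_pos hη)))).exists
  filter_upwards [hn] with X hX
  rw [Real.dist_eq] at h1 h2 ⊢
  have h3 := abs_sub_le (a X) (β n) L
  have h4 := le_abs_self (ε n - 0)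
  linarith

/-- The discriminants in the family, of sign `s`. -/
def Fam (s d : ℤ) : Prop := 0 < s * d ∧ d ≠ 1 ∧ ∀ p : ℕ, p.Prime → LocD S S₁ p d

lemma finite_disc (s : ℤ) (X : ℝ) : {d : ℤ | 0 < s * d ∧ |(d : ℝ)| < X}.Finite := by
  refine (Set.finite_Icc (-⌈X⌉) ⌈X⌉).subset fun d hd => ?_
  have h := abs_lt.1 hd.2
  have := Int.le_ceil X
  constructor
  · have : (-⌈X⌉ : ℝ) ≤ d := by linarith
    exact_mod_cast this
  · have : (d : ℝ) ≤ ⌈X⌉ := by linarith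
    exact_mod_cast this

lemma ncard_sq_dvd_le {s : ℤ} (hs : s = 1 ∨ s = -1) {k : ℕ} (hk : 0 < k) {X : ℝ} (hX : 0 ≤ X) :
    (({d : ℤ | (0 < s * d ∧ |(d : ℝ)| < X) ∧ (k : ℤ) ^ 2 ∣ d}.ncard : ℕ) : ℝ) ≤ X / k ^ 2 := by
  have hsub : {d : ℤ | (0 < s * d ∧ |(d : ℝ)| < X) ∧ (k : ℤ) ^ 2 ∣ d} ⊆
      (fun m : ℤ => s * (k ^ 2 * m)) '' Set.Icc 1 ⌊X / (k : ℝ) ^ 2⌋ := by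
    rintro _ ⟨⟨h1, h2⟩, m, rfl⟩
    have hss : s * s = 1 := by rcases hs with rfl | rfl <;> norm_num
    refine ⟨s * m, ⟨?_, ?_⟩, by linear_combination (k : ℤ) ^ 2 * m * hss⟩
    · by_contra h
      push Not at h
      nlinarith
    · rw [Int.le_floor, le_div_iff₀ (by positivity)]
      refine le_trans ?_ h2.le
      rcases hs with rfl | rfl
      · have := le_abs_self (((k : ℤ) ^ 2 * m : ℤ) : ℝ)
        push_cast at this ⊢
        linarith
      · have := neg_le_abs (((k : ℤ) ^ 2 * m : ℤ) : ℝ)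
        push_cast at this ⊢
        linarith
  calc (({d : ℤ | (0 < s * d ∧ |(d : ℝ)| < X) ∧ (k : ℤ) ^ 2 ∣ d}.ncard : ℕ) : ℝ)
      ≤ (((Set.Icc (1 : ℤ) ⌊X / (k : ℝ) ^ 2⌋).ncard : ℕ) : ℝ) := by
        exact_mod_cast (Set.ncard_le_ncard hsub ((Set.finite_Icc _ _).image _)).trans
          (Set.ncard_image_le (Set.finite_Icc _ _))
    _ = (⌊X / (k : ℝ) ^ 2⌋ : ℝ) := by
        rw [← Finset.coe_Icc, Set.ncard_coe_finset, Int.card_Icc]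
        have : 0 ≤ ⌊X / (k : ℝ) ^ 2⌋ := Int.floor_nonneg.2 (by positivity)
        rw [add_sub_cancel_right]
        exact_mod_cast Int.toNat_of_nonneg this
    _ ≤ X / k ^ 2 := Int.floor_le _

/-- Sum of `1 / k²` over `k ≥ n`. -/
lemma sum_tail_le {n N : ℕ} (hn : 0 < n) : ∑ k ∈ Finset.Ico n N, 1 / (k : ℝ) ^ 2 ≤ 2 / (n : ℝ) := by
  obtain ⟨m, rfl⟩ : ∃ m, n = m + 1 := ⟨n - 1, by omega⟩
  have h := sum_Ioo_inv_sq_le (α := ℝ) m N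
  have h2 : Finset.Ico (m + 1) N = Finset.Ioo m N := by
    ext; simp only [Finset.mem_Ico, Finset.mem_Ioo]; omega
  rw [h2]
  push_cast
  simp only [one_div]
  exact h

end Loc

namespace LatticeCount

variable {ι : Type*} [Fintype ι]

lemma tendsto_card_local {R : Set (ι → ℝ)} (hb : Bornology.IsBounded R)
    (hR : MeasurableSet R) (hfr : MeasureTheory.volume (frontier R) = 0) (P : Finset ℕ)
    {q : ℕ → ℕ} {E : ℕ → Set (ι → ℤ)} {k : ℕ → ℝ} (hq : ∀ p ∈ P, 0 < q p)
    (hE : ∀ p ∈ P, IsPeriodic (q p) (E p) ∧ density (q p) (E p) = k p)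
    (hcop : (P : Set ℕ).Pairwise fun a b => (q a).Coprime (q b)) :
    Tendsto (fun t : ℝ => ({v : ι → ℤ | (∀ p ∈ P, v ∈ E p) ∧ (fun i => (v i : ℝ) / t) ∈ R}.ncard : ℝ)
      / t ^ Fintype.card ι) atTop (nhds ((MeasureTheory.volume R).toReal * ∏ p ∈ P, k p)) := by
  have h0 := IsPeriodic.biInter P q E (fun p hp => (hE p hp).1)
  have h := tendsto_card_periodic hb hR hfr (Finset.prod_pos hq) h0
  have h2 := density_biInter P q E (fun p hp => (hq p hp).ne') (fun p hp => (hE p hp).1) hcop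
  rw [density] at h2
  rw [h2, Finset.prod_congr rfl fun p hp => (hE p hp).2] at h
  refine h.congr fun t => ?_
  rw [← Nat.card_coe_set_eq]
  congr 2
  refine Nat.card_congr (Equiv.subtypeEquivRight fun v => ?_)
  simp only [Set.mem_iInter]
  rfl

end LatticeCount

namespace Loc

open LatticeCount

lemma coprime_qD {a b : ℕ} (ha : a.Prime) (hb : b.Prime) (h : a ≠ b) : (qD a).Coprime (qD b) := by
  have h2 := (Nat.coprime_primes ha hb).2 h
  have key : ∀ p : ℕ, ∃ k, qD p = p ^ k := fun p => by
    unfold qD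
    split_ifs with h
    · exact ⟨4, by rw [h]; norm_num⟩
    · exact ⟨2, rfl⟩
  obtain ⟨k, hk⟩ := key a
  obtain ⟨l, hl⟩ := key b
  rw [hk, hl]
  exact Nat.Coprime.pow _ _ h2

variable (S S₁ : Finset ℕ)

lemma tendsto_locD {s : ℤ} (hs : s = 1 ∨ s = -1) (n : ℕ) :
    Tendsto (fun X : ℝ => ({d : ℤ | (0 < s * d ∧ |(d : ℝ)| < X) ∧
      ∀ p ∈ n.primesBelow, LocD S S₁ p d}.ncard : ℝ) / X) atTop
      (nhds (∏ p ∈ n.primesBelow, nu S S₁ p)) := by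
  have hpr : ∀ p ∈ n.primesBelow, p.Prime := fun p hp => (Nat.mem_primesBelow.1 hp).2
  set R : Set (Fin 1 → ℝ) := Set.univ.pi fun _ => (fun x : ℝ => s * x) ⁻¹' Set.Ioo 0 1 with hR
  have hR' : R = Set.univ.pi fun _ => if s = 1 then Set.Ioo 0 1 else Set.Ioo (-1) 0 := by
    rw [hR]
    congr 1
    ext _ x
    rcases hs with rfl | rfl
    · simp
    · simp [and_comm, neg_lt]
  have hvol : (MeasureTheory.volume R).toReal = 1 := by
    rw [hR', MeasureTheory.volume_pi_pi]
    split_ifs <;> simp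
  have hfr : MeasureTheory.volume (frontier R) = 0 := by
    refine Convex.addHaar_frontier _ ?_
    rw [hR']
    refine convex_pi fun _ _ => ?_
    split_ifs <;> exact convex_Ioo _ _
  have hm : MeasurableSet R := by
    rw [hR']
    refine MeasurableSet.univ_pi fun _ => ?_
    split_ifs <;> exact measurableSet_Ioo
  have hb : Bornology.IsBounded R := by
    rw [hR']
    refine Bornology.IsBounded.pi fun _ => ?_
    split_ifs <;> exact Metric.isBounded_Ioo _ _
  have h := tendsto_card_local hb hm hfr n.primesBelow (q := qD)
    (E := fun p => {v : Fin 1 → ℤ | LocD S S₁ p (v 0)}) (fun p hp => qD_pos (hpr p hp))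
    (fun p hp => locD_density S S₁ p (hpr p hp))
    (fun a ha b hb hab => coprime_qD (hpr a ha) (hpr b hb) hab)
  rw [hvol, one_mul] at h
  refine h.congr' ?_
  filter_upwards [eventually_gt_atTop 0] with X hX
  rw [Fintype.card_fin, pow_one]
  congr 2
  refine Set.ncard_congr (fun v _ => v 0) ?_ ?_ ?_
  · rintro v ⟨h1, h2⟩
    have h3 := h2 0 (Set.mem_univ _)
    have h4 : 0 < (s : ℝ) * (v 0 / X) ∧ (s : ℝ) * (v 0 / X) < 1 := h3
    rw [← mul_div_assoc] at h4
    have h5 : 0 < (s : ℝ) * v 0 := by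
      have := mul_pos h4.1 hX
      rwa [div_mul_cancel₀ _ hX.ne'] at this
    refine ⟨⟨by exact_mod_cast h5, ?_⟩, h1⟩
    have h6 := (div_lt_one hX).1 h4.2
    rcases hs with rfl | rfl
    · rw [abs_of_pos (by simpa using h5)]
      simpa using h6
    · rw [abs_of_neg (by simpa using h5)]
      simpa using h6
  · intro v w _ _ h
    ext i
    rw [Subsingleton.elim i 0, h]
  · rintro d ⟨⟨h1, h2⟩, h3⟩
    refine ⟨fun _ => d, ⟨h3, fun i _ => ?_⟩, rfl⟩
    show 0 < (s : ℝ) * (d / X) ∧ (s : ℝ) * (d / X) < 1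
    have h5 : 0 < (s : ℝ) * d := by exact_mod_cast h1
    rw [← mul_div_assoc, div_lt_one hX]
    refine ⟨div_pos h5 hX, ?_⟩
    rcases hs with rfl | rfl
    · rw [abs_of_pos (by simpa using h5)] at h2
      simpa using h2
    · rw [abs_of_neg (by simpa using h5)] at h2
      simpa using h2

lemma locD_of_large {p : ℕ} {d : ℤ} (hS₁ : S₁ ⊆ S) (hp2 : p ≠ 2) (hp : p ∉ S)
    (h : ¬ (p : ℤ) ^ 2 ∣ d) : LocD S S₁ p d := by
  refine ⟨?_, fun h' => absurd (hS₁ h') hp, fun h' => absurd h' hp⟩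
  unfold Fund
  rwa [if_neg hp2]

/-- The number of discriminants in the family. -/
noncomputable def famCount (s : ℤ) (X : ℝ) : ℝ := {d : ℤ | Fam S S₁ s d ∧ |(d : ℝ)| < X}.ncard

lemma tendsto_famCount {s : ℤ} (hs : s = 1 ∨ s = -1) (hS₁ : S₁ ⊆ S) {φ : ℝ}
    (hφ : Tendsto (fun n : ℕ => ∏ p ∈ n.primesBelow, nu S S₁ p) atTop (nhds φ)) :
    Tendsto (fun X => famCount S S₁ s X / X) atTop (nhds φ) := by
  refine sieve_limit hφ (ε := fun n : ℕ => 4 / (n : ℝ)) ?_ ?_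
  · exact tendsto_const_div_atTop_nhds_zero_nat 4
  filter_upwards [eventually_gt_atTop ((insert 2 S).sup id)] with n hn
  have hlarge : ∀ p, n ≤ p → p ≠ 2 ∧ p ∉ S := by
    intro p hp
    have : ∀ q ∈ insert 2 S, q ≠ p := fun q hq h => by
      have := Finset.le_sup (f := id) hq
      simp only [id] at this
      omega
    exact ⟨fun h => this 2 (Finset.mem_insert_self _ _) h.symm,
      fun h => this p (Finset.mem_insert_of_mem h) rfl⟩
  have hn0 : 0 < n := by omega
  have hn0' : (0 : ℝ) < n := by exact_mod_cast hn0
  have h1 := (Metric.tendsto_nhds.1 (tendsto_locD S S₁ hs n)) (1 / n) (by positivity)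
  filter_upwards [h1, eventually_ge_atTop (n : ℝ)] with X hX hXn
  have hX0 : 0 < X := hn0'.trans_le hXn
  set A := {d : ℤ | Fam S S₁ s d ∧ |(d : ℝ)| < X}
  set B := {d : ℤ | (0 < s * d ∧ |(d : ℝ)| < X) ∧ ∀ p ∈ n.primesBelow, LocD S S₁ p d}
  have hBfin : B.Finite := (finite_disc s X).subset fun d hd => hd.1
  have hAB : A ⊆ B := fun d hd => ⟨⟨hd.1.1, hd.2⟩, fun p hp =>
    hd.1.2.2 p (Nat.mem_primesBelow.1 hp).2⟩
  set N := ⌈X⌉₊ + 1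
  set E : ℕ → Set ℤ := fun k => {d : ℤ | (0 < s * d ∧ |(d : ℝ)| < X) ∧ (k : ℤ) ^ 2 ∣ d}
  have hEfin : ∀ k, (E k).Finite := fun k => (finite_disc s X).subset fun d hd => hd.1
  have hsub : B ⊆ A ∪ ({1} ∪ ⋃ k ∈ Finset.Ico n N, E k) := by
    intro d hd
    by_contra hcon
    simp only [Set.mem_union, not_or, Set.mem_iUnion, not_exists] at hcon
    refine hcon.1 ⟨⟨hd.1.1, fun h => hcon.2.1 h, fun p hp => ?_⟩, hd.1.2⟩
    by_cases hpn : p < n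
    · exact hd.2 p (Nat.mem_primesBelow.2 ⟨hpn, hp⟩)
    have hl := hlarge p (by omega)
    refine locD_of_large S S₁ hS₁ hl.1 hl.2 fun hdvd => ?_
    refine hcon.2.2 p (Finset.mem_Ico.2 ⟨by omega, ?_⟩) ⟨hd.1, hdvd⟩
    have hd0 : d ≠ 0 := by
      rintro rfl
      simpa using hd.1.1
    have h3 := Int.le_of_dvd (abs_pos.2 hd0) ((dvd_abs _ _).2 hdvd)
    have h4 : (p : ℝ) ^ 2 ≤ |(d : ℝ)| := by exact_mod_cast h3
    have h5 : (1 : ℝ) ≤ p := by exact_mod_cast hp.one_lt.le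
    have h6 : (p : ℝ) ≤ X := by nlinarith [hd.1.2]
    have h7 : (p : ℝ) ≤ (⌈X⌉₊ : ℝ) := h6.trans (Nat.le_ceil X)
    have : p ≤ ⌈X⌉₊ := by exact_mod_cast h7
    omega
  have hle1 : (A.ncard : ℝ) ≤ B.ncard := by exact_mod_cast Set.ncard_le_ncard hAB hBfin
  have hUfin : (⋃ k ∈ Finset.Ico n N, E k).Finite :=
    Set.Finite.biUnion (Finset.finite_toSet _) fun k _ => hEfin k
  have hle2 : (B.ncard : ℝ) ≤ A.ncard + (1 + ∑ k ∈ Finset.Ico n N, ((E k).ncard : ℝ)) := by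
    have h3 := (Set.ncard_le_ncard hsub ((hBfin.subset hAB).union
      ((Set.finite_singleton _).union hUfin))).trans (Set.ncard_union_le _ _)
    have h4 := Set.ncard_union_le {1} (⋃ k ∈ Finset.Ico n N, E k)
    have h5 := Finset.set_ncard_biUnion_le (Finset.Ico n N) E
    rw [Set.ncard_singleton] at h4
    exact_mod_cast h3.trans (by omega)
  have hle3 : ∑ k ∈ Finset.Ico n N, ((E k).ncard : ℝ) ≤ X * (2 / n) := by
    refine le_trans (Finset.sum_le_sum fun k hk => ncard_sq_dvd_le hs
      (hn0.trans_le (Finset.mem_Ico.1 hk).1) hX0.le) ?_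
    have := mul_le_mul_of_nonneg_left (sum_tail_le (N := N) hn0) hX0.le
    rw [Finset.mul_sum] at this
    refine le_trans (le_of_eq (Finset.sum_congr rfl fun k _ => ?_)) this
    ring
  rw [Real.dist_eq, abs_lt] at hX
  have hdiv1 : (A.ncard : ℝ) / X ≤ B.ncard / X := by gcongr
  have hdiv2 : (B.ncard : ℝ) / X ≤ A.ncard / X + (1 / n + 2 / n) := by
    have h1n : 1 ≤ X * (1 / n) := by
      rw [mul_one_div, le_div_iff₀ hn0']
      linarith
    have : (B.ncard : ℝ) ≤ A.ncard + X * (1 / n + 2 / n) := by nlinarith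
    calc (B.ncard : ℝ) / X ≤ (A.ncard + X * (1 / n + 2 / n)) / X := by gcongr
      _ = _ := by field_simp
  have h4 : (4 : ℝ) / n = 1 / n + 1 / n + 2 / n := by ring
  show |(A.ncard : ℝ) / X - _| ≤ 4 / n
  rw [abs_le]
  constructor <;> linarith [hX.1, hX.2]

end Loc

namespace CubicForm

/-- The sign of the discriminants in each of the two families. -/
def sg (j : Bool) : ℤ := if j then 1 else -1

/-- The constant in the discriminant of a parametrized form. -/
noncomputable def discConst (j : Bool) : ℝ := if j then 4 / 27 else 4

/-- The parametrization of real forms: for `α = u + iv`, `z = x + iy` and `L = X - zY`,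
the form `Re (α L² L̄)` when `j` is true, and `Re (α L³)` otherwise. -/
noncomputable def psi (j : Bool) (u v x y : ℝ) : Fin 4 → ℝ :=
  if j then
    ![u, (-2 * x * u - (u * x - v * y)) / 3, (u * (x ^ 2 + y ^ 2) + 2 * x * (u * x - v * y)) / 3,
      -(u * x - v * y) * (x ^ 2 + y ^ 2)]
  else
    ![u, -(u * x - v * y), u * (x ^ 2 - y ^ 2) - 2 * v * x * y,
      -(u * (x ^ 3 - 3 * x * y ^ 2) - v * (3 * x ^ 2 * y - y ^ 3))]

lemma sg_sq (j : Bool) : sg j * sg j = 1 := by cases j <;> simp [sg]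

lemma sg_eq (j : Bool) : sg j = 1 ∨ sg j = -1 := by cases j <;> simp [sg]

lemma discConst_pos (j : Bool) : 0 < discConst j := by
  cases j <;> simp only [discConst] <;> norm_num

lemma disc_psi (j : Bool) (u v x y : ℝ) :
    disc (psi j u v x y) = sg j * (discConst j * (u ^ 2 + v ^ 2) ^ 2 * y ^ 6) := by
  cases j
  · simp [disc, psi, hessA, hessB, hessC, sg, discConst]
    ring
  · simp [disc, psi, hessA, hessB, hessC, sg, discConst]
    ring

lemma psi_smul (j : Bool) (t u v x y : ℝ) : psi j (t * u) (t * v) x y = t • psi j u v x y := by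
  cases j <;> funext i <;> fin_cases i <;> simp [psi] <;> ring

/-- The form with complex root `z`: the Hessian, or the form itself. -/
def rt (j : Bool) (f : Fin 4 → ℝ) (z : ℂ) : Prop :=
  if j then eval (fun i => (f i : ℂ)) z 1 = 0
  else ((hessA f : ℝ) : ℂ) * z ^ 2 + (hessB f : ℝ) * z + (hessC f : ℝ) = 0

lemma rt_true_iff {f : Fin 4 → ℝ} {z : ℂ} (hz : 0 < z.im) :
    rt true f z ↔ 3 * f 2 = -f 0 * (3 * z.re ^ 2 - z.im ^ 2) - 6 * f 1 * z.re ∧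
      f 3 = -(f 0 * (z.re ^ 3 - 3 * z.re * z.im ^ 2) + 3 * f 1 * (z.re ^ 2 - z.im ^ 2)
        + 3 * f 2 * z.re) := by
  have h : rt true f z ↔
      (f 0 * (z.re ^ 3 - 3 * z.re * z.im ^ 2) + 3 * f 1 * (z.re ^ 2 - z.im ^ 2)
        + 3 * f 2 * z.re + f 3 = 0 ∧
      (f 0 * (3 * z.re ^ 2 - z.im ^ 2) + 6 * f 1 * z.re + 3 * f 2) * z.im = 0) := by
    simp only [rt, eval, if_true, Complex.ext_iff]
    simp [pow_succ, -mul_eq_zero]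
    constructor
    · grind
    · grind
  rw [h, mul_eq_zero, or_iff_left hz.ne']
  constructor
  · grind
  · grind

lemma rt_false_iff {f : Fin 4 → ℝ} {z : ℂ} (hz : 0 < z.im) :
    rt false f z ↔ hessB f = -2 * hessA f * z.re ∧
      hessC f = hessA f * (z.re ^ 2 + z.im ^ 2) := by
  have h : rt false f z ↔
      (hessA f * (z.re ^ 2 - z.im ^ 2) + hessB f * z.re + hessC f = 0 ∧
        (2 * hessA f * z.re + hessB f) * z.im = 0) := by
    simp only [rt, Complex.ext_iff]
    simp [pow_succ, -mul_eq_zero]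
    intro h1
    constructor <;> intro h2 <;> linear_combination h2
  rw [h, mul_eq_zero, or_iff_left hz.ne']
  constructor
  · grind
  · grind

lemma rt_psi (j : Bool) (u v : ℝ) {z : ℂ} (hz : 0 < z.im) : rt j (psi j u v z.re z.im) z := by
  cases j
  · rw [rt_false_iff hz]
    simp only [psi, hessA, hessB, hessC]
    constructor <;> simp <;> ring
  · rw [rt_true_iff hz]
    simp only [psi]
    constructor <;> simp <;> ring

lemma hessA_ne_zero {f : Fin 4 → ℝ} (h : disc f < 0) : hessA f ≠ 0 := by
  intro h0
  rw [disc, h0] at h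
  nlinarith [sq_nonneg (hessB f)]

lemma exists_psi_of_rt {j : Bool} {f : Fin 4 → ℝ} {z : ℂ} (hz : 0 < z.im)
    (hf : 0 < sg j * disc f) (h : rt j f z) : ∃ u v, f = psi j u v z.re z.im := by
  set x := z.re
  set y := z.im
  have hy : y ≠ 0 := hz.ne'
  cases j
  · rw [rt_false_iff hz] at h
    obtain ⟨h1, h2⟩ := h
    have hA : hessA f ≠ 0 := hessA_ne_zero (by simpa [sg] using hf)
    have e1 : f 0 * hessC f - f 1 * hessB f + f 2 * hessA f = 0 := by
      simp only [hessA, hessB, hessC]; ring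
    have e2 : f 1 * hessC f - f 2 * hessB f + f 3 * hessA f = 0 := by
      simp only [hessA, hessB, hessC]; ring
    rw [h1, h2] at e1 e2
    have e1' : f 2 = -(f 0 * (x ^ 2 + y ^ 2)) - 2 * f 1 * x :=
      mul_left_cancel₀ hA (by linear_combination e1)
    have e2' : f 3 = -(f 1 * (x ^ 2 + y ^ 2)) - 2 * f 2 * x :=
      mul_left_cancel₀ hA (by linear_combination e2)
    refine ⟨f 0, (f 1 + f 0 * x) / y, ?_⟩
    have hv : (f 1 + f 0 * x) / y * y = f 1 + f 0 * x := div_mul_cancel₀ _ hy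
    set v := (f 1 + f 0 * x) / y
    funext i
    fin_cases i
    · simp [psi]
    · simp [psi]; linear_combination -hv
    · simp [psi]; linear_combination e1' + 2 * x * hv
    · simp [psi]; linear_combination e2' - 2 * x * e1' - (3 * x ^ 2 - y ^ 2) * hv
  · rw [rt_true_iff hz] at h
    obtain ⟨h1, h2⟩ := h
    refine ⟨f 0, (3 * f 1 + 3 * f 0 * x) / y, ?_⟩
    have hv : (3 * f 1 + 3 * f 0 * x) / y * y = 3 * f 1 + 3 * f 0 * x := div_mul_cancel₀ _ hy
    set v := (3 * f 1 + 3 * f 0 * x) / y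
    funext i
    fin_cases i
    · simp [psi]
    · simp [psi]; linear_combination -hv / 3
    · simp [psi]; linear_combination h1 / 3 + 2 / 3 * x * hv
    · simp [psi]; linear_combination h2 - x * h1 - (x ^ 2 + y ^ 2) * hv

lemma rt_unique {j : Bool} {f : Fin 4 → ℝ} {z w : ℂ} (hz : 0 < z.im) (hw : 0 < w.im)
    (hf : 0 < sg j * disc f) (h : rt j f z) (h' : rt j f w) : z = w := by
  cases j
  · have hA : hessA f ≠ 0 := hessA_ne_zero (by simpa [sg] using hf)
    rw [rt_false_iff hz] at h
    rw [rt_false_iff hw] at h'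
    have h1 : z.re = w.re := by grind
    have h2 : z.re ^ 2 + z.im ^ 2 = w.re ^ 2 + w.im ^ 2 :=
      mul_left_cancel₀ hA (h.2.symm.trans h'.2)
    rw [h1] at h2
    have h3 : (z.im - w.im) * (z.im + w.im) = 0 := by linear_combination h2
    rcases mul_eq_zero.1 h3 with h3 | h3
    · exact Complex.ext h1 (by linarith)
    · linarith
  · obtain ⟨u, v, rfl⟩ := exists_psi_of_rt hz hf h
    rw [disc_psi] at hf
    have huv : 0 < u ^ 2 + v ^ 2 := by
      rcases (by positivity : 0 ≤ u ^ 2 + v ^ 2).eq_or_lt with h0 | h0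
      · rw [← h0] at hf
        simp at hf
      · exact h0
    rw [rt, if_pos rfl] at h'
    have key : eval (fun i => ((psi true u v z.re z.im i : ℝ) : ℂ)) w 1 =
        ((w - z) * (w - (starRingEnd ℂ) z)) * (u * w - (u * z.re - v * z.im : ℝ)) := by
      have e1 : (w - z) * (w - (starRingEnd ℂ) z) =
          w ^ 2 - 2 * z.re * w + (z.re ^ 2 + z.im ^ 2 : ℝ) := by
        have a1 := Complex.add_conj z
        have a2 := Complex.mul_conj z
        rw [Complex.normSq_apply] at a2
        push_cast at a1 a2 ⊢
        linear_combination -w * a1 + a2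
      rw [e1]
      simp [eval, psi]
      ring
    rw [key, mul_eq_zero, mul_eq_zero] at h'
    rcases h' with (h' | h') | h'
    · exact (sub_eq_zero.1 h').symm
    · have := congrArg Complex.im (sub_eq_zero.1 h')
      simp at this
      linarith
    · have h1 := congrArg Complex.im h'
      have h2 := congrArg Complex.re h'
      simp at h1 h2
      have hu : u = 0 := h1.resolve_right hw.ne'
      rw [hu] at h2
      simp [hz.ne'] at h2
      simp [hu, h2] at huv

lemma exists_rt {j : Bool} {f : Fin 4 → ℝ} (hf : 0 < sg j * disc f) (h0 : f 0 ≠ 0) :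
    ∃ z : ℂ, 0 < z.im ∧ rt j f z := by
  cases j
  · have hd : disc f < 0 := by simpa [sg] using hf
    have hA := hessA_ne_zero hd
    have hpos : 0 < -disc f / (2 * hessA f) ^ 2 := div_pos (by linarith) (by positivity)
    refine ⟨⟨-hessB f / (2 * hessA f), √(-disc f / (2 * hessA f) ^ 2)⟩, Real.sqrt_pos.2 hpos, ?_⟩
    rw [rt_false_iff (Real.sqrt_pos.2 hpos)]
    simp only
    rw [Real.sq_sqrt hpos.le]
    constructor
    · field_simp
    · rw [disc]
      field_simp
      ring
  · have hd : 0 < disc f := by simpa [sg] using hf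
    obtain ⟨w, hw⟩ : ∃ w : ℂ, eval (fun i => (f i : ℂ)) w 1 = 0 := by
      let P : Polynomial ℂ := (⟨f 0, 3 * f 1, 3 * f 2, f 3⟩ : Cubic ℂ).toPoly
      have hP : 0 < P.degree := by
        rw [Cubic.degree_of_a_ne_zero (by simpa using h0)]
        norm_num
      obtain ⟨w, hw⟩ := Complex.exists_root hP
      refine ⟨w, ?_⟩
      simpa [P, Cubic.toPoly, eval] using hw
    rcases lt_trichotomy w.im 0 with hi | hi | hi
    · refine ⟨(starRingEnd ℂ) w, by simpa using hi, ?_⟩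
      have := congrArg (starRingEnd ℂ) hw
      rw [rt, if_pos rfl]
      simpa [eval, map_ofNat] using this
    · set θ := w.re
      have hwθ : w = (θ : ℂ) := Complex.ext rfl (by simpa using hi)
      have hθ : f 0 * θ ^ 3 + 3 * f 1 * θ ^ 2 + 3 * f 2 * θ + f 3 = 0 := by
        rw [hwθ, eval] at hw
        have : ((f 0 * θ ^ 3 + 3 * f 1 * θ ^ 2 + 3 * f 2 * θ + f 3 : ℝ) : ℂ) = 0 := by
          rw [← hw]; push_cast; ring
        exact_mod_cast this
      set p := 3 * f 1 + f 0 * θ with hp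
      set r := 3 * f 2 + p * θ with hr
      have hdisc : 27 * disc f = -(p ^ 2 - 4 * f 0 * r) * (f 0 * θ ^ 2 + p * θ + r) ^ 2 := by
        have he : f 3 = -(f 0 * θ ^ 3 + 3 * f 1 * θ ^ 2 + 3 * f 2 * θ) := by linarith
        simp only [disc, hessA, hessB, hessC, he, hp, hr]
        ring
      have hneg : 0 < 4 * f 0 * r - p ^ 2 := by
        by_contra hcon
        nlinarith [sq_nonneg (f 0 * θ ^ 2 + p * θ + r)]
      have hpos : 0 < (4 * f 0 * r - p ^ 2) / (2 * f 0) ^ 2 := div_pos hneg (by positivity)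
      refine ⟨⟨-p / (2 * f 0), √((4 * f 0 * r - p ^ 2) / (2 * f 0) ^ 2)⟩,
        Real.sqrt_pos.2 hpos, ?_⟩
      rw [rt_true_iff (Real.sqrt_pos.2 hpos)]
      have hy := Real.sq_sqrt hpos.le
      set y := √((4 * f 0 * r - p ^ 2) / (2 * f 0) ^ 2)
      have hx : -p / (2 * f 0) * (2 * f 0) = -p := div_mul_cancel₀ _ (by positivity)
      set x := -p / (2 * f 0)
      rw [eq_div_iff (by positivity)] at hy
      simp only
      have e0 : f 0 * (x ^ 2 + y ^ 2) = r := mul_left_cancel₀ h0 (by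
        linear_combination hy / 4 + (2 * f 0 * x - p) / 4 * hx)
      have e1 : 3 * f 1 = p - f 0 * θ := by linarith
      have e2 : 3 * f 2 = r - p * θ := by linarith
      have e3 : f 3 = -r * θ := by
        rw [hr, hp]; linarith
      have hx' : p = -(2 * f 0 * x) := by linarith
      clear_value x y r p
      constructor
      · linear_combination e2 - e0 + 2 * x * e1 + (2 * x - θ) * hx'
      · grind
    · exact ⟨w, hi, by rw [rt, if_pos rfl]; exact hw⟩

open scoped MatrixGroups Modular
open UpperHalfPlane

/-- Extension of scalars of an integral form. -/
def toReal (f : Fin 4 → ℤ) : Fin 4 → ℝ := fun i => (f i : ℝ)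

/-- The form has no nontrivial rational zero. -/
def Irred (f : Fin 4 → ℤ) : Prop := ∀ x y : ℤ, eval f x y = 0 → x = 0 ∧ y = 0

/-- `SL₂(ℤ)`-equivalence of integral forms. -/
def orbSetoid : Setoid (Fin 4 → ℤ) where
  r f g := ∃ γ : SL(2, ℤ), g = act γ.1 f
  iseqv := by
    refine ⟨fun f => ⟨1, by simp [act_one]⟩, ?_, ?_⟩
    · rintro f g ⟨γ, rfl⟩
      refine ⟨γ⁻¹, ?_⟩
      rw [← act_mul, ← Matrix.SpecialLinearGroup.coe_mul, mul_inv_cancel,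
        Matrix.SpecialLinearGroup.coe_one, act_one]
    · rintro f g h ⟨γ, rfl⟩ ⟨δ, rfl⟩
      exact ⟨γ * δ, by rw [Matrix.SpecialLinearGroup.coe_mul, act_mul]⟩

/-- The orbit of a form. -/
def orb (f : Fin 4 → ℤ) : Quotient orbSetoid := Quotient.mk _ f

lemma orb_eq_iff {f g : Fin 4 → ℤ} : orb f = orb g ↔ ∃ γ : SL(2, ℤ), g = act γ.1 f :=
  Quotient.eq (r := orbSetoid)

lemma orb_act (γ : SL(2, ℤ)) (f : Fin 4 → ℤ) : orb (act γ.1 f) = orb f :=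
  (orb_eq_iff.2 ⟨γ, rfl⟩).symm

/-- The number of orbits of a set of forms. -/
noncomputable def orbs (F : Set (Fin 4 → ℤ)) : ℕ := (orb '' F).ncard

lemma det_eq (γ : SL(2, ℤ)) : γ 0 0 * γ 1 1 - γ 0 1 * γ 1 0 = 1 := by
  have := γ.det_coe
  rwa [Matrix.det_fin_two] at this

lemma disc_act_SL (γ : SL(2, ℤ)) (f : Fin 4 → ℤ) : disc (act γ.1 f) = disc f := by
  rw [disc_act]
  have := det_eq γ
  rw [this, one_pow, one_mul]

lemma Irred.act {f : Fin 4 → ℤ} (hf : Irred f) (γ : SL(2, ℤ)) : Irred (act γ.1 f) := by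
  intro x y h
  rw [eval_act] at h
  obtain ⟨h1, h2⟩ := hf _ _ h
  have hd := det_eq γ
  constructor
  · linear_combination γ 1 1 * h1 - γ 0 1 * h2 - x * hd
  · linear_combination γ 0 0 * h2 - γ 1 0 * h1 - y * hd

lemma Irred.ne_zero {f : Fin 4 → ℤ} (hf : Irred f) : f 0 ≠ 0 := fun h =>
  one_ne_zero (hf 1 0 (by simp [eval, h])).1

lemma disc_toReal (f : Fin 4 → ℤ) : disc (toReal f) = disc f :=
  (map_disc (Int.castRingHom ℝ) f).symm

/-- The complex root of an integral form in the upper half plane. -/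
def rtH (j : Bool) (f : Fin 4 → ℤ) (z : ℍ) : Prop := rt j (toReal f) z

lemma rtH_act {j : Bool} {f : Fin 4 → ℤ} {γ : SL(2, ℤ)} {z : ℍ} (h : rtH j f (γ • z)) :
    rtH j (act γ.1 f) z := by
  have hden : ((γ 1 0 : ℤ) : ℂ) * z + ((γ 1 1 : ℤ) : ℂ) ≠ 0 := by
    have := denom_ne_zero (γ : GL (Fin 2) ℝ) z
    simpa [denom] using this
  have hco := coe_specialLinearGroup_apply γ z
  simp only [algebraMap_int_eq, eq_intCast, Complex.ofReal_intCast] at hco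
  have hdR : ((γ 0 0 : ℤ) : ℝ) * (γ 1 1 : ℤ) - (γ 0 1 : ℤ) * (γ 1 0 : ℤ) = 1 := by
    exact_mod_cast det_eq γ
  have hact : toReal (act γ.1 f) = act (γ.1.map (Int.castRingHom ℝ)) (toReal f) :=
    map_act (Int.castRingHom ℝ) γ.1 f
  have heq : ((γ • z : ℍ) : ℂ) * (((γ 1 0 : ℤ) : ℂ) * z + ((γ 1 1 : ℤ) : ℂ)) =
      ((γ 0 0 : ℤ) : ℂ) * z + ((γ 0 1 : ℤ) : ℂ) := by
    rw [hco, div_mul_cancel₀ _ hden]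
  unfold rtH at h ⊢
  generalize ((γ • z : ℍ) : ℂ) = w at h heq
  cases j
  · simp only [rt, Bool.false_eq_true, if_false] at h ⊢
    rw [hact, hessA_act, hessB_act, hessC_act]
    simp only [Matrix.map_apply, eq_intCast]
    rw [hdR]
    push_cast
    linear_combination (((γ 1 0 : ℤ) : ℂ) * z + ((γ 1 1 : ℤ) : ℂ)) ^ 2 * h
      - ((hessA (toReal f) : ℝ) * (w * (((γ 1 0 : ℤ) : ℂ) * z + ((γ 1 1 : ℤ) : ℂ))
        + (((γ 0 0 : ℤ) : ℂ) * z + ((γ 0 1 : ℤ) : ℂ)))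
        + (hessB (toReal f) : ℝ) * (((γ 1 0 : ℤ) : ℂ) * z + ((γ 1 1 : ℤ) : ℂ))) * heq
  · simp only [rt, if_true] at h ⊢
    have e1 : (fun i => ((toReal (act γ.1 f) i : ℝ) : ℂ)) =
        act (γ.1.map (Int.castRingHom ℂ)) (fun i => ((toReal f i : ℝ) : ℂ)) := by
      have := map_act (Int.castRingHom ℂ) γ.1 f
      simpa [toReal, funext_iff, Function.comp_def] using this
    rw [e1, eval_act]
    simp only [Matrix.map_apply, eq_intCast, mul_one]
    have : eval (fun i => ((toReal f i : ℝ) : ℂ)) (((γ 0 0 : ℤ) : ℂ) * z + ((γ 0 1 : ℤ) : ℂ))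
        (((γ 1 0 : ℤ) : ℂ) * z + ((γ 1 1 : ℤ) : ℂ)) =
        (((γ 1 0 : ℤ) : ℂ) * z + ((γ 1 1 : ℤ) : ℂ)) ^ 3 *
          eval (fun i => ((toReal f i : ℝ) : ℂ)) w 1 := by
      rw [← heq]
      simp only [eval]
      ring
    rw [this, h, mul_zero]

lemma rtH_unique {j : Bool} {f : Fin 4 → ℤ} {z w : ℍ} (hf : 0 < sg j * disc f) (h : rtH j f z)
    (h' : rtH j f w) : z = w := by
  refine UpperHalfPlane.ext (rt_unique z.2 w.2 ?_ h h')
  rw [disc_toReal]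
  exact_mod_cast hf

lemma rtH_neg {j : Bool} {f : Fin 4 → ℤ} {z : ℍ} (h : rtH j f z) : rtH j (-f) z := by
  have := rtH_act (γ := -1) (f := f) (j := j) (z := z) (by simpa using h)
  rw [show ((-1 : SL(2, ℤ)) : SL(2, ℤ)).1 = -1 by simp, act_neg_one] at this
  exact this

lemma exists_rtH {j : Bool} {f : Fin 4 → ℤ} (hf : 0 < sg j * disc f) (h0 : f 0 ≠ 0) :
    ∃ z, rtH j f z := by
  obtain ⟨z, hz, h⟩ := exists_rt (j := j) (f := toReal f)
    (by rw [disc_toReal]; exact_mod_cast hf) (by simpa [toReal] using h0)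
  exact ⟨⟨z, hz⟩, h⟩

lemma orb_neg (f : Fin 4 → ℤ) : orb (-f) = orb f := by
  rw [← act_neg_one]
  have := orb_act (-1) f
  rwa [show ((-1 : SL(2, ℤ)) : SL(2, ℤ)).1 = -1 by simp] at this

/-- A set of integral forms stable under `SL₂(ℤ)`, irreducible and of fixed sign. -/
structure Good (j : Bool) (F : Set (Fin 4 → ℤ)) : Prop where
  irred : ∀ f ∈ F, Irred f
  sign : ∀ f ∈ F, 0 < sg j * disc f
  act_mem : ∀ f ∈ F, ∀ γ : SL(2, ℤ), act γ.1 f ∈ F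

namespace Good

variable {j : Bool} {F : Set (Fin 4 → ℤ)} (hF : Good j F)

include hF

lemma neg_mem {f : Fin 4 → ℤ} (hf : f ∈ F) : -f ∈ F := by
  have := hF.act_mem f hf (-1)
  rwa [show ((-1 : SL(2, ℤ)) : SL(2, ℤ)).1 = -1 by simp, act_neg_one] at this

lemma exists_fd {f : Fin 4 → ℤ} (hf : f ∈ F) :
    ∃ g ∈ F, orb g = orb f ∧ ∃ z ∈ 𝒟, rtH j g z := by
  obtain ⟨z, hz⟩ := exists_rtH (hF.sign f hf) (hF.irred f hf).ne_zero
  obtain ⟨γ, hγ⟩ := ModularGroup.exists_smul_mem_fd z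
  exact ⟨_, hF.act_mem f hf γ⁻¹, orb_act _ _, _, hγ, rtH_act (by simpa using hz)⟩

lemma image_fd : orb '' {f ∈ F | ∃ z ∈ 𝒟, rtH j f z} = orb '' F := by
  refine Set.Subset.antisymm (Set.image_mono fun f hf => hf.1) ?_
  rintro _ ⟨f, hf, rfl⟩
  obtain ⟨g, hg, h1, h2⟩ := hF.exists_fd hf
  exact ⟨g, ⟨hg, h2⟩, h1⟩

lemma two_mul_orbs_le (hfin : {f ∈ F | ∃ z ∈ 𝒟, rtH j f z}.Finite) :
    2 * orbs F ≤ {f ∈ F | ∃ z ∈ 𝒟, rtH j f z}.ncard := by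
  classical
  rw [orbs, ← hF.image_fd, ← hfin.coe_toFinset, ← Finset.coe_image, Set.ncard_coe_finset,
    Set.ncard_coe_finset]
  refine Finset.mul_card_image_le_card _ _ fun q hq => ?_
  obtain ⟨f, hf, rfl⟩ := Finset.mem_image.1 hq
  have hf' := (hfin.mem_toFinset).1 hf
  obtain ⟨h1, z, hz, h2⟩ := hf'
  have hne : f ≠ -f := by
    intro h
    have := congrFun h 0
    rw [Pi.neg_apply] at this
    exact (hF.irred f h1).ne_zero (by omega)
  rw [← Finset.card_pair hne]
  refine Finset.card_le_card ?_
  intro g hg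
  rw [Finset.mem_insert, Finset.mem_singleton] at hg
  rcases hg with rfl | rfl
  · exact Finset.mem_filter.2 ⟨hf, rfl⟩
  · exact Finset.mem_filter.2 ⟨hfin.mem_toFinset.2 ⟨hF.neg_mem h1, z, hz, rtH_neg h2⟩, orb_neg f⟩

lemma eq_or_eq_neg {f g : Fin 4 → ℤ} (hf : f ∈ F) {z w : ℍ} (hz : z ∈ 𝒟ᵒ) (hw : w ∈ 𝒟ᵒ)
    (hfz : rtH j f z) (hgw : rtH j g w) (h : orb f = orb g) : g = f ∨ g = -f := by
  obtain ⟨γ, rfl⟩ := orb_eq_iff.1 h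
  have h1 : rtH j f (γ • w) := by
    have := rtH_act (γ := γ⁻¹) (f := act γ.1 f) (z := γ • w) (by simpa using hgw)
    rwa [← act_mul, ← Matrix.SpecialLinearGroup.coe_mul, mul_inv_cancel,
        Matrix.SpecialLinearGroup.coe_one, act_one] at this
  have h2 := rtH_unique (hF.sign f hf) hfz h1
  rcases ModularGroup.eq_one_or_neg_one_of_mem_fdo_mem_fdo hw (h2 ▸ hz) with rfl | rfl
  · left; simp [act_one]
  · right
    rw [show ((-1 : SL(2, ℤ)) : SL(2, ℤ)).1 = -1 by simp, act_neg_one]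

lemma le_two_mul_orbs (hfin : {f ∈ F | ∃ z ∈ 𝒟, rtH j f z}.Finite) {E : Set (Fin 4 → ℤ)}
    (hE : ∀ f ∈ E, f ∈ F ∧ ∃ z ∈ 𝒟ᵒ, rtH j f z) : E.ncard ≤ 2 * orbs F := by
  classical
  have hEfin : E.Finite := hfin.subset fun f hf => ⟨(hE f hf).1, by
    obtain ⟨z, hz, h⟩ := (hE f hf).2
    exact ⟨z, ModularGroup.fdo_subset_fd hz, h⟩⟩
  have hle : (orb '' E).ncard ≤ orbs F := by
    refine Set.ncard_le_ncard (Set.image_mono fun f hf => (hE f hf).1) ?_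
    rw [← hF.image_fd]
    exact hfin.image _
  refine le_trans ?_ (Nat.mul_le_mul_left 2 hle)
  rw [← hEfin.coe_toFinset, ← Finset.coe_image, Set.ncard_coe_finset, Set.ncard_coe_finset]
  refine Finset.card_le_mul_card_image _ _ fun q hq => ?_
  obtain ⟨f, hf, rfl⟩ := Finset.mem_image.1 hq
  obtain ⟨h1, z, hz, h2⟩ := hE f (hEfin.mem_toFinset.1 hf)
  refine (Finset.card_le_card (t := {f, -f}) ?_).trans Finset.card_le_two
  intro g hg
  obtain ⟨hg1, hg2⟩ := Finset.mem_filter.1 hg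
  obtain ⟨h3, w, hw, h4⟩ := hE g (hEfin.mem_toFinset.1 hg1)
  rw [Finset.mem_insert, Finset.mem_singleton]
  exact hF.eq_or_eq_neg h1 hz hw h2 h4 hg2.symm

end Good

lemma psi_sq_le (j : Bool) (u v x y : ℝ) (i : Fin 4) :
    (psi j u v x y i) ^ 2 ≤ (u ^ 2 + v ^ 2) * (x ^ 2 + y ^ 2) ^ (i : ℕ) := by
  cases j <;> fin_cases i
  · simp [psi]; nlinarith [sq_nonneg v]
  · simp [psi]; nlinarith [sq_nonneg (u * y + v * x)]
  · simp [psi]; nlinarith [sq_nonneg (2 * u * x * y + v * (x ^ 2 - y ^ 2))]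
  · simp [psi]
    nlinarith [sq_nonneg (u * (3 * x ^ 2 * y - y ^ 3) + v * (x ^ 3 - 3 * x * y ^ 2))]
  · simp [psi]; nlinarith [sq_nonneg v]
  · simp [psi]
    nlinarith [sq_nonneg (u * y / 3 + v * x), mul_nonneg (sq_nonneg u) (sq_nonneg y),
      mul_nonneg (sq_nonneg v) (sq_nonneg y)]
  · simp [psi]
    have h1 : 0 ≤ (u * (2 * x * y / 3) + v * (x ^ 2 + y ^ 2 / 3)) ^ 2 := sq_nonneg _
    have h2 : 0 ≤ (u ^ 2 + v ^ 2) * ((x * y) ^ 2 * (8 / 9) + y ^ 4 * (8 / 9)) := by positivity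
    nlinarith
  · simp [psi]
    nlinarith [sq_nonneg ((u * y + v * x) * (x ^ 2 + y ^ 2))]

lemma finite_and_ncard_box_le {M : Fin 4 → ℝ} (h0 : 0 ≤ M 0) (h1 : 1 ≤ M 1) (h2 : 1 ≤ M 2)
    (h3 : 1 ≤ M 3) :
    {v : Fin 4 → ℤ | v 0 ≠ 0 ∧ ∀ i, |(v i : ℝ)| ≤ M i}.Finite ∧
    ({v : Fin 4 → ℤ | v 0 ≠ 0 ∧ ∀ i, |(v i : ℝ)| ≤ M i}.ncard : ℝ) ≤
      54 * (M 0 * M 1 * M 2 * M 3) := by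
  classical
  set B : Fin 4 → Finset ℤ := fun i =>
    if i = 0 then (Finset.Icc (-⌊M i⌋) ⌊M i⌋).erase 0 else Finset.Icc (-⌊M i⌋) ⌊M i⌋ with hB
  have hsub : {v : Fin 4 → ℤ | v 0 ≠ 0 ∧ ∀ i, |(v i : ℝ)| ≤ M i} ⊆
      (Fintype.piFinset B : Set (Fin 4 → ℤ)) := by
    rintro v ⟨hv0, hv⟩
    rw [Finset.mem_coe, Fintype.mem_piFinset]
    intro i
    have hi := abs_le.1 (hv i)
    have hm : v i ∈ Finset.Icc (-⌊M i⌋) ⌊M i⌋ := by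
      rw [Finset.mem_Icc, neg_le, Int.le_floor, Int.le_floor]
      push_cast
      exact ⟨by linarith, hi.2⟩
    simp only [hB]
    split_ifs with h
    · exact Finset.mem_erase.2 ⟨by rw [h]; exact hv0, hm⟩
    · exact hm
  have hcard : ∀ M : ℝ, 0 ≤ M → ((Finset.Icc (-⌊M⌋) ⌊M⌋).card : ℝ) ≤ 2 * M + 1 := by
    intro M hM
    rw [Int.card_Icc]
    have h0 : 0 ≤ ⌊M⌋ := Int.floor_nonneg.2 hM
    have h1 : (((⌊M⌋ + 1 - -⌊M⌋).toNat : ℤ) : ℝ) = 2 * ⌊M⌋ + 1 := by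
      rw [Int.toNat_of_nonneg (by omega)]
      push_cast; ring
    have h2 := Int.floor_le M
    calc (((⌊M⌋ + 1 - -⌊M⌋).toNat : ℕ) : ℝ) = 2 * ⌊M⌋ + 1 := by exact_mod_cast h1
      _ ≤ _ := by linarith
  have hB0 : ((B 0).card : ℝ) ≤ 2 * M 0 := by
    simp only [hB, if_true]
    have h0' : 0 ≤ ⌊M 0⌋ := Int.floor_nonneg.2 h0
    have hmem : (0 : ℤ) ∈ Finset.Icc (-⌊M 0⌋) ⌊M 0⌋ := Finset.mem_Icc.2 ⟨by omega, h0'⟩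
    rw [Finset.card_erase_of_mem hmem, Nat.cast_sub (Finset.card_pos.2 ⟨_, hmem⟩)]
    have := hcard (M 0) h0
    push_cast
    linarith
  have hBi : ∀ i, i ≠ 0 → 1 ≤ M i → ((B i).card : ℝ) ≤ 3 * M i := by grind
  refine ⟨(Finset.finite_toSet _).subset hsub, ?_⟩
  have h := Set.ncard_le_ncard hsub (Finset.finite_toSet _)
  rw [Set.ncard_coe_finset, Fintype.card_piFinset, Fin.prod_univ_four] at h
  calc (({v : Fin 4 → ℤ | v 0 ≠ 0 ∧ ∀ i, |(v i : ℝ)| ≤ M i}.ncard : ℕ) : ℝ)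
      ≤ ((B 0).card * (B 1).card * (B 2).card * (B 3).card : ℕ) := by exact_mod_cast h
    _ ≤ (2 * M 0) * (3 * M 1) * (3 * M 2) * (3 * M 3) := by
      rw [Nat.cast_mul, Nat.cast_mul, Nat.cast_mul]
      have e1 := hBi 1 (by decide) h1
      have e2 := hBi 2 (by decide) h2
      have e3 := hBi 3 (by decide) h3
      have n1 : 0 ≤ 3 * M 1 := by linarith
      have n2 : 0 ≤ 3 * M 2 := by linarith
      have n0 : 0 ≤ 2 * M 0 := by linarith
      exact mul_le_mul (mul_le_mul (mul_le_mul hB0 e1 (Nat.cast_nonneg _) n0) e2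
        (Nat.cast_nonneg _) (mul_nonneg n0 n1)) e3 (Nat.cast_nonneg _)
        (mul_nonneg (mul_nonneg n0 n1) n2)
    _ = _ := by ring

/-- Integral forms of nonzero leading coefficient with root of small real part and
imaginary part in `I`. -/
def cusp (j : Bool) (I : Set ℝ) (X : ℝ) : Set (Fin 4 → ℤ) :=
  {f | f 0 ≠ 0 ∧ 0 < sg j * disc f ∧ |((disc f : ℤ) : ℝ)| ≤ X ∧
    ∃ z : ℍ, rtH j f z ∧ |z.re| ≤ 1 / 2 ∧ z.im ∈ I}

lemma toReal_eq_psi {j : Bool} {f : Fin 4 → ℤ} {z : ℍ} (hf : 0 < sg j * disc f)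
    (h : rtH j f z) : ∃ u v, toReal f = psi j u v z.re z.im ∧
      |((disc f : ℤ) : ℝ)| = discConst j * (u ^ 2 + v ^ 2) ^ 2 * z.im ^ 6 := by
  have hf' : 0 < sg j * disc (toReal f) := by rw [disc_toReal]; exact_mod_cast hf
  obtain ⟨u, v, huv⟩ := exists_psi_of_rt (j := j) (f := toReal f) z.2 hf' h
  refine ⟨u, v, huv, ?_⟩
  have h2 : toReal f = psi j u v z.re z.im := huv
  rw [← disc_toReal, h2, disc_psi, abs_mul]
  have h3 : |((sg j : ℤ) : ℝ)| = 1 := by cases j <;> simp [sg]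
  have h4 := discConst_pos j
  rw [h3, one_mul, abs_of_nonneg (by positivity)]

/-- Size bounds for a form with root `z`, `|z| ≤ R`. -/
lemma abs_le_of_root {j : Bool} {f : Fin 4 → ℤ} {z w : ℍ} (hf : 0 < sg j * disc f)
    (h : rtH j f z) (h0 : f 0 ≠ 0) {g : Fin 4 → ℤ} (hg : 0 < sg j * disc g) (hgw : rtH j g w)
    (hdisc : disc g = disc f) (him : w.im = z.im)
    {X l q : ℝ} (hX : |((disc f : ℤ) : ℝ)| ≤ X) (hl : 0 < l) (hlX : 7 * X ≤ l ^ 4) (hq : 0 < q)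
    (hz : q ^ 2 ≤ z.im) {R : ℝ} (hR : 0 ≤ R) (hw : w.re ^ 2 + w.im ^ 2 ≤ R ^ 2) :
    (1 ≤ l / q ^ 3) ∧ ∀ i : Fin 4, |(g i : ℝ)| ≤ l / q ^ 3 * R ^ (i : ℕ) := by
  have key : ∀ u v : ℝ, discConst j * (u ^ 2 + v ^ 2) ^ 2 * z.im ^ 6 ≤ X →
      u ^ 2 + v ^ 2 ≤ (l / q ^ 3) ^ 2 := by
    intro u v h
    have hc : 4 / 27 ≤ discConst j := by
      cases j <;> simp only [discConst] <;> norm_num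
    have hy : (q ^ 2) ^ 6 ≤ z.im ^ 6 := by gcongr
    have h1 : 4 / 27 * (u ^ 2 + v ^ 2) ^ 2 * (q ^ 2) ^ 6 ≤ X := le_trans (by gcongr) h
    have h2 : ((u ^ 2 + v ^ 2) * q ^ 6) ^ 2 ≤ (l ^ 2) ^ 2 := by
      nlinarith
    have h3 := abs_le_of_sq_le_sq' h2 (by positivity)
    rw [div_pow, le_div_iff₀ (by positivity)]
    calc _ = (u ^ 2 + v ^ 2) * q ^ 6 := by ring
      _ ≤ _ := h3.2
  constructor
  · obtain ⟨u, v, h1, h2⟩ := toReal_eq_psi hf h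
    have h3 := key u v (h2 ▸ hX)
    have h4 := psi_sq_le j u v z.re z.im 0
    rw [← h1] at h4
    have h5 : (1 : ℝ) ≤ (toReal f 0) ^ 2 := by
      have : 0 < (f 0) ^ 2 := by positivity
      simp only [toReal]
      exact_mod_cast this
    simp only [Fin.val_zero, pow_zero, mul_one] at h4
    have h6 : 1 ^ 2 ≤ (l / q ^ 3) ^ 2 := by linarith
    exact le_of_sq_le_sq h6 (by positivity)
  · intro i
    obtain ⟨u, v, h1, h2⟩ := toReal_eq_psi hg hgw
    rw [hdisc, him] at h2
    have h3 := key u v (h2 ▸ hX)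
    have h4 := psi_sq_le j u v w.re w.im i
    rw [← h1] at h4
    refine abs_le_of_sq_le_sq ?_ (by positivity)
    calc ((g i : ℝ)) ^ 2 ≤ (u ^ 2 + v ^ 2) * (w.re ^ 2 + w.im ^ 2) ^ (i : ℕ) := h4
      _ ≤ (l / q ^ 3) ^ 2 * (R ^ 2) ^ (i : ℕ) := by gcongr
      _ = _ := by ring

lemma rtH_translate {j : Bool} {f : Fin 4 → ℤ} {z : ℍ} (h : rtH j f z) (n : ℤ) :
    rtH j (act (ModularGroup.T ^ (-n)).1 f) (ModularGroup.T ^ n • z) := by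
  refine rtH_act ?_
  rw [smul_smul, ← zpow_add]
  simpa using h

lemma re_translate (z : ℍ) (n : ℤ) : (ModularGroup.T ^ n • z).re = z.re + n := by
  have := congrArg Complex.re (modular_T_zpow_smul z n ▸ rfl :
    ((ModularGroup.T ^ n • z : ℍ) : ℂ) = (((n : ℝ) +ᵥ z : ℍ) : ℂ))
  simpa [add_comm] using this

lemma im_translate (z : ℍ) (n : ℤ) : (ModularGroup.T ^ n • z).im = z.im := by
  rw [modular_T_zpow_smul]
  simp

lemma cusp_shell (j : Bool) {X Y : ℝ} (hX : 0 ≤ X) (hY : 1 / 2 ≤ Y) :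
    (cusp j (Set.Ico Y (2 * Y)) X).Finite ∧
      Y * ((cusp j (Set.Ico Y (2 * Y)) X).ncard : ℝ) ≤ 1548288 * X := by
  set q := Real.sqrt Y with hq
  have hq0 : 0 < q := Real.sqrt_pos.2 (by linarith)
  have hqY : q ^ 2 = Y := Real.sq_sqrt (by linarith)
  obtain hempty | ⟨f₀, hf₀⟩ := (cusp j (Set.Ico Y (2 * Y)) X).eq_empty_or_nonempty
  · rw [hempty]
    simp only [Set.finite_empty, Set.ncard_empty, Nat.cast_zero, mul_zero, true_and]
    positivity
  have hXpos : 0 < X := by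
    obtain ⟨-, h1, h2, -⟩ := hf₀
    refine lt_of_lt_of_le ?_ h2
    rw [abs_pos]
    intro h
    have : disc f₀ = 0 := by exact_mod_cast h
    rw [this, mul_zero] at h1
    exact lt_irrefl _ h1
  set l := Real.sqrt (Real.sqrt (7 * X)) with hl
  have hl0 : 0 < l := by positivity
  have hl4 : l ^ 4 = 7 * X := by
    rw [show l ^ 4 = (l ^ 2) ^ 2 by ring, hl, Real.sq_sqrt (by positivity),
      Real.sq_sqrt (by positivity)]
  set n := ⌈Y⌉₊ with hn
  have hn1 : 1 ≤ n := Nat.one_le_ceil_iff.2 (by linarith)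
  have hnY : (n : ℝ) < Y + 1 := Nat.ceil_lt_add_one (by linarith)
  have hYn : Y ≤ n := Nat.le_ceil Y
  have main : ∀ f ∈ cusp j (Set.Ico Y (2 * Y)) X, ∀ k : ℕ, k < n →
      1 ≤ l / q ^ 3 ∧ act (ModularGroup.T ^ (-(2 * k : ℤ))).1 f ∈
        {v : Fin 4 → ℤ | v 0 ≠ 0 ∧ ∀ i, |(v i : ℝ)| ≤ l / q ^ 3 * (4 * Y) ^ (i : ℕ)} := by
    rintro f ⟨h0, hsg, hd, z, hz, hre, him⟩ k hk
    have hk' : (k : ℝ) ≤ Y := by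
      have : (k : ℝ) + 1 ≤ n := by exact_mod_cast hk
      linarith
    have hre' := abs_le.1 hre
    have := abs_le_of_root hsg hz h0 (g := act (ModularGroup.T ^ (-(2 * k : ℤ))).1 f)
      (by rw [disc_act_SL]; exact hsg) (rtH_translate hz (2 * k)) (disc_act_SL _ _)
      (im_translate _ _) hd hl0 hl4.ge hq0 (hqY ▸ him.1) (R := 4 * Y) (by linarith)
      (by
        rw [re_translate, im_translate]
        push_cast
        have h1 : (z.re + 2 * k) ^ 2 ≤ (3 * Y) ^ 2 := by
          apply sq_le_sq'
          · have : (0 : ℝ) ≤ k := Nat.cast_nonneg _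
            linarith
          · linarith
        have h2 : z.im ^ 2 ≤ (2 * Y) ^ 2 := by
          have := him.2
          gcongr
        nlinarith)
    refine ⟨this.1, ?_, this.2⟩
    have h3 : act (ModularGroup.T ^ (-(2 * k : ℤ))).1 f 0 = f 0 := by
      rw [ModularGroup.coe_T_zpow]
      simp [act]
    rw [h3]
    exact h0
  have hM := (main f₀ hf₀ 0 hn1).1
  have hR : 1 ≤ 4 * Y := by linarith
  obtain ⟨hfin, hcard⟩ := finite_and_ncard_box_le
    (M := fun i : Fin 4 => l / q ^ 3 * (4 * Y) ^ (i : ℕ)) (by positivity)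
    (one_le_mul_of_one_le_of_one_le hM (one_le_pow₀ hR))
    (one_le_mul_of_one_le_of_one_le hM (one_le_pow₀ hR))
    (one_le_mul_of_one_le_of_one_le hM (one_le_pow₀ hR))
  have hfc : (cusp j (Set.Ico Y (2 * Y)) X).Finite := by
    refine hfin.subset fun f hf => ?_
    have := (main f hf 0 hn1).2
    simpa [act_one] using this
  refine ⟨hfc, ?_⟩
  have hinj := Set.ncard_le_ncard_of_injOn (s := cusp j (Set.Ico Y (2 * Y)) X ×ˢ Set.Iio n)
    (fun x => act (ModularGroup.T ^ (-(2 * x.2 : ℤ))).1 x.1)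
    (fun x hx => (main x.1 hx.1 x.2 hx.2).2) (by
      rintro ⟨f, k⟩ ⟨hf, -⟩ ⟨g, m⟩ ⟨hg, -⟩ h
      obtain ⟨h0, hsg, hd, z, hz, hre, him⟩ := hf
      obtain ⟨h0', hsg', hd', w, hw, hre', him'⟩ := hg
      simp only at h
      have e1 := rtH_translate hz (2 * k)
      have e2 := rtH_translate hw (2 * m)
      rw [← h] at e2
      have e3 := rtH_unique (by rw [disc_act_SL]; exact hsg) e1 e2
      have e4 := congrArg UpperHalfPlane.re e3
      rw [re_translate, re_translate] at e4
      push_cast at e4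
      have hkm : k = m := by
        have a1 := abs_le.1 hre
        have a2 := abs_le.1 hre'
        have b1 : (k : ℝ) < m + 1 := by linarith
        have b2 : (m : ℝ) < k + 1 := by linarith
        have c1 : k < m + 1 := by exact_mod_cast b1
        have c2 : m < k + 1 := by exact_mod_cast b2
        omega
      subst hkm
      have h5 := congrArg (act (ModularGroup.T ^ (2 * k : ℤ)).1) h
      rw [← act_mul, ← act_mul, ← Matrix.SpecialLinearGroup.coe_mul, ← zpow_add] at h5
      simp [act_one] at h5
      rw [h5]) hfin
  rw [Set.ncard_prod] at hinj
  have hIio : (Set.Iio n).ncard = n := by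
    rw [← Finset.coe_Iio, Set.ncard_coe_finset, Nat.card_Iio]
  rw [hIio] at hinj
  have hinj' : ((cusp j (Set.Ico Y (2 * Y)) X).ncard : ℝ) * n ≤
      54 * (l / q ^ 3 * (l / q ^ 3 * (4 * Y)) * (l / q ^ 3 * (4 * Y) ^ 2) *
        (l / q ^ 3 * (4 * Y) ^ 3)) := by
    refine le_trans (b := (((Set.ncard {v : Fin 4 → ℤ | v 0 ≠ 0 ∧
      ∀ i, |(v i : ℝ)| ≤ l / q ^ 3 * (4 * Y) ^ (i : ℕ)} : ℕ)) : ℝ)) (by exact_mod_cast hinj) ?_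
    simpa using hcard
  have hprod : 54 * (l / q ^ 3 * (l / q ^ 3 * (4 * Y)) * (l / q ^ 3 * (4 * Y) ^ 2) *
        (l / q ^ 3 * (4 * Y) ^ 3)) = 1548288 * X := by
    rw [← hqY]
    field_simp
    rw [hl4]
    ring
  rw [hprod] at hinj'
  calc Y * ((cusp j (Set.Ico Y (2 * Y)) X).ncard : ℝ)
      ≤ n * ((cusp j (Set.Ico Y (2 * Y)) X).ncard : ℝ) := by gcongr
    _ ≤ _ := by linarith

lemma cusp_im_le {j : Bool} {X : ℝ} {f : Fin 4 → ℤ} (h0 : f 0 ≠ 0) (hsg : 0 < sg j * disc f)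
    (hd : |((disc f : ℤ) : ℝ)| ≤ X) {z : ℍ} (hz : rtH j f z) : z.im ≤ max 1 (1 + 7 * X) := by
  set q := Real.sqrt z.im with hq
  have hq0 : 0 < q := Real.sqrt_pos.2 z.im_pos
  have hqY : q ^ 2 = z.im := Real.sq_sqrt z.im_pos.le
  have hX : 0 ≤ X := le_trans (abs_nonneg _) hd
  set l := Real.sqrt (Real.sqrt (1 + 7 * X)) with hl
  have hl0 : 0 < l := by positivity
  have hl4 : l ^ 4 = 1 + 7 * X := by
    rw [show l ^ 4 = (l ^ 2) ^ 2 by ring, hl, Real.sq_sqrt (by positivity),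
      Real.sq_sqrt (by positivity)]
  have h := (abs_le_of_root hsg hz h0 hsg hz rfl rfl hd hl0 (by linarith) hq0 hqY.le
    (R := Real.sqrt (z.re ^ 2 + z.im ^ 2)) (Real.sqrt_nonneg _)
    (Real.sq_sqrt (by positivity)).ge).1
  rw [one_le_div (by positivity)] at h
  rw [le_max_iff]
  by_contra! hcon
  have hq1 : 1 < q := by
    by_contra! hle
    have : q ^ 2 ≤ 1 := pow_le_one₀ hq0.le hle
    linarith [hcon.1]
  have h4 : (q ^ 3) ^ 4 ≤ l ^ 4 := by gcongr
  have h5 : q ^ 2 ≤ (q ^ 3) ^ 4 := by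
    rw [← pow_mul]
    exact pow_le_pow_right₀ hq1.le (by norm_num)
  linarith [hcon.2]

/-- Few forms of bounded discriminant have their root high in the cusp. -/
theorem cusp_bound (j : Bool) {X T : ℝ} (hX : 0 ≤ X) (hT : 1 / 2 ≤ T) :
    (cusp j (Set.Ici T) X).Finite ∧
      ((cusp j (Set.Ici T) X).ncard : ℝ) ≤ 3096576 * X / T := by
  obtain ⟨K, hK⟩ := pow_unbounded_of_one_lt (max 1 (1 + 7 * X) / T) (one_lt_two (α := ℝ))
  rw [div_lt_iff₀ (by linarith)] at hK
  have hT0 : 0 < T := by linarith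
  have hs : ∀ k : ℕ, 1 / 2 ≤ 2 ^ k * T := fun k =>
    le_trans hT (le_mul_of_one_le_left hT0.le (one_le_pow₀ one_le_two))
  have hsub : cusp j (Set.Ici T) X ⊆
      ⋃ k ∈ Finset.range K, cusp j (Set.Ico (2 ^ k * T) (2 * (2 ^ k * T))) X := by
    rintro f ⟨h0, hsg, hd, z, hz, hre, him⟩
    have hle := cusp_im_le h0 hsg hd hz
    obtain ⟨k, hk1, hk2⟩ := exists_nat_pow_near (x := z.im / T) (y := 2)
      ((one_le_div hT0).2 him) one_lt_two
    rw [le_div_iff₀ hT0] at hk1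
    rw [div_lt_iff₀ hT0, pow_succ] at hk2
    have hkK : k < K := by
      have : (2 : ℝ) ^ k < 2 ^ K := by
        have : (2 : ℝ) ^ k * T < 2 ^ K * T := by linarith
        exact lt_of_mul_lt_mul_right this hT0.le
      exact (pow_lt_pow_iff_right₀ one_lt_two).1 this
    simp only [Set.mem_iUnion, Finset.mem_range]
    exact ⟨k, hkK, h0, hsg, hd, z, hz, hre, hk1, by linarith⟩
  have hfin : (⋃ k ∈ Finset.range K, cusp j (Set.Ico (2 ^ k * T) (2 * (2 ^ k * T))) X).Finite :=
    (Finset.range K).finite_toSet.biUnion fun k _ => (cusp_shell j hX (hs k)).1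
  refine ⟨hfin.subset hsub, ?_⟩
  have h1 := (Set.ncard_le_ncard hsub hfin).trans (Finset.set_ncard_biUnion_le _ _)
  calc ((cusp j (Set.Ici T) X).ncard : ℝ)
      ≤ ∑ k ∈ Finset.range K,
        ((cusp j (Set.Ico (2 ^ k * T) (2 * (2 ^ k * T))) X).ncard : ℝ) := by exact_mod_cast h1
    _ ≤ ∑ k ∈ Finset.range K, (1 / 2) ^ k * (1548288 * X / T) := by
      refine Finset.sum_le_sum fun k _ => ?_
      have h2 := (cusp_shell j hX (hs k)).2
      rw [mul_comm, ← le_div_iff₀ (by positivity)] at h2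
      refine h2.trans (le_of_eq ?_)
      rw [one_div, inv_pow]
      field_simp
    _ ≤ 2 * (1548288 * X / T) := by
      rw [← Finset.sum_mul]
      gcongr
      exact sum_geometric_two_le K
    _ = _ := by ring

open MeasureTheory

/-- Two pairs of real coordinates as a pair of complex numbers. -/
def toCC (w : Fin 4 → ℝ) : ℂ × ℂ := (⟨w 0, w 1⟩, ⟨w 2, w 3⟩)

/-- `toCC` as a measurable equivalence. -/
noncomputable def toCCEquiv : (Fin 4 → ℝ) ≃ᵐ ℂ × ℂ :=
  (MeasurableEquiv.piCongrLeft (fun _ : Fin 2 ⊕ Fin 2 => ℝ)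
    (finSumFinEquiv (m := 2) (n := 2)).symm).trans
  ((MeasurableEquiv.sumPiEquivProdPi (fun _ : Fin 2 ⊕ Fin 2 => ℝ)).trans
    (MeasurableEquiv.prodCongr Complex.measurableEquivPi.symm Complex.measurableEquivPi.symm))

lemma toCCEquiv_apply (w : Fin 4 → ℝ) : toCCEquiv w = toCC w := by
  have h : ∀ s : Fin 2 ⊕ Fin 2, (MeasurableEquiv.piCongrLeft (fun _ : Fin 2 ⊕ Fin 2 => ℝ)
      (finSumFinEquiv (m := 2) (n := 2)).symm) w s = w (finSumFinEquiv s) := by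
    intro s
    have := Equiv.piCongrLeft_apply_apply (fun _ : Fin 2 ⊕ Fin 2 => ℝ)
      (finSumFinEquiv (m := 2) (n := 2)).symm w (finSumFinEquiv s)
    rwa [Equiv.symm_apply_apply] at this
  have hl : Complex.measurableEquivPi.symm (fun i : Fin 2 => w (finSumFinEquiv (n := 2) (Sum.inl i))) =
      (⟨w 0, w 1⟩ : ℂ) := by
    rw [Complex.measurableEquivPi_symm_apply]
    refine Complex.ext ?_ ?_ <;> simp <;> rfl
  have hr : Complex.measurableEquivPi.symm (fun i : Fin 2 => w (finSumFinEquiv (m := 2) (Sum.inr i))) =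
      (⟨w 2, w 3⟩ : ℂ) := by
    rw [Complex.measurableEquivPi_symm_apply]
    refine Complex.ext ?_ ?_ <;> simp <;> rfl
  refine Prod.ext ?_ ?_
  · refine Eq.trans ?_ hl
    exact congrArg Complex.measurableEquivPi.symm (funext fun i => h (Sum.inl i))
  · refine Eq.trans ?_ hr
    exact congrArg Complex.measurableEquivPi.symm (funext fun i => h (Sum.inr i))

lemma measurePreserving_toCC : MeasurePreserving toCC volume volume := by
  have h : (toCCEquiv : (Fin 4 → ℝ) → ℂ × ℂ) = toCC := funext toCCEquiv_apply
  rw [← h]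
  exact (volume_measurePreserving_piCongrLeft (fun _ : Fin 2 ⊕ Fin 2 => ℝ) _).trans
    ((volume_measurePreserving_sumPiEquivProdPi (fun _ : Fin 2 ⊕ Fin 2 => ℝ)).trans
      ((Complex.volume_preserving_equiv_pi.symm _).prod
        (Complex.volume_preserving_equiv_pi.symm _)))

lemma measurableEmbedding_toCC : MeasurableEmbedding toCC := by
  have h : (toCCEquiv : (Fin 4 → ℝ) → ℂ × ℂ) = toCC := funext toCCEquiv_apply
  rw [← h]
  exact toCCEquiv.measurableEmbedding

/-- The parametrization of real forms by their leading parameter and root. -/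
noncomputable def Psi (j : Bool) (w : Fin 4 → ℝ) : Fin 4 → ℝ := psi j (w 0) (w 1) (w 2) (w 3)

/-- The Jacobian matrix of the parametrization. -/
noncomputable def jac (j : Bool) (w : Fin 4 → ℝ) : Matrix (Fin 4) (Fin 4) ℝ :=
  let u := w 0; let v := w 1; let x := w 2; let y := w 3
  if j then
    !![1, 0, 0, 0;
      -x, y / 3, -u, v / 3;
      (x ^ 2 + y ^ 2 + 2 * x ^ 2) / 3, -(2 * x * y) / 3, (6 * u * x - 2 * v * y) / 3,
        (2 * u * y - 2 * x * v) / 3;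
      -x * (x ^ 2 + y ^ 2), y * (x ^ 2 + y ^ 2), -u * (x ^ 2 + y ^ 2) - (u * x - v * y) * (2 * x),
        v * (x ^ 2 + y ^ 2) - (u * x - v * y) * (2 * y)]
  else
    !![1, 0, 0, 0;
      -x, y, -u, v;
      x ^ 2 - y ^ 2, -(2 * x * y), 2 * u * x - 2 * v * y, -(2 * u * y) - 2 * v * x;
      -(x ^ 3 - 3 * x * y ^ 2), 3 * x ^ 2 * y - y ^ 3,
        -(u * (3 * x ^ 2 - 3 * y ^ 2) - v * (6 * x * y)),
        -(u * (-(6 * x * y)) - v * (3 * x ^ 2 - 3 * y ^ 2))]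

lemma hasStrictFDerivAt_Psi (j : Bool) (w : Fin 4 → ℝ) :
    HasStrictFDerivAt (Psi j) (Matrix.toLin' (jac j w)).toContinuousLinearMap w := by
  have U := hasStrictFDerivAt_apply (𝕜 := ℝ) (F' := fun _ : Fin 4 => ℝ) 0 w
  have V := hasStrictFDerivAt_apply (𝕜 := ℝ) (F' := fun _ : Fin 4 => ℝ) 1 w
  have A := hasStrictFDerivAt_apply (𝕜 := ℝ) (F' := fun _ : Fin 4 => ℝ) 2 w
  have B := hasStrictFDerivAt_apply (𝕜 := ℝ) (F' := fun _ : Fin 4 => ℝ) 3 w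
  have S := (U.mul A).sub (V.mul B)
  have N := (A.mul A).add (B.mul B)
  have cg : ∀ {g g' : (Fin 4 → ℝ) → ℝ} {L L' : (Fin 4 → ℝ) →L[ℝ] ℝ},
      HasStrictFDerivAt g L w → (∀ w, g w = g' w) → (∀ v, L v = L' v) →
      HasStrictFDerivAt g' L' w := by
    intro g g' L L' h h1 h2
    rw [← funext h1, ← ContinuousLinearMap.ext h2]
    exact h
  rw [hasStrictFDerivAt_pi']
  intro i
  cases j <;> fin_cases i
  · refine cg U (fun w => ?_) (fun v => ?_)
    · simp [Psi, psi]
    · simp [jac, dotProduct, Fin.sum_univ_four]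
  · refine cg (S.const_mul (-1)) (fun w => ?_) (fun v => ?_)
    · simp [Psi, psi]
    · simp [jac, dotProduct, Fin.sum_univ_four]
      ring
  · refine cg ((U.mul ((A.mul A).sub (B.mul B))).sub ((V.mul (A.mul B)).const_mul 2))
      (fun w => ?_) (fun v => ?_)
    · simp [Psi, psi]
      ring
    · simp [jac, dotProduct, Fin.sum_univ_four]
      ring
  · refine cg (((U.mul ((A.mul (A.mul A)).sub ((A.mul (B.mul B)).const_mul 3))).sub
      (V.mul (((A.mul (A.mul B)).const_mul 3).sub (B.mul (B.mul B))))).const_mul (-1))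
      (fun w => ?_) (fun v => ?_)
    · simp [Psi, psi]
      ring
    · simp [jac, dotProduct, Fin.sum_univ_four]
      ring
  · refine cg U (fun w => ?_) (fun v => ?_)
    · simp [Psi, psi]
    · simp [jac, dotProduct, Fin.sum_univ_four]
  · refine cg ((((A.mul U).const_mul (-2)).sub S).const_mul (1 / 3)) (fun w => ?_) (fun v => ?_)
    · simp [Psi, psi]
      ring
    · simp [jac, dotProduct, Fin.sum_univ_four]
      ring
  · refine cg (((U.mul N).add ((A.mul S).const_mul 2)).const_mul (1 / 3))
      (fun w => ?_) (fun v => ?_)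
    · simp [Psi, psi]
      ring
    · simp [jac, dotProduct, Fin.sum_univ_four]
      ring
  · refine cg ((S.mul N).const_mul (-1)) (fun w => ?_) (fun v => ?_)
    · simp [Psi, psi]
      ring
    · simp [jac, dotProduct, Fin.sum_univ_four]
      ring

/-- The constant in the Jacobian determinant. -/
noncomputable def jacConst (j : Bool) : ℝ := if j then 4 / 9 else 4

lemma abs_det_jac (j : Bool) (w : Fin 4 → ℝ) :
    |((Matrix.toLin' (jac j w)).toContinuousLinearMap : (Fin 4 → ℝ) →L[ℝ] Fin 4 → ℝ).det| =
      jacConst j * w 3 ^ 4 * (w 0 ^ 2 + w 1 ^ 2) := by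
  have h : ((Matrix.toLin' (jac j w)).toContinuousLinearMap :
      (Fin 4 → ℝ) →L[ℝ] Fin 4 → ℝ).det = (jac j w).det := by
    rw [ContinuousLinearMap.det, LinearMap.coe_toContinuousLinearMap, LinearMap.det_toLin']
  have h2 : (jac j w).det = jacConst j * w 3 ^ 4 * (w 0 ^ 2 + w 1 ^ 2) ∨
      (jac j w).det = -(jacConst j * w 3 ^ 4 * (w 0 ^ 2 + w 1 ^ 2)) := by
    rw [Matrix.det_succ_row_zero]
    simp only [Fin.sum_univ_four, Matrix.det_fin_three, jac, jacConst]
    cases j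
    · left
      simp [Matrix.submatrix, Fin.succAbove]
      ring1
    · right
      simp [Matrix.submatrix, Fin.succAbove]
      ring1
  have h3 : 0 ≤ jacConst j * w 3 ^ 4 * (w 0 ^ 2 + w 1 ^ 2) := by
    have : 0 < jacConst j := by cases j <;> norm_num [jacConst]
    positivity
  rw [h]
  rcases h2 with h2 | h2
  · rw [h2, abs_of_nonneg h3]
  · rw [h2, abs_neg, abs_of_nonneg h3]

/-- Interior of the truncated fundamental domain of forms, in parameters. -/
def parOpen (j : Bool) (T : ℝ) : Set (Fin 4 → ℝ) :=
  {w | |w 2| < 1 / 2 ∧ 1 < w 2 ^ 2 + w 3 ^ 2 ∧ 0 < w 3 ∧ w 3 < T ∧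
    discConst j * (w 0 ^ 2 + w 1 ^ 2) ^ 2 * w 3 ^ 6 < 1 ∧ 0 < w 0 ^ 2 + w 1 ^ 2}

/-- The truncated fundamental domain of forms, in parameters. -/
def parClosed (j : Bool) (T : ℝ) : Set (Fin 4 → ℝ) :=
  {w | |w 2| ≤ 1 / 2 ∧ 1 ≤ w 2 ^ 2 + w 3 ^ 2 ∧ 0 ≤ w 3 ∧ w 3 ≤ T ∧
    discConst j * (w 0 ^ 2 + w 1 ^ 2) ^ 2 * w 3 ^ 6 ≤ 1}

lemma isOpen_parOpen (j : Bool) (T : ℝ) : IsOpen (parOpen j T) := by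
  unfold parOpen
  refine IsOpen.and ?_ (IsOpen.and ?_ (IsOpen.and ?_ (IsOpen.and ?_ (IsOpen.and ?_ ?_)))) <;>
  exact isOpen_lt (by fun_prop) (by fun_prop)

lemma isClosed_parClosed (j : Bool) (T : ℝ) : IsClosed (parClosed j T) := by
  unfold parClosed
  refine IsClosed.and ?_ (IsClosed.and ?_ (IsClosed.and ?_ (IsClosed.and ?_ ?_))) <;>
  exact isClosed_le (by fun_prop) (by fun_prop)

lemma norm_bounds {j : Bool} {T : ℝ} {w : Fin 4 → ℝ} (hw : w ∈ parClosed j T) :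
    3 / 4 ≤ w 3 ^ 2 ∧ w 0 ^ 2 + w 1 ^ 2 ≤ 4 := by
  obtain ⟨h1, h2, h3, h4, h5⟩ := hw
  have h1' := abs_le.1 h1
  have h6 : 3 / 4 ≤ w 3 ^ 2 := by nlinarith
  refine ⟨h6, ?_⟩
  have h7 : (3 / 4 : ℝ) ^ 3 ≤ w 3 ^ 6 := by
    rw [show w 3 ^ 6 = (w 3 ^ 2) ^ 3 by ring]
    gcongr
  have hc : 4 / 27 ≤ discConst j := by
    cases j <;> simp only [discConst] <;> norm_num
  have h8 : 4 / 27 * (w 0 ^ 2 + w 1 ^ 2) ^ 2 * (3 / 4) ^ 3 ≤ 1 := le_trans (by gcongr) h5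
  nlinarith [sq_nonneg (w 0), sq_nonneg (w 1)]

lemma isCompact_parClosed (j : Bool) (T : ℝ) : IsCompact (parClosed j T) := by
  refine Metric.isCompact_of_isClosed_isBounded (isClosed_parClosed j T) ?_
  refine (Metric.isBounded_closedBall (x := 0) (r := max 2 T)).subset fun w hw => ?_
  obtain ⟨b1, b2⟩ := norm_bounds hw
  obtain ⟨h1, h2, h3, h4, h5⟩ := hw
  have h2T : 2 ≤ max 2 T := le_max_left _ _
  rw [mem_closedBall_zero_iff, pi_norm_le_iff_of_nonneg (by linarith)]
  intro i
  rw [Real.norm_eq_abs]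
  have hs : ∀ a b : ℝ, a ^ 2 + b ^ 2 ≤ 4 → |a| ≤ 2 := fun a b h =>
    abs_le_of_sq_le_sq (by nlinarith [sq_nonneg b]) (by norm_num)
  fin_cases i
  · exact (hs _ _ b2).trans h2T
  · exact (hs (w 1) (w 0) (by linarith)).trans h2T
  · exact h1.trans (by linarith)
  · exact (abs_of_nonneg h3).le.trans (h4.trans (le_max_right _ _))

lemma injOn_Psi (j : Bool) (T : ℝ) : Set.InjOn (Psi j) (parOpen j T) := by
  rintro w ⟨-, -, h3, -, -, h6⟩ w' ⟨-, -, h3', -, -, -⟩ h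
  have hz : 0 < (⟨w 2, w 3⟩ : ℂ).im := h3
  have hz' : 0 < (⟨w' 2, w' 3⟩ : ℂ).im := h3'
  have r := rt_psi j (w 0) (w 1) hz
  have r' := rt_psi j (w' 0) (w' 1) hz'
  have hd : 0 < sg j * disc (Psi j w) := by
    rw [Psi, disc_psi, ← mul_assoc]
    have := discConst_pos j
    have hs : ((sg j : ℤ) : ℝ) * (sg j : ℤ) = 1 := by cases j <;> simp [sg]
    rw [hs]
    positivity
  change psi j (w 0) (w 1) (w 2) (w 3) = psi j (w' 0) (w' 1) (w' 2) (w' 3) at h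
  simp only at r r'
  rw [← h] at r'
  have e := rt_unique hz hz' hd r r'
  obtain ⟨e2, e3⟩ := Complex.mk.inj e
  rw [← e2, ← e3] at h
  have e0 : w 0 = w' 0 := by
    have := congrFun h 0
    cases j <;> simpa [psi] using this
  have e1 : w 1 = w' 1 := by
    have := congrFun h 1
    rw [← e0] at this
    have h30 := h3.ne'
    cases j <;> simp [psi] at this
    · exact this.resolve_right h30
    · exact this.resolve_right h30
  funext i
  fin_cases i
  · exact e0
  · exact e1
  · exact e2
  · exact e3

lemma isOpen_image_Psi (j : Bool) (T : ℝ) : IsOpen (Psi j '' parOpen j T) := by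
  rw [isOpen_iff_mem_nhds]
  rintro _ ⟨w, hw, rfl⟩
  have hdet : ((Matrix.toLin' (jac j w)).toContinuousLinearMap :
      (Fin 4 → ℝ) →L[ℝ] Fin 4 → ℝ).det ≠ 0 := by
    rw [← abs_ne_zero, abs_det_jac]
    have h3 := hw.2.2.1
    have h6 := hw.2.2.2.2.2
    have : jacConst j ≠ 0 := by cases j <;> norm_num [jacConst]
    positivity
  have h := hasStrictFDerivAt_Psi j w
  rw [← ContinuousLinearMap.coe_toContinuousLinearEquivOfDetNeZero _ hdet] at h
  rw [← h.map_nhds_eq_of_equiv]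
  exact image_mem_map ((isOpen_parOpen j T).mem_nhds hw)

lemma continuous_Psi (j : Bool) : Continuous (Psi j) :=
  continuous_iff_continuousAt.2 fun w => (hasStrictFDerivAt_Psi j w).hasFDerivAt.continuousAt

lemma parOpen_subset (j : Bool) (T : ℝ) : parOpen j T ⊆ parClosed j T :=
  fun _ ⟨h1, h2, h3, h4, h5, _⟩ => ⟨h1.le, h2.le, h3.le, h4.le, h5.le⟩

lemma volume_preimage_toCC_eq_zero {N : Set (ℂ × ℂ)} (h : volume N = 0) :
    volume (toCC ⁻¹' N) = 0 := by
  rw [measurePreserving_toCC.measure_preimage_emb measurableEmbedding_toCC, h]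

lemma volume_boundary (j : Bool) (T : ℝ) : volume (parClosed j T \ parOpen j T) = 0 := by
  have hc : ∀ (i : Fin 4) (c : ℝ), volume {w : Fin 4 → ℝ | w i = c} = 0 := fun i c => by
    rw [volume_pi]
    exact Measure.pi_hyperplane (fun _ : Fin 4 => (volume : Measure ℝ)) i c
  have hsph : volume (toCC ⁻¹' (Set.univ ×ˢ Metric.sphere (0 : ℂ) 1)) = 0 := by
    apply volume_preimage_toCC_eq_zero
    rw [Measure.volume_eq_prod, Measure.prod_prod, Measure.addHaar_sphere, mul_zero]
  have hzero : volume (toCC ⁻¹' (({0} : Set ℂ) ×ˢ (Set.univ : Set ℂ))) = 0 := by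
    apply volume_preimage_toCC_eq_zero
    rw [Measure.volume_eq_prod, Measure.prod_prod, measure_singleton, zero_mul]
  have hdisc : volume (toCC ⁻¹' {q : ℂ × ℂ | discConst j * (‖q.1‖ ^ 2) ^ 2 * q.2.im ^ 6 = 1}) = 0 := by
    apply volume_preimage_toCC_eq_zero
    have hm : MeasurableSet {q : ℂ × ℂ | discConst j * (‖q.1‖ ^ 2) ^ 2 * q.2.im ^ 6 = 1} :=
      (isClosed_eq (by fun_prop) continuous_const).measurableSet
    rw [Measure.volume_eq_prod, Measure.prod_apply_symm hm]
    refine (lintegral_congr fun z => ?_).trans lintegral_zero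
    set s := Real.sqrt (Real.sqrt ((discConst j * z.im ^ 6)⁻¹))
    refine measure_mono_null (fun a ha => ?_) (Measure.addHaar_sphere volume (0 : ℂ) s)
    have ha' : discConst j * (‖a‖ ^ 2) ^ 2 * z.im ^ 6 = 1 := ha
    have e1 : (‖a‖ ^ 2) ^ 2 = (discConst j * z.im ^ 6)⁻¹ := by grind
    rw [mem_sphere_zero_iff_norm]
    simp only [s]
    rw [← e1, Real.sqrt_sq (by positivity), Real.sqrt_sq (norm_nonneg _)]
  have hn : ∀ a b : ℝ, ‖(⟨a, b⟩ : ℂ)‖ ^ 2 = a ^ 2 + b ^ 2 := fun a b => by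
    rw [Complex.sq_norm, Complex.normSq_mk]; ring
  refine measure_mono_null (t := ({w | w 2 = 1 / 2} ∪ {w | w 2 = -(1 / 2)}) ∪
    ({w | w 3 = 0} ∪ {w | w 3 = T}) ∪ (toCC ⁻¹' (Set.univ ×ˢ Metric.sphere (0 : ℂ) 1) ∪
    toCC ⁻¹' (({0} : Set ℂ) ×ˢ (Set.univ : Set ℂ))) ∪
    toCC ⁻¹' {q : ℂ × ℂ | discConst j * (‖q.1‖ ^ 2) ^ 2 * q.2.im ^ 6 = 1}) ?_ ?_
  · rintro w ⟨⟨h1, h2, h3, h4, h5⟩, hno⟩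
    by_contra hcon
    simp only [Set.mem_union, not_or, Set.mem_preimage] at hcon
    obtain ⟨⟨⟨⟨c1, c2⟩, c3, c4⟩, c5, c6⟩, c7⟩ := hcon
    refine hno ⟨lt_of_le_of_ne h1 ?_, lt_of_le_of_ne h2 ?_, lt_of_le_of_ne h3 (Ne.symm c3),
      lt_of_le_of_ne h4 c4, lt_of_le_of_ne h5 ?_, ?_⟩
    · intro h
      rcases (abs_eq (by norm_num)).1 h with h | h
      · exact c1 h
      · exact c2 h
    · intro h
      refine c5 ⟨trivial, ?_⟩
      rw [mem_sphere_zero_iff_norm]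
      have : ‖(toCC w).2‖ ^ 2 = 1 := by
        rw [toCC, hn, ← h]
      exact (pow_eq_one_iff_of_nonneg (norm_nonneg _) two_ne_zero).1 this
    · intro h
      refine c7 ?_
      change discConst j * (‖(toCC w).1‖ ^ 2) ^ 2 * (toCC w).2.im ^ 6 = 1
      rw [toCC, hn]
      exact h
    · refine lt_of_le_of_ne (by positivity) fun h => c6 ⟨?_, trivial⟩
      have h0 : w 0 = 0 := by nlinarith [sq_nonneg (w 0), sq_nonneg (w 1)]
      have h1 : w 1 = 0 := by nlinarith [sq_nonneg (w 0), sq_nonneg (w 1)]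
      change (⟨w 0, w 1⟩ : ℂ) = 0
      rw [h0, h1]
      rfl
  · simp only [measure_union_null_iff]
    exact ⟨⟨⟨⟨hc _ _, hc _ _⟩, hc _ _, hc _ _⟩, hsph, hzero⟩, hdisc⟩

/-- The open truncated domain of real forms. -/
def regOpen (j : Bool) (T : ℝ) : Set (Fin 4 → ℝ) := Psi j '' parOpen j T

/-- The closed truncated domain of real forms. -/
def regClosed (j : Bool) (T : ℝ) : Set (Fin 4 → ℝ) := Psi j '' parClosed j T

lemma regOpen_subset (j : Bool) (T : ℝ) : regOpen j T ⊆ regClosed j T :=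
  Set.image_mono (parOpen_subset j T)

lemma isCompact_regClosed (j : Bool) (T : ℝ) : IsCompact (regClosed j T) :=
  (isCompact_parClosed j T).image (continuous_Psi j)

lemma volume_reg_diff (j : Bool) (T : ℝ) : volume (regClosed j T \ regOpen j T) = 0 := by
  refine measure_mono_null (t := Psi j '' (parClosed j T \ parOpen j T)) ?_ ?_
  · rintro _ ⟨⟨w, hw, rfl⟩, h⟩
    exact ⟨w, ⟨hw, fun h' => h ⟨w, h', rfl⟩⟩, rfl⟩
  · exact addHaar_image_eq_zero_of_differentiableOn_of_addHaar_eq_zero _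
      (fun w _ => (hasStrictFDerivAt_Psi j w).hasFDerivAt.differentiableAt.differentiableWithinAt)
      (volume_boundary j T)

lemma volume_frontier_regOpen (j : Bool) (T : ℝ) : volume (frontier (regOpen j T)) = 0 := by
  refine measure_mono_null ?_ (volume_reg_diff j T)
  rw [frontier, regOpen, (isOpen_image_Psi j T).interior_eq]
  exact Set.sdiff_subset_sdiff_left
    (closure_minimal (regOpen_subset j T) (isCompact_regClosed j T).isClosed)

lemma volume_frontier_regClosed (j : Bool) (T : ℝ) : volume (frontier (regClosed j T)) = 0 := by
  refine measure_mono_null ?_ (volume_reg_diff j T)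
  rw [frontier, (isCompact_regClosed j T).isClosed.closure_eq]
  exact Set.sdiff_subset_sdiff_right
    (interior_maximal (regOpen_subset j T) (isOpen_image_Psi j T))

lemma volume_regClosed (j : Bool) (T : ℝ) : volume (regClosed j T) = volume (regOpen j T) := by
  refine le_antisymm ?_ (measure_mono (regOpen_subset j T))
  calc volume (regClosed j T) ≤ volume (regOpen j T ∪ regClosed j T \ regOpen j T) :=
        measure_mono (by rw [Set.union_sdiff_self]; exact Set.subset_union_right)
    _ ≤ volume (regOpen j T) + volume (regClosed j T \ regOpen j T) := measure_union_le _ _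
    _ = _ := by rw [volume_reg_diff, add_zero]

/-- The truncated fundamental domain. -/
def domT (T : ℝ) : Set ℂ := {z | |z.re| < 1 / 2 ∧ 1 < z.re ^ 2 + z.im ^ 2 ∧ 0 < z.im ∧ z.im < T}

lemma isOpen_domT (T : ℝ) : IsOpen (domT T) := by
  unfold domT
  refine IsOpen.and ?_ (IsOpen.and ?_ (IsOpen.and ?_ ?_)) <;>
  exact isOpen_lt (by fun_prop) (by fun_prop)

lemma integral_fiber (k : ℝ) (hk : 0 < k) :
    ∫ a : ℂ, Set.indicator {a : ℂ | k * (‖a‖ ^ 2) ^ 2 < 1 ∧ 0 < ‖a‖ ^ 2} (fun a => ‖a‖ ^ 2) a =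
      Real.pi / (2 * k) := by
  set r := Real.sqrt (Real.sqrt k⁻¹) with hr
  have hr0 : 0 ≤ r := Real.sqrt_nonneg _
  have hr4 : r ^ 4 = k⁻¹ := by
    rw [show r ^ 4 = (r ^ 2) ^ 2 by ring, hr, Real.sq_sqrt (by positivity),
      Real.sq_sqrt (by positivity)]
  have hiff : ∀ y : ℝ, 0 ≤ y → (k * (y ^ 2) ^ 2 < 1 ↔ y < r) := by
    intro y hy
    rw [← pow_lt_pow_iff_left₀ hy hr0 (by norm_num : 4 ≠ 0), hr4, ← pow_mul, ← one_div,
      lt_div_iff₀ hk, mul_comm]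
  have h1 : ∀ a : ℂ, Set.indicator {a : ℂ | k * (‖a‖ ^ 2) ^ 2 < 1 ∧ 0 < ‖a‖ ^ 2}
      (fun a => ‖a‖ ^ 2) a = Set.indicator (Set.Ioo 0 r) (fun y => y ^ 2) ‖a‖ := by
    intro a
    simp only [Set.indicator_apply]
    refine if_congr ?_ rfl rfl
    change (k * (‖a‖ ^ 2) ^ 2 < 1 ∧ 0 < ‖a‖ ^ 2) ↔ _
    rw [hiff _ (norm_nonneg a), sq_pos_iff, Set.mem_Ioo, and_comm, (norm_nonneg a).lt_iff_ne']
  rw [integral_congr_ae (Eventually.of_forall h1), integral_fun_norm_addHaar volume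
    (Set.indicator (Set.Ioo 0 r) (fun y => y ^ 2))]
  have h2 : ∀ y : ℝ, y ^ (Module.finrank ℝ ℂ - 1) •
      Set.indicator (Set.Ioo 0 r) (fun y => y ^ 2) y =
      Set.indicator (Set.Ioo 0 r) (fun y => y ^ 3) y := by
    intro y
    rw [Complex.finrank_real_complex]
    simp only [Set.indicator_apply, smul_eq_mul]
    split_ifs
    · ring
    · simp
  simp_rw [h2]
  rw [setIntegral_indicator measurableSet_Ioo, Set.inter_eq_self_of_subset_right
    Set.Ioo_subset_Ioi_self, ← integral_Ioc_eq_integral_Ioo,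
    ← intervalIntegral.integral_of_le hr0, integral_pow, Complex.finrank_real_complex,
    measureReal_def, Complex.volume_ball]
  norm_num
  rw [hr4]
  field_simp
  norm_num

lemma integral_domT {T : ℝ} (hT : 1 ≤ T) :
    ∫ z in domT T, (z.im ^ 2)⁻¹ = Real.pi / 3 - 1 / T := by
  set g : ℝ × ℝ → ℝ := fun q => (q.2 ^ 2)⁻¹ with hg
  set S : Set (ℝ × ℝ) :=
    {q | |q.1| < 1 / 2 ∧ 1 < q.1 ^ 2 + q.2 ^ 2 ∧ 0 < q.2 ∧ q.2 < T} with hS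
  have hSm : MeasurableSet S := by
    refine IsOpen.measurableSet ?_
    refine IsOpen.and ?_ (IsOpen.and ?_ (IsOpen.and ?_ ?_)) <;>
    exact isOpen_lt (by fun_prop) (by fun_prop)
  have e1 : ∫ z in domT T, (z.im ^ 2)⁻¹ = ∫ q in S, g q :=
    Complex.volume_preserving_equiv_real_prod.setIntegral_preimage_emb
      Complex.measurableEquivRealProd.measurableEmbedding g S
  have hgS : IntegrableOn g S := by
    have hfin : volume S ≠ ⊤ := by
      refine ne_top_of_le_ne_top ?_ (measure_mono (t := Set.Icc (-1) 1 ×ˢ Set.Icc 0 T) ?_)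
      · rw [Measure.volume_eq_prod, Measure.prod_prod]
        simp [Real.volume_Icc, ENNReal.mul_eq_top]
      · grind
    refine Measure.integrableOn_of_bounded (M := 2) hfin ?_ ?_
    · exact (by fun_prop : Measurable g).aestronglyMeasurable
    · refine ae_restrict_of_forall_mem hSm ?_
      rintro q ⟨h1, h2, h3, h4⟩
      have h5 := abs_lt.1 h1
      rw [Real.norm_eq_abs, hg, abs_of_nonneg (by positivity)]
      refine inv_le_of_inv_le₀ (by norm_num) ?_
      nlinarith
  rw [e1, ← integral_indicator hSm, Measure.volume_eq_prod, integral_prod _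
    ((integrable_indicator_iff hSm).2 hgS)]
  have hinner : ∀ x : ℝ, ∫ y, Set.indicator S g (x, y) =
      Set.indicator (Set.Ioo (-(1 / 2)) (1 / 2)) (fun x => 1 / Real.sqrt (1 - x ^ 2) - 1 / T) x := by
    intro x
    by_cases hx : x ∈ Set.Ioo (-(1 / 2) : ℝ) (1 / 2)
    · rw [Set.indicator_of_mem hx]
      have hx' : |x| < 1 / 2 := abs_lt.2 hx
      have hx2 : x ^ 2 < 1 / 4 := by
        have := sq_lt_sq' (by linarith [hx.1]) hx.2
        linarith
      set s := Real.sqrt (1 - x ^ 2) with hs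
      have hs0 : 0 < s := Real.sqrt_pos.2 (by linarith)
      have hs2 : s ^ 2 = 1 - x ^ 2 := Real.sq_sqrt (by linarith)
      have hsT : s ≤ T := by nlinarith [sq_nonneg x]
      have h3 : ∀ y, Set.indicator S g (x, y) = Set.indicator (Set.Ioo s T) (fun y => y ^ (-2 : ℤ)) y := by
        intro y
        simp only [Set.indicator_apply]
        refine if_congr ?_ (by simp [hg]) rfl
        change (|x| < 1 / 2 ∧ 1 < x ^ 2 + y ^ 2 ∧ 0 < y ∧ y < T) ↔ s < y ∧ y < T
        constructor
        · rintro ⟨-, b, c, d⟩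
          exact ⟨lt_of_pow_lt_pow_left₀ 2 c.le (by linarith), d⟩
        · rintro ⟨b, d⟩
          have : s ^ 2 < y ^ 2 := by gcongr
          exact ⟨hx', by linarith, hs0.trans b, d⟩
      simp_rw [h3]
      rw [integral_indicator measurableSet_Ioo, ← integral_Ioc_eq_integral_Ioo,
        ← intervalIntegral.integral_of_le hsT, integral_zpow]
      · norm_num
        ring
      · right
        refine ⟨by norm_num, ?_⟩
        rw [Set.uIcc_of_le hsT]
        exact fun h => absurd h.1 (not_le.2 hs0)
    · rw [Set.indicator_of_notMem hx]
      have h3 : ∀ y, Set.indicator S g (x, y) = 0 := by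
        intro y
        refine Set.indicator_of_notMem (fun h => hx ?_) _
        exact abs_lt.1 h.1
      simp_rw [h3]
      simp
  rw [show (fun x => ∫ y, Set.indicator S g (x, y)) = _ from funext hinner,
    integral_indicator measurableSet_Ioo, ← integral_Ioc_eq_integral_Ioo,
    ← intervalIntegral.integral_of_le (by norm_num)]
  have hpos : ∀ x ∈ Set.uIcc (-(1 / 2) : ℝ) (1 / 2), 0 < 1 - x ^ 2 := by
    intro x hx
    rw [Set.uIcc_of_le (by norm_num)] at hx
    nlinarith [hx.1, hx.2]
  rw [intervalIntegral.integral_eq_sub_of_hasDerivAt (f := fun x => Real.arcsin x - x / T)]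
  · have h1 : Real.arcsin (1 / 2) = Real.pi / 6 := by
      rw [← Real.sin_pi_div_six, Real.arcsin_sin] <;> linarith [Real.pi_pos]
    rw [Real.arcsin_neg, h1]
    ring
  · intro x hx
    have hx2 := hpos x hx
    refine (Real.hasDerivAt_arcsin ?_ ?_).sub ((hasDerivAt_id x).div_const T)
    · rintro rfl; norm_num at hx2
    · rintro rfl; norm_num at hx2
  · refine ContinuousOn.intervalIntegrable ?_
    refine ContinuousOn.sub (ContinuousOn.div continuousOn_const (by fun_prop) ?_) continuousOn_const
    exact fun x hx => (Real.sqrt_pos.2 (hpos x hx)).ne'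

/-- The volume of the truncated domain of forms. -/
theorem volume_regOpen (j : Bool) {T : ℝ} (hT : 1 ≤ T) : (volume (regOpen j T)).toReal =
    (if j then 3 else 1) * (Real.pi / 2) * (Real.pi / 3 - 1 / T) := by
  have hd := discConst_pos j
  have hn : ∀ a b : ℝ, ‖(⟨a, b⟩ : ℂ)‖ ^ 2 = a ^ 2 + b ^ 2 := fun a b => by
    rw [Complex.sq_norm, Complex.normSq_mk]; ring
  have h1 := integral_image_eq_integral_abs_det_fderiv_smul volume
    (isOpen_parOpen j T).measurableSet
    (fun w _ => (hasStrictFDerivAt_Psi j w).hasFDerivAt.hasFDerivWithinAt)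
    (injOn_Psi j T) (fun _ => (1 : ℝ))
  simp only [abs_det_jac, smul_eq_mul, mul_one] at h1
  rw [setIntegral_const, smul_eq_mul, mul_one] at h1
  change (volume (Psi j '' parOpen j T)).toReal = _
  rw [← measureReal_def, h1]
  set S : Set (ℂ × ℂ) := {q | q.2 ∈ domT T ∧
    discConst j * q.2.im ^ 6 * (‖q.1‖ ^ 2) ^ 2 < 1 ∧ 0 < ‖q.1‖ ^ 2} with hS
  set g : ℂ × ℂ → ℝ := fun q => jacConst j * q.2.im ^ 4 * ‖q.1‖ ^ 2 with hg
  have hpre : parOpen j T = toCC ⁻¹' S := by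
    ext w
    change (_ ∧ _ ∧ _ ∧ _ ∧ _ ∧ _) ↔ ((_ ∧ _ ∧ _ ∧ _) ∧
      discConst j * w 3 ^ 6 * (‖(⟨w 0, w 1⟩ : ℂ)‖ ^ 2) ^ 2 < 1 ∧ 0 < ‖(⟨w 0, w 1⟩ : ℂ)‖ ^ 2)
    rw [hn, mul_right_comm]
    simp only [toCC]
    tauto
  have hSm : MeasurableSet S := by
    refine IsOpen.measurableSet (IsOpen.and ?_ (IsOpen.and ?_ ?_))
    · exact (isOpen_domT T).preimage continuous_snd
    · exact isOpen_lt (by fun_prop) (by fun_prop)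
    · exact isOpen_lt (by fun_prop) (by fun_prop)
  have e1 : ∫ w in parOpen j T, jacConst j * w 3 ^ 4 * (w 0 ^ 2 + w 1 ^ 2) = ∫ q in S, g q := by
    rw [hpre, ← measurePreserving_toCC.setIntegral_preimage_emb measurableEmbedding_toCC]
    simp only [hg, toCC, hn]
  have hgS : IntegrableOn g S := by
    have hc : IsCompact (Metric.closedBall (0 : ℂ) 2 ×ˢ Metric.closedBall (0 : ℂ) (T + 1)) :=
      (isCompact_closedBall _ _).prod (isCompact_closedBall _ _)
    refine IntegrableOn.mono_set ((by fun_prop : Continuous g).continuousOn.integrableOn_compact hc) ?_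
    rintro ⟨a, z⟩ h
    have hw : toCC ![a.re, a.im, z.re, z.im] = (a, z) := rfl
    have hmem : (![a.re, a.im, z.re, z.im] : Fin 4 → ℝ) ∈ parOpen j T := by
      rw [hpre, Set.mem_preimage, hw]; exact h
    have hb := (norm_bounds (parOpen_subset j T hmem)).2
    simp only [Matrix.cons_val_zero, Matrix.cons_val_one] at hb
    obtain ⟨h1, h2, h3, h4⟩ := h.1
    refine ⟨?_, ?_⟩
    · rw [mem_closedBall_zero_iff]
      have : ‖a‖ ^ 2 = a.re ^ 2 + a.im ^ 2 := hn a.re a.im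
      nlinarith [norm_nonneg a]
    · rw [mem_closedBall_zero_iff]
      refine (Complex.norm_le_abs_re_add_abs_im z).trans ?_
      simp only at h1 h3 h4
      rw [abs_of_pos h3]
      linarith
  rw [e1, ← integral_indicator hSm, Measure.volume_eq_prod, integral_prod_symm _
    ((integrable_indicator_iff hSm).2 hgS)]
  have hinner : ∀ z : ℂ, ∫ a, Set.indicator S g (a, z) = Set.indicator (domT T)
      (fun z => (if j then 3 else 1) * (Real.pi / 2) * (z.im ^ 2)⁻¹) z := by
    intro z
    by_cases hz : z ∈ domT T
    · rw [Set.indicator_of_mem hz]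
      have hy : 0 < z.im := hz.2.2.1
      have h3 : ∀ a, Set.indicator S g (a, z) = jacConst j * z.im ^ 4 *
          Set.indicator {a : ℂ | discConst j * z.im ^ 6 * (‖a‖ ^ 2) ^ 2 < 1 ∧ 0 < ‖a‖ ^ 2}
            (fun a => ‖a‖ ^ 2) a := by
        intro a
        by_cases ha : discConst j * z.im ^ 6 * (‖a‖ ^ 2) ^ 2 < 1 ∧ 0 < ‖a‖ ^ 2
        · rw [Set.indicator_of_mem (show (a, z) ∈ S from ⟨hz, ha⟩), Set.indicator_of_mem (by exact ha)]
        · rw [Set.indicator_of_notMem (fun h : (a, z) ∈ S => ha h.2),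
            Set.indicator_of_notMem (by exact ha), mul_zero]
      simp_rw [h3]
      rw [integral_const_mul, integral_fiber _ (by positivity)]
      cases j <;> simp [jacConst, discConst] <;> field_simp <;> norm_num
    · rw [Set.indicator_of_notMem hz]
      have h3 : ∀ a, Set.indicator S g (a, z) = 0 := fun a =>
        Set.indicator_of_notMem (fun h => hz h.1) _
      simp_rw [h3]
      simp
  rw [show (fun z => ∫ a, Set.indicator S g (a, z)) = _ from funext hinner,
    integral_indicator (isOpen_domT T).measurableSet, integral_const_mul, integral_domT hT]

/-- Pairs of integers with nonzero product of absolute value at most `N`. -/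
noncomputable def divPairs (N : ℕ) : Finset (ℤ × ℤ) :=
  (Finset.Icc (-(N : ℤ)) N ×ˢ Finset.Icc (-(N : ℤ)) N).filter
    fun s => s.1 * s.2 ≠ 0 ∧ |s.1 * s.2| ≤ N

lemma mem_divPairs {N : ℕ} {s : ℤ × ℤ} : s ∈ divPairs N ↔ s.1 * s.2 ≠ 0 ∧ |s.1 * s.2| ≤ N := by
  unfold divPairs
  rw [Finset.mem_filter, and_iff_right_iff_imp]
  rintro ⟨h1, h2⟩
  obtain ⟨ha, hb⟩ := mul_ne_zero_iff.1 h1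
  have ha' := Int.one_le_abs ha
  have hb' := Int.one_le_abs hb
  rw [abs_mul] at h2
  rw [Finset.mem_product, Finset.mem_Icc, Finset.mem_Icc, ← abs_le, ← abs_le]
  constructor <;> nlinarith

lemma card_divPairs_le (N : ℕ) : ((divPairs N).card : ℝ) ≤ 4 * (N * (1 + Real.log N)) := by
  classical
  have h := Finset.card_le_card_of_surjOn
    (s := ((Finset.Icc 1 N).sigma fun s => Finset.Icc 1 (N / s)) ×ˢ
      (({1, -1} : Finset ℤ) ×ˢ ({1, -1} : Finset ℤ))) (t := divPairs N)
    (fun x => (x.2.1 * (x.1.1 : ℤ), x.2.2 * (x.1.2 : ℤ))) (by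
      rintro ⟨a, b⟩ hab
      rw [Finset.mem_coe, mem_divPairs] at hab
      obtain ⟨h1, h2⟩ := hab
      obtain ⟨ha, hb⟩ := mul_ne_zero_iff.1 h1
      simp only at h1 h2 ha hb
      have ha' := Int.natAbs_pos.2 ha
      have hb' := Int.natAbs_pos.2 hb
      have h3 : a.natAbs * b.natAbs ≤ N := by
        rw [Int.abs_eq_natAbs, Int.natAbs_mul] at h2
        exact_mod_cast h2
      have hs : ∀ a : ℤ, a ≠ 0 → a.sign ∈ ({1, -1} : Finset ℤ) := by grind
      refine ⟨(⟨a.natAbs, b.natAbs⟩, (a.sign, b.sign)), ?_, ?_⟩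
      · rw [Finset.mem_coe, Finset.mem_product, Finset.mem_product, Finset.mem_sigma,
          Finset.mem_Icc, Finset.mem_Icc]
        refine ⟨⟨⟨ha', ?_⟩, hb', ?_⟩, hs a ha, hs b hb⟩
        · exact (Nat.le_mul_of_pos_right _ hb').trans h3
        · exact (Nat.le_div_iff_mul_le ha').2 (by rwa [mul_comm])
      · grind)
  rw [Finset.card_product, Finset.card_product, Finset.card_sigma] at h
  have h4 : (({1, -1} : Finset ℤ)).card = 2 := by decide
  simp only [Nat.card_Icc, Nat.add_sub_cancel, h4] at h
  calc ((divPairs N).card : ℝ) ≤ ((∑ s ∈ Finset.Icc 1 N, N / s) * (2 * 2) : ℕ) := by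
        exact_mod_cast h
    _ = 4 * ∑ s ∈ Finset.Icc 1 N, ((N / s : ℕ) : ℝ) := by push_cast; ring
    _ ≤ 4 * ∑ s ∈ Finset.Icc 1 N, (N : ℝ) * (s : ℝ)⁻¹ := by
        gcongr with s
        rw [← div_eq_mul_inv]
        exact Nat.cast_div_le
    _ ≤ _ := by
        rw [← Finset.mul_sum]
        have := harmonic_le_one_add_log N
        rw [harmonic_eq_sum_Icc] at this
        push_cast at this
        gcongr

lemma exists_coprime_root {f : Fin 4 → ℤ} (hf : ¬ Irred f) :
    ∃ x y : ℤ, IsCoprime x y ∧ eval f x y = 0 := by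
  unfold Irred at hf
  push Not at hf
  obtain ⟨x, y, h0, hxy⟩ := hf
  have hg : 0 < Int.gcd x y := by
    rw [Int.gcd_pos_iff]
    by_cases hx : x = 0
    · exact Or.inr (hxy hx)
    · exact Or.inl hx
  obtain ⟨x', y', hc, hx, hy⟩ := Int.exists_gcd_one hg
  refine ⟨x', y', Int.isCoprime_iff_gcd_eq_one.2 hc, ?_⟩
  have hg' : ((Int.gcd x y : ℕ) : ℤ) ^ 3 ≠ 0 := by positivity
  refine mul_left_cancel₀ hg' ?_
  rw [mul_zero, ← h0]
  generalize ((Int.gcd x y : ℕ) : ℤ) = g at hx hy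
  rw [hx, hy]
  simp only [eval]
  ring

lemma ncard_le_card_of_injOn {α β : Type*} {A : Set α} {T : Finset β} (φ : α → β)
    (hm : ∀ a ∈ A, φ a ∈ T) (hi : Set.InjOn φ A) : A.ncard ≤ T.card := by
  rw [← Set.ncard_coe_finset]
  exact Set.ncard_le_ncard_of_injOn φ hm hi T.finite_toSet

lemma funext_four {f g : Fin 4 → ℤ} (h0 : f 0 = g 0) (h1 : f 1 = g 1) (h2 : f 2 = g 2)
    (h3 : f 3 = g 3) : f = g := by
  funext i
  fin_cases i
  exacts [h0, h1, h2, h3]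

lemma mem_Icc_of_box {N : ℕ} {f : Fin 4 → ℤ} (hb : ∀ i, |f i| ≤ N) (i : Fin 4) :
    f i ∈ Finset.Icc (-(N : ℤ)) N :=
  Finset.mem_Icc.2 (abs_le.1 (hb i))

lemma finite_box (N : ℕ) : {f : Fin 4 → ℤ | ∀ i, |f i| ≤ N}.Finite :=
  (Fintype.piFinset fun _ : Fin 4 => Finset.Icc (-(N : ℤ)) N).finite_toSet.subset
    fun _ hf => Fintype.mem_piFinset.2 (mem_Icc_of_box hf)

lemma card_Icc_neg (N : ℕ) : (Finset.Icc (-(N : ℤ)) N).card = 2 * N + 1 := by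
  rw [Int.card_Icc]; omega

lemma card_coeff_eq_zero_le (N : ℕ) (k : Fin 4) :
    {f : Fin 4 → ℤ | f k = 0 ∧ ∀ i, |f i| ≤ N}.ncard ≤ (2 * N + 1) ^ 3 := by
  rw [← card_Icc_neg, ← Fintype.card_piFinset_const]
  refine ncard_le_card_of_injOn (fun f i => f (k.succAbove i))
    (fun f hf => Fintype.mem_piFinset.2 fun i => mem_Icc_of_box hf.2 _) fun f hf g hg h => ?_
  funext i
  obtain rfl | ⟨i, rfl⟩ := Fin.eq_self_or_eq_succAbove k i
  exacts [hf.1.trans hg.1.symm, congrFun h i]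

/-- Few forms with nonzero leading coefficient in a box are reducible. -/
lemma card_reducible_le (N : ℕ) :
    (({f : Fin 4 → ℤ | f 0 ≠ 0 ∧ ¬ Irred f ∧ ∀ i, |f i| ≤ N}.ncard : ℕ) : ℝ) ≤
      (2 * N + 1) ^ 3 + (2 * N + 1) * (4 * (N * (1 + Real.log N))) ^ 2 := by
  classical
  set I := Finset.Icc (-(N : ℤ)) N
  have hIc : I.card = 2 * N + 1 := card_Icc_neg N
  set A₀ := {f : Fin 4 → ℤ | f 3 = 0 ∧ ∀ i, |f i| ≤ N}
  set A₁ := {f : Fin 4 → ℤ | f 0 ≠ 0 ∧ f 3 ≠ 0 ∧ ¬ Irred f ∧ ∀ i, |f i| ≤ N}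
  have hsub : {f : Fin 4 → ℤ | f 0 ≠ 0 ∧ ¬ Irred f ∧ ∀ i, |f i| ≤ N} ⊆ A₀ ∪ A₁ := by grind
  have hA₁ : A₁.ncard ≤ (2 * N + 1) * ((divPairs N).card * (divPairs N).card) := by
    have key : ∀ f ∈ A₁, ∃ q : ℤ × ℤ × ℤ × ℤ,
        f 0 = q.1 * q.2.1 ∧ f 3 = q.2.2.1 * q.2.2.2 ∧ eval f q.2.2.1 q.1 = 0 := by
      intro f hf
      obtain ⟨x, y, hc, he⟩ := exists_coprime_root hf.2.2.1
      have hy : y ∣ f 0 := by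
        refine (hc.symm.pow_right (n := 3)).dvd_of_dvd_mul_right
          ⟨-(3 * f 1 * x ^ 2 + 3 * f 2 * x * y + f 3 * y ^ 2), ?_⟩
        simp only [eval] at he
        linear_combination he
      have hx : x ∣ f 3 := by
        refine (hc.pow_right (n := 3)).dvd_of_dvd_mul_right
          ⟨-(f 0 * x ^ 2 + 3 * f 1 * x * y + 3 * f 2 * y ^ 2), ?_⟩
        simp only [eval] at he
        linear_combination he
      obtain ⟨s, hs⟩ := hy
      obtain ⟨r, hr⟩ := hx
      exact ⟨(y, s, x, r), hs, hr, he⟩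
    choose! q hq using key
    have := ncard_le_card_of_injOn (A := A₁) (T := I ×ˢ divPairs N ×ˢ divPairs N)
      (fun f => (f 1, ((q f).1, (q f).2.1), ((q f).2.2.1, (q f).2.2.2))) (by
        intro f hf
        obtain ⟨h1, h2, -⟩ := hq f hf
        obtain ⟨h0, h3, -, hb⟩ := hf
        simp only [Finset.mem_product, mem_divPairs, ← h1, ← h2]
        exact ⟨mem_Icc_of_box hb 1, ⟨h0, hb 0⟩, h3, hb 3⟩) (by
        intro f hf g hg h
        obtain ⟨f1, f2, f3⟩ := hq f hf
        obtain ⟨g1, g2, g3⟩ := hq g hg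
        simp only [Prod.mk.injEq] at h
        obtain ⟨e1, ⟨e2, e3⟩, e4, e5⟩ := h
        rw [← e2, ← e3] at g1
        rw [← e4, ← e5] at g2
        rw [← e4, ← e2] at g3
        have h0 : f 0 = g 0 := f1.trans g1.symm
        have h3 : f 3 = g 3 := f2.trans g2.symm
        have hy : (q f).1 ≠ 0 := fun h => hf.1 (by rw [f1, h, zero_mul])
        have hx : (q f).2.2.1 ≠ 0 := fun h => hf.2.1 (by rw [f2, h, zero_mul])
        have h2 : f 2 = g 2 := by
          have hne : 3 * (q f).2.2.1 * (q f).1 ^ 2 ≠ 0 := by positivity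
          refine mul_left_cancel₀ hne ?_
          simp only [eval, ← h0, ← h3, ← e1] at f3 g3
          linear_combination f3 - g3
        exact funext_four h0 e1 h2 h3)
    rwa [Finset.card_product, Finset.card_product, hIc] at this
  have h1 : {f : Fin 4 → ℤ | f 0 ≠ 0 ∧ ¬ Irred f ∧ ∀ i, |f i| ≤ N}.ncard ≤
      (2 * N + 1) ^ 3 + (2 * N + 1) * ((divPairs N).card * (divPairs N).card) :=
    (Set.ncard_le_ncard hsub (((finite_box N).subset fun f hf => hf.2).union
      ((finite_box N).subset fun f hf => hf.2.2.2))).trans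
      ((Set.ncard_union_le _ _).trans (add_le_add (card_coeff_eq_zero_le N 3) hA₁))
  have hD := card_divPairs_le N
  calc _ ≤ (((2 * N + 1) ^ 3 + (2 * N + 1) * ((divPairs N).card * (divPairs N).card) : ℕ) : ℝ) :=
        by exact_mod_cast h1
    _ = (2 * N + 1) ^ 3 + (2 * N + 1) * ((divPairs N).card : ℝ) ^ 2 := by push_cast; ring
    _ ≤ _ := by gcongr

/-- The prime `p` divides all coefficients of the Hessian of `f`. -/
def HessDvd (p : ℕ) (f : Fin 4 → ℤ) : Prop :=
  (p : ℤ) ∣ hessA f ∧ (p : ℤ) ∣ hessB f ∧ (p : ℤ) ∣ hessC f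

/-- The integer parts of the quotients by `p` of integers of absolute value at most `N`. -/
noncomputable def quots (N p : ℕ) : Finset ℤ := Finset.Icc (-(N : ℤ) / p) (N / p)

lemma div_mem_quots {N p : ℕ} (hp : 0 < p) {x : ℤ} (hx : |x| ≤ N) : x / p ∈ quots N p := by
  have hp' : (0 : ℤ) < p := by exact_mod_cast hp
  obtain ⟨h1, h2⟩ := abs_le.1 hx
  exact Finset.mem_Icc.2 ⟨Int.ediv_le_ediv hp' h1, Int.ediv_le_ediv hp' h2⟩

lemma card_quots_le {N p : ℕ} (hp : 0 < p) : (quots N p).card ≤ 2 * (N / p) + 2 := by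
  have hp' : (0 : ℤ) < p := by exact_mod_cast hp
  have h : -((N : ℤ) / p) - 1 ≤ -(N : ℤ) / p := by
    rw [Int.le_ediv_iff_mul_le hp']
    have := Int.lt_ediv_add_one_mul_self (N : ℤ) hp'
    linarith
  rw [quots, Int.card_Icc]
  omega

lemma eq_of_div_eq {p : ℕ} (hp : p.Prime) {a x y r : ℤ} (ha : ¬ (p : ℤ) ∣ a)
    (hx : (p : ℤ) ∣ r - a * x) (hy : (p : ℤ) ∣ r - a * y) (h : x / p = y / p) : x = y := by
  have h1 : (p : ℤ) ∣ a * (y - x) := by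
    have := dvd_sub hx hy
    rwa [show r - a * x - (r - a * y) = a * (y - x) by ring] at this
  have h2 := ((Nat.prime_iff_prime_int.1 hp).dvd_or_dvd h1).resolve_left ha
  have h3 : y ≡ x [ZMOD p] := (Int.modEq_iff_dvd.2 (by simpa using h2)).symm
  rw [← Int.mul_ediv_add_emod x p, ← Int.mul_ediv_add_emod y p, h, h3]

lemma eq_of_dvd_of_div_eq {p : ℕ} {x y : ℤ} (hx : (p : ℤ) ∣ x) (hy : (p : ℤ) ∣ y)
    (h : x / p = y / p) : x = y := by
  rw [← Int.mul_ediv_cancel' hx, ← Int.mul_ediv_cancel' hy, h]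

lemma card_hessDvd_le {N p : ℕ} (hp : p.Prime) :
    {f : Fin 4 → ℤ | HessDvd p f ∧ ∀ i, |f i| ≤ N}.ncard ≤
      2 * ((2 * N + 1) ^ 2 * (2 * (N / p) + 2) ^ 2) := by
  set I := Finset.Icc (-(N : ℤ)) N with hI
  have hp' := Nat.prime_iff_prime_int.1 hp
  have hmem : ∀ {f : Fin 4 → ℤ}, (∀ i, |f i| ≤ N) → ∀ i j k l,
      (f i, f j, f k / p, f l / p) ∈ I ×ˢ I ×ˢ quots N p ×ˢ quots N p := fun hb i j k l => by
    simp only [Finset.mem_product]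
    exact ⟨mem_Icc_of_box hb _, mem_Icc_of_box hb _, div_mem_quots hp.pos (hb _),
      div_mem_quots hp.pos (hb _)⟩
  have hcard : (I ×ˢ I ×ˢ quots N p ×ˢ quots N p).card ≤
      (2 * N + 1) ^ 2 * (2 * (N / p) + 2) ^ 2 := by
    rw [Finset.card_product, Finset.card_product, Finset.card_product, hI, card_Icc_neg, pow_two,
      pow_two, ← mul_assoc]
    exact Nat.mul_le_mul_left _ (Nat.mul_le_mul (card_quots_le hp.pos) (card_quots_le hp.pos))
  set A₀ := {f : Fin 4 → ℤ | ¬ (p : ℤ) ∣ f 0 ∧ HessDvd p f ∧ ∀ i, |f i| ≤ N}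
  set A₁ := {f : Fin 4 → ℤ | (p : ℤ) ∣ f 0 ∧ HessDvd p f ∧ ∀ i, |f i| ≤ N}
  have hsub : {f : Fin 4 → ℤ | HessDvd p f ∧ ∀ i, |f i| ≤ N} ⊆ A₀ ∪ A₁ := by grind
  have hA₀ : A₀.ncard ≤ (2 * N + 1) ^ 2 * (2 * (N / p) + 2) ^ 2 := by
    have := ncard_le_card_of_injOn (A := A₀) (T := I ×ˢ I ×ˢ quots N p ×ˢ quots N p)
      (fun f => (f 0, f 1, f 2 / p, f 3 / p)) (fun f hf => hmem hf.2.2 _ _ _ _) (by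
        rintro f ⟨hf, hf', -⟩ g ⟨hg, hg', -⟩ h
        simp only [Prod.mk.injEq] at h
        obtain ⟨h0, h1, h2, h3⟩ := h
        obtain ⟨fA, fB, -⟩ := hf'
        obtain ⟨gA, gB, -⟩ := hg'
        simp only [hessA, hessB, ← h0, ← h1] at fA fB gA gB
        have e2 : f 2 = g 2 := eq_of_div_eq hp hf fA gA h2
        rw [← e2] at gB
        have e3 : f 3 = g 3 := eq_of_div_eq hp hf fB gB h3
        exact funext_four h0 h1 e2 e3)
    exact this.trans hcard
  have hA₁ : A₁.ncard ≤ (2 * N + 1) ^ 2 * (2 * (N / p) + 2) ^ 2 := by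
    have key : ∀ f ∈ A₁, (p : ℤ) ∣ f 2 := by
      rintro f ⟨h0, ⟨hA, -, hC⟩, -⟩
      simp only [hessA, hessC] at hA hC
      have h1 : (p : ℤ) ∣ f 1 := by
        refine hp'.dvd_of_dvd_pow (n := 2) ?_
        exact (Int.dvd_iff_dvd_of_dvd_sub hA).2 (h0.mul_right _)
      refine hp'.dvd_of_dvd_pow (n := 2) ?_
      exact (Int.dvd_iff_dvd_of_dvd_sub hC).2 (h1.mul_right _)
    have := ncard_le_card_of_injOn (A := A₁) (T := I ×ˢ I ×ˢ quots N p ×ˢ quots N p)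
      (fun f => (f 1, f 3, f 0 / p, f 2 / p)) (fun f hf => hmem hf.2.2 _ _ _ _) (by
        intro f hf g hg h
        simp only [Prod.mk.injEq] at h
        obtain ⟨h1, h3, h0, h2⟩ := h
        exact funext_four (eq_of_dvd_of_div_eq hf.1 hg.1 h0) h1
          (eq_of_dvd_of_div_eq (key f hf) (key g hg) h2) h3)
    exact this.trans hcard
  refine (Set.ncard_le_ncard hsub (((finite_box N).subset fun f hf => hf.2.2).union
      ((finite_box N).subset fun f hf => hf.2.2))).trans ((Set.ncard_union_le _ _).trans ?_)
  rw [two_mul]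
  exact add_le_add hA₀ hA₁

lemma card_large_primes_le {N : ℕ} (hN : 2 ≤ N) {A : ℤ} (hA : A ≠ 0) (hA' : |A| ≤ 2 * (N : ℤ) ^ 2) :
    (A.natAbs.primeFactors.filter (N < ·)).card ≤ 2 := by
  by_contra! h
  set P := A.natAbs.primeFactors.filter (N < ·)
  have h1 : (N + 1) ^ P.card ≤ ∏ p ∈ P, p :=
    Finset.pow_card_le_prod _ _ _ fun p hp => (Finset.mem_filter.1 hp).2
  have h2 : ∏ p ∈ P, p ≤ A.natAbs := by
    refine Nat.le_of_dvd (Int.natAbs_pos.2 hA) ?_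
    exact (Finset.prod_dvd_prod_of_subset _ _ _ (Finset.filter_subset _ _)).trans
      (Nat.prod_primeFactors_dvd _)
  have h3 : (N + 1) ^ 3 ≤ (N + 1) ^ P.card := Nat.pow_le_pow_right (by omega) h
  rw [Int.abs_eq_natAbs] at hA'
  have h4 : A.natAbs ≤ 2 * N ^ 2 := by exact_mod_cast hA'
  nlinarith

lemma card_hessDvd_large_le {N : ℕ} (hN : 2 ≤ N) :
    {f : Fin 4 → ℤ | (∃ p : ℕ, p.Prime ∧ N < p ∧ HessDvd p f) ∧ f 0 ≠ 0 ∧ ∀ i, |f i| ≤ N}.ncard ≤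
      5 * (2 * N + 1) ^ 3 := by
  classical
  set I := Finset.Icc (-(N : ℤ)) N with hI
  set S := {f : Fin 4 → ℤ | (∃ p : ℕ, p.Prime ∧ N < p ∧ HessDvd p f) ∧ f 0 ≠ 0 ∧ ∀ i, |f i| ≤ N}
  set A₀ := {f | f ∈ S ∧ hessA f = 0}
  set A₁ := {f | f ∈ S ∧ hessA f ≠ 0}
  have hsub : S ⊆ A₀ ∪ A₁ := by grind
  have hcard : (I ×ˢ I ×ˢ I).card = (2 * N + 1) ^ 3 := by
    rw [Finset.card_product, Finset.card_product, hI, card_Icc_neg]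
    ring
  have hA₀ : A₀.ncard ≤ (2 * N + 1) ^ 3 := by
    have := ncard_le_card_of_injOn (A := A₀) (T := I ×ˢ I ×ˢ I) (fun f => (f 0, f 1, f 3))
      (fun f hf => by simp [I, mem_Icc_of_box hf.1.2.2, -Finset.mem_Icc]) (by
        rintro f ⟨⟨-, hf, -⟩, hf'⟩ g ⟨-, hg'⟩ h
        simp only [Prod.mk.injEq] at h
        obtain ⟨h0, h1, h3⟩ := h
        have h2 : f 2 = g 2 := by
          refine mul_left_cancel₀ hf ?_
          simp only [hessA, ← h0, ← h1] at hf' hg'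
          linear_combination hg' - hf'
        exact funext_four h0 h1 h2 h3)
    rwa [hcard] at this
  have hA₁ : A₁.ncard ≤ (2 * N + 1) ^ 3 * 4 := by
    have key : ∀ f ∈ A₁, ∃ p : ℕ, p.Prime ∧ N < p ∧ HessDvd p f := fun f hf => hf.1.1
    choose! p hp using key
    set P : ℤ × ℤ × ℤ → Finset ℕ :=
      fun v => ((v.2.1 ^ 2 - v.1 * v.2.2).natAbs.primeFactors.filter (N < ·))
    have hP : ∀ v ∈ (I ×ˢ I ×ˢ I), v.2.1 ^ 2 - v.1 * v.2.2 ≠ 0 → (P v).card ≤ 2 := by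
      intro v hv h0
      refine card_large_primes_le hN h0 ?_
      simp only [Finset.mem_product, hI, Finset.mem_Icc, ← abs_le] at hv
      obtain ⟨h1, h2, h3⟩ := hv
      calc |v.2.1 ^ 2 - v.1 * v.2.2| ≤ |v.2.1 ^ 2| + |v.1 * v.2.2| := abs_sub _ _
        _ = |v.2.1| ^ 2 + |v.1| * |v.2.2| := by rw [abs_pow, abs_mul]
        _ ≤ N ^ 2 + N * N := by gcongr
        _ = _ := by ring
    set V := (I ×ˢ I ×ˢ I).filter fun v => v.2.1 ^ 2 - v.1 * v.2.2 ≠ 0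
    have := ncard_le_card_of_injOn (A := A₁)
      (T := V.sigma fun v => P v ×ˢ ({-1, 0} : Finset ℤ))
      (fun f => ⟨(f 0, f 1, f 2), (p f, f 3 / p f)⟩) (by
        intro f hf
        obtain ⟨hpp, hpN, hpd⟩ := hp f hf
        obtain ⟨⟨-, h0, hb⟩, hA⟩ := hf
        have hq := div_mem_quots hpp.pos (hb 3)
        rw [Finset.mem_sigma, Finset.mem_filter, Finset.mem_product,
          Finset.mem_product, Finset.mem_product, Finset.mem_filter, Nat.mem_primeFactors]
        refine ⟨⟨⟨mem_Icc_of_box hb 0, mem_Icc_of_box hb 1, mem_Icc_of_box hb 2⟩, hA⟩,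
          ⟨⟨hpp, Int.natCast_dvd.1 hpd.1, Int.natAbs_ne_zero.2 hA⟩, hpN⟩, ?_⟩
        have hpN' : (N : ℤ) < p f := by exact_mod_cast hpN
        have h1 : (N : ℤ) / p f = 0 := Int.ediv_eq_zero_of_lt (by positivity) hpN'
        have h2 : -1 ≤ -(N : ℤ) / p f := by
          rw [Int.le_ediv_iff_mul_le (by omega)]
          linarith
        rw [quots, Finset.mem_Icc, h1] at hq
        simp only [Finset.mem_insert, Finset.mem_singleton]
        omega) (by
        intro f hf g hg h
        obtain ⟨fp, fN, -, fB, -⟩ := hp f hf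
        obtain ⟨gp, gN, -, gB, -⟩ := hp g hg
        simp only [Sigma.mk.injEq, Prod.mk.injEq, heq_eq_eq] at h
        obtain ⟨⟨h0, h1, h2⟩, h4, h3⟩ := h
        rw [← h4] at h3 gB
        have hnd : ¬ ((p f : ℕ) : ℤ) ∣ f 0 := by
          intro hd
          have h5 := Int.le_of_dvd (abs_pos.2 hf.1.2.1) ((dvd_abs _ _).2 hd)
          have h6 := hf.1.2.2 0
          omega
        simp only [hessB, ← h0, ← h1, ← h2] at fB gB
        have e3 : f 3 = g 3 := eq_of_div_eq fp hnd fB gB h3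
        exact funext_four h0 h1 h2 e3)
    rw [Finset.card_sigma] at this
    calc A₁.ncard ≤ ∑ v ∈ V, (P v ×ˢ ({-1, 0} : Finset ℤ)).card := this
      _ ≤ ∑ v ∈ V, 4 := by
        refine Finset.sum_le_sum fun v hv => ?_
        have h1 := hP v (Finset.mem_filter.1 hv).1 (Finset.mem_filter.1 hv).2
        have h2 : ({-1, 0} : Finset ℤ).card = 2 := by decide
        rw [Finset.card_product, h2]
        omega
      _ ≤ _ := by
        rw [Finset.sum_const, smul_eq_mul, ← hcard]
        exact Nat.mul_le_mul_right _ (Finset.card_filter_le _ _)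
  have hfin : S.Finite := (finite_box N).subset fun f hf => hf.2.2
  have := (Set.ncard_le_ncard hsub ((hfin.subset fun f hf => hf.1).union
      (hfin.subset fun f hf => hf.1))).trans (Set.ncard_union_le _ _)
  omega

/-- Few forms in a box have Hessian divisible by a large prime. -/
lemma card_hessDvd_tail_le {N Y : ℕ} (hN : 2 ≤ N) (hY : 1 ≤ Y) :
    (({f : Fin 4 → ℤ | (∃ p : ℕ, p.Prime ∧ Y ≤ p ∧ HessDvd p f) ∧ f 0 ≠ 0 ∧
      ∀ i, |f i| ≤ N}.ncard : ℕ) : ℝ) ≤ 576 * N ^ 4 / Y + 135 * N ^ 3 := by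
  classical
  set S := {f : Fin 4 → ℤ | (∃ p : ℕ, p.Prime ∧ Y ≤ p ∧ HessDvd p f) ∧ f 0 ≠ 0 ∧ ∀ i, |f i| ≤ N}
  set L := {f : Fin 4 → ℤ | (∃ p : ℕ, p.Prime ∧ N < p ∧ HessDvd p f) ∧ f 0 ≠ 0 ∧ ∀ i, |f i| ≤ N}
  set Q := (Finset.Ico Y (N + 1)).filter Nat.Prime
  set B : ℕ → Set (Fin 4 → ℤ) := fun p => {f : Fin 4 → ℤ | HessDvd p f ∧ ∀ i, |f i| ≤ N}
  have hsub : S ⊆ (⋃ p ∈ Q, B p) ∪ L := by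
    rintro f ⟨⟨p, hp, hpY, hd⟩, h0, hb⟩
    rcases lt_or_ge N p with h | h
    · exact Or.inr ⟨⟨p, hp, h, hd⟩, h0, hb⟩
    · refine Or.inl (Set.mem_biUnion (x := p) ?_ ⟨hd, hb⟩)
      exact Finset.mem_filter.2 ⟨Finset.mem_Ico.2 ⟨hpY, by omega⟩, hp⟩
  have hfinU : ((⋃ p ∈ Q, B p) ∪ L).Finite := by
    refine (finite_box N).subset (Set.union_subset ?_ fun f hf => hf.2.2)
    exact Set.iUnion₂_subset fun p _ f hf => hf.2
  have h1 : S.ncard ≤ ∑ p ∈ Q, (B p).ncard + L.ncard :=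
    (Set.ncard_le_ncard hsub hfinU).trans ((Set.ncard_union_le _ _).trans
      (Nat.add_le_add_right (Finset.set_ncard_biUnion_le _ _) _))
  have hN' : (2 : ℝ) ≤ N := by exact_mod_cast hN
  have h2 : ∀ p ∈ Q, ((B p).ncard : ℝ) ≤ 288 * N ^ 4 * (1 / (p : ℝ) ^ 2) := by
    intro p hp
    obtain ⟨hpI, hpp⟩ := Finset.mem_filter.1 hp
    have hpN : p ≤ N := by have := (Finset.mem_Ico.1 hpI).2; omega
    have hp0 : (0 : ℝ) < p := by exact_mod_cast hpp.pos
    have h3 : ((B p).ncard : ℝ) ≤ 2 * ((2 * N + 1) ^ 2 * (2 * ((N / p : ℕ) : ℝ) + 2) ^ 2) := by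
      exact_mod_cast card_hessDvd_le (N := N) hpp
    have h4 : ((N / p : ℕ) : ℝ) ≤ N / p := Nat.cast_div_le
    have h5 : (1 : ℝ) ≤ N / p := by
      rw [le_div_iff₀ hp0, one_mul]; exact_mod_cast hpN
    calc ((B p).ncard : ℝ) ≤ 2 * ((2 * N + 1) ^ 2 * (2 * ((N / p : ℕ) : ℝ) + 2) ^ 2) := h3
      _ ≤ 2 * ((3 * N) ^ 2 * (4 * (N / p)) ^ 2) := by gcongr <;> linarith
      _ = _ := by field_simp; ring
  have h3 : (L.ncard : ℝ) ≤ 135 * N ^ 3 := by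
    have h4 : (L.ncard : ℝ) ≤ 5 * (2 * N + 1) ^ 3 := by exact_mod_cast card_hessDvd_large_le hN
    calc (L.ncard : ℝ) ≤ 5 * (2 * N + 1) ^ 3 := h4
      _ ≤ 5 * (3 * N) ^ 3 := by gcongr; linarith
      _ = _ := by ring
  calc (S.ncard : ℝ) ≤ ∑ p ∈ Q, ((B p).ncard : ℝ) + L.ncard := by exact_mod_cast h1
    _ ≤ ∑ p ∈ Q, 288 * (N : ℝ) ^ 4 * (1 / (p : ℝ) ^ 2) + 135 * N ^ 3 :=
      add_le_add (Finset.sum_le_sum h2) h3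
    _ ≤ ∑ p ∈ Finset.Ico Y (N + 1), 288 * (N : ℝ) ^ 4 * (1 / (p : ℝ) ^ 2) + 135 * N ^ 3 := by
      refine add_le_add_left (Finset.sum_le_sum_of_subset_of_nonneg (Finset.filter_subset _ _) ?_) _
      intros; positivity
    _ ≤ _ := by
      rw [← Finset.mul_sum]
      refine add_le_add_left ?_ _
      calc _ ≤ 288 * (N : ℝ) ^ 4 * (2 / Y) := by
            gcongr
            exact Loc.sum_tail_le hY
        _ = _ := by ring

/-- Irreducible forms of given sign and bounded discriminant. -/
def irr (j : Bool) (X : ℝ) : Set (Fin 4 → ℤ) :=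
  {f | Irred f ∧ 0 < sg j * disc f ∧ |((disc f : ℤ) : ℝ)| ≤ X}

lemma finite_fd_irr {j : Bool} {X : ℝ} {F : Set (Fin 4 → ℤ)} (hF : F ⊆ irr j X) :
    {f ∈ F | ∃ z ∈ 𝒟, rtH j f z} ⊆ cusp j (Set.Ici (1 / 2)) X := by
  rintro f ⟨hf, z, hz, h⟩
  obtain ⟨h1, h2, h3⟩ := hF hf
  refine ⟨h1.ne_zero, h2, h3, z, h, hz.2, ?_⟩
  have h4 := ModularGroup.three_le_four_mul_im_sq_of_mem_fd hz
  have h5 := z.im_pos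
  change 1 / 2 ≤ z.im
  nlinarith

lemma good_irr (j : Bool) (X : ℝ) : Good j (irr j X) where
  irred f hf := hf.1
  sign f hf := hf.2.1
  act_mem f hf γ := ⟨hf.1.act γ, by rw [disc_act_SL]; exact hf.2.1, by
    rw [disc_act_SL]; exact hf.2.2⟩

lemma finite_orb_irr (j : Bool) {X : ℝ} (hX : 0 ≤ X) : (orb '' irr j X).Finite := by
  rw [← (good_irr j X).image_fd]
  exact ((cusp_bound j hX le_rfl).1.subset (finite_fd_irr subset_rfl)).image _

lemma orbs_irr_le (j : Bool) {X : ℝ} (hX : 0 ≤ X) : (orbs (irr j X) : ℝ) ≤ 3096576 * X := by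
  obtain ⟨h1, h2⟩ := cusp_bound j hX (le_refl (1 / 2 : ℝ))
  have hs := finite_fd_irr (j := j) (subset_refl (irr j X))
  have h3 := ((good_irr j X).two_mul_orbs_le (h1.subset hs)).trans (Set.ncard_le_ncard hs h1)
  have h4 : (2 : ℝ) * orbs (irr j X) ≤ ((cusp j (Set.Ici (1 / 2)) X).ncard : ℝ) := by
    exact_mod_cast h3
  linarith

lemma act_smul {R : Type*} [CommRing R] (g : Matrix (Fin 2) (Fin 2) R) (t : R) (f : Fin 4 → R) :
    act g (t • f) = t • act g f := by
  funext i; fin_cases i <;> simp [act] <;> ring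

/-- The form whose discriminant is divisible by `p²` attached to `w`. -/
def low (p : ℤ) (w : Fin 4 → ℤ) : Fin 4 → ℤ := ![p ^ 2 * w 0, p * w 1, w 2, w 3]

/-- The overform of `low p w`. -/
def lift (p : ℤ) (w : Fin 4 → ℤ) : Fin 4 → ℤ := ![w 0, w 1, w 2, p * w 3]

lemma disc_low (p : ℤ) (w : Fin 4 → ℤ) : disc (low p w) = p ^ 2 * disc (lift p w) := by
  simp [disc, hessA, hessB, hessC, low, lift]; ring

lemma smul_low (p : ℤ) (w : Fin 4 → ℤ) : p • low p w = act !![p, 0; 0, 1] (lift p w) := by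
  funext i; fin_cases i <;> simp [act, low, lift] <;> ring

lemma eval_low (p : ℤ) (w : Fin 4 → ℤ) (x y : ℤ) :
    eval (low p w) x (p * y) = p ^ 2 * eval (lift p w) x y := by
  simp [eval, low, lift]; ring

lemma Irred.lift {p : ℤ} (hp : p ≠ 0) {w : Fin 4 → ℤ} (h : Irred (low p w)) :
    Irred (lift p w) := by
  intro x y hxy
  obtain ⟨h1, h2⟩ := h x (p * y) (by rw [eval_low, hxy, mul_zero])
  exact ⟨h1, (mul_eq_zero.1 h2).resolve_left hp⟩

lemma orb_low_eq {p : ℤ} (hp : p ≠ 0) {w w' g : Fin 4 → ℤ} {h h' : SL(2, ℤ)}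
    (hw : lift p w = act h.1 g) (hw' : lift p w' = act h'.1 g)
    (hd : p ∣ h 1 1 * h' 0 1 - h 0 1 * h' 1 1) : orb (low p w) = orb (low p w') := by
  obtain ⟨t, ht⟩ := hd
  have hk : lift p w' = act (h⁻¹ * h').1 (lift p w) := by
    rw [hw, hw', ← act_mul, ← Matrix.SpecialLinearGroup.coe_mul, mul_inv_cancel_left]
  set k := h⁻¹ * h'
  have hk01 : k 0 1 = p * t := by
    rw [← ht]
    simp [k, Matrix.mul_apply, Fin.sum_univ_two, Matrix.SpecialLinearGroup.coe_mul,
      Matrix.SpecialLinearGroup.coe_inv, Matrix.adjugate_fin_two]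
    ring
  have hdet := det_eq k
  refine orb_eq_iff.2 ⟨⟨!![k 0 0, t; p * k 1 0, k 1 1], ?_⟩, ?_⟩
  · rw [Matrix.det_fin_two_of]
    linear_combination hdet + k 1 0 * hk01
  · have h1 : p • low p w' = p • act !![k 0 0, t; p * k 1 0, k 1 1] (low p w) := by
      rw [← act_smul, smul_low, smul_low, hk, ← act_mul, ← act_mul]
      congr 1
      ext i l
      fin_cases i <;> fin_cases l <;> simp [Matrix.mul_apply, Fin.sum_univ_two]
      · ring
      · exact hk01
      · ring
    exact smul_right_injective _ hp h1

lemma exists_low {p : ℕ} (hp : p.Prime) (hp2 : p ≠ 2) {f : Fin 4 → ℤ}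
    (hf : ((p : ℤ)) ^ 2 ∣ disc f) (hH : ¬ HessDvd p f) :
    ∃ w : Fin 4 → ℤ, (¬ (p : ℤ) ∣ w 2) ∧ ∃ γ : SL(2, ℤ), low p w = act γ.1 f := by
  have hp' := Nat.prime_iff_prime_int.1 hp
  have hp2' : ¬ (p : ℤ) ∣ 2 := by
    intro h
    have := (Nat.prime_dvd_prime_iff_eq hp Nat.prime_two).1 (by exact_mod_cast h)
    exact hp2 this
  have hp4 : ¬ (p : ℤ) ∣ 4 := fun h => hp2' (hp'.dvd_of_dvd_pow (n := 2) (by simpa using h))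
  have hfp : (p : ℤ) ∣ disc f := (dvd_pow_self _ two_ne_zero).trans hf
  have hγ : ∃ γ : SL(2, ℤ), (p : ℤ) ∣ hessA (act γ.1 f) := by
    by_cases hA : (p : ℤ) ∣ hessA f
    · exact ⟨1, by simpa [act_one] using hA⟩
    · have hco : IsCoprime (p : ℤ) (2 * hessA f) :=
        (hp'.coprime_iff_not_dvd).2 fun h => (hp'.dvd_or_dvd h).elim hp2' hA
      obtain ⟨u, v, huv⟩ := hco
      refine ⟨⟨!![-v * hessB f, -1; 1, 0], by simp⟩, ?_⟩
      have h4 : (p : ℤ) ∣ 4 * hessA f * hessA (act !![-v * hessB f, -1; 1, 0] f) := by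
        have : 4 * hessA f * hessA (act !![-v * hessB f, -1; 1, 0] f) =
            p * (u ^ 2 * p * hessB f ^ 2) - disc f := by
          rw [hessA_act]
          simp only [Matrix.of_apply, Matrix.cons_val', Matrix.cons_val_zero, Matrix.cons_val_one,
            Matrix.cons_val_fin_one, disc]
          have h5 : 2 * hessA f * (-v * hessB f) + hessB f = u * p * hessB f := by
            linear_combination -hessB f * huv
          linear_combination (2 * hessA f * (-v * hessB f) + hessB f + u * p * hessB f) * h5
        rw [this]
        exact dvd_sub (Dvd.intro _ rfl) hfp
      rcases hp'.dvd_or_dvd h4 with h | h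
      · exact absurd ((hp'.dvd_or_dvd h).resolve_left hp4) hA
      · exact h
  obtain ⟨γ, hA⟩ := hγ
  have hH' : ¬ HessDvd p (act γ.1 f) := by
    rintro ⟨h1, h2, h3⟩
    have hf : f = act (γ⁻¹).1 (act γ.1 f) := by
      rw [← act_mul, ← Matrix.SpecialLinearGroup.coe_mul, mul_inv_cancel,
        Matrix.SpecialLinearGroup.coe_one, act_one]
    refine hH ⟨?_, ?_, ?_⟩
    · rw [hf, hessA_act]
      exact ((((h1.mul_right _).add ((h2.mul_right _).mul_right _)).add (h3.mul_right _))).mul_left _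
    · rw [hf, hessB_act]
      exact ((((((h1.mul_left _).mul_right _).mul_right _)).add (h2.mul_right _)).add
        (((h3.mul_left _).mul_right _).mul_right _)).mul_left _
    · rw [hf, hessC_act]
      exact ((((h1.mul_right _).add ((h2.mul_right _).mul_right _)).add (h3.mul_right _))).mul_left _
  rw [← disc_act_SL γ] at hf hfp
  generalize hg : act γ.1 f = g at *
  have hB : (p : ℤ) ∣ hessB g := by
    refine hp'.dvd_of_dvd_pow (n := 2) ?_
    have : hessB g ^ 2 = disc g + hessA g * (4 * hessC g) := by simp only [disc]; ring
    rw [this]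
    exact dvd_add hfp (hA.mul_right _)
  have hC : ¬ (p : ℤ) ∣ hessC g := fun h => hH' ⟨hA, hB, h⟩
  have hcop : ∀ {c : ℤ}, ¬ (p : ℤ) ∣ c → IsCoprime ((p : ℤ) ^ 2) c := fun h =>
    ((hp'.coprime_iff_not_dvd).2 h).pow_left
  have hA2 : ((p : ℤ)) ^ 2 ∣ hessA g := by
    refine (hcop (c := 4 * hessC g) fun h => (hp'.dvd_or_dvd h).elim hp4 hC).dvd_of_dvd_mul_right ?_
    have : hessA g * (4 * hessC g) = hessB g ^ 2 - disc g := by simp only [disc]; ring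
    rw [this]
    exact dvd_sub (pow_dvd_pow_of_dvd hB 2) hf
  have h0 : (p : ℤ) ∣ g 0 := by
    refine (hp'.dvd_or_dvd (a := g 0) (b := hessC g) ?_).resolve_right hC
    have : g 0 * hessC g = hessB g * g 1 - hessA g * g 2 := by
      simp only [hessA, hessB, hessC]; ring
    rw [this]
    exact dvd_sub (hB.mul_right _) (hA.mul_right _)
  have h1 : (p : ℤ) ∣ g 1 := by
    refine hp'.dvd_of_dvd_pow (n := 2) ?_
    have : g 1 ^ 2 = hessA g + g 0 * g 2 := by simp only [hessA]; ring
    rw [this]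
    exact dvd_add hA (h0.mul_right _)
  have h2 : ¬ (p : ℤ) ∣ g 2 := by
    intro h
    exact hC (dvd_sub (dvd_pow h two_ne_zero) (h1.mul_right _))
  have h00 : ((p : ℤ)) ^ 2 ∣ g 0 := by
    refine (hcop h2).dvd_of_dvd_mul_right ?_
    have : g 0 * g 2 = g 1 ^ 2 - hessA g := by simp only [hessA]; ring
    rw [this]
    exact dvd_sub (pow_dvd_pow_of_dvd h1 2) hA2
  obtain ⟨a, ha⟩ := h00
  obtain ⟨b, hb⟩ := h1
  refine ⟨![a, b, g 2, g 3], by simpa using h2, γ, ?_⟩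
  rw [hg]
  funext i
  fin_cases i <;> simp [low, ha, hb]

open Polynomial in
lemma card_zero_le {p : ℕ} [Fact p.Prime] (hp3 : p ≠ 3) {g : Fin 4 → ℤ} (h3 : (p : ℤ) ∣ g 3)
    (h2 : ¬ (p : ℤ) ∣ g 2) :
    ∃ s : Finset (ZMod p), s.card ≤ 3 ∧
      ∀ t : ZMod p, eval (fun i => (g i : ZMod p)) t 1 = 0 → t ∈ s := by
  set P : (ZMod p)[X] := C (g 0 : ZMod p) * X ^ 3 + C (3 * g 1 : ZMod p) * X ^ 2 +
    C (3 * g 2 : ZMod p) * X + C 0 with hP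
  have hc : P.coeff 1 ≠ 0 := by
    have h4 : P.coeff 1 = 3 * (g 2 : ZMod p) := by
      rw [hP, coeff_add, coeff_add, coeff_add, coeff_C_mul_X_pow, coeff_C_mul_X_pow,
        coeff_C_mul_X, coeff_C]
      norm_num
    rw [h4]
    refine mul_ne_zero ?_ fun h => h2 ((ZMod.intCast_zmod_eq_zero_iff_dvd _ _).1 h)
    intro h
    have h5 : ((3 : ℕ) : ZMod p) = 0 := by exact_mod_cast h
    rw [ZMod.natCast_eq_zero_iff] at h5
    exact hp3 ((Nat.prime_dvd_prime_iff_eq Fact.out Nat.prime_three).1 h5)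
  have hP0 : P ≠ 0 := fun h => hc (by simp [h])
  refine ⟨P.roots.toFinset, ?_, fun t ht => ?_⟩
  · exact (Multiset.toFinset_card_le _).trans ((card_roots' P).trans natDegree_cubic_le)
  · rw [Multiset.mem_toFinset, mem_roots hP0, IsRoot.def, ← ht]
    have h5 : (g 3 : ZMod p) = 0 := (ZMod.intCast_zmod_eq_zero_iff_dvd _ _).2 h3
    simp [hP, CubicForm.eval, h5]

/-- Forms with non-maximal discriminant at `p` come from forms of smaller discriminant. -/
lemma orbs_sq_dvd_le (j : Bool) {X : ℝ} (hX : 0 ≤ X) {p : ℕ} (hp : p.Prime) (hp5 : 3 < p) :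
    (orbs {f ∈ irr j X | ((p : ℤ)) ^ 2 ∣ disc f ∧ ¬ HessDvd p f} : ℝ) ≤
      12386304 * X * (1 / (p : ℝ) ^ 2) := by
  classical
  have : Fact p.Prime := ⟨hp⟩
  set F := {f ∈ irr j X | ((p : ℤ)) ^ 2 ∣ disc f ∧ ¬ HessDvd p f}
  have hp0 : (p : ℤ) ≠ 0 := by exact_mod_cast hp.ne_zero
  have key : ∀ q ∈ orb '' F, ∃ w : Fin 4 → ℤ,
      (¬ (p : ℤ) ∣ w 2) ∧ orb (low p w) = q ∧ lift p w ∈ irr j (X / p ^ 2) := by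
    rintro _ ⟨f, ⟨hf, hf2, hfH⟩, rfl⟩
    obtain ⟨w, hw, γ, hγ⟩ := exists_low hp (by omega) hf2 hfH
    have hl := (good_irr j X).act_mem f hf γ
    rw [← hγ] at hl
    refine ⟨w, hw, by rw [hγ, orb_act], hl.1.lift hp0, ?_, ?_⟩
    · have := hl.2.1
      rw [disc_low, mul_left_comm] at this
      exact pos_of_mul_pos_right this (by positivity)
    · have := hl.2.2
      rw [disc_low] at this
      push_cast at this
      rw [abs_mul, abs_of_pos (by positivity)] at this
      rwa [le_div_iff₀ (by positivity), mul_comm]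
  choose! w hw using key
  have hfin : (orb '' F).Finite := (finite_orb_irr j hX).subset (Set.image_mono fun f hf => hf.1)
  have hX' : 0 ≤ X / (p : ℝ) ^ 2 := by positivity
  have hcard : hfin.toFinset.card ≤ 4 * (hfin.toFinset.image fun q => orb (lift p (w q))).card := by
    refine Finset.card_le_mul_card_image _ _ fun b hb => ?_
    obtain ⟨q₀, hq₀, rfl⟩ := Finset.mem_image.1 hb
    obtain ⟨h2, -, -⟩ := hw q₀ (hfin.mem_toFinset.1 hq₀)
    set g := lift p (w q₀) with hg
    obtain ⟨s, hs, hs'⟩ := card_zero_le (p := p) (by omega) (g := g) (by simp [hg, lift])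
      (by simpa [hg, lift] using h2)
    have hh : ∀ q : Quotient orbSetoid, orb (lift p (w q)) = orb g → ∃ h : SL(2, ℤ),
        lift p (w q) = act h.1 g := fun q hq => orb_eq_iff.1 hq.symm
    choose! h hh using hh
    have hle : (Finset.insertNone s).card ≤ 4 := by
      rw [Finset.card_insertNone]; omega
    refine le_trans (Finset.card_le_card_of_injOn (t := Finset.insertNone s)
      (fun q => if ((h q 1 1 : ℤ) : ZMod p) = 0 then none
        else some (((h q 0 1 : ℤ) : ZMod p) / ((h q 1 1 : ℤ) : ZMod p))) ?_ ?_) hle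
    · intro q hq
      obtain ⟨-, hq'⟩ := Finset.mem_filter.1 hq
      have h3 := congrFun (hh q hq') 3
      simp only [Finset.mem_coe]
      split_ifs with h0
      · simp
      · rw [Finset.some_mem_insertNone]
        refine hs' _ ?_
        have h4 : eval (fun i => (g i : ZMod p)) ((h q 0 1 : ℤ) : ZMod p) ((h q 1 1 : ℤ) : ZMod p)
            = 0 := by
          have h5 := congrArg (Int.cast : ℤ → ZMod p) h3
          simp only [act, lift] at h5
          simp at h5
          simp only [eval]
          rw [h5]
        have h6 : eval (fun i => (g i : ZMod p)) ((h q 0 1 : ℤ) : ZMod p)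
            ((h q 1 1 : ℤ) : ZMod p) = ((h q 1 1 : ℤ) : ZMod p) ^ 3 *
            eval (fun i => (g i : ZMod p))
              (((h q 0 1 : ℤ) : ZMod p) / ((h q 1 1 : ℤ) : ZMod p)) 1 := by
          simp only [eval]
          field_simp
        rw [h4] at h6
        exact (mul_eq_zero.1 h6.symm).resolve_left (pow_ne_zero _ h0)
    · intro q hq q' hq' heq
      obtain ⟨hqF, hq⟩ := Finset.mem_filter.1 hq
      obtain ⟨hqF', hq'⟩ := Finset.mem_filter.1 hq'
      rw [← (hw q (hfin.mem_toFinset.1 hqF)).2.1, ← (hw q' (hfin.mem_toFinset.1 hqF')).2.1]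
      refine orb_low_eq hp0 (hh q hq) (hh q' hq') ?_
      rw [← ZMod.intCast_zmod_eq_zero_iff_dvd]
      push_cast
      simp only at heq
      split_ifs at heq with h1 h2 h2
      · rw [h1, h2]; ring
      · grind
  have hsub : ((hfin.toFinset.image fun q => orb (lift p (w q)) : Finset _) :
      Set (Quotient orbSetoid)) ⊆ orb '' irr j (X / p ^ 2) := by
    intro b hb
    obtain ⟨q, hq, rfl⟩ := Finset.mem_image.1 hb
    exact ⟨_, (hw q (hfin.mem_toFinset.1 hq)).2.2, rfl⟩
  have h1 := Set.ncard_le_ncard hsub (finite_orb_irr j hX')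
  rw [Set.ncard_coe_finset] at h1
  have h2 : orbs F ≤ 4 * orbs (irr j (X / p ^ 2)) := by
    rw [orbs, Set.ncard_eq_toFinset_card _ hfin]
    exact hcard.trans (Nat.mul_le_mul_left _ h1)
  calc (orbs F : ℝ) ≤ 4 * orbs (irr j (X / p ^ 2)) := by exact_mod_cast h2
    _ ≤ 4 * (3096576 * (X / p ^ 2)) := by gcongr; exact orbs_irr_le j hX'
    _ = _ := by ring

lemma mem_regClosed {j : Bool} {f : Fin 4 → ℤ} {t T : ℝ} (ht : 0 < t) (hf : 0 < sg j * disc f)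
    (hX : |((disc f : ℤ) : ℝ)| ≤ t ^ 4) {z : ℍ} (hz : z ∈ 𝒟) (h : rtH j f z) (hT : z.im ≤ T) :
    (fun i => (f i : ℝ) / t) ∈ regClosed j T := by
  obtain ⟨u, v, h1, h2⟩ := toReal_eq_psi hf h
  refine ⟨![u / t, v / t, z.re, z.im], ⟨?_, ?_, ?_, ?_, ?_⟩, ?_⟩
  · simpa using hz.2
  · have := hz.1
    rw [Complex.normSq_apply] at this
    simp only [Matrix.cons_val]
    change 1 ≤ z.re * z.re + z.im * z.im at this
    nlinarith
  · simpa using z.im_pos.le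
  · simpa using hT
  · simp only [Matrix.cons_val]
    have h3 : discConst j * ((u / t) ^ 2 + (v / t) ^ 2) ^ 2 * z.im ^ 6 =
        |((disc f : ℤ) : ℝ)| / t ^ 4 := by
      rw [h2]; field_simp
    rw [h3]
    exact (div_le_one (by positivity)).2 hX
  · have h3 : toReal f = t • psi j (u / t) (v / t) z.re z.im := by
      rw [← psi_smul, h1]
      congr 1 <;> field_simp
    funext i
    have h4 := congrFun h3 i
    simp only [toReal, Pi.smul_apply, smul_eq_mul] at h4
    simp only [Psi, Matrix.cons_val]
    rw [h4]
    field_simp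

lemma of_mem_regOpen {j : Bool} {f : Fin 4 → ℤ} {t T : ℝ} (ht : 0 < t) (hT : 1 ≤ T)
    (h : (fun i => (f i : ℝ) / t) ∈ regOpen j T) :
    0 < sg j * disc f ∧ |((disc f : ℤ) : ℝ)| < t ^ 4 ∧ (∃ z ∈ 𝒟ᵒ, rtH j f z) ∧
      ∀ i, |((f i : ℤ) : ℝ)| ≤ 6 * T ^ 3 * t := by
  obtain ⟨w, hw, hwf⟩ := h
  have hbd := (norm_bounds (parOpen_subset j T hw)).2
  obtain ⟨h1, h2, h3, h4, h5, h6⟩ := hw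
  have hf : toReal f = psi j (t * w 0) (t * w 1) (w 2) (w 3) := by
    rw [psi_smul]
    funext i
    have := congrFun hwf i
    simp only [Psi] at this
    simp only [toReal, Pi.smul_apply, smul_eq_mul, this]
    field_simp
  have hd : ((disc f : ℤ) : ℝ) = sg j * (t ^ 4 *
      (discConst j * (w 0 ^ 2 + w 1 ^ 2) ^ 2 * w 3 ^ 6)) := by
    rw [← disc_toReal, hf, disc_psi]; ring
  have hpos : 0 < t ^ 4 * (discConst j * (w 0 ^ 2 + w 1 ^ 2) ^ 2 * w 3 ^ 6) := by
    have := discConst_pos j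
    positivity
  have hs : ((sg j : ℤ) : ℝ) * (sg j : ℤ) = 1 := by exact_mod_cast sg_sq j
  refine ⟨?_, ?_, ?_, fun i => ?_⟩
  · have : (0 : ℝ) < ((sg j * disc f : ℤ) : ℝ) := by
      rw [Int.cast_mul, hd, ← mul_assoc, hs, one_mul]
      exact hpos
    exact_mod_cast this
  · have h7 : |((sg j : ℤ) : ℝ)| = 1 := by
      rcases sg_eq j with h | h <;> rw [h] <;> norm_num
    rw [hd, abs_mul, h7, one_mul, abs_of_pos hpos]
    exact mul_lt_of_lt_one_right (by positivity) h5
  · refine ⟨⟨⟨w 2, w 3⟩, h3⟩, ⟨?_, h1⟩, ?_⟩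
    · rw [Complex.normSq_apply]
      change 1 < w 2 * w 2 + w 3 * w 3
      nlinarith
    · have := rt_psi j (t * w 0) (t * w 1) (z := ⟨w 2, w 3⟩) h3
      rw [rtH, hf]
      exact this
  · have h7 := psi_sq_le j (t * w 0) (t * w 1) (w 2) (w 3) i
    rw [← hf] at h7
    have h8 := abs_lt.1 h1
    have h9 : w 2 ^ 2 + w 3 ^ 2 ≤ 2 * T ^ 2 := by nlinarith
    have h10 : (w 2 ^ 2 + w 3 ^ 2) ^ (i : ℕ) ≤ (2 * T ^ 2) ^ 3 :=
      (pow_le_pow_left₀ (by positivity) h9 _).trans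
        (pow_le_pow_right₀ (by nlinarith) (by omega))
    refine abs_le_of_sq_le_sq ?_ (by positivity)
    calc ((f i : ℤ) : ℝ) ^ 2 = toReal f i ^ 2 := rfl
      _ ≤ _ := h7
      _ ≤ (t ^ 2 * 4) * (2 * T ^ 2) ^ 3 := by
        refine mul_le_mul ?_ h10 (by positivity) (by positivity)
        nlinarith [sq_nonneg t]
      _ ≤ _ := by
        nlinarith

variable (S S₁ U : Finset ℕ)

/-- Irreducible forms of bounded discriminant with all local conditions. -/
def fam (j : Bool) (X : ℝ) : Set (Fin 4 → ℤ) :=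
  {f | (Irred f ∧ 0 < sg j * disc f ∧ |((disc f : ℤ) : ℝ)| < X) ∧
    ∀ p : ℕ, p.Prime → f ∈ Loc.LocF S S₁ U p}

variable {S S₁ U}

lemma fam_subset {j : Bool} {X : ℝ} : fam S S₁ U j X ⊆ irr j X := fun _ hf =>
  ⟨hf.1.1, hf.1.2.1, hf.1.2.2.le⟩

lemma hessDvd_act {d : ℤ} {f : Fin 4 → ℤ} (h : d ∣ hessA f ∧ d ∣ hessB f ∧ d ∣ hessC f)
    (g : Matrix (Fin 2) (Fin 2) ℤ) :
    d ∣ hessA (act g f) ∧ d ∣ hessB (act g f) ∧ d ∣ hessC (act g f) := by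
  obtain ⟨h1, h2, h3⟩ := h
  refine ⟨?_, ?_, ?_⟩
  · rw [hessA_act]
    exact ((((h1.mul_right _).add ((h2.mul_right _).mul_right _)).add (h3.mul_right _))).mul_left _
  · rw [hessB_act]
    exact ((((((h1.mul_left _).mul_right _).mul_right _)).add (h2.mul_right _)).add
      (((h3.mul_left _).mul_right _).mul_right _)).mul_left _
  · rw [hessC_act]
    exact ((((h1.mul_right _).add ((h2.mul_right _).mul_right _)).add (h3.mul_right _))).mul_left _

lemma locF_act {p : ℕ} {f : Fin 4 → ℤ} (hf : f ∈ Loc.LocF S S₁ U p) (γ : SL(2, ℤ)) :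
    act γ.1 f ∈ Loc.LocF S S₁ U p := by
  unfold Loc.LocF at hf ⊢
  split_ifs at hf ⊢
  · obtain ⟨h1, h2, h3, h4⟩ := hf
    obtain ⟨h1', h2', h3'⟩ := hessDvd_act ⟨h1, h2, h3⟩ γ.1
    exact ⟨h1', h2', h3', by rwa [disc_act_SL]⟩
  · change Loc.LocD S S₁ p (disc (act γ.1 f))
    rw [disc_act_SL]
    exact hf

lemma good_fam (j : Bool) (X : ℝ) : Good j (fam S S₁ U j X) where
  irred f hf := hf.1.1
  sign f hf := hf.1.2.1
  act_mem f hf γ := ⟨⟨hf.1.1.act γ, by rw [disc_act_SL]; exact hf.1.2.1, by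
    rw [disc_act_SL]; exact hf.1.2.2⟩, fun p hp => locF_act (hf.2 p hp) γ⟩

variable (S S₁ U)

/-- Integral points of a dilated region satisfying the local conditions at small primes. -/
def locPts (Y : ℕ) (R : Set (Fin 4 → ℝ)) (t : ℝ) : Set (Fin 4 → ℤ) :=
  {f | (∀ p ∈ Y.primesBelow, f ∈ Loc.LocF S S₁ U p) ∧ (fun i => (f i : ℝ) / t) ∈ R}

variable {S S₁ U}

lemma finite_locPts {Y : ℕ} {R : Set (Fin 4 → ℝ)} (hR : Bornology.IsBounded R) {t : ℝ}
    (ht : 0 < t) : (locPts S S₁ U Y R t).Finite :=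
  (LatticeCount.finite_lattice_of_isBounded hR ht).subset fun _ hf => hf.2

lemma upper_bound (j : Bool) {t T : ℝ} (ht : 0 < t) (hT : 1 / 2 ≤ T) (Y : ℕ) :
    (2 * orbs (fam S S₁ U j (t ^ 4)) : ℝ) ≤
      (locPts S S₁ U Y (regClosed j T) t).ncard + 3096576 * t ^ 4 / T := by
  have hX : 0 ≤ t ^ 4 := by positivity
  obtain ⟨c1, c2⟩ := cusp_bound j hX hT
  have hfl := finite_locPts (S := S) (S₁ := S₁) (U := U) (Y := Y)
    (isCompact_regClosed j T).isBounded ht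
  have hsub : {f ∈ fam S S₁ U j (t ^ 4) | ∃ z ∈ 𝒟, rtH j f z} ⊆
      locPts S S₁ U Y (regClosed j T) t ∪ cusp j (Set.Ici T) (t ^ 4) := by
    rintro f ⟨hf, z, hz, h⟩
    obtain ⟨h1, h2, h3⟩ := fam_subset hf
    rcases le_total z.im T with hzT | hzT
    · exact Or.inl ⟨fun p hp => hf.2 p (Nat.mem_primesBelow.1 hp).2,
        mem_regClosed ht h2 h3 hz h hzT⟩
    · exact Or.inr ⟨h1.ne_zero, h2, h3, z, h, hz.2, hzT⟩
  have hfin := (hfl.union c1).subset hsub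
  have h1 := ((good_fam (S := S) (S₁ := S₁) (U := U) j (t ^ 4)).two_mul_orbs_le hfin).trans
    ((Set.ncard_le_ncard hsub (hfl.union c1)).trans (Set.ncard_union_le _ _))
  have h2 : (2 * orbs (fam S S₁ U j (t ^ 4)) : ℝ) ≤
      (locPts S S₁ U Y (regClosed j T) t).ncard + (cusp j (Set.Ici T) (t ^ 4)).ncard := by
    exact_mod_cast h1
  linarith

/-- The error made in a box by reducible forms and forms with large content of the Hessian. -/
noncomputable def boxErr (N : ℕ) : ℝ :=
  2 * (2 * N + 1) ^ 3 + (2 * N + 1) * (4 * (N * (1 + Real.log N))) ^ 2 + 135 * N ^ 3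

lemma good_sq_dvd (j : Bool) (X : ℝ) (p : ℕ) :
    Good j {f ∈ irr j X | ((p : ℤ)) ^ 2 ∣ disc f ∧ ¬ HessDvd p f} where
  irred f hf := hf.1.1
  sign f hf := hf.1.2.1
  act_mem f hf γ := by
    refine ⟨(good_irr j X).act_mem f hf.1 γ, by rw [disc_act_SL]; exact hf.2.1, fun h => ?_⟩
    refine hf.2.2 ?_
    have := hessDvd_act h (γ⁻¹).1
    rwa [← act_mul, ← Matrix.SpecialLinearGroup.coe_mul, mul_inv_cancel,
      Matrix.SpecialLinearGroup.coe_one, act_one] at this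

lemma lower_bound (j : Bool) {t T : ℝ} (ht : 0 < t) (hT : 1 ≤ T) {Y N : ℕ} (hS₁ : S₁ ⊆ S)
    (hU : U ⊆ S₁) (hY : 3 < Y) (hYS : ∀ p, Y ≤ p → p ∉ S) (hN : 2 ≤ N)
    (hN' : 6 * T ^ 3 * t < N + 1) :
    ((locPts S S₁ U Y (regOpen j T) t).ncard : ℝ) ≤ 2 * orbs (fam S S₁ U j (t ^ 4)) +
      boxErr N + 576 * N ^ 4 / Y + 49545216 * t ^ 4 / Y := by
  classical
  set X := t ^ 4 with hX
  have hX0 : 0 ≤ X := by positivity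
  set L := locPts S S₁ U Y (regOpen j T) t
  set B₀ := {f : Fin 4 → ℤ | f 0 = 0 ∧ ∀ i, |f i| ≤ N}
  set B₁ := {f : Fin 4 → ℤ | f 0 ≠ 0 ∧ ¬ Irred f ∧ ∀ i, |f i| ≤ N}
  set B₂ := {f : Fin 4 → ℤ | (∃ p : ℕ, p.Prime ∧ Y ≤ p ∧ HessDvd p f) ∧ f 0 ≠ 0 ∧ ∀ i, |f i| ≤ N}
  set G : ℕ → Set (Fin 4 → ℤ) := fun p => {f ∈ irr j X | ((p : ℤ)) ^ 2 ∣ disc f ∧ ¬ HessDvd p f}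
  set E : ℕ → Set (Fin 4 → ℤ) := fun p => {f ∈ G p | ∃ z ∈ 𝒟ᵒ, rtH j f z}
  set M := {f ∈ fam S S₁ U j X | ∃ z ∈ 𝒟ᵒ, rtH j f z}
  set Q := (Finset.Ico Y (⌊X⌋₊ + 1)).filter Nat.Prime
  have hsub : L ⊆ M ∪ (B₀ ∪ (B₁ ∪ (B₂ ∪ ⋃ p ∈ Q, E p))) := by
    rintro f ⟨hloc, hf⟩
    obtain ⟨h1, h2, h3, h4⟩ := of_mem_regOpen ht hT hf
    have hbox : ∀ i, |f i| ≤ N := fun i => by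
      have : (|f i| : ℝ) < N + 1 := (h4 i).trans_lt hN'
      have : |f i| < (N : ℤ) + 1 := by exact_mod_cast this
      omega
    by_cases h0 : f 0 = 0
    · exact Or.inr (Or.inl ⟨h0, hbox⟩)
    by_cases hirr : Irred f
    swap
    · exact Or.inr (Or.inr (Or.inl ⟨h0, hirr, hbox⟩))
    by_cases hall : ∀ p : ℕ, p.Prime → f ∈ Loc.LocF S S₁ U p
    · exact Or.inl ⟨⟨⟨hirr, h1, h2⟩, hall⟩, h3⟩
    push Not at hall
    obtain ⟨p, hp, hpf⟩ := hall
    have hpY : Y ≤ p := by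
      by_contra! h
      exact hpf (hloc p (Nat.mem_primesBelow.2 ⟨h, hp⟩))
    have hpS := hYS p hpY
    have hd : ((p : ℤ)) ^ 2 ∣ disc f := by
      by_contra hd
      refine hpf ?_
      unfold Loc.LocF
      rw [if_neg fun h => hpS (hS₁ (hU h))]
      exact Loc.locD_of_large S S₁ hS₁ (by omega) hpS hd
    by_cases hH : HessDvd p f
    · exact Or.inr (Or.inr (Or.inr (Or.inl ⟨⟨p, hp, hpY, hH⟩, h0, hbox⟩)))
    · refine Or.inr (Or.inr (Or.inr (Or.inr (Set.mem_biUnion (x := p) ?_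
        ⟨⟨⟨hirr, h1, h2.le⟩, hd, hH⟩, h3⟩))))
      refine Finset.mem_filter.2 ⟨Finset.mem_Ico.2 ⟨hpY, ?_⟩, hp⟩
      have hd0 : disc f ≠ 0 := by
        rintro h
        rw [h, mul_zero] at h1
        exact lt_irrefl _ h1
      have h5 : ((p : ℤ)) ≤ |disc f| := by
        have h6 := Int.le_of_dvd (abs_pos.2 hd0) ((dvd_abs _ _).2 hd)
        nlinarith
      have h6 : (p : ℝ) ≤ X := by
        have : (p : ℝ) ≤ |((disc f : ℤ) : ℝ)| := by exact_mod_cast h5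
        linarith
      exact Nat.lt_succ_of_le (Nat.le_floor h6)
  have hcusp := (cusp_bound j hX0 (le_refl (1 / 2 : ℝ))).1
  have hfdfin : ∀ {F : Set (Fin 4 → ℤ)}, F ⊆ irr j X → {f ∈ F | ∃ z ∈ 𝒟, rtH j f z}.Finite :=
    fun hF => hcusp.subset (finite_fd_irr hF)
  have hofin : ∀ {F : Set (Fin 4 → ℤ)}, F ⊆ irr j X → {f ∈ F | ∃ z ∈ 𝒟ᵒ, rtH j f z}.Finite :=
    fun hF => (hfdfin hF).subset fun f ⟨hf, z, hz, h⟩ =>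
      ⟨hf, z, ModularGroup.fdo_subset_fd hz, h⟩
  have hG : ∀ p, G p ⊆ irr j X := fun p f hf => hf.1
  have fB₀ : B₀.Finite := (finite_box N).subset fun f hf => hf.2
  have fB₁ : B₁.Finite := (finite_box N).subset fun f hf => hf.2.2
  have fB₂ : B₂.Finite := (finite_box N).subset fun f hf => hf.2.2
  have fE : (⋃ p ∈ Q, E p).Finite := Set.Finite.biUnion (Finset.finite_toSet Q)
    fun p _ => hofin (hG p)
  have hcount : L.ncard ≤ M.ncard + (B₀.ncard + (B₁.ncard + (B₂.ncard +
      ∑ p ∈ Q, (E p).ncard))) := by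
    refine (Set.ncard_le_ncard hsub ((hofin fam_subset).union (fB₀.union (fB₁.union
      (fB₂.union fE))))).trans ((Set.ncard_union_le _ _).trans (Nat.add_le_add_left
      ((Set.ncard_union_le _ _).trans (Nat.add_le_add_left ((Set.ncard_union_le _ _).trans
      (Nat.add_le_add_left ((Set.ncard_union_le _ _).trans (Nat.add_le_add_left
      (Finset.set_ncard_biUnion_le _ _) _)) _)) _)) _))
  have hM : M.ncard ≤ 2 * orbs (fam S S₁ U j X) :=
    (good_fam j X).le_two_mul_orbs (hfdfin fam_subset) fun f hf => hf
  have hE : ∀ p ∈ Q, ((E p).ncard : ℝ) ≤ 24772608 * X * (1 / (p : ℝ) ^ 2) := by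
    intro p hp
    obtain ⟨hpI, hpp⟩ := Finset.mem_filter.1 hp
    have h3 : 3 < p := by have := (Finset.mem_Ico.1 hpI).1; omega
    have h4 : (E p).ncard ≤ 2 * orbs (G p) :=
      (good_sq_dvd j X p).le_two_mul_orbs (hfdfin (hG p)) fun f hf => hf
    have h5 : ((E p).ncard : ℝ) ≤ 2 * orbs (G p) := by exact_mod_cast h4
    have h6 : (orbs (G p) : ℝ) ≤ 12386304 * X * (1 / (p : ℝ) ^ 2) := orbs_sq_dvd_le j hX0 hpp h3
    linarith
  have hEs : ∑ p ∈ Q, ((E p).ncard : ℝ) ≤ 49545216 * X / Y := by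
    calc ∑ p ∈ Q, ((E p).ncard : ℝ) ≤ ∑ p ∈ Q, 24772608 * X * (1 / (p : ℝ) ^ 2) :=
          Finset.sum_le_sum hE
      _ ≤ ∑ p ∈ Finset.Ico Y (⌊X⌋₊ + 1), 24772608 * X * (1 / (p : ℝ) ^ 2) := by
        refine Finset.sum_le_sum_of_subset_of_nonneg (Finset.filter_subset _ _) ?_
        intros; positivity
      _ ≤ 24772608 * X * (2 / Y) := by
        rw [← Finset.mul_sum]
        gcongr
        exact Loc.sum_tail_le (by omega)
      _ = _ := by ring
  have hB₁ := card_reducible_le N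
  have hB₂ := card_hessDvd_tail_le (Y := Y) hN (by omega)
  change ((B₁.ncard : ℕ) : ℝ) ≤ _ at hB₁
  change ((B₂.ncard : ℕ) : ℝ) ≤ _ at hB₂
  have hc : (L.ncard : ℝ) ≤ M.ncard + (B₀.ncard + (B₁.ncard + (B₂.ncard +
      ∑ p ∈ Q, ((E p).ncard : ℝ)))) := by exact_mod_cast hcount
  have hM' : (M.ncard : ℝ) ≤ 2 * orbs (fam S S₁ U j X) := by exact_mod_cast hM
  have hB₀' : (B₀.ncard : ℝ) ≤ (2 * N + 1) ^ 3 := by exact_mod_cast card_coeff_eq_zero_le N 0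
  unfold boxErr
  linarith

end CubicForm

namespace CubicForm

open scoped Topology
open MeasureTheory

lemma boxErr_le {N : ℕ} (hN : 1 ≤ N) : boxErr N ≤ 957 * N ^ 4 / √N := by
  have h1 : (1 : ℝ) ≤ N := by exact_mod_cast hN
  have hs : 1 ≤ √(N : ℝ) := Real.one_le_sqrt.2 h1
  have hs2 : √(N : ℝ) ^ 2 = N := Real.sq_sqrt (by positivity)
  have hlog : (1 + Real.log N) ^ 2 ≤ 16 * √(N : ℝ) := by
    have h2 : (√√(N : ℝ)) ^ 2 = √(N : ℝ) := Real.sq_sqrt (by positivity)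
    have h3 : Real.log N = 4 * Real.log (√√(N : ℝ)) := by
      rw [Real.log_sqrt (by positivity), Real.log_sqrt (by positivity)]
      ring
    have h4 := Real.log_le_sub_one_of_pos (x := √√(N : ℝ)) (by positivity)
    calc (1 + Real.log N) ^ 2 ≤ (4 * √√(N : ℝ)) ^ 2 :=
          pow_le_pow_left₀ (by positivity) (by linarith) 2
      _ = _ := by rw [mul_pow, h2]; norm_num
  rw [le_div_iff₀ (by positivity), boxErr, mul_pow, mul_pow]
  set s := √(N : ℝ)
  have h5 : (2 * (N : ℝ) + 1) ≤ 3 * N := by linarith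
  have h6 : (2 * (N : ℝ) + 1) ^ 3 ≤ (3 * N) ^ 3 := pow_le_pow_left₀ (by positivity) h5 3
  have h7 : (2 * (N : ℝ) + 1) * (4 ^ 2 * ((N : ℝ) ^ 2 * (1 + Real.log N) ^ 2)) ≤
      3 * N * (4 ^ 2 * ((N : ℝ) ^ 2 * (16 * s))) := by gcongr
  have h8 : (N : ℝ) ^ 3 ≤ N ^ 3 * s := le_mul_of_one_le_right (by positivity) hs
  calc _ ≤ (957 * (N : ℝ) ^ 3 * s) * s := by
        refine mul_le_mul_of_nonneg_right ?_ (by positivity)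
        nlinarith
    _ = _ := by linear_combination 957 * (N : ℝ) ^ 3 * hs2

variable {S S₁ U : Finset ℕ}

/-- The density of `LocF`. -/
noncomputable def locDens (S S₁ U : Finset ℕ) (p : ℕ) : ℝ :=
  Loc.kap p * Loc.nu S S₁ p * (if p ∈ U then 2 / (p : ℝ) ^ 2 else 1)

lemma tendsto_locPts (hU : U ⊆ S₁) (Y : ℕ) {R : Set (Fin 4 → ℝ)} (hb : Bornology.IsBounded R)
    (hR : MeasurableSet R) (hfr : volume (frontier R) = 0) :
    Tendsto (fun t : ℝ => ((locPts S S₁ U Y R t).ncard : ℝ) / t ^ 4) atTop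
      (𝓝 ((volume R).toReal * ∏ p ∈ Y.primesBelow, locDens S S₁ U p)) := by
  have hpr : ∀ p ∈ Y.primesBelow, p.Prime := fun p hp => (Nat.mem_primesBelow.1 hp).2
  have h := LatticeCount.tendsto_card_local hb hR hfr Y.primesBelow (q := fun p => p ^ 2)
    (E := Loc.LocF S S₁ U) (k := locDens S S₁ U) (fun p hp => pow_pos (hpr p hp).pos 2)
    (fun p hp => Loc.locF_density S S₁ U hU p (hpr p hp))
    (fun a ha b hb hab => Nat.Coprime.pow 2 2 ((Nat.coprime_primes (hpr a ha) (hpr b hb)).2 hab))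
  simpa [locPts] using h

lemma eventually_boxErr {n : ℕ} (hn : 1 ≤ n) :
    ∀ᶠ t : ℝ in atTop, 2 ≤ ⌊6 * (n : ℝ) ^ 3 * t⌋₊ ∧
      boxErr ⌊6 * (n : ℝ) ^ 3 * t⌋₊ ≤ t ^ 4 / n ∧
      576 * (⌊6 * (n : ℝ) ^ 3 * t⌋₊ : ℝ) ^ 4 / ((n ^ 13 : ℕ) : ℝ) ≤ 746496 * (t ^ 4 / n) := by
  have h1 : Tendsto (fun t : ℝ => ⌊6 * (n : ℝ) ^ 3 * t⌋₊) atTop atTop :=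
    tendsto_nat_floor_atTop.comp (tendsto_id.const_mul_atTop (by positivity))
  set K : ℝ := 957 * 1296 * n ^ 13 with hK
  filter_upwards [h1.eventually_ge_atTop 2, h1.eventually_ge_atTop ⌈K ^ 2⌉₊, eventually_ge_atTop 0]
    with t h2 h3 ht
  set N := ⌊6 * (n : ℝ) ^ 3 * t⌋₊
  have hN : (N : ℝ) ≤ 6 * (n : ℝ) ^ 3 * t := Nat.floor_le (by positivity)
  have hN4 : (N : ℝ) ^ 4 ≤ 1296 * n ^ 12 * t ^ 4 := by
    calc (N : ℝ) ^ 4 ≤ (6 * (n : ℝ) ^ 3 * t) ^ 4 := pow_le_pow_left₀ (by positivity) hN 4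
      _ = _ := by ring
  have hKN : K ≤ √(N : ℝ) := by
    refine Real.le_sqrt_of_sq_le ?_
    exact (Nat.le_ceil _).trans (by exact_mod_cast h3)
  refine ⟨h2, (boxErr_le (by omega)).trans ?_, ?_⟩
  · calc 957 * (N : ℝ) ^ 4 / √N ≤ 957 * (1296 * n ^ 12 * t ^ 4) / K := by gcongr
      _ = t ^ 4 / n := by rw [hK]; field_simp
  · push_cast
    calc 576 * (N : ℝ) ^ 4 / (n : ℝ) ^ 13 ≤ 576 * (1296 * n ^ 12 * t ^ 4) / (n : ℝ) ^ 13 := by gcongr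
      _ = _ := by field_simp; ring

/-- The number of real embeddings weight in the main term. -/
noncomputable def cInf (j : Bool) : ℝ := if j then 3 else 1

lemma tendsto_prod_locDens (hS : ∀ p ∈ S, p.Prime) (hS₁ : S₁ ⊆ S) (hU : U ⊆ S₁) {φ : ℝ}
    (hφ : Tendsto (fun n : ℕ => ∏ p ∈ n.primesBelow, Loc.nu S S₁ p) atTop (𝓝 φ)) :
    Tendsto (fun n : ℕ => ∏ p ∈ n.primesBelow, locDens S S₁ U p) atTop
      (𝓝 (12 / Real.pi ^ 2 * φ * (2 ^ U.card / (∏ p ∈ U, (p : ℝ)) ^ 2))) := by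
  have h := Loc.tendsto_prod_kap.mul hφ
  simp_rw [← Finset.prod_mul_distrib] at h
  have hpos : ∀ p : ℕ, p.Prime → Loc.kap p * Loc.nu S S₁ p ≠ 0 := fun p hp => by
    refine mul_ne_zero ?_ (Loc.nu_pos S S₁ hp).ne'
    unfold Loc.kap
    have := Loc.one_sub_pos hp
    split_ifs <;> positivity
  have h2 := Loc.tendsto_prod_of_eq_off (T := U) (f := locDens S S₁ U)
    (fun p hp => hS p (hS₁ (hU hp))) (fun p _ hpU => by simp [locDens, hpU]) hpos h
  convert h2 using 2
  congr 1
  rw [← Finset.prod_pow, ← Finset.prod_const, ← Finset.prod_div_distrib]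
  refine Finset.prod_congr rfl fun p hp => ?_
  rw [locDens, if_pos hp, mul_div_cancel_left₀ _ (hpos p (hS p (hS₁ (hU hp))))]

theorem tendsto_orbs_fam (hS : ∀ p ∈ S, p.Prime) (hS₁ : S₁ ⊆ S) (hU : U ⊆ S₁) {φ : ℝ}
    (hφ : Tendsto (fun n : ℕ => ∏ p ∈ n.primesBelow, Loc.nu S S₁ p) atTop (𝓝 φ)) (j : Bool) :
    Tendsto (fun X : ℝ => ((orbs (fam S S₁ U j X) : ℕ) : ℝ) / X) atTop
      (𝓝 (cInf j * φ * (2 ^ U.card / (∏ p ∈ U, (p : ℝ)) ^ 2))) := by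
  set P : ℕ → ℝ := fun n => ∏ p ∈ (n ^ 13).primesBelow, locDens S S₁ U p with hP
  have hPlim : Tendsto P atTop _ := (tendsto_prod_locDens hS hS₁ hU hφ).comp
    (tendsto_pow_atTop (by norm_num : (13 : ℕ) ≠ 0))
  have hvol : Tendsto (fun n : ℕ => (if j then 3 else 1) * (Real.pi / 2) *
      (Real.pi / 3 - 1 / (n : ℝ))) atTop
      (𝓝 ((if j then 3 else 1) * (Real.pi / 2) * (Real.pi / 3 - 0))) :=
    (tendsto_const_nhds.sub tendsto_one_div_atTop_nhds_zero_nat).const_mul _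
  have hβ := (hvol.mul hPlim).div_const 2
  have hL : (if j then 3 else 1) * (Real.pi / 2) * (Real.pi / 3 - 0) *
      (12 / Real.pi ^ 2 * φ * (2 ^ U.card / (∏ p ∈ U, (p : ℝ)) ^ 2)) / 2 =
      cInf j * φ * (2 ^ U.card / (∏ p ∈ U, (p : ℝ)) ^ 2) := by
    unfold cInf
    have := Real.pi_ne_zero
    field_simp
    ring
  rw [hL] at hβ
  refine Loc.sieve_limit (ε := fun n : ℕ => 100000000 / (n : ℝ)) hβ
    (tendsto_const_div_atTop_nhds_zero_nat _) ?_
  filter_upwards [eventually_gt_atTop (max 3 (S.sup id))] with n hn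
  have hn3 : 3 < n := (le_max_left _ _).trans_lt hn
  have hnY : n ≤ n ^ 13 := Nat.le_self_pow (by norm_num) n
  have hYS : ∀ p, n ^ 13 ≤ p → p ∉ S := fun p hp hpS => by
    have h1 := Finset.le_sup (f := id) hpS
    have h2 := (le_max_right 3 (S.sup id)).trans_lt hn
    simp only [id] at h1
    omega
  have hn1 : (1 : ℝ) ≤ n := by exact_mod_cast (by omega : 1 ≤ n)
  have hv := volume_regOpen j hn1
  set V : ℝ := (if j then 3 else 1) * (Real.pi / 2) * (Real.pi / 3 - 1 / (n : ℝ)) * P n with hV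
  have hO := tendsto_locPts (S := S) hU (n ^ 13) ((isCompact_regClosed j n).isBounded.subset
    (regOpen_subset j n)) (isOpen_image_Psi j n).measurableSet (volume_frontier_regOpen j n)
  have hC := tendsto_locPts (S := S) hU (n ^ 13) (isCompact_regClosed j n).isBounded
    (isCompact_regClosed j n).measurableSet (volume_frontier_regClosed j n)
  rw [volume_regClosed] at hC
  rw [hv] at hO hC
  change Tendsto _ _ (𝓝 V) at hO
  change Tendsto _ _ (𝓝 V) at hC
  clear_value V
  have hn0 : (0 : ℝ) < 1 / n := by positivity
  have key : ∀ᶠ t : ℝ in atTop, |((orbs (fam S S₁ U j (t ^ 4)) : ℕ) : ℝ) / t ^ 4 - V / 2| ≤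
      100000000 / (n : ℝ) := by
    filter_upwards [(Metric.tendsto_nhds.1 hO) _ hn0, (Metric.tendsto_nhds.1 hC) _ hn0,
      eventually_boxErr (by omega : 1 ≤ n), eventually_gt_atTop 0] with t h1 h2 h3 ht
    obtain ⟨h3, h4, h5⟩ := h3
    have hX : 0 < t ^ 4 := by positivity
    rw [Real.dist_eq, abs_lt] at h1 h2
    have hlo := lower_bound (S := S) j ht hn1 hS₁ hU (hn3.trans_le hnY) hYS h3 (Nat.lt_floor_add_one _)
    have hup := upper_bound (S := S) (S₁ := S₁) (U := U) j ht (T := n) (by linarith) (n ^ 13)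
    have h6 : 49545216 * t ^ 4 / ((n ^ 13 : ℕ) : ℝ) ≤ 49545216 * (t ^ 4 / n) := by
      rw [mul_div_assoc]
      gcongr
    have h7 := h1.1
    have h8 := h2.2
    rw [lt_sub_iff_add_lt, lt_div_iff₀ hX] at h7
    rw [sub_lt_iff_lt_add, div_lt_iff₀ hX] at h8
    rw [abs_le, le_sub_iff_add_le, le_div_iff₀ hX, sub_le_iff_le_add, div_le_iff₀ hX]
    have e1 : t ^ 4 / n = 1 / n * t ^ 4 := by ring
    have e2 : (100000000 : ℝ) / n = 100000000 * (1 / n) := by ring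
    have e3 : 3096576 * t ^ 4 / (n : ℝ) = 3096576 * (1 / n * t ^ 4) := by ring
    rw [e1] at h4 h5 h6
    rw [e3] at hup
    rw [e2]
    have h9 : 0 < 1 / n * t ^ 4 := by positivity
    constructor
    · linarith
    · linarith
  have hpw := (tendsto_rpow_atTop (show (0 : ℝ) < 1 / 4 by norm_num)).eventually key
  filter_upwards [hpw, eventually_ge_atTop 0] with X hX hX0
  have : (X ^ (1 / 4 : ℝ)) ^ 4 = X := by
    rw [← Real.rpow_natCast, ← Real.rpow_mul hX0]
    norm_num
  rwa [this] at hX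

end CubicForm

namespace Loc

lemma sq_emod_eight {k : ℤ} (hk : ¬ (2 : ℤ) ∣ k) : k ^ 2 % 8 = 1 := by
  have := Int.eight_dvd_sq_sub_one_of_odd (by rwa [← Int.not_even_iff_odd, even_iff_two_dvd] : Odd k)
  omega

lemma spl_mul_sq {p : ℕ} (hp : p.Prime) {k : ℤ} (hk : ¬ (p : ℤ) ∣ k) (d : ℤ) :
    Spl p (d * k ^ 2) ↔ Spl p d := by
  have hpp := Nat.prime_iff_prime_int.1 hp
  unfold Spl
  split_ifs with h
  · subst h
    have := sq_emod_eight hk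
    rw [Int.mul_emod, this, mul_one, Int.emod_emod]
  · have := Fact.mk hp
    have hk' : (k : ZMod p) ≠ 0 := fun h => hk ((ZMod.intCast_zmod_eq_zero_iff_dvd k p).1 h)
    refine and_congr (not_congr ⟨fun h => (hpp.dvd_or_dvd h).resolve_right
      fun h => hk (hpp.dvd_of_dvd_pow h), fun h => h.mul_right _⟩) ?_
    push_cast
    exact ⟨fun ⟨x, hx⟩ => ⟨x / k, by field_simp; rw [hx]; ring⟩,
      fun ⟨x, hx⟩ => ⟨x * k, by rw [hx]; ring⟩⟩

lemma fund_mul_sq {p : ℕ} (hp : p.Prime) {k : ℤ} (hk : ¬ (p : ℤ) ∣ k) (d : ℤ) :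
    Fund p (d * k ^ 2) ↔ Fund p d := by
  have hpp := Nat.prime_iff_prime_int.1 hp
  unfold Fund
  split_ifs with h
  · subst h
    have h1 := sq_emod_eight hk
    obtain ⟨q, hq⟩ : ∃ q, k ^ 2 = 8 * q + 1 := ⟨k ^ 2 / 8, by omega⟩
    rcases Int.even_or_odd' d with ⟨e, rfl | rfl⟩
    · have : 2 * e * k ^ 2 = 16 * (e * q) + 2 * e := by rw [hq]; ring
      omega
    · have : (2 * e + 1) * k ^ 2 = 16 * (e * q) + 8 * q + (2 * e + 1) := by rw [hq]; ring
      omega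
  · refine not_congr ⟨fun h => ?_, fun h => h.mul_right _⟩
    refine (IsCoprime.dvd_of_dvd_mul_right ?_ h)
    exact ((hpp.coprime_iff_not_dvd).2 hk).pow

lemma locD_mul_sq (S S₁ : Finset ℕ) {p : ℕ} (hp : p.Prime) {k : ℤ} (hk : ¬ (p : ℤ) ∣ k) (d : ℤ) :
    LocD S S₁ p (d * k ^ 2) ↔ LocD S S₁ p d := by
  unfold LocD
  rw [spl_mul_sq hp hk, fund_mul_sq hp hk]

end Loc

namespace CubicForm

open scoped Topology

/-- Irreducible forms of discriminant `m ^ 2 * d` with Hessian divisible by `m`. -/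
def irrDM (m : ℕ) (d : ℤ) : Set (Fin 4 → ℤ) :=
  {f | HessDvd m f ∧ disc f = (m : ℤ) ^ 2 * d ∧ Irred f}

variable {S S₁ U : Finset ℕ}

lemma prod_not_dvd {T : Finset ℕ} (hT : ∀ q ∈ T, q.Prime) {p : ℕ} (hp : p.Prime) (h : p ∉ T) :
    ¬ (p : ℤ) ∣ ((∏ q ∈ T, q : ℕ) : ℤ) := by
  rw [Int.natCast_dvd_natCast, hp.prime.dvd_finsetProd_iff]
  rintro ⟨q, hq, hpq⟩
  exact h (((Nat.prime_dvd_prime_iff_eq hp (hT q hq)).1 hpq) ▸ hq)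

lemma hessDvd_prod (hU : ∀ p ∈ U, p.Prime) {f : Fin 4 → ℤ} :
    HessDvd (∏ p ∈ U, p) f ↔ ∀ p ∈ U, HessDvd p f := by
  have key : ∀ n : ℤ, ((∏ p ∈ U, p : ℕ) : ℤ) ∣ n ↔ ∀ p ∈ U, (p : ℤ) ∣ n := fun n => by
    simp_rw [Int.natCast_dvd]
    exact ⟨fun h p hp => (Finset.dvd_prod_of_mem _ hp).trans h,
      fun h => Finset.prod_primes_dvd _ (fun p hp => (hU p hp).prime) h⟩
  unfold HessDvd
  simp only [key]
  exact ⟨fun h p hp => ⟨h.1 p hp, h.2.1 p hp, h.2.2 p hp⟩,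
    fun h => ⟨fun p hp => (h p hp).1, fun p hp => (h p hp).2.1, fun p hp => (h p hp).2.2⟩⟩

lemma mem_locF_iff (hS : ∀ p ∈ S, p.Prime) (hS₁ : S₁ ⊆ S) (hU : U ⊆ S₁) {f : Fin 4 → ℤ} :
    (∀ p : ℕ, p.Prime → f ∈ Loc.LocF S S₁ U p) ↔ ∃ d : ℤ, (∀ p : ℕ, p.Prime → Loc.LocD S S₁ p d) ∧
      HessDvd (∏ p ∈ U, p) f ∧ disc f = ((∏ p ∈ U, p : ℕ) : ℤ) ^ 2 * d := by
  have hUp : ∀ p ∈ U, p.Prime := fun p hp => hS p (hS₁ (hU hp))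
  have hquot : ∀ p ∈ U, ∀ d : ℤ, disc f = ((∏ p ∈ U, p : ℕ) : ℤ) ^ 2 * d →
      ∃ k : ℤ, ¬ (p : ℤ) ∣ k ∧ disc f / (p : ℤ) ^ 2 = d * k ^ 2 := by
    intro p hp d hd
    refine ⟨((∏ q ∈ U.erase p, q : ℕ) : ℤ), prod_not_dvd
      (fun q hq => hUp q (Finset.mem_of_mem_erase hq)) (hUp p hp) (Finset.notMem_erase p U), ?_⟩
    have h0 : (p : ℤ) ^ 2 ≠ 0 := pow_ne_zero 2 (by exact_mod_cast (hUp p hp).ne_zero)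
    rw [hd, ← Finset.mul_prod_erase U _ hp]
    push_cast
    rw [show ((p : ℤ) * ∏ i ∈ U.erase p, (i : ℤ)) ^ 2 * d =
      (p : ℤ) ^ 2 * (d * (∏ i ∈ U.erase p, (i : ℤ)) ^ 2) by ring, Int.mul_ediv_cancel_left _ h0]
  constructor
  · intro h
    have hH : HessDvd (∏ p ∈ U, p) f := by
      refine (hessDvd_prod hUp).2 fun p hp => ?_
      have := h p (hUp p hp)
      rw [Loc.LocF, if_pos hp] at this
      exact ⟨this.1, this.2.1, this.2.2.1⟩
    obtain ⟨d, hd⟩ : ((∏ p ∈ U, p : ℕ) : ℤ) ^ 2 ∣ disc f := by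
      obtain ⟨⟨a, ha⟩, ⟨b, hb⟩, ⟨c, hc⟩⟩ := hH
      refine ⟨b ^ 2 - 4 * a * c, ?_⟩
      rw [disc, ha, hb, hc]
      ring
    refine ⟨d, fun p hp => ?_, hH, hd⟩
    have hf := h p hp
    unfold Loc.LocF at hf
    split_ifs at hf with hpU
    · obtain ⟨k, hk, he⟩ := hquot p hpU d hd
      have h4 := hf.2.2.2
      rw [he, Loc.spl_mul_sq hp hk] at h4
      exact ⟨h4.fund, fun _ => h4, fun _ h => absurd (hU hpU) h⟩
    · change Loc.LocD S S₁ p (disc f) at hf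
      rwa [hd, mul_comm, Loc.locD_mul_sq S S₁ hp (prod_not_dvd hUp hp hpU)] at hf
  · rintro ⟨d, hd, hH, he⟩ p hp
    unfold Loc.LocF
    split_ifs with hpU
    · obtain ⟨k, hk, hq⟩ := hquot p hpU d he
      obtain ⟨h1, h2, h3⟩ := (hessDvd_prod hUp).1 hH p hpU
      refine ⟨h1, h2, h3, ?_⟩
      rw [hq, Loc.spl_mul_sq hp hk]
      exact (hd p hp).2.1 (hU hpU)
    · change Loc.LocD S S₁ p (disc f)
      rw [he, mul_comm, Loc.locD_mul_sq S S₁ hp (prod_not_dvd hUp hp hpU)]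
      exact hd p hp

/-- The discriminants of the family below `X`. -/
noncomputable def famFin (S S₁ : Finset ℕ) (s : ℤ) (X : ℝ) : Finset ℤ :=
  (Set.Finite.subset (t := {d : ℤ | Loc.Fam S S₁ s d ∧ |(d : ℝ)| < X}) (Loc.finite_disc s X)
    fun _ h => ⟨h.1.1, h.2⟩).toFinset

lemma mem_famFin {s : ℤ} {X : ℝ} {d : ℤ} :
    d ∈ famFin S S₁ s X ↔ Loc.Fam S S₁ s d ∧ |(d : ℝ)| < X := by
  simp [famFin]

lemma card_famFin (s : ℤ) (X : ℝ) : ((famFin S S₁ s X).card : ℝ) = Loc.famCount S S₁ s X := by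
  rw [famFin, Loc.famCount, Set.ncard_eq_toFinset_card _
    (Set.Finite.subset (Loc.finite_disc s X) fun _ h => ⟨h.1.1, h.2⟩)]

lemma orbs_biUnion (D : Finset ℤ) {G : ℤ → Set (Fin 4 → ℤ)} (hfin : ∀ d ∈ D, (orb '' G d).Finite)
    {m : ℤ} (hm : m ≠ 0) (hG : ∀ d, ∀ f ∈ G d, disc f = m * d) :
    orbs (⋃ d ∈ D, G d) = ∑ d ∈ D, orbs (G d) := by
  classical
  induction D using Finset.induction_on with
  | empty => simp [orbs]
  | insert a D ha ih =>
    rw [Finset.sum_insert ha, ← ih fun d hd => hfin d (Finset.mem_insert_of_mem hd), orbs,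
      Finset.set_biUnion_insert, Set.image_union, Set.ncard_union_eq ?_
      (hfin a (Finset.mem_insert_self _ _)) ?_]
    · rfl
    · rw [Set.disjoint_left]
      rintro _ ⟨f, hf, rfl⟩ ⟨g, hg, hfg⟩
      simp only [Set.mem_iUnion] at hg
      obtain ⟨b, hb, hg⟩ := hg
      obtain ⟨γ, h⟩ := orb_eq_iff.1 hfg
      have h2 : m * a = m * b := by rw [← hG a f hf, ← hG b g hg, h, disc_act_SL]
      exact ha (mul_left_cancel₀ hm h2 ▸ hb)
    · simp only [Set.image_iUnion]
      exact D.finite_toSet.biUnion fun d hd => hfin d (Finset.mem_insert_of_mem hd)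

lemma irrDM_subset {j : Bool} {m : ℕ} (hm : 0 < m) {d : ℤ} (hd : 0 < sg j * d) {X : ℝ}
    (hX : |(d : ℝ)| ≤ X) : irrDM m d ⊆ irr j ((m : ℝ) ^ 2 * X) := by
  rintro f ⟨h1, h2, h3⟩
  refine ⟨h3, ?_, ?_⟩
  · rw [h2]
    have : 0 < (m : ℤ) ^ 2 * (sg j * d) := by positivity
    linarith
  · rw [h2]
    push_cast
    rw [abs_mul, abs_of_nonneg (by positivity : (0 : ℝ) ≤ (m : ℝ) ^ 2)]
    gcongr

lemma sum_orbs_irrDM (hS : ∀ p ∈ S, p.Prime) (hS₁ : S₁ ⊆ S) (hU : U ⊆ S₁) (j : Bool) {X : ℝ}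
    (hX : 1 < X) :
    |((orbs (fam S S₁ U j (((∏ p ∈ U, p : ℕ) : ℝ) ^ 2 * X)) : ℕ) : ℝ) -
      ∑ d ∈ famFin S S₁ (sg j) X, ((orbs (irrDM (∏ p ∈ U, p) d) : ℕ) : ℝ)| ≤
      orbs (irrDM (∏ p ∈ U, p) 1) := by
  classical
  set m := ∏ p ∈ U, p
  have hm : 0 < m := Finset.prod_pos fun p hp => (hS p (hS₁ (hU hp))).pos
  have hm2 : (0 : ℝ) < (m : ℝ) ^ 2 := by positivity
  have hmz : ((m : ℤ)) ^ 2 ≠ 0 := by positivity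
  set D := famFin S S₁ (sg j) X
  set D₁ : Finset ℤ := if 0 < sg j * 1 ∧ ∀ p : ℕ, p.Prime → Loc.LocD S S₁ p 1 then insert 1 D else D
    with hD₁
  have h1D : (1 : ℤ) ∉ D := fun h => (mem_famFin.1 h).1.2.1 rfl
  have hmem : ∀ d, d ∈ D₁ ↔ (0 < sg j * d ∧ ∀ p : ℕ, p.Prime → Loc.LocD S S₁ p d) ∧ |(d : ℝ)| < X := by
    intro d
    by_cases hd : d = 1
    · subst hd
      rw [hD₁]
      split_ifs with h
      · exact ⟨fun _ => ⟨h, by simpa using hX⟩, fun _ => Finset.mem_insert_self _ _⟩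
      · exact ⟨fun h' => absurd h' h1D, fun h' => absurd h'.1 h⟩
    · have : d ∈ D₁ ↔ d ∈ D := by
        rw [hD₁]
        split_ifs
        · simp [hd]
        · rfl
      rw [this, mem_famFin, Loc.Fam]
      tauto
  have hfin : ∀ d ∈ D₁, (orb '' irrDM m d).Finite := fun d hd =>
    (finite_orb_irr j (by positivity)).subset
      (Set.image_mono (irrDM_subset hm ((hmem d).1 hd).1.1 ((hmem d).1 hd).2.le))
  have hfam : fam S S₁ U j ((m : ℝ) ^ 2 * X) = ⋃ d ∈ D₁, irrDM m d := by
    ext f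
    simp only [Set.mem_iUnion, hmem]
    constructor
    · rintro ⟨⟨h1, h2, h3⟩, h4⟩
      obtain ⟨d, hd, h5, h6⟩ := (mem_locF_iff hS hS₁ hU).1 h4
      change disc f = (m : ℤ) ^ 2 * d at h6
      rw [h6] at h2 h3
      push_cast at h3
      rw [abs_mul, abs_of_pos hm2, mul_lt_mul_iff_right₀ hm2] at h3
      refine ⟨d, ⟨⟨?_, hd⟩, h3⟩, h5, h6, h1⟩
      refine pos_of_mul_pos_right (a := (m : ℤ) ^ 2) ?_ (by positivity)
      linarith
    · rintro ⟨d, ⟨⟨h1, h2⟩, h3⟩, h4, h5, h6⟩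
      refine ⟨⟨h6, ?_, ?_⟩, (mem_locF_iff hS hS₁ hU).2 ⟨d, h2, h4, h5⟩⟩
      · rw [h5]
        have : 0 < (m : ℤ) ^ 2 * (sg j * d) := by positivity
        linarith
      · rw [h5]
        push_cast
        rw [abs_mul, abs_of_pos hm2]
        exact (mul_lt_mul_iff_right₀ hm2).2 h3
  rw [hfam, orbs_biUnion D₁ hfin hmz fun d f hf => hf.2.1]
  push_cast
  rw [hD₁]
  split_ifs
  · rw [Finset.sum_insert h1D]
    simp
  · simp

theorem tendsto_sum_orbs (hS : ∀ p ∈ S, p.Prime) (hS₁ : S₁ ⊆ S) {φ : ℝ}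
    (hφ : Tendsto (fun n : ℕ => ∏ p ∈ n.primesBelow, Loc.nu S S₁ p) atTop (𝓝 φ)) (j : Bool) :
    Tendsto (fun X : ℝ => (∑ d ∈ famFin S S₁ (sg j) X, ∑ U ∈ S₁.powerset,
      ((orbs (irrDM (∏ p ∈ U, p) d) : ℕ) : ℝ)) / X) atTop (𝓝 (3 ^ S₁.card * cInf j * φ)) := by
  have hlim : (3 : ℝ) ^ S₁.card * cInf j * φ = ∑ U ∈ S₁.powerset, cInf j * φ * 2 ^ U.card := by
    have h := Finset.prod_one_add (f := fun _ : ℕ => (2 : ℝ)) S₁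
    simp only [Finset.prod_const] at h
    rw [← Finset.mul_sum, ← h]
    norm_num
    ring
  simp_rw [Finset.sum_comm (s := famFin S S₁ (sg j) _), Finset.sum_div]
  rw [hlim]
  refine tendsto_finsetSum _ fun U hU => ?_
  rw [Finset.mem_powerset] at hU
  set m := ∏ p ∈ U, p with hm_def
  have hm : 0 < m := Finset.prod_pos fun p hp => (hS p (hS₁ (hU hp))).pos
  have hm2 : (0 : ℝ) < (m : ℝ) ^ 2 := by positivity
  have h1 := (tendsto_orbs_fam hS hS₁ hU hφ j).comp (tendsto_id.const_mul_atTop hm2)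
  have h2 := h1.const_mul ((m : ℝ) ^ 2)
  have h3 : (m : ℝ) ^ 2 * (cInf j * φ * (2 ^ U.card / (∏ p ∈ U, (p : ℝ)) ^ 2)) =
      cInf j * φ * 2 ^ U.card := by
    have : (∏ p ∈ U, (p : ℝ)) = m := by rw [hm_def]; push_cast; rfl
    rw [this]
    field_simp
  rw [h3] at h2
  have h4 : Tendsto (fun X : ℝ => ((orbs (irrDM m 1) : ℕ) : ℝ) / X) atTop (𝓝 0) :=
    tendsto_const_nhds.div_atTop tendsto_id
  refine (tendsto_iff_of_dist ?_).1 h2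
  refine squeeze_zero' (Eventually.of_forall fun _ => dist_nonneg) ?_ h4
  filter_upwards [eventually_gt_atTop 1] with X hX
  have h5 := sum_orbs_irrDM hS hS₁ hU j hX
  have hX0 : 0 < X := by linarith
  rw [Real.dist_eq, le_div_iff₀ hX0, ← abs_of_pos hX0, ← abs_mul, abs_of_pos hX0]
  refine le_of_eq_of_le ?_ h5
  congr 1
  simp only [Function.comp, id]
  rw [← Finset.sum_div, ← hm_def]
  field_simp

end CubicForm

/-- A presentation of `K` as the quadratic field generated by a square root `r` of `d`. -/
structure QuadData (K : Type*) [Field K] [NumberField K] (d : ℤ) where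
  /-- The square root of `d`. -/
  r : K
  /-- The nontrivial automorphism. -/
  conj : K →+* K
  r_sq : r ^ 2 = d
  conj_r : conj r = -r
  exists_coord : ∀ z : K, ∃ u v : ℚ, z = u + v * r

namespace Loc

/-- All the local conditions for being a fundamental discriminant. -/
def IsFund (d : ℤ) : Prop := d ≠ 1 ∧ ∀ p : ℕ, p.Prime → Fund p d

lemma IsFund.ne_zero {d : ℤ} (hd : IsFund d) : d ≠ 0 := by
  rintro rfl
  have := hd.2 3 Nat.prime_three
  simp [Fund] at this

lemma IsFund.emod_two {d : ℤ} (hd : IsFund d) : d % 4 = 1 ∨ d % 16 = 8 ∨ d % 16 = 12 := by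
  simpa [Fund] using hd.2 2 Nat.prime_two

lemma IsFund.not_sq_dvd {d : ℤ} (hd : IsFund d) {p : ℕ} (hp : p.Prime) (h2 : p ≠ 2) :
    ¬ (p : ℤ) ^ 2 ∣ d := by
  simpa [Fund, h2] using hd.2 p hp

/-- If `q² ∣ d` then `q` is `1` or `2`. -/
lemma IsFund.eq_one_or_two {d : ℤ} (hd : IsFund d) {q : ℕ} (hq : (q : ℤ) ^ 2 ∣ d) :
    q = 1 ∨ q = 2 := by
  have hodd : ∀ p : ℕ, p.Prime → p ∣ q → p = 2 := by
    intro p hp hpq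
    by_contra h2
    exact hd.not_sq_dvd hp h2 ((pow_dvd_pow_of_dvd (Int.natCast_dvd_natCast.2 hpq) 2).trans hq)
  rcases Nat.even_or_odd q with ⟨k, hk⟩ | hq1
  · right
    have h16 : ¬ 2 ∣ k := by
      rintro ⟨l, rfl⟩
      have : (16 : ℤ) ∣ d := by
        refine Dvd.dvd.trans ⟨(l : ℤ) ^ 2, ?_⟩ hq
        rw [hk]; push_cast; ring
      have := hd.emod_two
      omega
    have : k = 1 := by
      by_contra h1
      obtain ⟨p, hp, hpk⟩ := Nat.exists_prime_and_dvd h1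
      have := hodd p hp (hk ▸ hpk.trans ⟨2, by ring⟩)
      exact h16 (this ▸ hpk)
    omega
  · left
    by_contra h1
    obtain ⟨p, hp, hpk⟩ := Nat.exists_prime_and_dvd h1
    have := hodd p hp hpk
    subst this
    exact (Nat.not_even_iff_odd.2 hq1) (even_iff_two_dvd.2 hpk)

/-- The integrality criterion for `(a + w√d)/2`. -/
lemma IsFund.isInt {d : ℤ} (hd : IsFund d) {a k : ℤ} {w : ℚ} (h : a ^ 2 - d * w ^ 2 = 4 * k) :
    ∃ b : ℤ, w = b := by
  have hq0 : (w.den : ℚ) ≠ 0 := by exact_mod_cast w.den_nz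
  have hw : w = w.num / w.den := (Rat.num_div_den w).symm
  have h1 : (w.den : ℤ) ^ 2 * (a ^ 2 - 4 * k) = d * w.num ^ 2 := by
    have : ((w.den : ℚ)) ^ 2 * (a ^ 2 - 4 * k) = d * w.num ^ 2 := by
      rw [hw] at h
      field_simp at h
      linarith
    exact_mod_cast this
  have hcop : IsCoprime ((w.den : ℤ) ^ 2) (w.num ^ 2) := by
    refine IsCoprime.pow ?_
    have := w.reduced
    rw [Int.isCoprime_iff_gcd_eq_one, Int.gcd_comm]
    simpa [Int.gcd] using this
  have hdvd : (w.den : ℤ) ^ 2 ∣ d := hcop.dvd_of_dvd_mul_right (h1 ▸ dvd_mul_right _ _)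
  rcases hd.eq_one_or_two hdvd with h2 | h2
  · refine ⟨w.num, ?_⟩
    rw [hw, h2]; simp
  · exfalso
    have hn : w.num % 2 = 1 := by
      have := w.reduced
      rw [h2] at this
      have := (Nat.coprime_two_right.1 this)
      rw [Nat.odd_iff] at this
      omega
    rw [h2] at h1 hdvd
    obtain ⟨m, hm⟩ := hdvd
    push_cast at h1 hm
    have h3 : a ^ 2 - 4 * k = m * w.num ^ 2 := by rw [hm] at h1; linarith
    have h4 : w.num ^ 2 % 8 = 1 := Loc.sq_emod_eight (by omega)
    have h5 : m % 4 = 2 ∨ m % 4 = 3 := by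
      have := hd.emod_two
      omega
    have h6 : (m * w.num ^ 2) % 4 = m % 4 := by
      rw [Int.mul_emod, show w.num ^ 2 % 4 = 1 by omega]; omega
    have h7 : a ^ 2 % 4 = 0 ∨ a ^ 2 % 4 = 1 := by
      rcases Int.emod_two_eq_zero_or_one a with h | h
      · left
        obtain ⟨c, rfl⟩ := Int.dvd_of_emod_eq_zero h
        ring_nf; omega
      · right
        have := Loc.sq_emod_eight (by omega : ¬ 2 ∣ a)
        omega
    omega

end Loc

namespace QuadData

variable {K : Type*} [Field K] [NumberField K] {d : ℤ} (D : QuadData K d)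

@[simp] lemma conj_ratCast (q : ℚ) : D.conj (q : K) = q := map_ratCast D.conj q

lemma conj_ne_zero {z : K} (hz : z ≠ 0) : D.conj z ≠ 0 := by
  simpa using hz

variable (hd : Loc.IsFund d)
include hd

lemma r_ne_zero : D.r ≠ 0 := by
  intro h
  have := D.r_sq
  rw [h] at this
  have h2 : (d : K) = 0 := by rw [← this]; ring
  exact hd.ne_zero (by exact_mod_cast h2)

lemma eq_zero_of_coord {u v : ℚ} (h : (u : K) + v * D.r = 0) : u = 0 ∧ v = 0 := by
  have h2 := congrArg D.conj h
  simp only [map_add, map_mul, conj_ratCast, D.conj_r, map_zero] at h2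
  have hu : (u : K) = 0 := by linear_combination (h + h2) / 2
  have hv : (v : K) * D.r = 0 := by linear_combination (h - h2) / 2
  have hv' := (mul_eq_zero.1 hv).resolve_right (D.r_ne_zero hd)
  exact ⟨by exact_mod_cast hu, by exact_mod_cast hv'⟩

lemma coord_unique {u v u' v' : ℚ} (h : (u : K) + v * D.r = u' + v' * D.r) :
    u = u' ∧ v = v' := by
  have := D.eq_zero_of_coord hd (u := u - u') (v := v - v') (by push_cast; linear_combination h)
  exact ⟨by linarith [this.1], by linarith [this.2]⟩

lemma exists_rat_of_conj {z : K} (h : D.conj z = z) : ∃ q : ℚ, z = q := by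
  obtain ⟨u, v, rfl⟩ := D.exists_coord z
  simp only [map_add, map_mul, conj_ratCast, D.conj_r] at h
  have := D.coord_unique hd (u := u) (v := -v) (u' := u) (v' := v)
    (by push_cast; linear_combination h)
  have hv : v = 0 := by linarith [this.2]
  exact ⟨u, by simp [hv]⟩

/-- Integers of `K` in half-integral coordinates. -/
lemma isIntegral_iff (z : K) : IsIntegral ℤ z ↔
    ∃ a b k : ℤ, 2 * z = a + b * D.r ∧ a ^ 2 - d * b ^ 2 = 4 * k := by
  constructor
  · intro hz
    have hz' : IsIntegral ℤ (D.conj z) := hz.map D.conj.toIntAlgHom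
    have hZ : ∀ q : ℚ, IsIntegral ℤ (q : K) → ∃ n : ℤ, q = n := by
      intro q hq
      have : IsIntegral ℤ q := by
        rw [← isIntegral_algebraMap_iff (algebraMap ℚ K).injective]
        simpa using hq
      obtain ⟨n, hn⟩ := IsIntegrallyClosed.isIntegral_iff.1 this
      exact ⟨n, by simpa using hn.symm⟩
    obtain ⟨u, v, rfl⟩ := D.exists_coord z
    simp only [map_add, map_mul, conj_ratCast, D.conj_r] at hz'
    obtain ⟨a, ha⟩ := hZ (2 * u) (by
      have h := hz.add hz'
      rwa [show (u : K) + v * D.r + (u + v * -D.r) = (2 * u : ℚ) by push_cast; ring] at h)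
    obtain ⟨k, hk⟩ := hZ (u ^ 2 - d * v ^ 2) (by
      have h := hz.mul hz'
      rwa [show ((u : K) + v * D.r) * (u + v * -D.r) = (u ^ 2 - d * v ^ 2 : ℚ) by
        push_cast; linear_combination -(v : K) ^ 2 * D.r_sq] at h)
    obtain ⟨b, hb⟩ := hd.isInt (a := a) (k := k) (w := 2 * v) (by
      rw [← ha]; linear_combination 4 * hk)
    refine ⟨a, b, k, ?_, ?_⟩
    · have h1 : (a : K) = 2 * u := by exact_mod_cast congrArg (Rat.cast : ℚ → K) ha.symm
      have h2 : (b : K) = 2 * v := by exact_mod_cast congrArg (Rat.cast : ℚ → K) hb.symm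
      rw [h1, h2]; ring
    · have : (a : ℚ) ^ 2 - d * b ^ 2 = 4 * k := by
        rw [← ha, ← hb]; linear_combination 4 * hk
      exact_mod_cast this
  · rintro ⟨a, b, k, h1, h2⟩
    have h2' : (a : K) ^ 2 - d * b ^ 2 = 4 * k := by exact_mod_cast h2
    refine ⟨Polynomial.X ^ 2 + (-Polynomial.C a * Polynomial.X + Polynomial.C k), ?_, ?_⟩
    · refine Polynomial.monic_X_pow_add ?_
      refine (Polynomial.degree_add_le _ _).trans_lt (max_lt ?_ ?_)
      · rw [← Polynomial.C_neg]
        exact (Polynomial.degree_C_mul_X_le _).trans_lt (by norm_num)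
      · exact Polynomial.degree_C_le.trans_lt (by norm_num)
    · simp only [Polynomial.eval₂_add, Polynomial.eval₂_mul, Polynomial.eval₂_neg,
        Polynomial.eval₂_pow, Polynomial.eval₂_X, Polynomial.eval₂_C]
      simp only [algebraMap_int_eq, eq_intCast]
      have h3 : z = (a + b * D.r) / 2 := by rw [← h1]; ring
      rw [h3]
      linear_combination (-1 / 4 : K) * h2' + (b : K) ^ 2 / 4 * D.r_sq

end QuadData

lemma Loc.IsFund.ne_sq {d : ℤ} (hd : IsFund d) (t : ℤ) : d ≠ t ^ 2 := by
  intro h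
  have h1 : ((t.natAbs : ℕ) : ℤ) ^ 2 = t ^ 2 := by simp
  rcases hd.eq_one_or_two (h ▸ h1.dvd) with h2 | h2
  · exact hd.1 (by rw [h, ← h1, h2]; norm_num)
  · have : d = 4 := by rw [h, ← h1, h2]; norm_num
    have := hd.emod_two
    omega

namespace QuadData

variable {K : Type*} [Field K] [NumberField K] {d : ℤ} (D : QuadData K d)

/-- `ω₁, ω₂` generate `I` over `ℤ`. -/
def ZGen (I : FractionalIdeal (𝓞 K)⁰ K) (w₁ w₂ : K) : Prop :=
  ∀ z, z ∈ I ↔ ∃ a b : ℤ, z = a * w₁ + b * w₂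

omit [NumberField K] in
lemma ZGen.left {I : FractionalIdeal (𝓞 K)⁰ K} {w₁ w₂ : K} (h : ZGen I w₁ w₂) : w₁ ∈ I :=
  (h _).2 ⟨1, 0, by simp⟩

omit [NumberField K] in
lemma ZGen.right {I : FractionalIdeal (𝓞 K)⁰ K} {w₁ w₂ : K} (h : ZGen I w₁ w₂) : w₂ ∈ I :=
  (h _).2 ⟨0, 1, by simp⟩

/-- The form `f` is the `√d`-part of `2δ(ω₁x + ω₂y)³`, with the normalisation
`N(δ) n³ = m`, where `n` is the oriented covolume of `ω₁, ω₂`. -/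
structure Rep (m : ℕ) (f : Fin 4 → ℤ) (w₁ w₂ δ : K) : Prop where
  h0 : f 0 * D.r = δ * w₁ ^ 3 - D.conj δ * D.conj w₁ ^ 3
  h1 : f 1 * D.r = δ * (w₁ ^ 2 * w₂) - D.conj δ * (D.conj w₁ ^ 2 * D.conj w₂)
  h2 : f 2 * D.r = δ * (w₁ * w₂ ^ 2) - D.conj δ * (D.conj w₁ * D.conj w₂ ^ 2)
  h3 : f 3 * D.r = δ * w₂ ^ 3 - D.conj δ * D.conj w₂ ^ 3
  hm : δ * D.conj δ * (D.conj w₁ * w₂ - w₁ * D.conj w₂) ^ 3 = m * D.r ^ 3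

namespace Rep

variable {D} {m : ℕ} {f : Fin 4 → ℤ} {w₁ w₂ δ : K}

lemma act (h : D.Rep m f w₁ w₂ δ) (g : Matrix (Fin 2) (Fin 2) ℤ) (hg : g.det = 1) :
    D.Rep m (CubicForm.act g f) (g 0 0 * w₁ + g 1 0 * w₂) (g 0 1 * w₁ + g 1 1 * w₂) δ := by
  obtain ⟨h0, h1, h2, h3, hm⟩ := h
  have hdet : (g 0 0 : K) * g 1 1 - g 0 1 * g 1 0 = 1 := by
    rw [Matrix.det_fin_two] at hg; exact_mod_cast hg
  constructor
  · simp only [CubicForm.act, map_add, map_mul, map_intCast, Matrix.cons_val]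
    push_cast
    linear_combination (g 0 0 : K) ^ 3 * h0 + 3 * g 0 0 ^ 2 * g 1 0 * h1
      + 3 * g 0 0 * g 1 0 ^ 2 * h2 + g 1 0 ^ 3 * h3
  · simp only [CubicForm.act, map_add, map_mul, map_intCast, Matrix.cons_val]
    push_cast
    linear_combination (g 0 0 : K) ^ 2 * g 0 1 * h0
      + (g 0 0 ^ 2 * g 1 1 + 2 * g 0 0 * g 0 1 * g 1 0) * h1
      + (2 * g 0 0 * g 1 0 * g 1 1 + g 0 1 * g 1 0 ^ 2) * h2 + g 1 0 ^ 2 * g 1 1 * h3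
  · simp only [CubicForm.act, map_add, map_mul, map_intCast, Matrix.cons_val]
    push_cast
    linear_combination (g 0 0 : K) * g 0 1 ^ 2 * h0
      + (2 * g 0 0 * g 0 1 * g 1 1 + g 0 1 ^ 2 * g 1 0) * h1
      + (g 0 0 * g 1 1 ^ 2 + 2 * g 0 1 * g 1 0 * g 1 1) * h2 + g 1 0 * g 1 1 ^ 2 * h3
  · simp only [CubicForm.act, map_add, map_mul, map_intCast, Matrix.cons_val]
    push_cast
    linear_combination (g 0 1 : K) ^ 3 * h0 + 3 * g 0 1 ^ 2 * g 1 1 * h1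
      + 3 * g 0 1 * g 1 1 ^ 2 * h2 + g 1 1 ^ 3 * h3
  · simp only [map_add, map_mul, map_intCast]
    rw [← hm, show (g 0 0 * D.conj w₁ + g 1 0 * D.conj w₂) * (g 0 1 * w₁ + g 1 1 * w₂) -
      (g 0 0 * w₁ + g 1 0 * w₂) * (g 0 1 * D.conj w₁ + g 1 1 * D.conj w₂) =
      ((g 0 0 : K) * g 1 1 - g 0 1 * g 1 0) * (D.conj w₁ * w₂ - w₁ * D.conj w₂) by ring,
      hdet, one_mul]

lemma scale (h : D.Rep m f w₁ w₂ δ) {k : K} (hk : k ≠ 0) :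
    D.Rep m f (k * w₁) (k * w₂) ((k ^ 3)⁻¹ * δ) := by
  obtain ⟨h0, h1, h2, h3, hm⟩ := h
  have hk' := D.conj_ne_zero hk
  constructor
  · rw [h0]; simp only [map_mul, map_inv₀, map_pow]; field_simp
  · rw [h1]; simp only [map_mul, map_inv₀, map_pow]; field_simp
  · rw [h2]; simp only [map_mul, map_inv₀, map_pow]; field_simp
  · rw [h3]; simp only [map_mul, map_inv₀, map_pow]; field_simp
  · rw [← hm]; simp only [map_mul, map_inv₀, map_pow]; field_simp

lemma hessA_eq (h : D.Rep m f w₁ w₂ δ) : ((CubicForm.hessA f : ℤ) : K) * D.r ^ 2 =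
    δ * D.conj δ * (D.conj w₁ * w₂ - w₁ * D.conj w₂) ^ 2 * (w₁ * D.conj w₁) := by
  simp only [CubicForm.hessA]
  push_cast
  linear_combination (f 1 * D.r + (δ * (w₁ ^ 2 * w₂) - D.conj δ * (D.conj w₁ ^ 2 * D.conj w₂))) * h.h1
    - f 2 * D.r * h.h0 - (δ * w₁ ^ 3 - D.conj δ * D.conj w₁ ^ 3) * h.h2

lemma hessB_eq (h : D.Rep m f w₁ w₂ δ) : ((CubicForm.hessB f : ℤ) : K) * D.r ^ 2 =
    δ * D.conj δ * (D.conj w₁ * w₂ - w₁ * D.conj w₂) ^ 2 * (w₁ * D.conj w₂ + D.conj w₁ * w₂) := by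
  simp only [CubicForm.hessB]
  push_cast
  linear_combination f 2 * D.r * h.h1 + (δ * (w₁ ^ 2 * w₂) - D.conj δ * (D.conj w₁ ^ 2 * D.conj w₂)) * h.h2
    - f 3 * D.r * h.h0 - (δ * w₁ ^ 3 - D.conj δ * D.conj w₁ ^ 3) * h.h3

lemma hessC_eq (h : D.Rep m f w₁ w₂ δ) : ((CubicForm.hessC f : ℤ) : K) * D.r ^ 2 =
    δ * D.conj δ * (D.conj w₁ * w₂ - w₁ * D.conj w₂) ^ 2 * (w₂ * D.conj w₂) := by
  simp only [CubicForm.hessC]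
  push_cast
  linear_combination (f 2 * D.r + (δ * (w₁ * w₂ ^ 2) - D.conj δ * (D.conj w₁ * D.conj w₂ ^ 2))) * h.h2
    - f 3 * D.r * h.h1 - (δ * (w₁ ^ 2 * w₂) - D.conj δ * (D.conj w₁ ^ 2 * D.conj w₂)) * h.h3

variable (hd : Loc.IsFund d)
include hd

lemma disc_eq (h : D.Rep m f w₁ w₂ δ) : CubicForm.disc f = (m : ℤ) ^ 2 * d := by
  have hr := D.r_ne_zero hd
  have hA := h.hessA_eq
  have hB := h.hessB_eq
  have hC := h.hessC_eq
  have hm := h.hm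
  have key : ((CubicForm.disc f : ℤ) : K) * D.r ^ 4 = (((m : ℤ) ^ 2 * d : ℤ) : K) * D.r ^ 4 := by
    simp only [CubicForm.disc]
    push_cast
    set N := δ * D.conj δ
    set a := D.conj w₁
    set b := D.conj w₂
    clear_value N a b
    calc (((CubicForm.hessB f : ℤ) : K) ^ 2 - 4 * ((CubicForm.hessA f : ℤ) : K) * ((CubicForm.hessC f : ℤ) : K)) * D.r ^ 4
        = (((CubicForm.hessB f : ℤ) : K) * D.r ^ 2) ^ 2
          - 4 * (((CubicForm.hessA f : ℤ) : K) * D.r ^ 2) * (((CubicForm.hessC f : ℤ) : K) * D.r ^ 2) := by ring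
      _ = (N * (a * w₂ - w₁ * b) ^ 3) ^ 2 := by rw [hA, hB, hC]; ring
      _ = (m : K) ^ 2 * d * D.r ^ 4 := by rw [hm, ← D.r_sq]; ring
  exact_mod_cast mul_right_cancel₀ (pow_ne_zero 4 hr) key

variable (hm0 : 0 < m)
include hm0

lemma ne_zero (h : D.Rep m f w₁ w₂ δ) :
    δ ≠ 0 ∧ w₁ ≠ 0 ∧ w₂ ≠ 0 ∧ D.conj w₁ * w₂ - w₁ * D.conj w₂ ≠ 0 := by
  have hr := D.r_ne_zero hd
  have hm1 : (m : K) ≠ 0 := by exact_mod_cast hm0.ne'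
  have h4 : D.conj w₁ * w₂ - w₁ * D.conj w₂ ≠ 0 := by
    intro h0
    have := h.hm
    rw [h0] at this
    simp [hm1, hr] at this
  refine ⟨?_, ?_, ?_, h4⟩
  · rintro rfl
    have := h.hm
    simp [hm1, hr] at this
  · rintro rfl; simp at h4
  · rintro rfl; simp at h4

/-- The form determines the pair up to scaling. -/
lemma unique {w₁' w₂' δ' : K} (h : D.Rep m f w₁ w₂ δ) (h' : D.Rep m f w₁' w₂' δ') :
    ∃ k : K, k ≠ 0 ∧ w₁' = k * w₁ ∧ w₂' = k * w₂ ∧ δ' = (k ^ 3)⁻¹ * δ := by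
  have hr := D.r_ne_zero hd
  have hA : ∀ {w₁ w₂ δ : K}, D.Rep m f w₁ w₂ δ → ((CubicForm.hessA f : ℤ) : K) ≠ 0 ∧
      2 * ((CubicForm.hessA f : ℤ) : K) * w₂ = (((CubicForm.hessB f : ℤ) : K) + m * D.r) * w₁ := by
    intro w₁ w₂ δ h
    obtain ⟨n1, n2, n3, n4⟩ := h.ne_zero hd hm0
    have hA := h.hessA_eq
    have hB := h.hessB_eq
    constructor
    · intro h0
      rw [h0, zero_mul] at hA
      have n5 := D.conj_ne_zero n1
      have n6 := D.conj_ne_zero n2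
      exact (mul_ne_zero (mul_ne_zero (mul_ne_zero n1 n5) (pow_ne_zero 2 n4))
        (mul_ne_zero n2 n6)) hA.symm
    · refine mul_right_cancel₀ (pow_ne_zero 2 hr) ?_
      linear_combination 2 * w₂ * hA - w₁ * hB + w₁ * h.hm
  obtain ⟨a0, a1⟩ := hA h
  obtain ⟨-, a1'⟩ := hA h'
  obtain ⟨n1, n2, n3, n4⟩ := h.ne_zero hd hm0
  obtain ⟨n1', n2', n3', n4'⟩ := h'.ne_zero hd hm0
  have e2 : w₂' = w₁' / w₁ * w₂ := by grind
  have hk : w₁' / w₁ ≠ 0 := div_ne_zero n2' n2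
  refine ⟨w₁' / w₁, hk, by field_simp, e2, ?_⟩
  have hs := h.scale hk
  have e1 : w₁' / w₁ * w₁ = w₁' := by field_simp
  rw [← e2, e1] at hs
  set δ₂ := ((w₁' / w₁) ^ 3)⁻¹ * δ
  clear_value δ₂
  have c0 := h'.h0.symm.trans hs.h0
  have c1 := h'.h1.symm.trans hs.h1
  have key : (δ' - δ₂) * (w₁' ^ 2 * (D.conj w₁' * w₂' - w₁' * D.conj w₂')) = 0 := by
    linear_combination D.conj w₁' * c1 - D.conj w₂' * c0
  have := (mul_eq_zero.1 key).resolve_right (mul_ne_zero (pow_ne_zero 2 n2') n4')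
  linear_combination this

/-- Two bases of the same ideal give equivalent forms. -/
lemma orb_eq {f' : Fin 4 → ℤ} {w₁' w₂' : K} {I : FractionalIdeal (𝓞 K)⁰ K}
    (hI : ZGen I w₁ w₂) (hI' : ZGen I w₁' w₂')
    (h : D.Rep m f w₁ w₂ δ) (h' : D.Rep m f' w₁' w₂' δ) :
    CubicForm.orb f = CubicForm.orb f' := by
  have hr := D.r_ne_zero hd
  obtain ⟨n1, n2, n3, n4⟩ := h.ne_zero hd hm0
  obtain ⟨a, c, hac⟩ := (hI _).1 hI'.left
  obtain ⟨b, e, hbe⟩ := (hI _).1 hI'.right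
  have hcov : D.conj w₁' * w₂' - w₁' * D.conj w₂' =
      ((a * e - b * c : ℤ) : K) * (D.conj w₁ * w₂ - w₁ * D.conj w₂) := by
    rw [hac, hbe]; simp only [map_add, map_mul, map_intCast]; push_cast; ring
  have hdet : a * e - b * c = 1 := by
    have h1 := h.hm.trans h'.hm.symm
    rw [hcov] at h1
    have h2 : ((a * e - b * c : ℤ) : K) ^ 3 = 1 := by
      have n5 : δ * D.conj δ * (D.conj w₁ * w₂ - w₁ * D.conj w₂) ^ 3 ≠ 0 :=
        mul_ne_zero (mul_ne_zero n1 (D.conj_ne_zero n1)) (pow_ne_zero 3 n4)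
      refine mul_left_cancel₀ n5 ?_
      linear_combination -h1
    have h3 : (a * e - b * c) ^ 3 = 1 ^ 3 := by rw [one_pow]; exact_mod_cast h2
    exact (Odd.strictMono_pow (by decide : Odd 3)).injective h3
  have hdet' : (!![a, b; c, e] : Matrix (Fin 2) (Fin 2) ℤ).det = 1 := by
    rw [Matrix.det_fin_two]; simpa using hdet
  rw [CubicForm.orb_eq_iff]
  refine ⟨⟨!![a, b; c, e], hdet'⟩, ?_⟩
  have hs := h.act _ hdet'
  simp only [Matrix.of_apply, Matrix.cons_val', Matrix.cons_val_zero, Matrix.cons_val_fin_one,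
    Matrix.cons_val_one] at hs
  rw [← hac, ← hbe] at hs
  have e : ∀ {x y : ℤ}, (x : K) * D.r = y * D.r → x = y := fun h => by
    exact_mod_cast mul_right_cancel₀ hr h
  funext i
  fin_cases i
  · exact e (h'.h0.trans hs.h0.symm)
  · exact e (h'.h1.trans hs.h1.symm)
  · exact e (h'.h2.trans hs.h2.symm)
  · exact e (h'.h3.trans hs.h3.symm)

end Rep

end QuadData

lemma Loc.IsFund.four_dvd {d : ℤ} (hd : IsFund d) : ∃ k, d ^ 2 - d = 4 * k := by
  obtain ⟨k, hk⟩ | ⟨k, hk⟩ : (∃ k, d = 4 * k) ∨ ∃ k, d = 4 * k + 1 := by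
    rcases hd.emod_two with h | h | h
    · exact Or.inr ⟨d / 4, by omega⟩
    · exact Or.inl ⟨d / 4, by omega⟩
    · exact Or.inl ⟨d / 4, by omega⟩
  · exact ⟨4 * k ^ 2 - k, by rw [hk]; ring⟩
  · exact ⟨4 * k ^ 2 + k, by rw [hk]; ring⟩

namespace QuadData

variable {K : Type*} [Field K] [NumberField K] {d : ℤ} (D : QuadData K d) (hd : Loc.IsFund d)
include hd

/-- The generator `(d + √d)/2` of the ring of integers. -/
noncomputable def tau : 𝓞 K :=
  ⟨(d + D.r) / 2, (D.isIntegral_iff hd _).2 <| by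
    obtain ⟨k, hk⟩ := hd.four_dvd
    exact ⟨d, 1, k, by push_cast; ring, by rw [← hk]; ring⟩⟩

lemma coe_tau : (D.tau hd : K) = (d + D.r) / 2 := rfl

lemma exists_int_coord (z : 𝓞 K) : ∃ x y : ℤ, z = x + y * D.tau hd := by
  obtain ⟨a, b, k, h1, h2⟩ := (D.isIntegral_iff hd z).1 z.isIntegral_coe
  obtain ⟨l, hl⟩ := hd.four_dvd
  have h3 : ∃ x, a - d * b = 2 * x := by
    have : (2 : ℤ) ∣ (a - d * b) ^ 2 := by
      refine ⟨2 * k + d * b ^ 2 - d * a * b + 2 * l * b ^ 2, ?_⟩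
      linear_combination h2 + b ^ 2 * hl
    exact Int.prime_two.dvd_of_dvd_pow this
  obtain ⟨x, hx⟩ := h3
  refine ⟨x, b, RingOfIntegers.ext ?_⟩
  have hx' : (a : K) - d * b = 2 * x := by exact_mod_cast hx
  simp only [map_add, map_mul, map_intCast, coe_tau]
  linear_combination (h1 + hx') / 2

lemma coe_exists_int_coord (z : 𝓞 K) : ∃ x y : ℤ, (z : K) = x + y * ((d + D.r) / 2) := by
  obtain ⟨x, y, h⟩ := D.exists_int_coord hd z
  exact ⟨x, y, by rw [h]; simp [coe_tau]⟩

omit hd in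
/-- A generating pair of nonzero covolume is a basis. -/
lemma exists_basis {M : Type*} [AddCommGroup M] (φ : M →+ K)
    (v₀ v₁ : M) (hv : ∀ z, ∃ a b : ℤ, z = a • v₀ + b • v₁)
    (h0 : D.conj (φ v₀) * φ v₁ - φ v₀ * D.conj (φ v₁) ≠ 0) :
    ∃ b : Module.Basis (Fin 2) ℤ M, b 0 = v₀ ∧ b 1 = v₁ := by
  have hli : LinearIndependent ℤ ![v₀, v₁] := by
    rw [LinearIndependent.pair_iff]
    intro a b hab
    have h1 := congrArg φ hab
    simp only [map_add, map_zsmul, map_zero, zsmul_eq_mul] at h1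
    have h2 := congrArg D.conj h1
    simp only [map_add, map_mul, map_intCast, map_zero] at h2
    have ha : (a : K) = 0 := by grind
    have hb : (b : K) = 0 := by grind
    exact ⟨by exact_mod_cast ha, by exact_mod_cast hb⟩
  have hsp : ⊤ ≤ Submodule.span ℤ (Set.range ![v₀, v₁]) := by
    intro z _
    obtain ⟨a, b, rfl⟩ := hv z
    exact add_mem (Submodule.smul_mem _ _ (Submodule.subset_span ⟨0, rfl⟩))
      (Submodule.smul_mem _ _ (Submodule.subset_span ⟨1, rfl⟩))
  exact ⟨Module.Basis.mk hli hsp, by simp, by simp⟩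

lemma exists_int_basis : ∃ b : Module.Basis (Fin 2) ℤ (𝓞 K), b 0 = 1 ∧ b 1 = D.tau hd := by
  have hr := D.r_ne_zero hd
  exact D.exists_basis (M := 𝓞 K) (algebraMap (𝓞 K) K).toAddMonoidHom 1
    (D.tau hd) (fun z => by
      obtain ⟨x, y, h⟩ := D.exists_int_coord hd z
      exact ⟨x, y, by simpa using h⟩) (by
      have h2 : D.conj 2 = 2 := map_ofNat _ 2
      have : D.conj 1 * (D.tau hd : K) - 1 * D.conj (D.tau hd : K) ≠ 0 := by
        rw [coe_tau]
        simp only [map_one, map_add, map_div₀, map_intCast, D.conj_r, h2]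
        convert hr using 1
        ring
      simpa using this)

/-- The norm of an ideal is the covolume of a basis. -/
lemma absNorm_eq {I : FractionalIdeal (𝓞 K)⁰ K} {w₁ w₂ : K} (hI : ZGen I w₁ w₂) {n : ℚ}
    (hn : n ≠ 0) (h : D.conj w₁ * w₂ - w₁ * D.conj w₂ = n * D.r) :
    FractionalIdeal.absNorm I = |n| := by
  have hr := D.r_ne_zero hd
  obtain ⟨b₀, h00, h01⟩ := D.exists_int_basis hd
  obtain ⟨bI, h10, h11⟩ := D.exists_basis (M := I)
    ((Submodule.subtype (I : Submodule (𝓞 K) K)).toAddMonoidHom) ⟨w₁, hI.left⟩ ⟨w₂, hI.right⟩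
    (fun z => by
      obtain ⟨a, b, h⟩ := (hI z).1 z.2
      refine ⟨a, b, Subtype.ext ?_⟩
      rw [h]
      simp) (by
      have : (n : K) * D.r ≠ 0 := mul_ne_zero (by exact_mod_cast hn) hr
      rw [← h] at this
      exact this)
  rw [← FractionalIdeal.abs_det_basis_change b₀ I bI]
  congr 1
  set b' := b₀.localizationLocalization ℚ ℤ⁰ K with hb'
  have hrep : ∀ z : K, z = (b'.repr z 0 : ℚ) + (b'.repr z 1 : ℚ) * ((d + D.r) / 2) := by
    intro z
    conv_lhs => rw [← b'.sum_repr z]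
    rw [Fin.sum_univ_two, hb', Module.Basis.localizationLocalization_apply,
      Module.Basis.localizationLocalization_apply, h00, h01, ← coe_tau D hd]
    simp [Algebra.smul_def]
  rw [Module.Basis.det_apply, Matrix.det_fin_two]
  simp only [Module.Basis.toMatrix_apply, Function.comp, h10, h11]
  have e1 := hrep w₁
  have e2 := hrep w₂
  set x₁ := b'.repr w₁ 0
  set y₁ := b'.repr w₁ 1
  set x₂ := b'.repr w₂ 0
  set y₂ := b'.repr w₂ 1
  clear_value x₁ y₁ x₂ y₂
  rw [e1, e2] at h
  have h2 : D.conj 2 = 2 := map_ofNat _ 2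
  simp only [map_add, map_mul, conj_ratCast, map_div₀, map_intCast, D.conj_r, h2] at h
  have : ((x₁ * y₂ - x₂ * y₁ : ℚ) : K) = n := by
    refine mul_right_cancel₀ hr ?_
    push_cast
    linear_combination h
  exact_mod_cast this

omit hd in
lemma exists_norm (z : K) : ∃ N : ℚ, z * D.conj z = N := by
  obtain ⟨u, v, rfl⟩ := D.exists_coord z
  refine ⟨u ^ 2 - d * v ^ 2, ?_⟩
  simp only [map_add, map_mul, conj_ratCast, D.conj_r]
  push_cast
  linear_combination -(v : K) ^ 2 * D.r_sq

omit hd in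
lemma exists_cov (z w : K) : ∃ n : ℚ, D.conj z * w - z * D.conj w = n * D.r := by
  obtain ⟨u, v, rfl⟩ := D.exists_coord z
  obtain ⟨u', v', rfl⟩ := D.exists_coord w
  refine ⟨2 * (u * v' - v * u'), ?_⟩
  simp only [map_add, map_mul, conj_ratCast, D.conj_r]
  push_cast
  ring

lemma absNorm_spanSingleton {z : K} (hz : z ≠ 0) {N : ℚ} (hN : z * D.conj z = N) :
    FractionalIdeal.absNorm (FractionalIdeal.spanSingleton (𝓞 K)⁰ z) = |N| := by
  have hN0 : N ≠ 0 := by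
    rintro rfl
    exact mul_ne_zero hz (D.conj_ne_zero hz) (by simpa using hN)
  refine D.absNorm_eq hd (w₁ := z) (w₂ := z * D.tau hd) (fun w => ?_) hN0 ?_
  · rw [FractionalIdeal.mem_spanSingleton]
    constructor
    · rintro ⟨y, rfl⟩
      obtain ⟨a, b, rfl⟩ := D.exists_int_coord hd y
      refine ⟨a, b, ?_⟩
      simp only [Algebra.smul_def, map_add, map_mul, map_intCast]
      ring
    · rintro ⟨a, b, rfl⟩
      refine ⟨a + b * D.tau hd, ?_⟩
      simp only [Algebra.smul_def, map_add, map_mul, map_intCast]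
      ring
  · rw [← hN, coe_tau]
    have h2 : D.conj 2 = 2 := map_ofNat _ 2
    simp only [map_add, map_mul, map_div₀, map_intCast, D.conj_r, h2]
    ring

lemma absNorm_mul_pow {I : FractionalIdeal (𝓞 K)⁰ K} {w₁ w₂ δ : K} (hI : ZGen I w₁ w₂) {n N : ℚ}
    (hn : n ≠ 0) (h : D.conj w₁ * w₂ - w₁ * D.conj w₂ = n * D.r) (hδ : δ ≠ 0)
    (hN : δ * D.conj δ = N) :
    FractionalIdeal.absNorm (FractionalIdeal.spanSingleton (𝓞 K)⁰ δ * I ^ 3) = |N * n ^ 3| := by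
  rw [map_mul, map_pow, D.absNorm_spanSingleton hd hδ hN, D.absNorm_eq hd hI hn h, abs_mul,
    abs_pow]

lemma exists_zgen (I : (FractionalIdeal (𝓞 K)⁰ K)ˣ) : ∃ w₁ w₂ : K, ZGen I.1 w₁ w₂ ∧
    D.conj w₁ * w₂ - w₁ * D.conj w₂ ≠ 0 := by
  have hrank : Module.finrank ℤ I.1 = 2 := by
    obtain ⟨b, -⟩ := D.exists_int_basis hd
    rw [fractionalIdeal_rank, Module.finrank_eq_card_basis b, Fintype.card_fin]
  let b : Module.Basis (Fin 2) ℤ I.1 := Module.finBasisOfFinrankEq ℤ I.1 hrank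
  have hc : ∀ x y : ℤ, ((x • b 0 + y • b 1 : I.1) : K) = x * b 0 + y * b 1 := by simp
  have hmem : ∀ z : K, z ∈ I.1 ↔ ∃ x y : ℤ, z = x * b 0 + y * b 1 := by
    intro z
    constructor
    · intro hz
      refine ⟨b.repr ⟨z, hz⟩ 0, b.repr ⟨z, hz⟩ 1, ?_⟩
      have := congrArg (fun z : I.1 => (z : K)) (b.sum_repr ⟨z, hz⟩)
      simp only [Fin.sum_univ_two] at this
      exact this.symm.trans (hc _ _)
    · rintro ⟨x, y, rfl⟩
      rw [← hc]
      exact (x • b 0 + y • b 1 : I.1).2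
  refine ⟨b 0, b 1, hmem, fun h => ?_⟩
  have hli := b.linearIndependent
  rw [show (b : Fin 2 → I.1) = ![b 0, b 1] by funext i; fin_cases i <;> rfl,
    LinearIndependent.pair_iff] at hli
  have hb0 : ((b 0 : I.1) : K) ≠ 0 := by
    intro h0
    have := hli 1 0 (Subtype.ext (by simp [h0]))
    simp at this
  obtain ⟨q, hq⟩ := D.exists_rat_of_conj hd (z := (b 1 : K) / (b 0 : K)) (by
    rw [map_div₀, div_eq_div_iff (D.conj_ne_zero hb0) hb0]
    linear_combination -h)
  rw [div_eq_iff hb0] at hq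
  have hqe : (q : K) * q.den = q.num := by
    have := Rat.mul_den_eq_num q
    exact_mod_cast congrArg (Rat.cast : ℚ → K) this
  have := hli q.num (-q.den) (Subtype.ext (by
    refine (hc _ _).trans ?_
    rw [hq, ← hqe]
    push_cast
    ring))
  have h2 : q.den = 0 := by exact_mod_cast neg_eq_zero.1 this.2
  exact q.den_nz h2

/-- Norms of elements of an ideal are divisible by the norm of the ideal. -/
lemma exists_norm_dvd {I : FractionalIdeal (𝓞 K)⁰ K} {w₁ w₂ : K} (hI : ZGen I w₁ w₂) (x y : ℤ) :
    ∃ q : ℤ, ((x * w₁ + y * w₂) * D.conj (x * w₁ + y * w₂)) * D.r =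
      q * (D.conj w₁ * w₂ - w₁ * D.conj w₂) := by
  have hmem : (D.tau hd : K) * (x * w₁ + y * w₂) ∈ I := by
    have := (I : Submodule (𝓞 K) K).smul_mem (D.tau hd) ((hI _).2 ⟨x, y, rfl⟩)
    simpa [Algebra.smul_def] using this
  obtain ⟨p, q, hpq⟩ := (hI _).1 hmem
  refine ⟨x * q - y * p, ?_⟩
  have h2 : D.conj 2 = 2 := map_ofNat _ 2
  rw [coe_tau] at hpq
  have hpq' := congrArg D.conj hpq
  simp only [map_add, map_mul, map_div₀, map_intCast, D.conj_r, h2] at hpq' ⊢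
  push_cast
  linear_combination (x * D.conj w₁ + y * D.conj w₂) * hpq - (x * w₁ + y * w₂) * hpq'

omit hd in
lemma mul3_mem {I : FractionalIdeal (𝓞 K)⁰ K} {δ : K} {J : Ideal (𝓞 K)}
    (h : FractionalIdeal.spanSingleton (𝓞 K)⁰ δ * I ^ 3 = J) {x y z : K} (hx : x ∈ I) (hy : y ∈ I)
    (hz : z ∈ I) : ∃ w : 𝓞 K, δ * (x * y * z) = w := by
  have h1 : δ * (x * y * z) ∈ FractionalIdeal.spanSingleton (𝓞 K)⁰ δ * I ^ 3 := by
    rw [pow_succ, pow_two]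
    exact FractionalIdeal.mul_mem_mul (FractionalIdeal.mem_spanSingleton_self _ _)
      (FractionalIdeal.mul_mem_mul (FractionalIdeal.mul_mem_mul hx hy) hz)
  rw [h, FractionalIdeal.mem_coeIdeal] at h1
  obtain ⟨w, -, hw⟩ := h1
  exact ⟨w, hw.symm⟩

lemma exists_im (w : 𝓞 K) : ∃ b : ℤ, (b : K) * D.r = w - D.conj w := by
  obtain ⟨x, y, h⟩ := D.coe_exists_int_coord hd w
  refine ⟨y, ?_⟩
  have h2 : D.conj 2 = 2 := map_ofNat _ 2
  rw [h]
  simp only [map_add, map_mul, map_div₀, map_intCast, D.conj_r, h2]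
  ring

/-- Every pair `(I, δ)` with `δI³` integral of norm `m` comes from a form. -/
lemma exists_form {m : ℕ} (I : (FractionalIdeal (𝓞 K)⁰ K)ˣ) {δ : K} (hδ : δ ≠ 0)
    {J : Ideal (𝓞 K)} (hJ : FractionalIdeal.spanSingleton (𝓞 K)⁰ δ * I.1 ^ 3 = J)
    (hJm : Ideal.absNorm J = m) : ∃ w₁ w₂ : K, ∃ f : Fin 4 → ℤ, ZGen I.1 w₁ w₂ ∧
      D.Rep m f w₁ w₂ δ ∧ CubicForm.HessDvd m f := by
  have hr := D.r_ne_zero hd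
  obtain ⟨w₁, w₂, hI, hcov, hN⟩ : ∃ w₁ w₂ : K, ZGen I.1 w₁ w₂ ∧
      D.conj w₁ * w₂ - w₁ * D.conj w₂ ≠ 0 ∧
      δ * D.conj δ * (D.conj w₁ * w₂ - w₁ * D.conj w₂) ^ 3 = m * D.r ^ 3 := by
    obtain ⟨w₁, w₂, hI, h0⟩ := D.exists_zgen hd I
    obtain ⟨n, hn⟩ := D.exists_cov w₁ w₂
    obtain ⟨N, hN⟩ := D.exists_norm δ
    have hn0 : n ≠ 0 := by
      rintro rfl
      exact h0 (by simpa using hn)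
    have h1 := D.absNorm_mul_pow hd hI hn0 hn hδ hN
    rw [hJ, FractionalIdeal.coeIdeal_absNorm, hJm] at h1
    rcases abs_choice (N * n ^ 3) with h2 | h2
    · refine ⟨w₁, w₂, hI, h0, ?_⟩
      rw [h2] at h1
      have h3 : (m : K) = N * n ^ 3 := by exact_mod_cast congrArg (Rat.cast : ℚ → K) h1
      rw [hn, hN, h3]; ring
    · refine ⟨w₂, w₁, fun z => ?_, fun h => h0 (by linear_combination -h), ?_⟩
      · rw [hI z]
        constructor <;> rintro ⟨a, b, rfl⟩ <;> exact ⟨b, a, by ring⟩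
      · rw [h2] at h1
        have h3 : (m : K) = -(N * n ^ 3) := by exact_mod_cast congrArg (Rat.cast : ℚ → K) h1
        rw [show D.conj w₂ * w₁ - w₂ * D.conj w₁ = -(n * D.r) by rw [← hn]; ring, hN, h3]; ring
  have him : ∀ {x y z : K}, x ∈ I.1 → y ∈ I.1 → z ∈ I.1 → ∃ b : ℤ, (b : K) * D.r =
      δ * (x * y * z) - D.conj δ * (D.conj x * D.conj y * D.conj z) := by
    intro x y z hx hy hz
    obtain ⟨w, hw⟩ := mul3_mem hJ hx hy hz
    obtain ⟨b, hb⟩ := D.exists_im hd w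
    refine ⟨b, ?_⟩
    rw [hb, ← hw]
    simp only [map_mul]
  obtain ⟨f₀, hf₀⟩ := him hI.left hI.left hI.left
  obtain ⟨f₁, hf₁⟩ := him hI.left hI.left hI.right
  obtain ⟨f₂, hf₂⟩ := him hI.left hI.right hI.right
  obtain ⟨f₃, hf₃⟩ := him hI.right hI.right hI.right
  have hrep : D.Rep m ![f₀, f₁, f₂, f₃] w₁ w₂ δ :=
    ⟨by simp only [Matrix.cons_val]; rw [hf₀]; ring, by simp only [Matrix.cons_val]; rw [hf₁]; ring,
      by simp only [Matrix.cons_val]; rw [hf₂]; ring, by simp only [Matrix.cons_val]; rw [hf₃]; ring,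
      hN⟩
  refine ⟨w₁, w₂, _, hI, hrep, ?_⟩
  obtain ⟨q₁, h1⟩ := D.exists_norm_dvd hd hI 1 0
  obtain ⟨q₂, h2⟩ := D.exists_norm_dvd hd hI 0 1
  obtain ⟨q₃, h3⟩ := D.exists_norm_dvd hd hI 1 1
  have hA := hrep.hessA_eq
  have hB := hrep.hessB_eq
  have hC := hrep.hessC_eq
  set f : Fin 4 → ℤ := ![f₀, f₁, f₂, f₃]
  simp only [map_add, Int.cast_one, Int.cast_zero, one_mul, zero_mul, add_zero, zero_add] at h1 h2 h3
  have e : ∀ {x y : ℤ}, (x : K) * D.r ^ 3 = y * D.r ^ 3 → x = y := fun h => by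
    exact_mod_cast mul_right_cancel₀ (pow_ne_zero 3 hr) h
  set a := D.conj w₁
  set b := D.conj w₂
  set c := D.conj δ
  clear_value a b c f
  refine ⟨⟨q₁, e ?_⟩, ⟨q₃ - q₁ - q₂, e ?_⟩, ⟨q₂, e ?_⟩⟩
  · push_cast
    linear_combination D.r * hA + δ * c * (a * w₂ - w₁ * b) ^ 2 * h1 + q₁ * hN
  · push_cast
    linear_combination D.r * hB + δ * c * (a * w₂ - w₁ * b) ^ 2 * (h3 - h1 - h2)
      + (q₃ - q₁ - q₂) * hN
  · push_cast
    linear_combination D.r * hC + δ * c * (a * w₂ - w₁ * b) ^ 2 * h2 + q₂ * hN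

/-- A lattice in `K` stable under `√d`-multiplication, as a fractional ideal. -/
lemma exists_ideal {w₁ w₂ : K} (h1 : ∃ a b : ℤ, (d + D.r) / 2 * w₁ = a * w₁ + b * w₂)
    (h2 : ∃ a b : ℤ, (d + D.r) / 2 * w₂ = a * w₁ + b * w₂) (h0 : w₁ ≠ 0) :
    ∃ I : (FractionalIdeal (𝓞 K)⁰ K)ˣ, ZGen I.1 w₁ w₂ := by
  let J : FractionalIdeal (𝓞 K)⁰ K :=
    FractionalIdeal.spanSingleton _ w₁ + FractionalIdeal.spanSingleton _ w₂
  have hJ : ZGen J w₁ w₂ := by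
    intro z
    simp only [J, FractionalIdeal.mem_add, FractionalIdeal.mem_spanSingleton]
    constructor
    · rintro ⟨_, ⟨x, rfl⟩, _, ⟨y, rfl⟩, rfl⟩
      obtain ⟨p, q, hx⟩ := D.coe_exists_int_coord hd x
      obtain ⟨s, t, hy⟩ := D.coe_exists_int_coord hd y
      obtain ⟨a, b, hab⟩ := h1
      obtain ⟨a', b', hab'⟩ := h2
      refine ⟨p + q * a + t * a', q * b + s + t * b', ?_⟩
      rw [Algebra.smul_def, Algebra.smul_def]
      push_cast
      linear_combination w₁ * hx + w₂ * hy + (q : K) * hab + t * hab'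
    · rintro ⟨a, b, rfl⟩
      exact ⟨a * w₁, ⟨a, by simp [Algebra.smul_def]⟩, b * w₂, ⟨b, by simp [Algebra.smul_def]⟩, rfl⟩
  have hne : J ≠ 0 := by
    intro h
    have := hJ.left
    rw [h, FractionalIdeal.mem_zero_iff] at this
    exact h0 this
  exact ⟨Units.mk0 J hne, hJ⟩

omit hd in
lemma exists_cube_le {I : FractionalIdeal (𝓞 K)⁰ K} {w₁ w₂ δ : K} (hI : ZGen I w₁ w₂)
    (h0 : IsIntegral ℤ (δ * w₁ ^ 3)) (h1 : IsIntegral ℤ (δ * (w₁ ^ 2 * w₂)))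
    (h2 : IsIntegral ℤ (δ * (w₁ * w₂ ^ 2))) (h3 : IsIntegral ℤ (δ * w₂ ^ 3)) :
    ∃ J : Ideal (𝓞 K), FractionalIdeal.spanSingleton (𝓞 K)⁰ δ * I ^ 3 = J := by
  suffices h : FractionalIdeal.spanSingleton (𝓞 K)⁰ δ * I ^ 3 ≤ 1 by
    obtain ⟨J, hJ⟩ := FractionalIdeal.le_one_iff_exists_coeIdeal.1 h
    exact ⟨J, hJ.symm⟩
  have hz : ∀ n : ℤ, IsIntegral ℤ (n : K) := fun n => isIntegral_algebraMap (R := ℤ) (A := K) (x := n)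
  have key : ∀ x ∈ I, ∀ y ∈ I, ∀ z ∈ I, IsIntegral ℤ (δ * (x * y * z)) := by
    intro x hx y hy z hz'
    obtain ⟨a, b, rfl⟩ := (hI _).1 hx
    obtain ⟨a', b', rfl⟩ := (hI _).1 hy
    obtain ⟨a'', b'', rfl⟩ := (hI _).1 hz'
    have e : δ * ((a * w₁ + b * w₂) * (a' * w₁ + b' * w₂) * (a'' * w₁ + b'' * w₂)) =
      ((a * a' * a'' : ℤ) : K) * (δ * w₁ ^ 3)
      + ((a * a' * b'' + a * b' * a'' + b * a' * a'' : ℤ) : K) * (δ * (w₁ ^ 2 * w₂))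
      + ((a * b' * b'' + b * a' * b'' + b * b' * a'' : ℤ) : K) * (δ * (w₁ * w₂ ^ 2))
      + ((b * b' * b'' : ℤ) : K) * (δ * w₂ ^ 3) := by push_cast; ring
    rw [e]
    exact ((((hz _).mul h0).add ((hz _).mul h1)).add ((hz _).mul h2)).add ((hz _).mul h3)
  rw [show FractionalIdeal.spanSingleton (𝓞 K)⁰ δ * I ^ 3 =
    I * (I * (I * FractionalIdeal.spanSingleton (𝓞 K)⁰ δ)) by ring]
  have key2 : ∀ x ∈ I, ∀ y ∈ I, ∀ z ∈ I, ∀ w : 𝓞 K,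
      x * (y * (z * (w • δ))) ∈ (1 : FractionalIdeal (𝓞 K)⁰ K) := by
    intro x hx y hy z hz w
    rw [FractionalIdeal.mem_one_iff]
    obtain ⟨v, hv⟩ : ∃ v : 𝓞 K, algebraMap (𝓞 K) K v = δ * (x * y * z) :=
      ⟨⟨_, key x hx y hy z hz⟩, rfl⟩
    refine ⟨w * v, ?_⟩
    rw [map_mul, hv, Algebra.smul_def]
    ring
  rw [FractionalIdeal.mul_le]
  intro x hx
  suffices h : FractionalIdeal.spanSingleton (𝓞 K)⁰ x *
      (I * (I * FractionalIdeal.spanSingleton (𝓞 K)⁰ δ)) ≤ 1 from fun j hj =>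
    h (FractionalIdeal.mem_singleton_mul.2 ⟨j, hj, rfl⟩)
  rw [mul_left_comm, FractionalIdeal.mul_le]
  intro y hy
  suffices h : FractionalIdeal.spanSingleton (𝓞 K)⁰ y * (FractionalIdeal.spanSingleton (𝓞 K)⁰ x *
      (I * FractionalIdeal.spanSingleton (𝓞 K)⁰ δ)) ≤ 1 from fun j hj =>
    h (FractionalIdeal.mem_singleton_mul.2 ⟨j, hj, rfl⟩)
  rw [mul_left_comm _ I, mul_left_comm _ I, FractionalIdeal.mul_le]
  intro z hz j hj
  rw [FractionalIdeal.spanSingleton_mul_spanSingleton,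
    FractionalIdeal.spanSingleton_mul_spanSingleton, FractionalIdeal.mem_spanSingleton] at hj
  obtain ⟨w, rfl⟩ := hj
  have := key2 x hx y hy z hz w
  convert this using 1
  simp only [Algebra.smul_def]
  ring

/-- Every form comes from a pair `(I, δ)`. -/
lemma exists_pair {m : ℕ} (hm : 0 < m) {f : Fin 4 → ℤ} (hf : CubicForm.HessDvd m f)
    (hdisc : CubicForm.disc f = (m : ℤ) ^ 2 * d) : ∃ I : (FractionalIdeal (𝓞 K)⁰ K)ˣ,
      ∃ w₁ w₂ δ : K, ∃ J : Ideal (𝓞 K), δ ≠ 0 ∧ ZGen I.1 w₁ w₂ ∧ D.Rep m f w₁ w₂ δ ∧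
      FractionalIdeal.spanSingleton (𝓞 K)⁰ δ * I.1 ^ 3 = J ∧ Ideal.absNorm J = m := by
  have hr := D.r_ne_zero hd
  have hrr := D.r_sq
  have h2 : D.conj 2 = 2 := map_ofNat _ 2
  have hm0 : (m : ℤ) ≠ 0 := by exact_mod_cast hm.ne'
  obtain ⟨⟨A, hA⟩, ⟨B, hB⟩, ⟨C, hC⟩⟩ := hf
  have hABC : B ^ 2 - 4 * A * C = d := by
    refine mul_left_cancel₀ (pow_ne_zero 2 hm0) ?_
    rw [← hdisc, CubicForm.disc, hA, hB, hC]; ring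
  have hA0 : A ≠ 0 := by
    rintro rfl
    exact hd.ne_sq B (by rw [← hABC]; ring)
  -- the two syzygies between the form and its Hessian
  have s1 : A * f 2 = B * f 1 - C * f 0 := by
    refine mul_left_cancel₀ hm0 ?_
    linear_combination (norm := (simp only [CubicForm.hessA, CubicForm.hessB, CubicForm.hessC]; ring))
      -f 2 * hA + f 1 * hB - f 0 * hC
  have s2 : A * f 3 = B * f 2 - C * f 1 := by
    refine mul_left_cancel₀ hm0 ?_
    linear_combination (norm := (simp only [CubicForm.hessA, CubicForm.hessB, CubicForm.hessC]; ring))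
      -f 3 * hA + f 2 * hB - f 1 * hC
  have s3 : A * f 1 ^ 2 - B * f 0 * f 1 + C * f 0 ^ 2 = m * A ^ 2 := by
    refine mul_left_cancel₀ hm0 ?_
    have hA2 : CubicForm.hessA f ^ 2 = (m * A) ^ 2 := by rw [hA]
    linear_combination (norm := (simp only [CubicForm.hessA, CubicForm.hessB, CubicForm.hessC]; ring))
      -f 1 ^ 2 * hA + f 0 * f 1 * hB - f 0 ^ 2 * hC + hA2
  obtain ⟨k, hk⟩ : ∃ k, d - B = 2 * k := by
    have h3 : (2 : ℤ) ∣ d - B := by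
      obtain ⟨l, hl⟩ := hd.four_dvd
      have : (2 : ℤ) ∣ (d - B) ^ 2 := ⟨d + 2 * l - d * B + 2 * A * C, by
          linear_combination hl + hABC⟩
      exact Int.prime_two.dvd_of_dvd_pow this
    exact h3
  have hABCK : (B : K) ^ 2 - 4 * A * C = d := by exact_mod_cast hABC
  have s1K : (A : K) * f 2 = B * f 1 - C * f 0 := by exact_mod_cast s1
  have s2K : (A : K) * f 3 = B * f 2 - C * f 1 := by exact_mod_cast s2
  have s3K : (A : K) * f 1 ^ 2 - B * f 0 * f 1 + C * f 0 ^ 2 = m * A ^ 2 := by exact_mod_cast s3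
  have hkK : (d : K) - B = 2 * k := by exact_mod_cast hk
  have hAK : (A : K) ≠ 0 := by exact_mod_cast hA0
  set t : K := (B + D.r) / (2 * A) with ht
  have htA : 2 * A * t = B + D.r := by rw [ht]; field_simp
  have ht2 : A * t ^ 2 = B * t - C := by
    rw [ht]; field_simp
    linear_combination hrr - hABCK
  have hct : D.conj t = (B - D.r) / (2 * A) := by
    rw [ht]; simp only [map_div₀, map_add, map_mul, map_intCast, D.conj_r, h2]; ring
  set δ : K := (2 * A * f 1 - B * f 0 + f 0 * D.r) / 2 with hδ
  have d0 : 2 * (δ * 1 ^ 3) = ((2 * A * f 1 - B * f 0 : ℤ) : K) + (f 0 : ℤ) * D.r := by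
    rw [hδ]; push_cast; ring
  have step : ∀ (a b x : K) (y : K), 2 * x = a + b * D.r →
      4 * A * (x * t) = (a * B + b * d) + (a + b * B) * D.r := by
    intro a b x y hx
    linear_combination 2 * x * htA + (B + D.r) * hx + b * hrr
  have d1 : 2 * (δ * (1 ^ 2 * t)) = ((B * f 1 - 2 * C * f 0 : ℤ) : K) + (f 1 : ℤ) * D.r := by
    refine mul_left_cancel₀ (mul_ne_zero two_ne_zero hAK) ?_
    have := step _ _ _ 0 d0
    push_cast at this ⊢
    linear_combination this - (f 0 : K) * hABCK
  have d2 : 2 * (δ * (1 * t ^ 2)) = ((B * f 2 - 2 * C * f 1 : ℤ) : K) + (f 2 : ℤ) * D.r := by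
    refine mul_left_cancel₀ (mul_ne_zero two_ne_zero hAK) ?_
    have := step _ _ _ 0 d1
    push_cast at this ⊢
    linear_combination this - (f 1 : K) * hABCK - 2 * (B + D.r) * s1K
  have d3 : 2 * (δ * t ^ 3) = ((B * f 3 - 2 * C * f 2 : ℤ) : K) + (f 3 : ℤ) * D.r := by
    refine mul_left_cancel₀ (mul_ne_zero two_ne_zero hAK) ?_
    have := step _ _ _ 0 d2
    push_cast at this ⊢
    linear_combination this - (f 2 : K) * hABCK - 2 * (B + D.r) * s2K
  have hN : δ * D.conj δ = m * A ^ 3 := by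
    rw [hδ]
    simp only [map_div₀, map_add, map_sub, map_mul, map_intCast, D.conj_r, h2]
    linear_combination (A : K) * s3K - (f 0 : K) ^ 2 / 4 * hrr + (f 0 : K) ^ 2 / 4 * hABCK
  have hcov : D.conj 1 * t - 1 * D.conj t = ((1 / A : ℚ) : K) * D.r := by
    rw [hct, ht, map_one]; push_cast; field_simp; ring
  have hδ0 : δ ≠ 0 := by
    intro h0
    rw [h0, zero_mul] at hN
    have hmK : (m : K) ≠ 0 := by exact_mod_cast hm.ne'
    exact mul_ne_zero hmK (pow_ne_zero 3 hAK) hN.symm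
  obtain ⟨I, hI⟩ := D.exists_ideal hd (w₁ := 1) (w₂ := t)
    ⟨k, A, by linear_combination (-1 / 2 : K) * htA + hkK / 2⟩
    ⟨-C, B + k, by push_cast; linear_combination (-t / 2) * htA + t / 2 * hkK + ht2⟩ one_ne_zero
  have hZ : ∀ {x : K} {a b : ℤ}, 2 * x = (a : K) + b * D.r → (∃ k, a ^ 2 - d * b ^ 2 = 4 * k) →
      IsIntegral ℤ x := by
    rintro x a b h ⟨k, hk⟩
    exact (D.isIntegral_iff hd x).2 ⟨a, b, k, h, hk⟩
  obtain ⟨J, hJ⟩ := exists_cube_le (δ := δ) hI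
    (hZ d0 ⟨A * (A * f 1 ^ 2 - B * f 0 * f 1 + C * f 0 ^ 2), by rw [← hABC]; ring⟩)
    (hZ d1 ⟨C * (A * f 1 ^ 2 - B * f 0 * f 1 + C * f 0 ^ 2), by rw [← hABC]; ring⟩)
    (hZ d2 ⟨C * (A * f 2 ^ 2 - B * f 1 * f 2 + C * f 1 ^ 2), by rw [← hABC]; ring⟩)
    (hZ d3 ⟨C * (A * f 3 ^ 2 - B * f 2 * f 3 + C * f 2 ^ 2), by rw [← hABC]; ring⟩)
  have hre : ∀ {x : K} {a b : ℤ}, 2 * x = (a : K) + b * D.r → (b : K) * D.r = x - D.conj x := by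
    intro x a b h
    have h' := congrArg D.conj h
    simp only [map_mul, map_add, map_intCast, D.conj_r, h2] at h'
    linear_combination (h' - h) / 2
  refine ⟨I, 1, t, δ, J, hδ0, hI, ⟨?_, ?_, ?_, ?_, ?_⟩, hJ, ?_⟩
  · rw [hre d0]; simp only [map_mul, map_pow]
  · rw [hre d1]; simp only [map_mul, map_pow]
  · rw [hre d2]; simp only [map_mul, map_pow]
  · rw [hre d3]; simp only [map_mul, map_pow]
  · rw [hcov, hN]; push_cast; field_simp
  · have h3 := D.absNorm_mul_pow hd hI (n := 1 / A) (N := m * A ^ 3) (by positivity) hcov hδ0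
      (by rw [hN]; push_cast; ring)
    rw [hJ, FractionalIdeal.coeIdeal_absNorm] at h3
    have hAQ : (A : ℚ) ≠ 0 := by exact_mod_cast hA0
    have h4 : (m : ℚ) * A ^ 3 * (1 / A) ^ 3 = m := by field_simp
    rw [h4, abs_of_nonneg (by positivity)] at h3
    exact_mod_cast h3

end QuadData

/-- Two sets in correspondence have equally many classes. -/
lemma Set.ncard_image_eq_of_rel {α β γ γ' : Type*} (R : α → β → Prop) {F : Set α} {P : Set β}
    (q : α → γ) (s : β → γ') (h1 : ∀ f ∈ F, ∃ p ∈ P, R f p) (h2 : ∀ p ∈ P, ∃ f ∈ F, R f p)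
    (h : ∀ f ∈ F, ∀ f' ∈ F, ∀ p ∈ P, ∀ p' ∈ P, R f p → R f' p' → (q f = q f' ↔ s p = s p')) :
    (q '' F).ncard = (s '' P).ncard := by
  let T : Set (γ × γ') := {t | ∃ f ∈ F, ∃ p ∈ P, R f p ∧ t = (q f, s p)}
  have e1 : Prod.fst '' T = q '' F := by
    ext x
    constructor
    · grind
    · rintro ⟨f, hf, rfl⟩
      obtain ⟨p, hp, hfp⟩ := h1 f hf
      exact ⟨_, ⟨f, hf, p, hp, hfp, rfl⟩, rfl⟩
  have e2 : Prod.snd '' T = s '' P := by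
    ext x
    constructor
    · grind
    · rintro ⟨p, hp, rfl⟩
      obtain ⟨f, hf, hfp⟩ := h2 p hp
      exact ⟨_, ⟨f, hf, p, hp, hfp, rfl⟩, rfl⟩
  rw [← e1, ← e2, Set.InjOn.ncard_image, Set.InjOn.ncard_image]
  · rintro _ ⟨f, hf, p, hp, hfp, rfl⟩ _ ⟨f', hf', p', hp', hfp', rfl⟩ he
    exact Prod.ext ((h f hf f' hf' p hp p' hp' hfp hfp').2 he) he
  · rintro _ ⟨f, hf, p, hp, hfp, rfl⟩ _ ⟨f', hf', p', hp', hfp', rfl⟩ he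
    exact Prod.ext he ((h f hf f' hf' p hp p' hp' hfp hfp').1 he)

namespace QuadData

variable {K : Type*} [Field K] [NumberField K] {d : ℤ} (D : QuadData K d) (hd : Loc.IsFund d)

variable (K) in
/-- Scaling of pairs `(I, δ)` by `κ`: `(κI, κ⁻³δ)`. -/
noncomputable def scaleHom : Kˣ →* (FractionalIdeal (𝓞 K)⁰ K)ˣ × Kˣ :=
  (toPrincipalIdeal (𝓞 K) K).prod ((powMonoidHom 3 : Kˣ →* Kˣ)⁻¹)

variable (K) in
/-- The ideal `δI³`. -/
noncomputable def cubeHom : (FractionalIdeal (𝓞 K)⁰ K)ˣ × Kˣ →* (FractionalIdeal (𝓞 K)⁰ K)ˣ :=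
  ((toPrincipalIdeal (𝓞 K) K).comp (MonoidHom.snd _ _)) *
    (powMonoidHom 3).comp (MonoidHom.fst _ _)

lemma coe_cubeHom (I : (FractionalIdeal (𝓞 K)⁰ K)ˣ) (δ : Kˣ) :
    ((cubeHom K (I, δ) : (FractionalIdeal (𝓞 K)⁰ K)ˣ) : FractionalIdeal (𝓞 K)⁰ K) =
      FractionalIdeal.spanSingleton (𝓞 K)⁰ (δ : K) * I.1 ^ 3 := by
  simp [cubeHom]

variable (K) in
/-- Integral ideals of norm `m`. -/
def idealsOfNorm (m : ℕ) : Set (FractionalIdeal (𝓞 K)⁰ K)ˣ :=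
  {x | ∃ J : Ideal (𝓞 K), x.1 = J ∧ Ideal.absNorm J = m}

omit [NumberField K] in
lemma ZGen.ext {I I' : FractionalIdeal (𝓞 K)⁰ K} {w₁ w₂ : K} (h : ZGen I w₁ w₂)
    (h' : ZGen I' w₁ w₂) : I = I' := by
  refine SetLike.ext fun z => ?_
  rw [h z, h' z]

lemma ZGen.scale {I : FractionalIdeal (𝓞 K)⁰ K} {w₁ w₂ : K} (h : ZGen I w₁ w₂) (k : K) :
    ZGen (FractionalIdeal.spanSingleton (𝓞 K)⁰ k * I) (k * w₁) (k * w₂) := by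
  intro z
  rw [FractionalIdeal.mem_singleton_mul]
  constructor
  · rintro ⟨y, hy, rfl⟩
    obtain ⟨a, b, rfl⟩ := (h y).1 hy
    exact ⟨a, b, by ring⟩
  · rintro ⟨a, b, rfl⟩
    exact ⟨_, (h _).2 ⟨a, b, rfl⟩, by ring⟩

omit [NumberField K] in
lemma ZGen.act {I : FractionalIdeal (𝓞 K)⁰ K} {w₁ w₂ : K} (h : ZGen I w₁ w₂)
    (g : Matrix (Fin 2) (Fin 2) ℤ) (hg : g.det = 1) :
    ZGen I (g 0 0 * w₁ + g 1 0 * w₂) (g 0 1 * w₁ + g 1 1 * w₂) := by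
  have hdet : (g 0 0 : K) * g 1 1 - g 0 1 * g 1 0 = 1 := by
    rw [Matrix.det_fin_two] at hg; exact_mod_cast congrArg (Int.cast : ℤ → K) hg
  intro z
  rw [h z]
  constructor
  · rintro ⟨a, b, rfl⟩
    refine ⟨g 1 1 * a - g 0 1 * b, -g 1 0 * a + g 0 0 * b, ?_⟩
    push_cast
    linear_combination (-(a : K) * w₁ - b * w₂) * hdet
  · rintro ⟨a, b, rfl⟩
    exact ⟨g 0 0 * a + g 0 1 * b, g 1 0 * a + g 1 1 * b, by push_cast; ring⟩

include D hd

/-- Orbits of forms correspond to pairs `(I, δ)` up to scaling. -/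
theorem orbs_eq {m : ℕ} (hm : 0 < m) :
    CubicForm.orbs {f | CubicForm.HessDvd m f ∧ CubicForm.disc f = (m : ℤ) ^ 2 * d} =
      ((QuotientGroup.mk : _ → _ ⧸ (scaleHom K).range) '' (cubeHom K ⁻¹' idealsOfNorm K m)).ncard := by
  refine Set.ncard_image_eq_of_rel (fun f p => ∃ w₁ w₂ : K, ZGen p.1.1 w₁ w₂ ∧
    D.Rep m f w₁ w₂ p.2) _ _ ?_ ?_ ?_
  · rintro f ⟨h1, h2⟩
    obtain ⟨I, w₁, w₂, δ, J, hδ, hI, hr, hJ, hn⟩ := D.exists_pair hd hm h1 h2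
    exact ⟨(I, Units.mk0 δ hδ), ⟨J, by rw [coe_cubeHom]; exact hJ, hn⟩, w₁, w₂, hI, hr⟩
  · rintro ⟨I, δ⟩ ⟨J, hJ, hn⟩
    rw [coe_cubeHom] at hJ
    obtain ⟨w₁, w₂, f, hI, hr, hf⟩ := D.exists_form hd I δ.ne_zero hJ hn
    exact ⟨f, ⟨hf, hr.disc_eq hd⟩, w₁, w₂, hI, hr⟩
  · rintro f - f' - ⟨I, δ⟩ - ⟨I', δ'⟩ - ⟨w₁, w₂, hI, hr⟩ ⟨w₁', w₂', hI', hr'⟩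
    simp only at hI hr hI' hr'
    rw [CubicForm.orb_eq_iff, QuotientGroup.eq]
    constructor
    · rintro ⟨γ, rfl⟩
      have hr2 := hr.act γ.1 γ.2
      have hI2 := hI.act γ.1 γ.2
      obtain ⟨k, hk, e1, e2, e3⟩ := hr2.unique hd hm hr'
      refine ⟨Units.mk0 k hk, ?_⟩
      rw [eq_inv_mul_iff_mul_eq]
      refine Prod.ext (Units.ext ?_) (Units.ext ?_)
      · have := hI2.scale k
        rw [← e1, ← e2] at this
        rw [← hI'.ext this |>.symm]
        simp [scaleHom, mul_comm]
      · simp only [scaleHom, MonoidHom.prod_apply, Prod.mk_mul_mk, Units.val_mul, e3,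
          MonoidHom.inv_apply, powMonoidHom_apply, Units.val_inv_eq_inv_val, Units.val_pow_eq_pow_val,
          Units.val_mk0]
        ring
    · rintro ⟨k, hk⟩
      rw [eq_inv_mul_iff_mul_eq] at hk
      have h1 := congrArg (fun x => (x.1 : FractionalIdeal (𝓞 K)⁰ K)) hk
      have h2 := congrArg (fun x => (x.2 : K)) hk
      simp only [scaleHom, MonoidHom.prod_apply, Prod.mk_mul_mk, Units.val_mul,
          MonoidHom.inv_apply, powMonoidHom_apply, Units.val_inv_eq_inv_val, Units.val_pow_eq_pow_val,
          coe_toPrincipalIdeal] at h1 h2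
      have hr2 := hr.scale k.ne_zero
      have hI2 := hI.scale (k : K)
      rw [mul_comm, h1] at hI2
      rw [mul_comm _ (δ : K), h2] at hr2
      have := hr2.orb_eq hd hm hI2 hI' hr'
      exact (CubicForm.orb_eq_iff).1 this

end QuadData

lemma MonoidHom.ncard_preimage {G H : Type*} [Group G] [Group H] (ψ : G →* H) (T : Set H) :
    (ψ ⁻¹' T).ncard = (T ∩ Set.range ψ).ncard * Nat.card ψ.ker := by
  rw [← Nat.card_coe_set_eq, ← Nat.card_coe_set_eq, ← Nat.card_prod]
  choose s hs using fun y : (T ∩ Set.range ψ : Set H) => y.2.2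
  refine Nat.card_congr ⟨fun x => (⟨ψ x, x.2, x, rfl⟩, ⟨(s ⟨ψ x, x.2, x, rfl⟩)⁻¹ * x, ?_⟩),
    fun p => ⟨s p.1 * p.2, ?_⟩, fun x => ?_, fun p => ?_⟩
  · rw [MonoidHom.mem_ker, map_mul, map_inv, hs, inv_mul_cancel]
  · rw [Set.mem_preimage, map_mul, hs, (MonoidHom.mem_ker).1 p.2.2, mul_one]
    exact p.1.2.1
  · simp
  · obtain ⟨y, z, hz⟩ := p
    have h : ψ (s y * z) = y := by rw [map_mul, hs, (MonoidHom.mem_ker).1 hz, mul_one]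
    have h' : (⟨ψ (s y * z), by rw [h]; exact y.2⟩ : (T ∩ Set.range ψ : Set H)) = y :=
      Subtype.ext h
    refine Prod.ext h' (Subtype.ext ?_)
    simp only [h']
    simp

lemma MonoidHom.card_eq_card_range_mul_card_ker {G H : Type*} [Group G] [Group H] (ψ : G →* H) :
    Nat.card G = Nat.card ψ.range * Nat.card ψ.ker := by
  have := ψ.ncard_preimage Set.univ
  rwa [Set.preimage_univ, Set.ncard_univ, Set.univ_inter, ← Nat.card_coe_set_eq,
    ← MonoidHom.coe_range] at this

namespace QuadData

variable {K : Type*} [Field K] [NumberField K]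

lemma scaleHom_range_le_ker : (scaleHom K).range ≤ (cubeHom K).ker := by
  rintro _ ⟨k, rfl⟩
  simp [scaleHom, cubeHom, MonoidHom.mem_ker]

variable (K) in
/-- `(I, δ) ↦ δI³` on classes of pairs. -/
noncomputable def cubeHomBar :
    ((FractionalIdeal (𝓞 K)⁰ K)ˣ × Kˣ) ⧸ (scaleHom K).range →* (FractionalIdeal (𝓞 K)⁰ K)ˣ :=
  QuotientGroup.lift _ (cubeHom K) scaleHom_range_le_ker

variable (K) in
/-- `(I, δ) ↦ [I]` on classes of pairs. -/
noncomputable def classHom :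
    ((FractionalIdeal (𝓞 K)⁰ K)ˣ × Kˣ) ⧸ (scaleHom K).range →* ClassGroup (𝓞 K) :=
  QuotientGroup.lift _ ((ClassGroup.mk K).comp (MonoidHom.fst _ _)) (by
    rintro _ ⟨k, rfl⟩
    simp only [scaleHom, MonoidHom.prod_apply, MonoidHom.coe_comp, Function.comp_apply,
      MonoidHom.coe_fst, MonoidHom.mem_ker]
    rw [ClassGroup.mk_eq_one_iff, coe_toPrincipalIdeal]
    exact ⟨_, FractionalIdeal.coe_spanSingleton _ _⟩)

lemma classGroup_mk_surjective : Function.Surjective (ClassGroup.mk (R := 𝓞 K) K) :=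
  fun c => ClassGroup.induction (K := K) (P := fun c => ∃ I, ClassGroup.mk K I = c)
    (fun I => ⟨I, rfl⟩) c

lemma mk_eq_one_iff_exists {I : (FractionalIdeal (𝓞 K)⁰ K)ˣ} :
    ClassGroup.mk K I = 1 ↔ ∃ k : Kˣ, toPrincipalIdeal (𝓞 K) K k = I := by
  rw [← (ClassGroup.equiv K).injective.eq_iff]
  simp only [ClassGroup.equiv_mk, FractionalIdeal.canonicalEquiv_self, RingEquiv.coe_mulEquiv_refl,
    QuotientGroup.mk'_apply, map_one, QuotientGroup.eq_one_iff, MonoidHom.mem_range, Units.ext_iff,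
    Units.coe_mapEquiv, MulEquiv.refl_apply]

lemma mem_range_cubeHomBar {x : (FractionalIdeal (𝓞 K)⁰ K)ˣ} :
    x ∈ Set.range (cubeHomBar K) ↔ ∃ c, ClassGroup.mk K x = c ^ 3 := by
  constructor
  · rintro ⟨y, rfl⟩
    induction y using QuotientGroup.induction_on with | H y => ?_
    obtain ⟨I, δ⟩ := y
    refine ⟨ClassGroup.mk K I, ?_⟩
    have h : ClassGroup.mk K (toPrincipalIdeal (𝓞 K) K δ) = 1 := mk_eq_one_iff_exists.2 ⟨δ, rfl⟩
    change ClassGroup.mk K (cubeHom K (I, δ)) = _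
    simp [cubeHom, h]
  · rintro ⟨c, hc⟩
    obtain ⟨I, rfl⟩ := classGroup_mk_surjective (K := K) c
    rw [← map_pow, ← mul_inv_eq_one, ← map_inv, ← map_mul] at hc
    obtain ⟨δ, hδ⟩ := mk_eq_one_iff_exists.1 hc
    refine ⟨QuotientGroup.mk (I, δ), ?_⟩
    change cubeHom K (I, δ) = _
    simp [cubeHom, hδ]

/-- `u ↦ (1, u)`. -/
noncomputable def unitHom : (𝓞 K)ˣ →*
    ((FractionalIdeal (𝓞 K)⁰ K)ˣ × Kˣ) ⧸ (scaleHom K).range :=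
  (QuotientGroup.mk' _).comp ((MonoidHom.inr _ _).comp (Units.map (algebraMap (𝓞 K) K).toMonoidHom))

lemma toPrincipalIdeal_eq_one_iff {k : Kˣ} : toPrincipalIdeal (𝓞 K) K k = 1 ↔
    ∃ u : (𝓞 K)ˣ, Units.map (algebraMap (𝓞 K) K).toMonoidHom u = k := by
  rw [toPrincipalIdeal_eq_iff, Units.val_one]
  constructor
  · intro h
    have h' : toPrincipalIdeal (𝓞 K) K k⁻¹ = 1 := by
      rw [map_inv, inv_eq_one, toPrincipalIdeal_eq_iff, h, Units.val_one]
    rw [toPrincipalIdeal_eq_iff, Units.val_one] at h'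
    obtain ⟨a, ha⟩ := (FractionalIdeal.mem_one_iff _).1 (h ▸ FractionalIdeal.mem_spanSingleton_self _ (k : K))
    obtain ⟨b, hb⟩ := (FractionalIdeal.mem_one_iff _).1
      (h' ▸ FractionalIdeal.mem_spanSingleton_self _ ((k⁻¹ : Kˣ) : K))
    have hab : a * b = 1 := by
      apply FaithfulSMul.algebraMap_injective (𝓞 K) K
      rw [map_mul, ha, hb, Units.mul_inv, map_one]
    exact ⟨Units.mkOfMulEqOne a b hab, Units.ext ha⟩
  · rintro ⟨u, rfl⟩
    refine le_antisymm ?_ ?_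
    · rw [FractionalIdeal.spanSingleton_le_iff_mem]
      exact (FractionalIdeal.mem_one_iff _).2 ⟨u, rfl⟩
    · rw [FractionalIdeal.one_le, FractionalIdeal.mem_spanSingleton]
      refine ⟨(u⁻¹ : (𝓞 K)ˣ), ?_⟩
      change algebraMap (𝓞 K) K _ * algebraMap (𝓞 K) K _ = _
      rw [← map_mul, Units.inv_mul, map_one]

lemma unitHom_ker : (unitHom (K := K)).ker = (powMonoidHom 3 : (𝓞 K)ˣ →* (𝓞 K)ˣ).range := by
  ext u
  rw [MonoidHom.mem_ker]
  change QuotientGroup.mk _ = _ ↔ _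
  rw [QuotientGroup.eq_one_iff]
  have hinj : Function.Injective (Units.map (algebraMap (𝓞 K) K).toMonoidHom) :=
    Units.map_injective (FaithfulSMul.algebraMap_injective (𝓞 K) K)
  constructor
  · rintro ⟨k, hk⟩
    have h1 := congrArg Prod.fst hk
    have h2 := congrArg Prod.snd hk
    obtain ⟨v, rfl⟩ := toPrincipalIdeal_eq_one_iff.1 h1
    refine ⟨v⁻¹, hinj ?_⟩
    refine Eq.trans ?_ h2
    simp [scaleHom]
  · rintro ⟨v, rfl⟩
    refine ⟨Units.map (algebraMap (𝓞 K) K).toMonoidHom v⁻¹, Prod.ext ?_ ?_⟩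
    · exact toPrincipalIdeal_eq_one_iff.2 ⟨_, rfl⟩
    · simp [scaleHom]

lemma card_ker_cubeHomBar : Nat.card (cubeHomBar K).ker =
    Nat.card {c : ClassGroup (𝓞 K) // c ^ 3 = 1} *
      (powMonoidHom 3 : (𝓞 K)ˣ →* (𝓞 K)ˣ).range.index := by
  rw [← unitHom_ker, Subgroup.index_ker,
    ((classHom K).comp (cubeHomBar K).ker.subtype).card_eq_card_range_mul_card_ker]
  congr 1
  · refine Nat.card_congr (Equiv.subtypeEquivRight fun c => ?_)
    constructor
    · rintro ⟨⟨y, hy⟩, rfl⟩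
      induction y using QuotientGroup.induction_on with | H y => ?_
      obtain ⟨I, δ⟩ := y
      change cubeHom K (I, δ) = 1 at hy
      change ClassGroup.mk K I ^ 3 = 1
      rw [← map_pow]
      refine mk_eq_one_iff_exists.2 ⟨δ⁻¹, ?_⟩
      rw [map_inv]
      exact inv_eq_of_mul_eq_one_right hy
    · intro hc
      obtain ⟨I, rfl⟩ := classGroup_mk_surjective (K := K) c
      rw [← map_pow] at hc
      obtain ⟨δ, hδ⟩ := mk_eq_one_iff_exists.1 hc
      refine ⟨⟨QuotientGroup.mk (I, δ⁻¹), ?_⟩, rfl⟩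
      change cubeHom K (I, δ⁻¹) = 1
      simp [cubeHom, hδ]
  · rw [Nat.card_congr (Subgroup.equivMapOfInjective _ (cubeHomBar K).ker.subtype
      (Subgroup.subtype_injective _)).toEquiv]
    congr 2
    ext x
    constructor
    · rintro ⟨⟨y, hy⟩, hy', rfl⟩
      induction y using QuotientGroup.induction_on with | H y => ?_
      obtain ⟨I, δ⟩ := y
      obtain ⟨k, rfl⟩ := mk_eq_one_iff_exists.1 (show ClassGroup.mk K I = 1 from hy')
      change toPrincipalIdeal (𝓞 K) K δ * (toPrincipalIdeal (𝓞 K) K k) ^ 3 = 1 at hy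
      rw [← map_pow, ← map_mul] at hy
      obtain ⟨u, hu⟩ := toPrincipalIdeal_eq_one_iff.1 hy
      refine ⟨u, ?_⟩
      refine QuotientGroup.eq.2 ⟨k, Prod.ext ?_ ?_⟩
      · simp [scaleHom]
      · change _ = (Units.map (algebraMap (𝓞 K) K).toMonoidHom u)⁻¹ * δ
        rw [hu]
        simp [scaleHom]
    · rintro ⟨u, rfl⟩
      refine ⟨⟨unitHom u, ?_⟩, ?_, rfl⟩
      · change toPrincipalIdeal (𝓞 K) K _ * 1 ^ 3 = 1
        rw [one_pow, mul_one]
        exact toPrincipalIdeal_eq_one_iff.2 ⟨u, rfl⟩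
      · exact map_one (ClassGroup.mk K)

/-- The number of classes of pairs whose associated ideal is integral of norm `m`. -/
lemma ncard_classes (m : ℕ) :
    ((QuotientGroup.mk : _ → _ ⧸ (scaleHom K).range) '' (cubeHom K ⁻¹' idealsOfNorm K m)).ncard =
      (idealsOfNorm K m ∩ {x | ∃ c, ClassGroup.mk K x = c ^ 3}).ncard *
        (Nat.card {c : ClassGroup (𝓞 K) // c ^ 3 = 1} *
          (powMonoidHom 3 : (𝓞 K)ˣ →* (𝓞 K)ˣ).range.index) := by
  have h : (QuotientGroup.mk : _ → _ ⧸ (scaleHom K).range) '' (cubeHom K ⁻¹' idealsOfNorm K m) =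
      cubeHomBar K ⁻¹' idealsOfNorm K m := by
    ext x
    induction x using QuotientGroup.induction_on with | H y => ?_
    constructor
    · rintro ⟨z, hz, hzy⟩
      rw [← hzy]
      exact hz
    · intro hy
      exact ⟨y, hy, rfl⟩
  have h' : Set.range (cubeHomBar K) = {x | ∃ c, ClassGroup.mk K x = c ^ 3} :=
    Set.ext fun x => mem_range_cubeHomBar
  rw [h, MonoidHom.ncard_preimage, card_ker_cubeHomBar, h']

end QuadData

lemma Module.Basis.index_cubes {U M : Type*} [CommGroup U] [AddCommGroup M] {n : ℕ}
    (b : Module.Basis (Fin n) ℤ M) (q : U →* Multiplicative M) (hq : Function.Surjective q)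
    (h : (Nat.card q.ker).Coprime 3) : (powMonoidHom 3 : U →* U).range.index = 3 ^ n := by
  let f : U →* Multiplicative (Fin n → ZMod 3) :=
    MonoidHom.mk' (fun u => Multiplicative.ofAdd fun i => ((b.repr (q u).toAdd i : ℤ) : ZMod 3)) (by
        intro u v
        rw [← ofAdd_add]
        congr 1
        ext i
        simp)
  have hf : ∀ u i, (f u).toAdd i = ((b.repr (q u).toAdd i : ℤ) : ZMod 3) := fun u i => rfl
  have hex : ∀ c : Fin n → ℤ, ∃ u : U, ∀ i, b.repr (q u).toAdd i = c i := by
    intro c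
    obtain ⟨u, hu⟩ := hq (Multiplicative.ofAdd (b.equivFun.symm c))
    refine ⟨u, fun i => ?_⟩
    rw [hu, toAdd_ofAdd, ← b.equivFun_apply, LinearEquiv.apply_symm_apply]
  have hsurj : Function.Surjective f := by
    intro c
    obtain ⟨u, hu⟩ := hex fun i => ((c.toAdd i).val : ℤ)
    refine ⟨u, Multiplicative.toAdd.injective (funext fun i => ?_)⟩
    rw [hf, hu]
    simp
  have hker : f.ker = (powMonoidHom 3 : U →* U).range := by
    ext u
    constructor
    · intro hu
      have hdvd : ∀ i, ∃ k : ℤ, b.repr (q u).toAdd i = 3 * k := by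
        intro i
        have h1 : (f u).toAdd i = 0 := by rw [(MonoidHom.mem_ker).1 hu]; rfl
        rw [hf] at h1
        exact (ZMod.intCast_zmod_eq_zero_iff_dvd _ 3).1 h1
      choose c hc using hdvd
      obtain ⟨v, hv⟩ := hex c
      have h2 : (v ^ 3)⁻¹ * u ∈ q.ker := by
        rw [MonoidHom.mem_ker, map_mul, map_inv, inv_mul_eq_one]
        apply Multiplicative.toAdd.injective
        apply b.repr.injective
        ext i
        rw [hc, map_pow, toAdd_pow, map_nsmul, Finsupp.smul_apply, hv]
        simp
      obtain ⟨z, hz⟩ := (powCoprime h).surjective ⟨_, h2⟩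
      refine ⟨v * z, ?_⟩
      have h3 := congrArg Subtype.val hz
      simp only [powCoprime_apply, Subgroup.coe_pow] at h3
      rw [powMonoidHom_apply, mul_pow, h3, mul_inv_cancel_left]
    · rintro ⟨v, rfl⟩
      rw [MonoidHom.mem_ker, powMonoidHom_apply, map_pow]
      apply Multiplicative.toAdd.injective
      funext i
      rw [toAdd_pow, Pi.smul_apply, toAdd_one, Pi.zero_apply, nsmul_eq_mul]
      exact mul_eq_zero_of_left (by decide) _
  rw [← hker, Subgroup.index_ker, MonoidHom.range_eq_top.2 hsurj]
  simp

lemma NumberField.Units.index_cubes {K : Type*} [Field K] [NumberField K]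
    (h : (Nat.card (Units.torsion K)).Coprime 3) :
    (powMonoidHom 3 : (𝓞 K)ˣ →* (𝓞 K)ˣ).range.index = 3 ^ Units.rank K := by
  let q : (𝓞 K)ˣ →* Multiplicative (Additive ((𝓞 K)ˣ ⧸ Units.torsion K)) :=
    ⟨⟨fun u => Multiplicative.ofAdd (Additive.ofMul (QuotientGroup.mk u)), rfl⟩, fun _ _ => rfl⟩
  have hq : q.ker = Units.torsion K := Subgroup.ext fun u => QuotientGroup.eq_one_iff u
  exact Module.Basis.index_cubes (M := Additive ((𝓞 K)ˣ ⧸ Units.torsion K))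
    (Units.basisModTorsion K) q QuotientGroup.mk_surjective (by rwa [hq])

namespace QuadData

variable {K : Type*} [Field K] [NumberField K] {d : ℤ} (D : QuadData K d) (hd : Loc.IsFund d)

include D hd

lemma card_torsion_coprime (h3 : d ≠ -3) : (Nat.card (Units.torsion K)).Coprime 3 := by
  rw [Nat.coprime_comm, Nat.prime_three.coprime_iff_not_dvd]
  intro h
  have : Fact (Nat.Prime 3) := ⟨Nat.prime_three⟩
  obtain ⟨z, hz⟩ := exists_prime_orderOf_dvd_card' 3 h
  obtain ⟨x, y, hxy⟩ := D.coe_exists_int_coord hd ((z : (𝓞 K)ˣ) : 𝓞 K)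
  set w : K := (((z : (𝓞 K)ˣ) : 𝓞 K) : K) with hw
  have hinj : Function.Injective fun u : Units.torsion K => (((u : (𝓞 K)ˣ) : 𝓞 K) : K) :=
    fun u v huv => Subtype.ext (Units.ext (RingOfIntegers.ext huv))
  have h1 : w ^ 3 = 1 := by
    have := congrArg (fun u : Units.torsion K => (((u : (𝓞 K)ˣ) : 𝓞 K) : K)) (hz ▸ pow_orderOf_eq_one z)
    simpa using this
  have h2 : w ≠ 1 := by
    intro h2
    have : z = 1 := hinj (by rw [hw] at h2; simpa only [OneMemClass.coe_one, Units.val_one, map_one] using h2)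
    rw [this, orderOf_one] at hz
    omega
  have h4 : w ^ 2 + w + 1 = 0 := by
    refine (mul_eq_zero.1 ?_).resolve_left (sub_ne_zero.2 h2)
    linear_combination h1
  have hr := D.r_sq
  have h5 : (((2 * x + y * d + 1) ^ 2 + y ^ 2 * d + 3 : ℤ) : ℚ) +
      (((2 * (2 * x + y * d + 1) * y : ℤ) : ℚ) : K) * D.r = 0 := by
    push_cast
    rw [hxy] at h4
    linear_combination 4 * h4 - (y : K) ^ 2 * hr
  obtain ⟨h6, h7⟩ := D.eq_zero_of_coord hd h5
  have h6 : (2 * x + y * d + 1) ^ 2 + y ^ 2 * d + 3 = 0 := by exact_mod_cast h6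
  have h7 : 2 * (2 * x + y * d + 1) * y = 0 := by exact_mod_cast h7
  rcases mul_eq_zero.1 h7 with h8 | rfl
  · have h8 : 2 * x + y * d + 1 = 0 := by omega
    rw [h8] at h6
    have h9 : y ^ 2 * (-d) = 3 := by linarith
    have hy : y ^ 2 ∣ 3 := ⟨_, h9.symm⟩
    have hy1 : y ^ 2 ≤ 3 := Int.le_of_dvd (by norm_num) hy
    have : y ≤ 1 := by nlinarith
    have : -1 ≤ y := by nlinarith
    interval_cases y <;> omega
  · nlinarith [sq_nonneg (2 * x + 0 * d + 1)]

lemma rank_eq : Units.rank K = if 0 < d then 1 else 0 := by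
  obtain ⟨b, -⟩ := D.exists_int_basis hd
  have hfin : Module.finrank ℚ K = 2 := by
    rw [← RingOfIntegers.rank, Module.finrank_eq_card_basis b, Fintype.card_fin]
  have hcard := InfinitePlace.card_add_two_mul_card_eq_rank K
  have hφ : ∀ φ : K →+* ℂ, φ D.r ^ 2 = d := fun φ => by
    rw [← map_pow, D.r_sq, map_intCast]
  rw [Units.rank, InfinitePlace.card_eq_nrRealPlaces_add_nrComplexPlaces]
  split_ifs with h
  · have : IsTotallyReal K := by
      refine ⟨fun v => ?_⟩
      rw [InfinitePlace.isReal_iff, ComplexEmbedding.isReal_iff]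
      set φ := v.embedding
      have h1 : (starRingEnd ℂ) (φ D.r) = φ D.r := by
        rw [Complex.conj_eq_iff_im]
        have h2 := hφ φ
        have h3 := congrArg Complex.re h2
        have h4 := congrArg Complex.im h2
        simp only [pow_two, Complex.mul_re, Complex.mul_im, Complex.intCast_re, Complex.intCast_im]
          at h3 h4
        have h5 : (0 : ℝ) < d := by exact_mod_cast h
        by_contra h6
        have h7 : (φ D.r).re = 0 := by
          refine (mul_eq_zero.1 (show (φ D.r).re * (φ D.r).im = 0 by linarith)).resolve_right h6
        rw [h7] at h3
        nlinarith [mul_self_nonneg (φ D.r).im]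
      ext z
      obtain ⟨x, y, rfl⟩ := D.exists_coord z
      rw [ComplexEmbedding.conjugate_coe_eq]
      simp [h1]
    rw [IsTotallyReal.nrComplexPlaces_eq_zero] at hcard ⊢
    omega
  · have : IsTotallyComplex K := by
      refine ⟨fun v => ?_⟩
      rw [InfinitePlace.isComplex_iff, ComplexEmbedding.isReal_iff]
      set φ := v.embedding
      intro h1
      have h2 := hφ φ
      have h1 := congrArg (fun ψ : K →+* ℂ => ψ D.r) h1
      simp only [ComplexEmbedding.conjugate_coe_eq, Complex.conj_eq_iff_im] at h1
      have h3 := congrArg Complex.re h2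
      simp only [pow_two, Complex.mul_re, Complex.intCast_re, h1] at h3
      have h5 : (d : ℝ) < 0 := by
        have := hd.ne_zero
        exact_mod_cast (show d < 0 by omega)
      nlinarith [mul_self_nonneg (φ D.r).re]
    rw [IsTotallyComplex.nrRealPlaces_eq_zero] at hcard ⊢
    omega

/-- Counting orbits of forms by ideals that are cubes in the class group. -/
theorem orbs_count (h3 : d ≠ -3) {m : ℕ} (hm : 0 < m) :
    CubicForm.orbs {f | CubicForm.HessDvd m f ∧ CubicForm.disc f = (m : ℤ) ^ 2 * d} =
      (idealsOfNorm K m ∩ {x | ∃ c, ClassGroup.mk K x = c ^ 3}).ncard *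
        (Nat.card {c : ClassGroup (𝓞 K) // c ^ 3 = 1} * 3 ^ (if 0 < d then 1 else 0)) := by
  rw [D.orbs_eq hd hm, ncard_classes, Units.index_cubes (D.card_torsion_coprime hd h3),
    D.rank_eq hd]

end QuadData

section Group

variable {G : Type*} [CommGroup G]

lemma card_cube_torsion [Finite G] : Nat.card {x : G // x ^ 3 = 1} *
    Nat.card (powMonoidHom 3 : G →* G).range = Nat.card G := by
  rw [(powMonoidHom 3 : G →* G).card_eq_card_range_mul_card_ker, mul_comm]
  rfl

lemma card_quotient_cube_torsion [Finite G] (H : Subgroup G) :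
    Nat.card {x : G ⧸ H // x ^ 3 = 1} *
      Nat.card ((powMonoidHom 3 : G →* G).range ⊔ H : Subgroup G) = Nat.card G := by
  have h1 := card_cube_torsion (G := G ⧸ H)
  have h2 := ((QuotientGroup.mk' H).comp
    ((powMonoidHom 3 : G →* G).range ⊔ H).subtype).card_eq_card_range_mul_card_ker
  have h3 : ((QuotientGroup.mk' H).comp ((powMonoidHom 3 : G →* G).range ⊔ H).subtype).range =
      (powMonoidHom 3 : G ⧸ H →* G ⧸ H).range := by
    ext x
    constructor
    · rintro ⟨⟨y, hy⟩, rfl⟩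
      obtain ⟨_, ⟨a, rfl⟩, b, hb, rfl⟩ := Subgroup.mem_sup.1 hy
      refine ⟨QuotientGroup.mk a, ?_⟩
      have : (QuotientGroup.mk b : G ⧸ H) = 1 := (QuotientGroup.eq_one_iff b).2 hb
      simp [this]
    · rintro ⟨x, rfl⟩
      induction x using QuotientGroup.induction_on with | H a => ?_
      exact ⟨⟨a ^ 3, Subgroup.mem_sup_left ⟨a, rfl⟩⟩, rfl⟩
  have h4 : Nat.card ((QuotientGroup.mk' H).comp
      ((powMonoidHom 3 : G →* G).range ⊔ H).subtype).ker = Nat.card H := by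
    refine Nat.card_congr ⟨fun x => ⟨x.1.1, (QuotientGroup.eq_one_iff _).1 x.2⟩,
      fun x => ⟨⟨x.1, Subgroup.mem_sup_right x.2⟩, (QuotientGroup.eq_one_iff _).2 x.2⟩,
      fun _ => rfl, fun _ => rfl⟩
  rw [h2, h3, h4, ← mul_assoc, h1, ← Subgroup.card_eq_card_quotient_mul_card_subgroup]

lemma Subgroup.mem_sup_zpowers_iff {M : Subgroup G} {g : G} (h3 : g ^ 3 ∈ M) {c : G} :
    c ∈ M ⊔ Subgroup.zpowers g ↔ c ∈ M ∨ c * g ∈ M ∨ c * g⁻¹ ∈ M := by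
  have hg : g ∈ M ⊔ Subgroup.zpowers g :=
    Subgroup.mem_sup_right (Subgroup.mem_zpowers g)
  constructor
  · intro h
    obtain ⟨a, ha, _, ⟨j, rfl⟩, rfl⟩ := Subgroup.mem_sup.1 h
    have key : ∀ i : ℤ, 3 ∣ i → g ^ i ∈ M := by
      rintro _ ⟨q, rfl⟩
      rw [zpow_mul]
      exact Subgroup.zpow_mem _ (by exact_mod_cast h3) _
    have : j % 3 = 0 ∨ j % 3 = 1 ∨ j % 3 = 2 := by omega
    rcases this with h | h | h
    · exact Or.inl (mul_mem ha (key j (by omega)))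
    · refine Or.inr (Or.inr ?_)
      rw [mul_assoc, ← zpow_sub_one]
      exact mul_mem ha (key _ (by omega))
    · refine Or.inr (Or.inl ?_)
      rw [mul_assoc, ← zpow_add_one]
      exact mul_mem ha (key _ (by omega))
  · rintro (h | h | h)
    · exact Subgroup.mem_sup_left h
    · simpa using mul_mem (Subgroup.mem_sup_left h) (inv_mem hg)
    · simpa using mul_mem (Subgroup.mem_sup_left h) hg

open scoped Classical in
/-- A function built up by averaging over `1, g, g⁻¹` is uniform on a subgroup. -/
lemma exists_eq_ite_of_insert {ι : Type*} [DecidableEq ι] {N : Subgroup G} (hN : ∀ x : G, x ^ 3 ∈ N)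
    (g : ι → G) (W : Finset ι) (E : Finset ι → G → ℕ)
    (h0 : ∀ c ∈ N, E ∅ c = 1) (h0' : ∀ c ∉ N, E ∅ c = 0)
    (h1 : ∀ p V, insert p V ⊆ W → p ∉ V → ∀ c,
      E (insert p V) c = E V c + (E V (c * g p) + E V (c * (g p)⁻¹))) (V : Finset ι) (hV : V ⊆ W) :
    ∃ k, ∀ c, E V c = if c ∈ N ⊔ Subgroup.closure (g '' V) then k else 0 := by
  induction V using Finset.induction_on with
  | empty =>
    refine ⟨1, fun c => ?_⟩
    split_ifs with h
    · exact h0 c (by simpa using h)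
    · exact h0' c (by simpa using h)
  | insert p V hp ih =>
    obtain ⟨k, hk⟩ := ih ((Finset.subset_insert p V).trans hV)
    set M := N ⊔ Subgroup.closure (g '' V) with hM
    have hM' : N ⊔ Subgroup.closure (g '' (insert p V : Finset ι)) = M ⊔ Subgroup.zpowers (g p) := by
      rw [Finset.coe_insert, Set.image_insert_eq, Set.insert_eq, Subgroup.closure_union,
        ← Subgroup.zpowers_eq_closure, hM, sup_assoc, sup_comm (Subgroup.zpowers (g p))]
    have h3 : ∀ x : G, x ^ 3 ∈ M := fun x => Subgroup.mem_sup_left (hN x)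
    rw [hM']
    by_cases hg : g p ∈ M
    · refine ⟨3 * k, fun c => ?_⟩
      rw [h1 p V hV hp, hk, hk, hk, M.mul_mem_cancel_right hg, M.mul_mem_cancel_right (inv_mem hg),
        sup_eq_left.2 (by rwa [Subgroup.zpowers_le])]
      split_ifs <;> omega
    · refine ⟨k, fun c => ?_⟩
      rw [h1 p V hV hp, hk, hk, hk, if_congr (Subgroup.mem_sup_zpowers_iff (h3 _)) rfl rfl]
      have e1 : c ∈ M → ¬ c * g p ∈ M := fun h h' => hg ((M.mul_mem_cancel_left h).1 h')
      have e2 : c ∈ M → ¬ c * (g p)⁻¹ ∈ M := fun h h' =>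
        hg (inv_mem_iff.1 ((M.mul_mem_cancel_left h).1 h'))
      have e3 : c * g p ∈ M → ¬ c * (g p)⁻¹ ∈ M := by
        intro h h'
        have h2 := M.mul_mem (h3 (g p)) (M.mul_mem h' (inv_mem h))
        apply hg
        rw [mul_inv, mul_mul_mul_comm, mul_inv_cancel, one_mul] at h2
        convert h2 using 1
        group
      by_cases c1 : c ∈ M
      · simp [c1, e1 c1, e2 c1]
      · grind

lemma sum_eq_of_insert [Fintype G] {ι : Type*} [DecidableEq ι] {N : Subgroup G}
    (g : ι → G) (W : Finset ι) (E : Finset ι → G → ℕ)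
    (h0 : ∀ c ∈ N, E ∅ c = 1) (h0' : ∀ c ∉ N, E ∅ c = 0)
    (h1 : ∀ p V, insert p V ⊆ W → p ∉ V → ∀ c,
      E (insert p V) c = E V c + (E V (c * g p) + E V (c * (g p)⁻¹))) (V : Finset ι) (hV : V ⊆ W) :
    ∑ c, E V c = 3 ^ V.card * Nat.card N := by
  induction V using Finset.induction_on with
  | empty =>
    classical
    rw [Finset.card_empty, pow_zero, one_mul, Nat.card_eq_fintype_card, Fintype.card_subtype,
      Finset.card_filter]
    refine Finset.sum_congr rfl fun c _ => ?_
    split_ifs with h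
    · exact h0 c h
    · exact h0' c h
  | insert p V hp ih =>
    have ih := ih ((Finset.subset_insert p V).trans hV)
    simp only [h1 p V hV hp, Finset.sum_add_distrib]
    rw [Fintype.sum_equiv (Equiv.mulRight (g p)) (fun c => E V (c * g p)) (E V) fun _ => rfl,
      Fintype.sum_equiv (Equiv.mulRight (g p)⁻¹) (fun c => E V (c * (g p)⁻¹)) (E V) fun _ => rfl,
      ih, Finset.card_insert_of_notMem hp]
    ring

open scoped Classical in
/-- Counting by characters of exponent three. -/
theorem card_mul_card_torsion [Finite G] {ι : Type*} [DecidableEq ι] (g : ι → G) (W : Finset ι)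
    (H : Subgroup G) (E : Finset ι → G → ℕ)
    (hH : (powMonoidHom 3 : G →* G).range ⊔ H =
      (powMonoidHom 3 : G →* G).range ⊔ Subgroup.closure (g '' W))
    (h0 : ∀ c ∈ (powMonoidHom 3 : G →* G).range, E ∅ c = 1)
    (h0' : ∀ c ∉ (powMonoidHom 3 : G →* G).range, E ∅ c = 0)
    (h1 : ∀ p V, insert p V ⊆ W → p ∉ V → ∀ c,
      E (insert p V) c = E V c + (E V (c * g p) + E V (c * (g p)⁻¹))) :
    E W 1 * Nat.card {x : G // x ^ 3 = 1} = 3 ^ W.card * Nat.card {x : G ⧸ H // x ^ 3 = 1} := by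
  have := Fintype.ofFinite G
  obtain ⟨k, hk⟩ := exists_eq_ite_of_insert (N := (powMonoidHom 3 : G →* G).range)
    (fun x => ⟨x, rfl⟩) g W E h0 h0' h1 W subset_rfl
  have hs := sum_eq_of_insert g W E h0 h0' h1 W subset_rfl
  have e1 := card_cube_torsion (G := G)
  have e2 := card_quotient_cube_torsion H
  rw [hH] at e2
  set M := (powMonoidHom 3 : G →* G).range ⊔ Subgroup.closure (g '' W)
  have e3 : ∑ c, E W c = k * Nat.card M := by
    simp [hk, ← Finset.sum_filter, Fintype.card_subtype, mul_comm]
  rw [hk, if_pos (one_mem _)]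
  have hpos : 0 < Nat.card M := Nat.card_pos
  refine Nat.eq_of_mul_eq_mul_right hpos ?_
  calc k * Nat.card {x : G // x ^ 3 = 1} * Nat.card M
      = (k * Nat.card M) * Nat.card {x : G // x ^ 3 = 1} := by ring
    _ = 3 ^ W.card * (Nat.card {x : G // x ^ 3 = 1} *
          Nat.card (powMonoidHom 3 : G →* G).range) := by rw [← e3, hs]; ring
    _ = 3 ^ W.card * Nat.card {x : G ⧸ H // x ^ 3 = 1} * Nat.card M := by rw [e1, ← e2]; ring

end Group

/-- `(p)` is the product of the distinct primes `P` and `Q`. -/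
def SplitPair {R : Type*} [CommRing R] (p : ℕ) (P Q : Ideal R) : Prop :=
  P ≠ Q ∧ P.IsPrime ∧ Q.IsPrime ∧ Ideal.span {((p : ℕ) : R)} = P * Q

namespace SplitPair

lemma symm {R : Type*} [CommRing R] {p : ℕ} {P Q : Ideal R} (h : SplitPair p P Q) :
    SplitPair p Q P := ⟨h.1.symm, h.2.2.1, h.2.1, by rw [h.2.2.2, mul_comm]⟩

variable {K : Type*} [Field K] [NumberField K] (hK : Module.finrank ℤ (𝓞 K) = 2)
  {p : ℕ} (hp : p.Prime) {P Q : Ideal (𝓞 K)} (h : SplitPair p P Q)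

lemma mk0_right {P Q : (Ideal (𝓞 K))⁰} (h : SplitPair p P.1 Q.1) :
    ClassGroup.mk0 Q = (ClassGroup.mk0 P)⁻¹ := by
  rw [eq_inv_iff_mul_eq_one, mul_comm, ← map_mul, ClassGroup.mk0_eq_one_iff]
  exact ⟨⟨(p : 𝓞 K), h.2.2.2.symm⟩⟩

include hK in
lemma absNorm_span : Ideal.absNorm (Ideal.span {((p : ℕ) : 𝓞 K)}) = p ^ 2 := by
  rw [Ideal.absNorm_span_natCast, hK]

include hK hp h

lemma absNorm_left : Ideal.absNorm P = p := by
  have h1 := absNorm_span hK (p := p)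
  rw [h.2.2.2, map_mul] at h1
  have hP : Ideal.absNorm P ≠ 1 := fun e => h.2.1.ne_top (Ideal.absNorm_eq_one_iff.1 e)
  have hQ : Ideal.absNorm Q ≠ 1 := fun e => h.2.2.1.ne_top (Ideal.absNorm_eq_one_iff.1 e)
  exact (((hp.mul_eq_prime_sq_iff hP hQ).1 h1)).1

lemma ne_bot : P ≠ ⊥ := by
  rintro rfl
  have := h.absNorm_left hK hp
  rw [Ideal.absNorm_bot] at this
  exact hp.ne_zero this.symm

lemma eq_or_eq {P' : Ideal (𝓞 K)} (hP' : P'.IsPrime) (hm : ((p : ℕ) : 𝓞 K) ∈ P') :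
    P' = P ∨ P' = Q := by
  have h1 : P * Q ≤ P' := by
    rw [← h.2.2.2, Ideal.span_singleton_le_iff_mem]
    exact hm
  have hPm : P.IsMaximal := h.2.1.isMaximal (h.ne_bot hK hp)
  have hQm : Q.IsMaximal := h.2.2.1.isMaximal (h.symm.ne_bot hK hp)
  rcases hP'.mul_le.1 h1 with h2 | h2
  · exact Or.inl (hPm.eq_of_le hP'.ne_top h2).symm
  · exact Or.inr (hQm.eq_of_le hP'.ne_top h2).symm

lemma exists_mul {k : ℕ} {I : Ideal (𝓞 K)} (hI : Ideal.absNorm I = p * k) :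
    ∃ J, Ideal.absNorm J = k ∧ (I = P * J ∨ I = Q * J) := by
  obtain ⟨P', hP', hu, J, rfl⟩ := Ideal.exists_isMaximal_dvd_of_dvd_absNorm' hp I ⟨k, hI⟩
  have hm : ((p : ℕ) : 𝓞 K) ∈ P' := by
    have : (p : ℤ) ∈ P'.under ℤ := hu ▸ Ideal.mem_span_singleton_self _
    simpa [Ideal.mem_comap] using this
  have hn : Ideal.absNorm P' = p := by
    rcases h.eq_or_eq hK hp hP'.isPrime hm with rfl | rfl
    · exact h.absNorm_left hK hp
    · exact h.symm.absNorm_left hK hp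
  rw [map_mul, hn] at hI
  refine ⟨J, Nat.eq_of_mul_eq_mul_left hp.pos hI, ?_⟩
  rcases h.eq_or_eq hK hp hP'.isPrime hm with rfl | rfl
  · exact Or.inl rfl
  · exact Or.inr rfl

lemma mul_ne_mul {k : ℕ} (hk : ¬ p ∣ k) {I J : Ideal (𝓞 K)} (hJ : Ideal.absNorm J = k) :
    P * I ≠ Q * J := by
  intro he
  have hPp : Prime P := Ideal.prime_of_isPrime (h.ne_bot hK hp) h.2.1
  have hQm : Q.IsMaximal := h.2.2.1.isMaximal (h.symm.ne_bot hK hp)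
  have hPm : P.IsMaximal := h.2.1.isMaximal (h.ne_bot hK hp)
  rcases hPp.dvd_or_dvd (Dvd.intro _ he) with h1 | h1
  · exact h.1 (hQm.eq_of_le hPm.ne_top (Ideal.le_of_dvd h1)).symm
  · have := map_dvd Ideal.absNorm h1
    rw [h.absNorm_left hK hp, hJ] at this
    exact hk this

end SplitPair

namespace QuadData

variable {K : Type*} [Field K] [NumberField K]

variable (K) in
/-- The number of ideals of norm `m` whose class lies in `c⁻¹N`. -/
noncomputable def idealCount (N : Subgroup (ClassGroup (𝓞 K))) (m : ℕ)
    (c : ClassGroup (𝓞 K)) : ℕ :=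
  (idealsOfNorm K m ∩ {x | c * ClassGroup.mk K x ∈ N}).ncard

lemma finite_idealsOfNorm (m : ℕ) : (idealsOfNorm K m).Finite := by
  refine Set.Finite.of_finite_image (f := fun x => x.1) ?_ Units.val_injective.injOn
  refine ((Ideal.finite_setOfPred_absNorm_eq (S := 𝓞 K) m).image
    fun J : Ideal (𝓞 K) => ((J : Ideal (𝓞 K)) : FractionalIdeal (𝓞 K)⁰ K)).subset ?_
  rintro _ ⟨x, ⟨J, hJ, hm⟩, rfl⟩
  exact ⟨J, hm, hJ.symm⟩

lemma idealCount_one (N : Subgroup (ClassGroup (𝓞 K))) (c : ClassGroup (𝓞 K)) [Decidable (c ∈ N)] :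
    idealCount K N 1 c = if c ∈ N then 1 else 0 := by
  have h : idealsOfNorm K 1 = {1} := by
    ext x
    constructor
    · rintro ⟨J, hJ, h1⟩
      rw [Ideal.absNorm_eq_one_iff.1 h1] at hJ
      exact Units.ext (by simpa using hJ)
    · rintro rfl
      exact ⟨⊤, by simp, by simp⟩
  rw [idealCount, h]
  split_ifs with hc
  · rw [Set.inter_eq_left.2, Set.ncard_singleton]
    rintro _ rfl
    change c * _ ∈ N
    rwa [map_one, mul_one]
  · rw [Set.ncard_eq_zero ((Set.finite_singleton _).inter_of_left _), Set.eq_empty_iff_forall_notMem]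
    rintro _ ⟨rfl, h2⟩
    change c * _ ∈ N at h2
    rw [map_one, mul_one] at h2
    exact hc h2

lemma idealCount_mul (hK : Module.finrank ℤ (𝓞 K) = 2) (N : Subgroup (ClassGroup (𝓞 K)))
    {p : ℕ} (hp : p.Prime) {P Q : (Ideal (𝓞 K))⁰} (h : SplitPair p P.1 Q.1) {k : ℕ} (hk : ¬ p ∣ k)
    (c : ClassGroup (𝓞 K)) : idealCount K N (p * k) c =
      idealCount K N k (c * ClassGroup.mk0 P) + idealCount K N k (c * (ClassGroup.mk0 P)⁻¹) := by
  rw [← h.mk0_right]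
  set f : (Ideal (𝓞 K))⁰ → (FractionalIdeal (𝓞 K)⁰ K)ˣ → (FractionalIdeal (𝓞 K)⁰ K)ˣ :=
    fun P x => FractionalIdeal.mk0 K P * x with hf
  have hset : idealsOfNorm K (p * k) ∩ {x | c * ClassGroup.mk K x ∈ N} =
      f P '' (idealsOfNorm K k ∩ {x | c * ClassGroup.mk0 P * ClassGroup.mk K x ∈ N}) ∪
      f Q '' (idealsOfNorm K k ∩ {x | c * ClassGroup.mk0 Q * ClassGroup.mk K x ∈ N}) := by
    have key : ∀ (P : (Ideal (𝓞 K))⁰), Ideal.absNorm P.1 = p →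
        f P '' (idealsOfNorm K k ∩ {x | c * ClassGroup.mk0 P * ClassGroup.mk K x ∈ N}) =
        (f P '' idealsOfNorm K k) ∩ {x | c * ClassGroup.mk K x ∈ N} := by
      intro P hP
      ext x
      constructor
      · rintro ⟨y, ⟨hy, hc⟩, rfl⟩
        refine ⟨⟨y, hy, rfl⟩, ?_⟩
        change _ * ClassGroup.mk K (FractionalIdeal.mk0 K P * y) ∈ N
        rwa [map_mul, ClassGroup.mk_mk0, ← mul_assoc]
      · rintro ⟨⟨y, hy, rfl⟩, hc⟩
        refine ⟨y, ⟨hy, ?_⟩, rfl⟩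
        change _ * ClassGroup.mk K (FractionalIdeal.mk0 K P * y) ∈ N at hc
        rwa [map_mul, ClassGroup.mk_mk0, ← mul_assoc] at hc
    rw [key P (h.absNorm_left hK hp), key Q (h.symm.absNorm_left hK hp), ← Set.union_inter_distrib_right]
    congr 1
    ext x
    constructor
    · rintro ⟨I, hI, hn⟩
      obtain ⟨J, hJ, hIJ⟩ := h.exists_mul hK hp hn
      have hJ0 : J ≠ ⊥ := by
        rintro rfl
        rcases hIJ with rfl | rfl <;> exact x.ne_zero (by simp at hI)
      have hmem : FractionalIdeal.mk0 K ⟨J, mem_nonZeroDivisors_of_ne_zero hJ0⟩ ∈ idealsOfNorm K k :=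
        ⟨J, rfl, hJ⟩
      rcases hIJ with rfl | rfl
      · exact Or.inl ⟨_, hmem, Units.ext (by simp [hf, hI])⟩
      · exact Or.inr ⟨_, hmem, Units.ext (by simp [hf, hI])⟩
    · rintro (⟨y, ⟨J, hJ, hn⟩, rfl⟩ | ⟨y, ⟨J, hJ, hn⟩, rfl⟩)
      · exact ⟨P.1 * J, by simp [hf, hJ], by rw [map_mul, hn, h.absNorm_left hK hp]⟩
      · exact ⟨Q.1 * J, by simp [hf, hJ], by rw [map_mul, hn, h.symm.absNorm_left hK hp]⟩
  have hfin : ∀ (P : (Ideal (𝓞 K))⁰) (s : Set _),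
      (f P '' (idealsOfNorm K k ∩ s)).Finite := fun P s =>
    ((finite_idealsOfNorm k).inter_of_left s).image _
  rw [idealCount, hset, Set.ncard_union_eq ?_ (hfin _ _) (hfin _ _),
    Set.ncard_image_of_injective _ (mul_right_injective _),
    Set.ncard_image_of_injective _ (mul_right_injective _)]
  · rfl
  · rw [Set.disjoint_left]
    rintro _ ⟨x, ⟨⟨I, hI, -⟩, -⟩, rfl⟩ ⟨y, ⟨⟨J, hJ, hn⟩, -⟩, hxy⟩
    refine h.mul_ne_mul hK hp hk hn (I := I) ?_
    have := congrArg Units.val hxy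
    simp only [hf, Units.val_mul, FractionalIdeal.coe_mk0, hI, hJ] at this
    rw [← FractionalIdeal.coeIdeal_mul, ← FractionalIdeal.coeIdeal_mul,
      FractionalIdeal.coeIdeal_inj] at this
    exact this.symm

lemma mk0_sq_of_not_split (hK : Module.finrank ℤ (𝓞 K) = 2) {p : ℕ} (hp : p.Prime)
    (hns : ¬ ∃ P Q : Ideal (𝓞 K), SplitPair p P Q) {P : (Ideal (𝓞 K))⁰} (hP : P.1.IsPrime)
    (hm : ((p : ℕ) : 𝓞 K) ∈ P.1) : ClassGroup.mk0 P ^ 2 = 1 := by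
  obtain ⟨J, hJ⟩ := Ideal.dvd_span_singleton.2 hm
  have hn := SplitPair.absNorm_span hK (p := p)
  rw [hJ, map_mul] at hn
  rw [← map_pow, ClassGroup.mk0_eq_one_iff, SubmonoidClass.coe_pow, pow_two]
  have hP1 : Ideal.absNorm P.1 ≠ 1 := fun e => hP.ne_top (Ideal.absNorm_eq_one_iff.1 e)
  by_cases hJ1 : Ideal.absNorm J = 1
  · rw [Ideal.absNorm_eq_one_iff.1 hJ1, Ideal.mul_top] at hJ
    exact ⟨⟨(p : 𝓞 K) * p, by rw [← hJ, Ideal.span_singleton_mul_span_singleton]⟩⟩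
  · have hJp := ((hp.mul_eq_prime_sq_iff hP1 hJ1).1 hn).2
    have hJP : J.IsPrime := Ideal.isPrime_of_irreducible_absNorm (by rwa [hJp])
    have : P.1 = J := by
      by_contra hne
      exact hns ⟨P, J, hne, hP, hJP, hJ⟩
    exact ⟨⟨(p : 𝓞 K), by rw [show P.1 * P.1 = P.1 * J by rw [← this]]; exact hJ.symm⟩⟩

theorem sum_idealCount (hK : Module.finrank ℤ (𝓞 K) = 2) {S S₁ : Finset ℕ}
    {H : Subgroup (ClassGroup (𝓞 K))}
    (hH : H = Subgroup.closure {c | ∃ P : (Ideal (𝓞 K))⁰, P.1.IsPrime ∧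
      (∃ p ∈ S, ((p : ℕ) : 𝓞 K) ∈ P.1) ∧ c = ClassGroup.mk0 P})
    (hS : ∀ p ∈ S, p.Prime) (hS₁ : S₁ ⊆ S)
    (hsp : ∀ p ∈ S₁, ∃ P Q : Ideal (𝓞 K), SplitPair p P Q)
    (hns : ∀ p ∈ S, p ∉ S₁ → ¬ ∃ P Q : Ideal (𝓞 K), SplitPair p P Q) :
    (∑ U ∈ S₁.powerset, idealCount K (powMonoidHom 3).range (∏ p ∈ U, p) 1) *
      Nat.card {c : ClassGroup (𝓞 K) // c ^ 3 = 1} = 3 ^ S₁.card *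
      Nat.card {x : ClassGroup (𝓞 K) ⧸ H // x ^ 3 = 1} := by
  classical
  have hex : ∀ p, ∃ P Q : (Ideal (𝓞 K))⁰, p ∈ S₁ → SplitPair p P.1 Q.1 := by
    intro p
    by_cases h : p ∈ S₁
    · obtain ⟨P, Q, hPQ⟩ := hsp p h
      have hp := hS p (hS₁ h)
      exact ⟨⟨P, mem_nonZeroDivisors_of_ne_zero (hPQ.ne_bot hK hp)⟩,
        ⟨Q, mem_nonZeroDivisors_of_ne_zero (hPQ.symm.ne_bot hK hp)⟩, fun _ => hPQ⟩
    · exact ⟨1, 1, fun h' => (h h').elim⟩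
  choose P Q hPQ using hex
  have key := card_mul_card_torsion (fun p => ClassGroup.mk0 (P p)) S₁ H
    (fun V c => ∑ U ∈ V.powerset, idealCount K (powMonoidHom 3).range (∏ p ∈ U, p) c)
  refine key ?_ ?_ ?_ ?_
  · subst hH
    refine le_antisymm (sup_le le_sup_left ((Subgroup.closure_le _).2 ?_))
      (sup_le le_sup_left ((Subgroup.closure_le _).2 ?_))
    · rintro _ ⟨P', hP', ⟨p, hpS, hm⟩, rfl⟩
      by_cases hp : p ∈ S₁
      · refine Subgroup.mem_sup_right ?_
        have hg := Subgroup.subset_closure (Set.mem_image_of_mem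
          (fun p => ClassGroup.mk0 (P p)) (Finset.mem_coe.2 hp))
        rcases (hPQ p hp).eq_or_eq hK (hS p hpS) hP' hm with h | h
        · rw [Subtype.ext h]
          exact hg
        · rw [Subtype.ext h, (hPQ p hp).mk0_right]
          exact inv_mem hg
      · refine Subgroup.mem_sup_left ⟨ClassGroup.mk0 P', ?_⟩
        rw [powMonoidHom_apply, pow_succ, mk0_sq_of_not_split hK (hS p hpS) (hns p hpS hp) hP' hm,
          one_mul]
    · rintro _ ⟨p, hp, rfl⟩
      refine Subgroup.mem_sup_right (Subgroup.subset_closure ⟨P p, (hPQ p hp).2.1, ⟨p, hS₁ hp, ?_⟩, rfl⟩)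
      rw [← Ideal.dvd_span_singleton, (hPQ p hp).2.2.2]
      exact dvd_mul_right _ _
  · intro c hc
    simp [idealCount_one, hc]
  · intro c hc
    simp [idealCount_one, hc]
  · intro p V hV hpV c
    have hp := hV (Finset.mem_insert_self p V)
    rw [Finset.sum_powerset_insert hpV, ← Finset.sum_add_distrib, ← Finset.sum_add_distrib,
      ← Finset.sum_add_distrib]
    refine Finset.sum_congr rfl fun U hU => congrArg _ ?_
    have hUV := Finset.mem_powerset.1 hU
    rw [Finset.prod_insert fun h => hpV (hUV h)]
    refine idealCount_mul hK _ (hS p (hS₁ hp)) (hPQ p hp) (fun hd => ?_) c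
    obtain ⟨q, hq, hpq⟩ := (hS p (hS₁ hp)).prime.dvd_finsetProd_iff _ |>.1 hd
    rw [(Nat.prime_dvd_prime_iff_eq (hS p (hS₁ hp))
      (hS q (hS₁ (hV (Finset.mem_insert_of_mem (hUV hq)))))).1 hpq] at hpV
    exact hpV (hUV hq)

end QuadData

section

open scoped MatrixGroups

namespace CubicForm

lemma exists_act_zero {f : Fin 4 → ℤ} (hf : ¬ Irred f) : ∃ γ : SL(2, ℤ), act γ.1 f 0 = 0 := by
  obtain ⟨x, y, ⟨u, v, huv⟩, h⟩ := exists_coprime_root hf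
  refine ⟨⟨!![x, -v; y, u], by rw [Matrix.det_fin_two_of]; linear_combination huv⟩, ?_⟩
  simp only [eval, act] at h ⊢
  simp
  linear_combination h

lemma not_irred_of_zero {f : Fin 4 → ℤ} (h : f 0 = 0) : ¬ Irred f := fun hf => hf.ne_zero h

lemma irred_of_squarefree {d : ℤ} {m : ℕ} (hm : Squarefree m) (hm1 : m ≠ 1)
    (hmd : ∀ p : ℕ, p.Prime → p ∣ m → ¬ (p : ℤ) ∣ d) {f : Fin 4 → ℤ} (h : HessDvd m f)
    (hf : disc f = (m : ℤ) ^ 2 * d) : Irred f := by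
  by_contra hI
  obtain ⟨γ, hγ⟩ := exists_act_zero hI
  obtain ⟨p, hp, hpm⟩ := Nat.exists_prime_and_dvd hm1
  have hpp := Nat.prime_iff_prime_int.1 hp
  obtain ⟨k, rfl⟩ := hpm
  have hpk : ¬ p ∣ k := fun hk =>
    hp.not_isUnit (hm p (mul_dvd_mul_left p hk))
  obtain ⟨hA, -, hC⟩ := hessDvd_act h γ.1
  rw [← disc_act_SL γ] at hf
  have hdvd : (p : ℤ) ∣ ((p * k : ℕ) : ℤ) := Int.natCast_dvd_natCast.2 (dvd_mul_right p k)
  generalize act γ.1 f = g at hγ hA hC hf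
  simp only [disc, hessA, hessB, hessC, hγ, zero_mul, sub_zero] at hA hC hf
  obtain ⟨b, hb⟩ := hpp.dvd_of_dvd_pow (hdvd.trans hA)
  have h2 := hdvd.trans hC
  rw [hb, mul_assoc, dvd_sub_left (dvd_mul_right _ _)] at h2
  obtain ⟨c, hc⟩ := hpp.dvd_of_dvd_pow h2
  have h3 : (k : ℤ) ^ 2 * d = p * (4 * b ^ 3 * g 3 - 3 * p * b ^ 2 * c ^ 2) := by
    have hp0 : (p : ℤ) ^ 2 ≠ 0 := pow_ne_zero _ hpp.ne_zero
    refine mul_left_cancel₀ hp0 ?_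
    push_cast at hf
    rw [hb, hc] at hf
    linear_combination -hf
  rcases hpp.dvd_or_dvd (Dvd.intro _ h3.symm) with h4 | h4
  · exact hpk (Int.natCast_dvd_natCast.1 (hpp.dvd_of_dvd_pow h4))
  · exact hmd p hp (dvd_mul_right p k) h4

/-- The representative of the reducible forms of discriminant `d`. -/
def redForm (d : ℤ) : Fin 4 → ℤ := ![0, 1, d % 2, (d + 3 * (d % 2) ^ 2) / 4]

variable {d : ℤ} (hd : Loc.IsFund d)
include hd

lemma disc_redForm : disc (redForm d) = d := by
  have h : 4 * ((d + 3 * (d % 2) ^ 2) / 4) = d + 3 * (d % 2) ^ 2 := by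
    have := hd.emod_two
    rcases Int.emod_two_eq_zero_or_one d with h | h <;> rw [h] <;> omega
  simp [disc, hessA, hessB, hessC, redForm]
  linear_combination h

lemma orb_eq_redForm {f : Fin 4 → ℤ} (h0 : f 0 = 0) (hf : disc f = d) : orb f = orb (redForm d) := by
  have h1 : f 1 ^ 2 * (4 * f 1 * f 3 - 3 * f 2 ^ 2) = d := by
    rw [← hf]
    simp only [disc, hessA, hessB, hessC, h0]
    ring
  have hb : f 1 ^ 2 = 1 := by
    have hdv : ((f 1).natAbs : ℤ) ^ 2 ∣ d := by
      rw [Int.natCast_natAbs, sq_abs]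
      exact Dvd.intro _ h1
    rw [← sq_abs, ← Int.natCast_natAbs]
    rcases hd.eq_one_or_two hdv with h | h
    · rw [h]; norm_num
    · exfalso
      have h4 : f 1 ^ 2 = 4 := by rw [← sq_abs, ← Int.natCast_natAbs, h]; norm_num
      obtain ⟨k, hk⟩ : ∃ k, f 1 = 2 * k := by
        have : f 1 % 2 = 0 := by omega
        exact ⟨f 1 / 2, by omega⟩
      have h5 : d = 32 * (k * f 3) - 12 * f 2 ^ 2 := by
        rw [← h1, h4, hk]; ring
      have h6 := hd.emod_two
      rcases Int.even_or_odd' (f 2) with ⟨c, hc | hc⟩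
      · have : f 2 ^ 2 = 4 * c ^ 2 := by rw [hc]; ring
        omega
      · have : f 2 ^ 2 = 4 * (c ^ 2 + c) + 1 := by rw [hc]; ring
        omega
  obtain ⟨t, ht⟩ : ∃ t, 2 * t = f 1 * (d % 2) - f 2 := by
    refine ⟨(f 1 * (d % 2) - f 2) / 2, Int.mul_ediv_cancel' ?_⟩
    rw [show f 1 ^ 2 * (4 * f 1 * f 3 - 3 * f 2 ^ 2) = 4 * (f 1 * f 3) - 3 * f 2 ^ 2 by
      rw [hb]; ring] at h1
    rcases mul_self_eq_one_iff.1 ((pow_two (f 1)).symm.trans hb) with h | h <;> rw [h] at h1 ⊢ <;>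
    rcases Int.even_or_odd' (f 2) with ⟨c, hc | hc⟩ <;> rw [hc] at h1 ⊢ <;> ring_nf at h1 ⊢ <;> omega
  rw [orb_eq_iff]
  refine ⟨⟨!![f 1, t; 0, f 1], by rw [Matrix.det_fin_two_of]; linear_combination hb⟩, ?_⟩
  set γ : SL(2, ℤ) := ⟨!![f 1, t; 0, f 1], by rw [Matrix.det_fin_two_of]; linear_combination hb⟩
    with hγ
  have hdisc := (disc_act_SL γ f).trans (hf.trans (disc_redForm hd).symm)
  have e0 : act γ.1 f 0 = 0 := by simp [act, hγ, h0]
  have e1 : act γ.1 f 1 = 1 := by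
    simp [act, hγ, h0]
    linear_combination (f 1 ^ 2 + 1) * hb
  have e2 : act γ.1 f 2 = d % 2 := by
    simp [act, hγ, h0]
    linear_combination f 1 ^ 3 * ht + (d % 2) * (f 1 ^ 2 + 1) * hb
  have e3 : act γ.1 f 3 = redForm d 3 := by
    have h2 : redForm d 0 = 0 ∧ redForm d 1 = 1 ∧ redForm d 2 = d % 2 := ⟨rfl, rfl, rfl⟩
    simp only [disc, hessA, hessB, hessC, e0, e1, e2, h2] at hdisc
    linarith
  ext i
  fin_cases i
  · exact e0.symm
  · exact e1.symm
  · exact e2.symm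
  · exact e3.symm

theorem orbs_eq_add {m : ℕ} (hm : Squarefree m)
    (hmd : ∀ p : ℕ, p.Prime → p ∣ m → ¬ (p : ℤ) ∣ d) :
    orbs {f | HessDvd m f ∧ disc f = (m : ℤ) ^ 2 * d} =
      orbs (irrDM m d) + if m = 1 then 1 else 0 := by
  split_ifs with hm1
  · subst hm1
    have hset : orb '' {f | HessDvd 1 f ∧ disc f = ((1 : ℕ) : ℤ) ^ 2 * d} =
        insert (orb (redForm d)) (orb '' irrDM 1 d) := by
      rw [← Set.image_insert_eq]
      refine Set.Subset.antisymm ?_ (Set.image_mono ?_)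
      · rintro _ ⟨f, ⟨h1, h2⟩, rfl⟩
        by_cases hI : Irred f
        · exact ⟨f, Or.inr ⟨h1, h2, hI⟩, rfl⟩
        · obtain ⟨γ, hγ⟩ := exists_act_zero hI
          refine ⟨redForm d, Or.inl rfl, ?_⟩
          rw [← orb_act γ f, orb_eq_redForm hd hγ]
          rw [disc_act_SL, h2]
          simp
      · rintro f (rfl | h)
        · exact ⟨by simp [HessDvd], by simp [disc_redForm hd]⟩
        · exact ⟨h.1, h.2.1⟩
    have hfin : (orb '' irrDM 1 d).Finite := by
      obtain ⟨j, hj⟩ : ∃ j, 0 < sg j * d := by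
        rcases lt_or_gt_of_ne hd.ne_zero with h | h
        · exact ⟨false, by simpa [sg] using h⟩
        · exact ⟨true, by simpa [sg] using h⟩
      exact (finite_orb_irr j (by positivity)).subset (Set.image_mono (irrDM_subset one_pos hj le_rfl))
    rw [orbs, hset, Set.ncard_insert_of_notMem _ hfin, orbs]
    rintro ⟨f, ⟨-, -, hf⟩, h⟩
    obtain ⟨γ, hγ⟩ := orb_eq_iff.1 h
    exact not_irred_of_zero (f := redForm d) rfl (hγ ▸ hf.act γ)
  · rw [add_zero, irrDM]
    congr 1
    ext f
    exact ⟨fun h => ⟨h.1, h.2, irred_of_squarefree hm hm1 hmd h.1 h.2⟩, fun h => ⟨h.1, h.2.1⟩⟩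

end CubicForm

end

namespace QuadData

variable {K : Type*} [Field K] [NumberField K] {d : ℤ} (D : QuadData K d)
include D

lemma finrank_int (hd : Loc.IsFund d) : Module.finrank ℤ (𝓞 K) = 2 := by
  obtain ⟨b, -⟩ := D.exists_int_basis hd
  simpa using Module.finrank_eq_card_basis b

theorem sum_orbs (hd : Loc.IsFund d) (h3 : d ≠ -3) {S S₁ : Finset ℕ}
    {H : Subgroup (ClassGroup (𝓞 K))}
    (hH : H = Subgroup.closure {c | ∃ P : (Ideal (𝓞 K))⁰, P.1.IsPrime ∧
      (∃ p ∈ S, ((p : ℕ) : 𝓞 K) ∈ P.1) ∧ c = ClassGroup.mk0 P})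
    (hS : ∀ p ∈ S, p.Prime) (hS₁ : S₁ ⊆ S) (hdvd : ∀ p ∈ S₁, ¬ (p : ℤ) ∣ d)
    (hsp : ∀ p ∈ S₁, ∃ P Q : Ideal (𝓞 K), SplitPair p P Q)
    (hns : ∀ p ∈ S, p ∉ S₁ → ¬ ∃ P Q : Ideal (𝓞 K), SplitPair p P Q) :
    ∑ U ∈ S₁.powerset, CubicForm.orbs (CubicForm.irrDM (∏ p ∈ U, p) d) + 1 =
      3 ^ (S₁.card + if 0 < d then 1 else 0) *
        Nat.card {x : ClassGroup (𝓞 K) ⧸ H // x ^ 3 = 1} := by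
  have hprime : ∀ U ∈ S₁.powerset, ∀ p ∈ U, p.Prime := fun U hU p hp =>
    hS p (hS₁ (Finset.mem_powerset.1 hU hp))
  have h1 : ∀ U ∈ S₁.powerset, CubicForm.orbs (CubicForm.irrDM (∏ p ∈ U, p) d) +
      (if U = ∅ then 1 else 0) = idealCount K (powMonoidHom 3).range (∏ p ∈ U, p) 1 *
        (Nat.card {c : ClassGroup (𝓞 K) // c ^ 3 = 1} * 3 ^ (if 0 < d then 1 else 0)) := by
    intro U hU
    have hP := hprime U hU
    have hset : ((powMonoidHom 3 : ClassGroup (𝓞 K) →* _).range : Set (ClassGroup (𝓞 K))) =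
        {x | ∃ c, x = c ^ 3} := by
      ext x
      exact ⟨fun ⟨c, hc⟩ => ⟨c, hc.symm⟩, fun ⟨c, hc⟩ => ⟨c, hc.symm⟩⟩
    have hone : (∏ p ∈ U, p = 1) = (U = ∅) := propext
      ⟨fun h => Finset.eq_empty_of_forall_notMem fun p hp =>
        (hP p hp).one_lt.ne' (Nat.eq_one_of_dvd_one (h ▸ Finset.dvd_prod_of_mem _ hp)),
        fun h => by rw [h, Finset.prod_empty]⟩
    have h2 := D.orbs_count hd h3 (Finset.prod_pos fun p hp => (hP p hp).pos)
    rw [CubicForm.orbs_eq_add hd (Finset.squarefree_prod_of_pairwise_isCoprime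
      (fun p hp q hq hpq => Nat.coprime_iff_isRelPrime.1
        ((Nat.coprime_primes (hP p hp) (hP q hq)).2 hpq)) fun p hp => (hP p hp).squarefree)] at h2
    · simp only [hone] at h2
      rw [h2, idealCount]
      congr 3
      ext x
      change (∃ c, ClassGroup.mk K x = c ^ 3) ↔
        1 * ClassGroup.mk K x ∈ (powMonoidHom 3 : ClassGroup (𝓞 K) →* _).range
      rw [one_mul, ← SetLike.mem_coe, hset]
      rfl
    · intro p hp hpU
      obtain ⟨q, hq, hpq⟩ := (hp.prime.dvd_finsetProd_iff _).1 hpU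
      rw [(Nat.prime_dvd_prime_iff_eq hp (hP q hq)).1 hpq]
      exact hdvd q (Finset.mem_powerset.1 hU hq)
  have h2 := Finset.sum_congr rfl h1
  rw [Finset.sum_add_distrib, Finset.sum_ite_eq' , if_pos (Finset.empty_mem_powerset _),
    ← Finset.sum_mul, ← mul_assoc, sum_idealCount (D.finrank_int hd) hH hS hS₁ hsp hns] at h2
  rw [h2]
  ring

lemma not_mem_span (hd : Loc.IsFund d) {p : ℕ} {a b : ℤ} (hb : ¬ (p : ℤ) ∣ b) :
    (a + b * D.tau hd : 𝓞 K) ∉ Ideal.span {((p : ℕ) : 𝓞 K)} := by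
  rw [Ideal.mem_span_singleton]
  rintro ⟨z, hz⟩
  obtain ⟨x, y, rfl⟩ := D.exists_int_coord hd z
  have h := congrArg (fun z : 𝓞 K => (z : K)) hz
  simp only [map_add, map_mul, map_intCast, map_natCast, coe_tau] at h
  have h2 := (D.coord_unique hd (u := a + b * d / 2) (v := b / 2) (u' := p * (x + y * d / 2))
    (v' := p * y / 2) (by push_cast; linear_combination h)).2
  refine hb ⟨y, ?_⟩
  have : (b : ℚ) = p * y := by linarith
  exact_mod_cast this

lemma tau_sq (hd : Loc.IsFund d) {k : ℤ} (hk : d ^ 2 - d = 4 * k) :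
    D.tau hd ^ 2 = d * D.tau hd - k := by
  refine RingOfIntegers.coe_injective ?_
  have hk' : (d : K) ^ 2 - d = 4 * k := by exact_mod_cast congrArg (Int.cast : ℤ → K) hk
  simp only [map_sub, map_mul, map_pow, map_intCast, coe_tau]
  linear_combination (D.r_sq - hk') / 4

omit D in
/-- An integer in a proper ideal above `p` is divisible by `p`. -/
lemma dvd_of_mem {R : Type*} [CommRing R] {p : ℕ} (hp : p.Prime) {P : Ideal R} (hP : P ≠ ⊤)
    (hm : ((p : ℕ) : R) ∈ P) {n : ℤ} (hn : (n : R) ∈ P) : (p : ℤ) ∣ n := by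
  by_contra h
  obtain ⟨u, v, huv⟩ := ((Nat.prime_iff_prime_int.1 hp).coprime_iff_not_dvd).2 h
  refine hP ((Ideal.eq_top_iff_one P).2 ?_)
  have := congrArg (Int.cast : ℤ → R) huv
  push_cast at this
  rw [← this]
  exact add_mem (P.mul_mem_left _ hm) (P.mul_mem_left _ hn)

lemma split_iff_exists (hd : Loc.IsFund d) {k : ℤ} (hk : d ^ 2 - d = 4 * k) {p : ℕ} (hp : p.Prime) :
    (∃ P Q : Ideal (𝓞 K), SplitPair p P Q) ↔
      ∃ t : ℤ, (p : ℤ) ∣ t ^ 2 - d * t + k ∧ ¬ (p : ℤ) ∣ 2 * t - d := by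
  have hK := D.finrank_int hd
  have hsq := D.tau_sq hd hk
  set τ := D.tau hd with hτ
  have hnm : ∀ a b : ℤ, ¬ (p : ℤ) ∣ b → (a + b * τ : 𝓞 K) ∉ Ideal.span {((p : ℕ) : 𝓞 K)} :=
    fun a b hb => D.not_mem_span hd hb
  clear_value τ
  have hcast : ∀ {n : ℤ}, (p : ℤ) ∣ n → ∃ c : 𝓞 K, (n : 𝓞 K) = p * c := by
    rintro _ ⟨c, rfl⟩
    exact ⟨c, by push_cast; rfl⟩
  have h1p : ¬ (p : ℤ) ∣ 1 := fun h => hp.one_lt.ne' (by exact_mod_cast Int.eq_one_of_dvd_one (by positivity) h)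
  constructor
  · rintro ⟨P, Q, h⟩
    have hpP : ((p : ℕ) : 𝓞 K) ∈ P := by
      rw [← Ideal.dvd_span_singleton, h.2.2.2]; exact dvd_mul_right _ _
    have hpQ : ((p : ℕ) : 𝓞 K) ∈ Q := by
      rw [← Ideal.dvd_span_singleton, h.2.2.2]; exact dvd_mul_left _ _
    obtain ⟨t, ht⟩ : ∃ t : ℤ, τ - t ∈ P := by
      have hc : Nat.card (𝓞 K ⧸ P) = p := by
        rw [← h.absNorm_left hK hp, Ideal.absNorm_apply, Submodule.cardQuot_apply]
      have hP1 : (1 : 𝓞 K ⧸ P) ≠ 0 := fun e =>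
        h.2.1.ne_top ((Ideal.eq_top_iff_one P).2 (Ideal.Quotient.eq_zero_iff_mem.1 e))
      have : Fact p.Prime := ⟨hp⟩
      obtain ⟨t, ht⟩ := mem_zmultiples_of_prime_card hc hP1 (g' := Ideal.Quotient.mk P τ)
      refine ⟨t, Ideal.Quotient.eq.1 ?_⟩
      rw [← ht]
      simp
    have h1 : (p : ℤ) ∣ t ^ 2 - d * t + k := by
      refine dvd_of_mem hp h.2.1.ne_top hpP ?_
      have : ((t ^ 2 - d * t + k : ℤ) : 𝓞 K) = (d - τ - t) * (τ - t) := by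
        push_cast
        linear_combination hsq
      rw [this]
      exact P.mul_mem_left _ ht
    refine ⟨t, h1, fun h2 => ?_⟩
    obtain ⟨c, hc⟩ := hcast h1
    obtain ⟨e, he⟩ := hcast h2
    push_cast at hc he
    have htQ : τ - t ∈ Q := by
      refine h.2.2.1.mem_of_pow_mem 2 ?_
      rw [show (τ - t) ^ 2 = (t * e - c - e * τ) * p by
        linear_combination hsq + (t - τ) * he - hc]
      exact Q.mul_mem_left _ hpQ
    have hco : IsCoprime P Q := by
      have hPm : P.IsMaximal := h.2.1.isMaximal (h.ne_bot hK hp)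
      have hQm : Q.IsMaximal := h.2.2.1.isMaximal (h.symm.ne_bot hK hp)
      exact Ideal.isCoprime_iff_sup_eq.2 (hPm.coprime_of_ne hQm h.1)
    refine hnm (-t) 1 h1p ?_
    rw [h.2.2.2, Ideal.mul_eq_inf_of_isCoprime hco]
    have : ((-t : ℤ) + (1 : ℤ) * τ : 𝓞 K) = τ - t := by push_cast; ring
    rw [this]
    exact ⟨ht, htQ⟩
  · rintro ⟨t, h1, h2⟩
    obtain ⟨c, hc⟩ := hcast h1
    push_cast at hc
    set P : Ideal (𝓞 K) := Ideal.span {(p : 𝓞 K), τ - t} with hP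
    set Q : Ideal (𝓞 K) := Ideal.span {(p : 𝓞 K), d - τ - t} with hQ
    have hpP : (p : 𝓞 K) ∈ P := Ideal.subset_span (Or.inl rfl)
    have hpQ : (p : 𝓞 K) ∈ Q := Ideal.subset_span (Or.inl rfl)
    have htP : τ - t ∈ P := Ideal.subset_span (Or.inr rfl)
    have htQ : d - τ - t ∈ Q := Ideal.subset_span (Or.inr rfl)
    have hPQ : Ideal.span {(p : 𝓞 K)} = P * Q := by
      refine le_antisymm ((Ideal.span_singleton_le_iff_mem _).2 ?_) ?_
      · obtain ⟨u, v, huv⟩ := ((Nat.prime_iff_prime_int.1 hp).coprime_iff_not_dvd).2 h2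
        have huv' := congrArg (Int.cast : ℤ → 𝓞 K) huv
        push_cast at huv'
        rw [show (p : 𝓞 K) = u * (p * p) - v * ((τ - t) * p + p * (d - τ - t)) by
          linear_combination -(p : 𝓞 K) * huv']
        exact sub_mem (Ideal.mul_mem_left _ _ (Ideal.mul_mem_mul hpP hpQ)) (Ideal.mul_mem_left _ _
          (add_mem (Ideal.mul_mem_mul htP hpQ) (Ideal.mul_mem_mul hpP htQ)))
      · rw [hP, hQ, Ideal.span_pair_mul_span_pair, Ideal.span_le]
        rintro x (rfl | rfl | rfl | rfl) <;> rw [SetLike.mem_coe, Ideal.mem_span_singleton]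
        · exact dvd_mul_right _ _
        · exact dvd_mul_right _ _
        · exact dvd_mul_left _ _
        · exact ⟨c, by linear_combination hc - hsq⟩
    have hn := SplitPair.absNorm_span hK (p := p)
    rw [hPQ, map_mul] at hn
    have hP1 : Ideal.absNorm P ≠ 1 := fun e => by
      rw [Ideal.absNorm_eq_one_iff.1 e, Ideal.top_mul] at hPQ
      refine hnm (d - t) (-1) (by rwa [dvd_neg]) (hPQ ▸ ?_)
      convert htQ using 1
      push_cast
      ring
    have hQ1 : Ideal.absNorm Q ≠ 1 := fun e => by
      rw [Ideal.absNorm_eq_one_iff.1 e, Ideal.mul_top] at hPQ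
      refine hnm (-t) 1 h1p (hPQ ▸ ?_)
      convert htP using 1
      push_cast
      ring
    obtain ⟨hP2, hQ2⟩ := (hp.mul_eq_prime_sq_iff hP1 hQ1).1 hn
    refine ⟨P, Q, fun e => h2 ?_, Ideal.isPrime_of_irreducible_absNorm (by rwa [hP2]),
      Ideal.isPrime_of_irreducible_absNorm (by rwa [hQ2]), hPQ⟩
    refine dvd_of_mem hp (fun e => hP1 (Ideal.absNorm_eq_one_iff.2 e)) hpP ?_
    rw [← e] at htQ
    convert neg_mem (add_mem htP htQ) using 1
    push_cast
    ring

theorem split_iff (hd : Loc.IsFund d) {p : ℕ} (hp : p.Prime) :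
    (∃ P Q : Ideal (𝓞 K), SplitPair p P Q) ↔ Loc.Spl p d := by
  obtain ⟨k, hk⟩ := hd.four_dvd
  rw [D.split_iff_exists hd hk hp, Loc.Spl]
  have hpp := Nat.prime_iff_prime_int.1 hp
  split_ifs with h2
  · subst h2
    constructor
    · rintro ⟨t, h1, h3⟩
      have hd8 := Loc.sq_emod_eight (k := d) (by push_cast at h3; omega)
      have : (2 : ℤ) ∣ t * (t - d) := by
        rcases Int.even_or_odd' t with ⟨c, hc | hc⟩
        · exact Dvd.dvd.mul_right ⟨c, hc⟩ _
        · exact Dvd.dvd.mul_left (by push_cast at h3; omega) _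
      have : (2 : ℤ) ∣ k := by grind
      omega
    · intro h
      have hd8 := Loc.sq_emod_eight (k := d) (by omega)
      exact ⟨0, by simp; omega, by simp; omega⟩
  · have hp2 : ¬ (p : ℤ) ∣ 2 := fun h =>
      h2 ((Nat.prime_dvd_prime_iff_eq hp Nat.prime_two).1 (by exact_mod_cast h))
    have key : ∀ t, (p : ℤ) ∣ t ^ 2 - d * t + k ↔ (p : ℤ) ∣ (2 * t - d) ^ 2 - d := fun t => by
      rw [show (2 * t - d) ^ 2 - d = 2 * (2 * (t ^ 2 - d * t + k)) by linear_combination hk]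
      exact ⟨fun h => (h.mul_left _).mul_left _, fun h =>
        ((hpp.dvd_or_dvd ((hpp.dvd_or_dvd h).resolve_left hp2)).resolve_left hp2)⟩
    constructor
    · rintro ⟨t, h1, h3⟩
      rw [key] at h1
      refine ⟨fun h => h3 (hpp.dvd_of_dvd_pow ((dvd_sub_left h).1 h1)), ⟨((2 * t - d : ℤ) : ZMod p), ?_⟩⟩
      have := (ZMod.intCast_zmod_eq_zero_iff_dvd _ p).2 h1
      push_cast at this ⊢
      linear_combination -this
    · rintro ⟨h1, s, hs⟩
      obtain ⟨u, v, huv⟩ := (hpp.coprime_iff_not_dvd).2 hp2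
      obtain ⟨s, rfl⟩ := ZMod.intCast_surjective s
      have h3 : (p : ℤ) ∣ d - s * s := by
        rw [← ZMod.intCast_zmod_eq_zero_iff_dvd]
        push_cast
        rw [hs, sub_self]
      have h4 : (p : ℤ) ∣ (2 * (v * (s + d)) - d) ^ 2 - d := by
        rw [show (2 * (v * (s + d)) - d) ^ 2 - d = p * (p * u ^ 2 * (s + d) ^ 2 - 2 * s * u * (s + d)) -
          (d - s * s) by linear_combination ((2 * v * (s + d) - d) + (s - p * u * (s + d))) * (s + d) * huv]
        exact dvd_sub (dvd_mul_right _ _) h3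
      refine ⟨v * (s + d), (key _).2 h4, fun h => h1 ?_⟩
      exact (dvd_sub_right (dvd_pow h two_ne_zero)).1 h4

end QuadData

open Polynomial in
/-- The coordinates on `ℚ(√d)`. -/
lemma nonempty_quadData {d : ℤ} (hd : Loc.IsFund d) : Nonempty (QuadData (Kd d) d) := by
  have hirr : Irreducible (X ^ 2 - C (d : ℚ)) := by
    refine X_pow_sub_C_irreducible_of_prime Nat.prime_two fun b hb => ?_
    obtain ⟨t, ht⟩ := Rat.isSquare_intCast_iff.1 ⟨b, by rw [← hb, sq]⟩
    exact hd.ne_sq t (ht.trans (sq t).symm)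
  have hr : aeval (sqrtD d) (X ^ 2 - C (d : ℚ)) = 0 := by simp [sqrtD_sq]
  have hmin := minpoly.eq_of_irreducible_of_monic hirr hr (monic_X_pow_sub_C _ two_ne_zero)
  have hint : IsIntegral ℚ (sqrtD d) := ⟨_, monic_X_pow_sub_C _ two_ne_zero, hr⟩
  let pb : PowerBasis ℚ (Kd d) := adjoin.powerBasis hint
  have hgen : pb.gen ^ 2 = d := Subtype.ext <| by
    change sqrtD d ^ 2 = ((d : Kd d) : ℂ)
    simp [sqrtD_sq]
  have hminpb : minpoly ℚ pb.gen = X ^ 2 - C (d : ℚ) := hmin ▸ minpoly_gen ℚ (sqrtD d)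
  refine ⟨pb.gen, (pb.lift (-pb.gen) (by simp [hminpb, hgen])).toRingHom, hgen,
    pb.lift_gen _ _, fun z => ?_⟩
  obtain ⟨f, hf, rfl⟩ := pb.exists_eq_aeval z
  rw [← pb.natDegree_minpoly, hminpb, natDegree_X_pow_sub_C] at hf
  obtain ⟨a, b, rfl⟩ := exists_eq_X_add_C_of_natDegree_le_one (Nat.le_of_lt_succ hf)
  exact ⟨b, a, by simp [add_comm]⟩

lemma isFundamentalDiscriminant_iff {d : ℤ} : IsFundamentalDiscriminant d ↔ Loc.IsFund d := by
  have hsq : ∀ n : ℤ, Squarefree n ↔ ∀ p : ℕ, p.Prime → ¬ (p : ℤ) ^ 2 ∣ n := fun n => by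
    rw [← Int.squarefree_natAbs, Nat.squarefree_iff_prime_squarefree]
    refine forall₂_congr fun p hp => not_congr ?_
    rw [← Int.natCast_dvd, ← sq, Nat.cast_pow]
  have h2 : Loc.Fund 2 d ↔ d % 4 = 1 ∨ d % 16 = 8 ∨ d % 16 = 12 := by simp [Loc.Fund]
  have hp2 : ∀ p : ℕ, p ≠ 2 → (Loc.Fund p d ↔ ¬ (p : ℤ) ^ 2 ∣ d) := fun p hp => by
    simp [Loc.Fund, hp]
  refine and_congr_right fun _ => ⟨?_, fun h => ?_⟩
  · rintro (⟨h4, hd⟩ | ⟨m, rfl, hm, hd⟩) p hp <;> rcases eq_or_ne p 2 with rfl | h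
    · exact h2.2 (Or.inl h4)
    · exact (hp2 p h).2 ((hsq d).1 hd p hp)
    · exact h2.2 (by omega)
    · refine (hp2 p h).2 fun hdvd => (hsq m).1 hd p hp ?_
      refine (IsCoprime.pow_left ?_).dvd_of_dvd_mul_left hdvd
      exact_mod_cast Nat.isCoprime_iff_coprime.2
        (((Nat.coprime_primes hp Nat.prime_two).2 h).pow_right 2)
  · have hodd : ∀ {n : ℤ}, n ∣ d → ¬ (4 : ℤ) ∣ n → Squarefree n := fun {n} hn h4 =>
      (hsq n).2 fun p hp hpn => by
        rcases eq_or_ne p 2 with rfl | hp'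
        · exact h4 (by simpa using hpn)
        · exact (hp2 p hp').1 (h p hp) (hpn.trans hn)
    rcases h2.1 (h 2 Nat.prime_two) with h4 | h4
    · exact Or.inl ⟨h4, hodd dvd_rfl (by omega)⟩
    · exact Or.inr ⟨d / 4, by omega, by omega, hodd ⟨4, by omega⟩ (by omega)⟩

lemma fam_iff {S S₁ : Finset ℕ} (hS : ∀ p ∈ S, p.Prime) (hS₁ : S₁ ⊆ S) {s d : ℤ} :
    Loc.Fam S S₁ s d ↔ IsFundamentalDiscriminant d ∧ 0 < s * d ∧
      (∀ p ∈ S₁, SplitsIn p d) ∧ ∀ p ∈ S \ S₁, ¬ SplitsIn p d := by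
  rw [isFundamentalDiscriminant_iff]
  have hspl : Loc.IsFund d → ∀ p ∈ S, (SplitsIn p d ↔ Loc.Spl p d) := fun hd p hp => by
    obtain ⟨D⟩ := nonempty_quadData hd
    exact D.split_iff hd (hS p hp)
  constructor
  · rintro ⟨hs, h1, h⟩
    have hd : Loc.IsFund d := ⟨h1, fun p hp => (h p hp).1⟩
    refine ⟨hd, hs, fun p hp => (hspl hd p (hS₁ hp)).2 ((h p (hS p (hS₁ hp))).2.1 hp),
      fun p hp => ?_⟩
    obtain ⟨hp, hp₁⟩ := Finset.mem_sdiff.1 hp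
    exact fun hn => (h p (hS p hp)).2.2 hp hp₁ ((hspl hd p hp).1 hn)
  · rintro ⟨hd, hs, h1, h2⟩
    exact ⟨hs, hd.1, fun p hp => ⟨hd.2 p hp, fun hp₁ => (hspl hd p (hS₁ hp₁)).1 (h1 p hp₁),
      fun hpS hp₁ hn => h2 p (Finset.mem_sdiff.2 ⟨hpS, hp₁⟩) ((hspl hd p hpS).2 hn)⟩⟩

lemma sum_orbs_add_one {S S₁ : Finset ℕ} (hS : ∀ p ∈ S, p.Prime) (hS₁ : S₁ ⊆ S) {s d : ℤ}
    (hd : Loc.Fam S S₁ s d) (h3 : d ≠ -3) :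
    ∑ U ∈ S₁.powerset, CubicForm.orbs (CubicForm.irrDM (∏ p ∈ U, p) d) + 1 =
      3 ^ (S₁.card + if 0 < d then 1 else 0) * Nat.card {x : ClS S d // x ^ 3 = 1} := by
  obtain ⟨hfd, -, hsp, hns⟩ := (fam_iff hS hS₁).1 hd
  have hfund := isFundamentalDiscriminant_iff.1 hfd
  obtain ⟨D⟩ := nonempty_quadData hfund
  refine D.sum_orbs hfund h3 rfl hS hS₁ (fun p hp hdvd => ?_) hsp fun p hp hp₁ =>
    hns p (Finset.mem_sdiff.2 ⟨hp, hp₁⟩)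
  have h := (hd.2.2 p (hS p (hS₁ hp))).2.1 hp
  unfold Loc.Spl at h
  split_ifs at h with h2
  · subst h2
    omega
  · exact h.1 hdvd

lemma hasAverage_of_finset {F : ℤ → Prop} {f : ℤ → ℝ} {A : ℝ} (T : ℝ → Finset ℤ)
    (hT : ∀ X d, d ∈ T X ↔ F d ∧ |(d : ℝ)| < X)
    (h : Tendsto (fun X => (∑ d ∈ T X, f d) / (T X).card) atTop (nhds A)) : HasAverage F f A := by
  refine h.congr fun X => ?_
  have hset : {d : ℤ | F d ∧ |(d : ℝ)| < X} = T X := Set.ext fun d => (hT X d).symm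
  rw [hset, finsum_mem_coe_finset, ← Set.ncard_coe_finset, ← hset]
  rfl

lemma hasAverage_sg {S S₁ : Finset ℕ} (hS : ∀ p ∈ S, p.Prime) (hS₁ : S₁ ⊆ S) (j : Bool) :
    HasAverage (fun d => IsFundamentalDiscriminant d ∧ 0 < CubicForm.sg j * d ∧
        (∀ p ∈ S₁, SplitsIn p d) ∧ ∀ p ∈ S \ S₁, ¬ SplitsIn p d)
      (fun d => (Nat.card {x : ClS S d // x ^ 3 = 1} : ℝ))
      ((3 ^ S₁.card * CubicForm.cInf j + 1) / 3 ^ (S₁.card + if j then 1 else 0)) := by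
  obtain ⟨φ, hφ0, hφ⟩ := Loc.exists_tendsto_prod_nu S S₁ hS hS₁
  have hsg : CubicForm.sg j = 1 ∨ CubicForm.sg j = -1 := by cases j <;> simp [CubicForm.sg]
  have hcount := Loc.tendsto_famCount S S₁ hsg hS₁ hφ
  have horbs := CubicForm.tendsto_sum_orbs hS hS₁ hφ j
  set f : ℤ → ℝ := fun d => (Nat.card {x : ClS S d // x ^ 3 = 1} : ℝ)
  set c : ℝ := 3 ^ (S₁.card + if j then 1 else 0) with hc
  have hc0 : c ≠ 0 := by positivity
  set o : ℤ → ℝ := fun d => ∑ U ∈ S₁.powerset,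
    ((CubicForm.orbs (CubicForm.irrDM (∏ p ∈ U, p) d) : ℕ) : ℝ)
  set e : ℝ := c * f (-3) - o (-3) - 1
  have hf : ∀ X : ℝ, ∀ d ∈ CubicForm.famFin S S₁ (CubicForm.sg j) X, c * f d =
      o d + 1 + if d = -3 then e else 0 := by
    intro X d hd
    split_ifs with h3
    · rw [h3]
      ring
    have hd := (CubicForm.mem_famFin.1 hd).1
    have hj : (0 < d) = (j = true) := by
      have := hd.1
      cases j <;> simp [CubicForm.sg] at this ⊢ <;> omega
    have h := sum_orbs_add_one hS hS₁ hd h3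
    simp only [hj] at h
    have h' := congrArg (Nat.cast : ℕ → ℝ) h
    push_cast at h'
    rw [add_zero, hc, ← h']
  have hlim : Tendsto (fun X : ℝ => (∑ d ∈ CubicForm.famFin S S₁ (CubicForm.sg j) X, f d) / X) atTop
      (nhds ((3 ^ S₁.card * CubicForm.cInf j * φ + φ + 0) / c)) := by
    have hexc : Tendsto (fun X : ℝ => (if -3 ∈ CubicForm.famFin S S₁ (CubicForm.sg j) X then
        e else 0) / X) atTop (nhds 0) := by
      refine squeeze_zero_norm' (a := fun X : ℝ => |e| / X) ?_
        (tendsto_const_nhds.div_atTop tendsto_id)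
      filter_upwards [eventually_gt_atTop 0] with X hX
      rw [Real.norm_eq_abs, abs_div, abs_of_pos hX]
      refine div_le_div_of_nonneg_right ?_ hX.le
      split_ifs <;> simp
    clear_value e
    refine (((horbs.add hcount).add hexc).div_const c).congr fun X => ?_
    rw [← add_div, ← add_div, div_div, mul_comm X, ← div_div]
    congr 1
    rw [div_eq_iff hc0, mul_comm _ c, Finset.mul_sum, Finset.sum_congr rfl (hf X),
      Finset.sum_add_distrib, Finset.sum_add_distrib, Finset.sum_ite_eq',
      ← CubicForm.card_famFin]
    simp
  have hres := hlim.div hcount hφ0.ne'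
  have hval : (3 ^ S₁.card * CubicForm.cInf j * φ + φ + 0) / c / φ =
      (3 ^ S₁.card * CubicForm.cInf j + 1) / c := by
    field_simp
    ring
  rw [hval] at hres
  refine hasAverage_of_finset (CubicForm.famFin S S₁ (CubicForm.sg j)) (fun X d => ?_)
    (hres.congr' ?_)
  · rw [CubicForm.mem_famFin, fam_iff hS hS₁]
  · filter_upwards [eventually_gt_atTop 0] with X hX
    rw [CubicForm.card_famFin]
    exact div_div_div_cancel_right₀ hX.ne' _ _

/-- As `K` varies over real (resp. imaginary) quadratic fields, ordered by absolute
discriminant, in which every prime of `S₁` splits and no prime of `S \ S₁` splits,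
the average size of `Cl(K)_S[3]` is `1 + c'_∞/3^{|S₁|}`, with `c'_∞ = 1/3` in the
real case and `c'_∞ = 1` in the imaginary case. -/
theorem avg_ClS_three_torsion_fixed_splitting (S : Finset ℕ) (hS : ∀ p ∈ S, p.Prime)
    (S₁ : Finset ℕ) (hS₁ : S₁ ⊆ S) :
    HasAverage (fun d => IsFundamentalDiscriminant d ∧ 0 < d ∧
        (∀ p ∈ S₁, SplitsIn p d) ∧ ∀ p ∈ S \ S₁, ¬ SplitsIn p d)
      (fun d => (Nat.card {x : ClS S d // x ^ 3 = 1} : ℝ))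
      (1 + (1 / 3 : ℝ) / 3 ^ S₁.card) ∧
    HasAverage (fun d => IsFundamentalDiscriminant d ∧ d < 0 ∧
        (∀ p ∈ S₁, SplitsIn p d) ∧ ∀ p ∈ S \ S₁, ¬ SplitsIn p d)
      (fun d => (Nat.card {x : ClS S d // x ^ 3 = 1} : ℝ))
      (1 + (1 : ℝ) / 3 ^ S₁.card) := by
  constructor
  · convert hasAverage_sg hS hS₁ true using 1
    · simp [CubicForm.sg]
    · simp only [CubicForm.cInf, if_true, pow_succ]
      field_simp
  · convert hasAverage_sg hS hS₁ false using 1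
    · simp [CubicForm.sg]
    · simp [CubicForm.cInf]
      field_simp
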